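/- Let (ξ,η) ∈ ℂ × ℂ* and let β, τ, ν ∈ ℝ with 1 ≤ τ < 2, β > τ and ν > 2 + β − τ + (τ−1)(2−τ)/(β+1−τ). Suppose that for each sufficiently large positive integer D there exists a non-zero polynomial P_D ∈ ℤ[X₁,X₂] of (total) degree ≤ D and norm ≤ exp(D^β) such that max_{0 ≤ i < 3⌊D^τ⌋} |𝒟₁^i P_D(ξ,η)| ≤ exp(−D^ν). Then ξ and η are algebraic over ℚ, and moreover 𝒟₁^i P_D(ξ,η) = 0 for all 0 ≤ i < 3⌊D^τ⌋ for each sufficiently large integer D. -/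

import Mathlib

open MvPolynomial

/-- The derivation `𝒟₁ = ∂/∂X₁ + X₂·∂/∂X₂` of `ℂ[X₁,X₂]` (variables indexed `0, 1`). -/
noncomputable def D1 : MvPolynomial (Fin 2) ℂ → MvPolynomial (Fin 2) ℂ :=
  fun P => pderiv 0 P + X 1 * pderiv 1 P

section Saturation
variable {k : Type*} [Field k]

/-- The substitution `X₀ ↦ 0`. -/
noncomputable def killX0 (k : Type*) [Field k] : MvPolynomial (Fin 3) k →ₐ[k] MvPolynomial (Fin 3) k :=
  aeval ![0, X 1, X 2]

lemma killX0_X0 : killX0 k (X 0) = 0 := by simp [killX0]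
lemma killX0_X1 : killX0 k (X 1) = X 1 := by simp [killX0]
lemma killX0_X2 : killX0 k (X 2) = X 2 := by simp [killX0]

lemma X0_dvd_sub_killX0 (f : MvPolynomial (Fin 3) k) : X 0 ∣ f - killX0 k f := by
  induction f using MvPolynomial.induction_on with
  | C a => simp [killX0]
  | add p q hp hq =>
    have := dvd_add hp hq
    rw [map_add]
    convert this using 1
    ring
  | mul_X p i hp =>
    rw [map_mul]
    have h : (X 0 : MvPolynomial (Fin 3) k) ∣ X i - killX0 k (X i) := by
      fin_cases i
      · simp [killX0]
      · simp [killX0]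
      · simp [killX0]
    have h2 : p * X i - killX0 k p * killX0 k (X i)
        = (p - killX0 k p) * X i + killX0 k p * (X i - killX0 k (X i)) := by ring
    rw [h2]
    exact dvd_add (hp.mul_right _) (h.mul_left _)

lemma X0_dvd_of_killX0 {f : MvPolynomial (Fin 3) k} (h : killX0 k f = 0) : X 0 ∣ f := by
  simpa [h] using X0_dvd_sub_killX0 f

lemma IsRelPrime.exists_syzygy {R : Type*} [CommRing R] [IsDomain R] [DecompositionMonoid R]
    {P Q : R} (hP : P ≠ 0) (h : IsRelPrime P Q) {α β : R} (e : α * P + β * Q = 0) :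
    ∃ c, α = Q * c ∧ β = -(P * c) := by
  have h1 : P ∣ β := by
    apply h.dvd_of_dvd_mul_right
    exact ⟨-α, by linear_combination e⟩
  obtain ⟨c, rfl⟩ := h1
  refine ⟨-c, ?_, by ring⟩
  apply mul_right_cancel₀ hP
  linear_combination e

lemma mem_span_pair_of_X_mul_mem {P Q : MvPolynomial (Fin 3) k} (hP : P ≠ 0)
    (h : IsRelPrime P Q) {f : MvPolynomial (Fin 3) k}
    (hf : ∀ i, X i * f ∈ Ideal.span {P, Q}) : f ∈ Ideal.span {P, Q} := by
  classical
  simp only [Ideal.mem_span_pair] at hf ⊢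
  obtain ⟨α, β, h0⟩ := hf 0
  set φ := killX0 k
  have hX0 : (X 0 : MvPolynomial (Fin 3) k) ≠ 0 := X_ne_zero 0
  have hX1 : (X 1 : MvPolynomial (Fin 3) k) ≠ 0 := X_ne_zero 1
  -- reduced forms modulo `X₀`
  have hpr : Prime (X 0 : MvPolynomial (Fin 3) k) := X_prime
  have hne : ¬ (φ P = 0 ∧ φ Q = 0) := by
    rintro ⟨h1, h2⟩
    exact hpr.not_isUnit (h (X0_dvd_of_killX0 h1) (X0_dvd_of_killX0 h2))
  have hred : ∃ g P0 Q0, IsRelPrime P0 Q0 ∧ g * P0 = φ P ∧ g * Q0 = φ Q ∧ g ≠ 0 ∧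
      (P0 ≠ 0 ∨ Q0 ≠ 0) := by
    by_cases h1 : φ P = 0
    · have h2 : φ Q ≠ 0 := fun h2 => hne ⟨h1, h2⟩
      exact ⟨φ Q, 0, 1, isRelPrime_one_right, by simp [h1], by simp, h2, by simp⟩
    · obtain ⟨P0, Q0, g, hr, e1, e2⟩ :=
        UniqueFactorizationMonoid.exists_reduced_factors (φ P) h1 (φ Q)
      refine ⟨g, P0, Q0, hr, e1, e2, ?_, ?_⟩
      · rintro rfl; simp at e1; exact h1 e1.symm
      · left; rintro rfl; simp at e1; exact h1 e1.symm
  obtain ⟨g, P0, Q0, hr, eP, eQ, hg, hPQ⟩ := hred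
  have hs0 : φ α * P0 + φ β * Q0 = 0 := by
    apply mul_left_cancel₀ hg
    have := congrArg φ h0
    simp only [map_add, map_mul] at this
    rw [show φ (X 0) = 0 from killX0_X0] at this
    linear_combination this + φ α * eP + φ β * eQ
  have hsyz : ∃ c, φ α = Q0 * c ∧ φ β = -(P0 * c) := by
    by_cases hP0 : P0 = 0
    · subst hP0
      have hu : IsUnit Q0 := by
        have := isRelPrime_zero_left.mp hr
        exact this
      obtain ⟨u, hu⟩ := hu
      refine ⟨↑u⁻¹ * φ α, ?_, ?_⟩
      · rw [← hu, ← mul_assoc]; simp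
      · have : φ β * Q0 = 0 := by simpa using hs0
        rcases mul_eq_zero.mp this with h | h
        · simp [h]
        · rcases hPQ with h' | h'
          · exact absurd rfl h'
          · exact absurd h h'
    · exact hr.exists_syzygy hP0 hs0
  obtain ⟨c, hc1, hc2⟩ := hsyz
  -- `g ∣ Xᵢ c` for `i = 1, 2`
  have key : ∀ i, φ (X i) = X i → ∃ s, X i * c = g * s := by
    intro i hi
    obtain ⟨α1, β1, h1⟩ := hf i
    have hk : (X i * α - X 0 * α1) * P + (X i * β - X 0 * β1) * Q = 0 := by
      linear_combination X i * h0 - X 0 * h1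
    obtain ⟨s, hs1, hs2⟩ := h.exists_syzygy hP hk
    have e1 := congrArg φ hs1
    have e2 := congrArg φ hs2
    simp only [map_sub, map_mul, map_neg, hi] at e1 e2
    rw [show φ (X 0) = 0 from killX0_X0] at e1 e2
    refine ⟨φ s, ?_⟩
    rcases hPQ with h' | h'
    · apply mul_left_cancel₀ h'
      linear_combination (-1 : MvPolynomial (Fin 3) k) * e2 - φ s * eP + X i * hc2
    · apply mul_left_cancel₀ h'
      linear_combination e1 - φ s * eQ - X i * hc1
  obtain ⟨s1, hs1⟩ := key 1 killX0_X1
  obtain ⟨s2, hs2⟩ := key 2 killX0_X2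
  have h12 : X 1 * s2 = X 2 * s1 := by
    apply mul_left_cancel₀ hg
    linear_combination X 2 * hs1 - X 1 * hs2
  have h1d : (X 1 : MvPolynomial (Fin 3) k) ∣ s1 := by
    have hp1 : Prime (X 1 : MvPolynomial (Fin 3) k) := X_prime
    have : X 1 ∣ X 2 * s1 := ⟨s2, h12.symm⟩
    rcases hp1.dvd_or_dvd this with h | h
    · exfalso
      have := X_dvd_X.mp h
      simp at this
    · exact h
  obtain ⟨c', rfl⟩ := h1d
  have hcc : c = g * c' := by
    apply mul_left_cancel₀ hX1
    linear_combination hs1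
  obtain ⟨a', ha⟩ := X0_dvd_sub_killX0 (α - Q * c')
  obtain ⟨b', hb⟩ := X0_dvd_sub_killX0 (β + P * c')
  have hidem : ∀ f, φ (φ f) = φ f := by
    intro f
    have : φ.comp φ = φ := by
      apply MvPolynomial.algHom_ext
      intro i
      fin_cases i
      · simp [φ, killX0]
      · simp [φ, killX0]
      · simp [φ, killX0]
    exact DFunLike.congr_fun this f
  have ea : φ (α - Q * c') = 0 := by
    have e1 : φ α = φ Q * c' := by rw [hc1, hcc, ← eQ]; ring
    have e2 : φ (φ α) = φ (φ Q) * φ c' := by rw [e1, map_mul]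
    rw [hidem, hidem] at e2
    rw [map_sub, map_mul, e2, sub_self]
  have eb : φ (β + P * c') = 0 := by
    have e1 : φ β = -(φ P * c') := by rw [hc2, hcc, ← eP]; ring
    have e2 : φ (φ β) = -(φ (φ P) * φ c') := by rw [e1, map_neg, map_mul]
    rw [hidem, hidem] at e2
    rw [map_add, map_mul, e2]; ring
  change _ - φ _ = _ at ha
  change _ - φ _ = _ at hb
  rw [ea, sub_zero] at ha
  rw [eb, sub_zero] at hb
  refine ⟨a', b', ?_⟩
  apply mul_left_cancel₀ hX0
  linear_combination h0 - P * ha - Q * hb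

/-- The linear form `X₀ + u X₁ + u² X₂`. -/
noncomputable def linForm {R : Type*} [CommSemiring R] (u : R) : MvPolynomial (Fin 3) R :=
  X 0 + C u * X 1 + C (u ^ 2) * X 2

lemma exists_linForm_nonzerodivisor [CharZero k] {P Q : MvPolynomial (Fin 3) k} (hP : P ≠ 0)
    (h : IsRelPrime P Q) : ∃ u : ℕ, ∀ f, linForm (u : k) * f ∈ Ideal.span {P, Q} →
      f ∈ Ideal.span {P, Q} := by
  classical
  set I := Ideal.span {P, Q}
  let M := MvPolynomial (Fin 3) k ⧸ I
  have hfin : (associatedPrimes (MvPolynomial (Fin 3) k) M).Finite :=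
    associatedPrimes.finite _ _
  by_contra! hcon
  choose f hf hfI using hcon
  -- each zero divisor lies in an associated prime
  have hmem : ∀ u : ℕ, ∃ p ∈ associatedPrimes (MvPolynomial (Fin 3) k) M, linForm (u : k) ∈ p := by
    intro u
    have : linForm (u : k) ∈ ⋃ p ∈ associatedPrimes (MvPolynomial (Fin 3) k) M, (p : Set _) := by
      rw [biUnion_associatedPrimes_eq_zero_divisors]
      refine ⟨Ideal.Quotient.mk I (f u), ?_, ?_⟩
      · rw [Ne, Ideal.Quotient.eq_zero_iff_mem]; exact hfI u
      · have : linForm (u : k) • Ideal.Quotient.mk I (f u)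
          = Ideal.Quotient.mk I (linForm (u : k) * f u) := rfl
        rw [this, Ideal.Quotient.eq_zero_iff_mem]; exact hf u
    simpa using this
  choose p hp hup using hmem
  obtain ⟨q, hq, hinf⟩ : ∃ q ∈ associatedPrimes (MvPolynomial (Fin 3) k) M,
      (p ⁻¹' {q}).Infinite := by
    by_contra! hcon
    have : (Set.univ : Set ℕ) ⊆ ⋃ q ∈ associatedPrimes (MvPolynomial (Fin 3) k) M, p ⁻¹' {q} := by
      intro u _
      simp only [Set.mem_iUnion]
      exact ⟨p u, hp u, rfl⟩
    refine Set.infinite_univ (Set.Finite.subset (hfin.biUnion ?_) this)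
    intro q hq
    exact hcon q hq
  obtain ⟨a, ha⟩ := hinf.nonempty
  obtain ⟨b, hb, hab⟩ := (hinf.sdiff (Set.finite_singleton a)).nonempty.imp fun _ h => h
  obtain ⟨c, hc, hcab⟩ := (hinf.sdiff (Set.toFinite {a, b})).nonempty.imp fun _ h => h
  have ha' : linForm (a : k) ∈ q := by have := hup a; rwa [show p a = q from ha] at this
  have hb' : linForm (b : k) ∈ q := by have := hup b; rwa [show p b = q from hb] at this
  have hc' : linForm (c : k) ∈ q := by have := hup c; rwa [show p c = q from hc] at this
  have nab : (b : k) - a ≠ 0 := by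
    rw [sub_ne_zero]; exact_mod_cast hab
  have nac : (c : k) - a ≠ 0 := by
    rw [sub_ne_zero]; intro h; apply hcab; left; exact_mod_cast h
  have nbc : (c : k) - b ≠ 0 := by
    rw [sub_ne_zero]; intro h; apply hcab; right; exact_mod_cast h
  have cancel : ∀ (x : k) (g : MvPolynomial (Fin 3) k), x ≠ 0 → C x * g ∈ q → g ∈ q := by
    intro x g hx hg
    have := q.mul_mem_left (C x⁻¹) hg
    rwa [← mul_assoc, ← C_mul, inv_mul_cancel₀ hx, C_1, one_mul] at this
  have g1 : (X 1 + C ((b : k) + a) * X 2 : MvPolynomial (Fin 3) k) ∈ q := by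
    apply cancel _ _ nab
    have := q.sub_mem hb' ha'
    convert this using 1
    simp only [linForm, C_sub, C_add, C_pow]; ring
  have g2 : (X 1 + C ((c : k) + a) * X 2 : MvPolynomial (Fin 3) k) ∈ q := by
    apply cancel _ _ nac
    have := q.sub_mem hc' ha'
    convert this using 1
    simp only [linForm, C_sub, C_add, C_pow]; ring
  have x2 : (X 2 : MvPolynomial (Fin 3) k) ∈ q := by
    apply cancel _ _ nbc
    have := q.sub_mem g2 g1
    convert this using 1
    simp only [C_sub, C_add]; ring
  have x1 : (X 1 : MvPolynomial (Fin 3) k) ∈ q := by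
    have := q.sub_mem g1 (q.mul_mem_left (C ((b : k) + a)) x2)
    convert this using 1; ring
  have x0 : (X 0 : MvPolynomial (Fin 3) k) ∈ q := by
    have := q.sub_mem (q.sub_mem ha' (q.mul_mem_left (C (a : k)) x1))
      (q.mul_mem_left (C ((a : k) ^ 2)) x2)
    convert this using 1; simp only [linForm]; ring
  obtain ⟨hprime, y, hy⟩ := isAssociatedPrime_iff.mp (AssociatedPrimes.mem_iff.mp hq)
  obtain ⟨f0, rfl⟩ := Ideal.Quotient.mk_surjective y
  have hXf : ∀ i, X i * f0 ∈ I := by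
    intro i
    have hi : (X i : MvPolynomial (Fin 3) k) ∈ q := by
      fin_cases i
      · exact x0
      · exact x1
      · exact x2
    rw [hy, Submodule.mem_colon_singleton] at hi
    have h2 : (X i : MvPolynomial (Fin 3) k) • Ideal.Quotient.mk I f0
      = Ideal.Quotient.mk I (X i * f0) := rfl
    rw [h2, Submodule.mem_bot, Ideal.Quotient.eq_zero_iff_mem] at hi
    exact hi
  have := mem_span_pair_of_X_mul_mem hP h hXf
  apply hprime.ne_top
  rw [Ideal.eq_top_iff_one, hy, Submodule.mem_colon_singleton, one_smul, Submodule.mem_bot,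
    Ideal.Quotient.eq_zero_iff_mem]
  exact this

end Saturation

section Homog
variable {R : Type*} [CommRing R]

/-- Exponents of the monomials of degree `L` in three variables. -/
abbrev Mon (L : ℕ) : Type := ↥((Finset.univ : Finset (Fin 3)).finsuppAntidiag L)

lemma Mon.degree_eq {L : ℕ} (m : Mon L) : (m : Fin 3 →₀ ℕ).degree = L := by
  have := Finset.mem_finsuppAntidiag.mp m.2
  rw [Finsupp.degree_eq_sum]
  exact this.1

lemma mem_finsuppAntidiag_iff_degree {L : ℕ} {m : Fin 3 →₀ ℕ} :
    m ∈ (Finset.univ : Finset (Fin 3)).finsuppAntidiag L ↔ m.degree = L := by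
  rw [Finset.mem_finsuppAntidiag, Finsupp.degree_eq_sum]
  simp

lemma card_Mon (L : ℕ) : Fintype.card (Mon L) = (L + 2).choose 2 := by
  rw [Fintype.card_coe, Finset.card_finsuppAntidiag_nat_eq_choose]
  simp only [Finset.card_univ, Fintype.card_fin]
  rw [show 3 + L - 1 = L + 2 by omega]
  exact Nat.choose_symm_of_eq_add rfl

/-- Coordinates of a form of degree `L`. -/
noncomputable def homogCoord (R : Type*) [CommRing R] (L : ℕ) :
    homogeneousSubmodule (Fin 3) R L ≃ₗ[R] (Mon L → R) where
  toFun f m := coeff (m : Fin 3 →₀ ℕ) (f : MvPolynomial (Fin 3) R)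
  map_add' f g := by ext m; simp
  map_smul' c f := by ext m; simp
  invFun c := ⟨∑ m : Mon L, monomial (m : Fin 3 →₀ ℕ) (c m), by
    apply Submodule.sum_mem
    intro m _
    rw [mem_homogeneousSubmodule]
    exact isHomogeneous_monomial _ (Mon.degree_eq m)⟩
  left_inv f := by
    ext n
    simp only [coeff_sum, coeff_monomial]
    by_cases hn : n.degree = L
    · have hn' := mem_finsuppAntidiag_iff_degree.mpr hn
      rw [Finset.sum_eq_single (⟨n, hn'⟩ : Mon L)]
      · simp
      · intro b _ hb
        rw [if_neg]
        intro h; apply hb; ext1; exact h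
      · simp
    · have h0 : coeff n (f : MvPolynomial (Fin 3) R) = 0 := by
        by_contra h
        apply hn
        rw [Finsupp.degree_eq_weight_one]
        exact (mem_homogeneousSubmodule _ _).mp f.2 h
      rw [h0]
      apply Finset.sum_eq_zero
      intro b _
      rw [if_neg]
      intro h; apply hn; rw [← h]; exact Mon.degree_eq b
  right_inv c := by
    ext m
    simp only [coeff_sum, coeff_monomial]
    rw [Finset.sum_eq_single m]
    · simp
    · intro b _ hb
      rw [if_neg]
      intro h; apply hb; ext1; exact h
    · simp

lemma homogeneousComponent_mul_left {P c : MvPolynomial (Fin 3) R} {d : ℕ}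
    (hP : P.IsHomogeneous d) (n : ℕ) :
    homogeneousComponent n (P * c) = if d ≤ n then P * homogeneousComponent (n - d) c else 0 := by
  conv_lhs => rw [← sum_homogeneousComponent c]
  rw [Finset.mul_sum, map_sum]
  have h : ∀ i, homogeneousComponent n (P * homogeneousComponent i c)
      = if n = d + i then P * homogeneousComponent i c else 0 := by
    intro i
    exact homogeneousComponent_of_mem (hP.mul (homogeneousComponent_isHomogeneous i c))
  simp only [h]
  split_ifs with hd
  · have : ∀ i, (if n = d + i then P * homogeneousComponent i c else 0)
        = if i = n - d then P * homogeneousComponent (n - d) c else 0 := by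
      intro i
      by_cases hi : i = n - d
      · rw [if_pos hi, if_pos (by omega), hi]
      · rw [if_neg hi, if_neg (by omega)]
    simp only [this, Finset.sum_ite_eq', Finset.mem_range]
    split_ifs with h2
    · rfl
    · rw [homogeneousComponent_eq_zero _ _ (by omega), mul_zero]
  · apply Finset.sum_eq_zero
    intro i _
    rw [if_neg (by omega)]

end Homog

section Dim
variable {k : Type*} [Field k]

instance (L : ℕ) : Module.Finite k (homogeneousSubmodule (Fin 3) k L) :=
  Module.Finite.equiv (homogCoord k L).symm

lemma finrank_homog (L : ℕ) :
    Module.finrank k (homogeneousSubmodule (Fin 3) k L) = (L + 2).choose 2 := by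
  rw [(homogCoord k L).finrank_eq, Module.finrank_fintype_fun_eq_card, card_Mon]

/-- The map `(α, β) ↦ α P + β Q` on forms of degree `M`. -/
noncomputable def bezoutMap (P Q : MvPolynomial (Fin 3) k) (M : ℕ) :
    (homogeneousSubmodule (Fin 3) k M × homogeneousSubmodule (Fin 3) k M) →ₗ[k]
      MvPolynomial (Fin 3) k where
  toFun p := p.1 * P + p.2 * Q
  map_add' p q := by simp; ring
  map_smul' c p := by simp

/-- The forms of degree `M + d` in the span of `P` and `Q`. -/
noncomputable def bezoutSpace (P Q : MvPolynomial (Fin 3) k) (M : ℕ) :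
    Submodule k (MvPolynomial (Fin 3) k) := LinearMap.range (bezoutMap P Q M)

lemma finrank_bezoutSpace {P Q : MvPolynomial (Fin 3) k} {d : ℕ} (hP : P ≠ 0)
    (hPd : P.IsHomogeneous d) (hQd : Q.IsHomogeneous d) (h : IsRelPrime P Q) (E : ℕ) :
    Module.finrank k (bezoutSpace P Q (d + E)) + (E + 2).choose 2
      = 2 * (d + E + 2).choose 2 := by
  have hr := LinearMap.finrank_range_add_finrank_ker (bezoutMap P Q (d + E))
  rw [Module.finrank_prod, finrank_homog] at hr
  let ψ : homogeneousSubmodule (Fin 3) k E →ₗ[k] LinearMap.ker (bezoutMap P Q (d + E)) :=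
    { toFun := fun c => ⟨(⟨Q * c, hQd.mul c.2⟩, ⟨-(P * c), (hPd.mul c.2).neg⟩), by
        simp [bezoutMap]; ring⟩
      map_add' := by
        intro a b
        ext1
        simp only [Submodule.coe_add, Prod.mk_add_mk]
        congr 1 <;> ext1 <;> simp <;> ring
      map_smul' := by
        intro a b
        ext1
        simp only [Submodule.coe_smul, Prod.smul_mk, RingHom.id_apply]
        congr 1 <;> ext1 <;> simp }
  have hψ : Function.Bijective ψ := by
    constructor
    · intro a b hab
      have h1 : -(P * (a : MvPolynomial (Fin 3) k)) = -(P * (b : MvPolynomial (Fin 3) k)) :=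
        congrArg (fun x : LinearMap.ker (bezoutMap P Q (d + E)) =>
          ((x.1.2 : homogeneousSubmodule (Fin 3) k (d + E)) : MvPolynomial (Fin 3) k)) hab
      rw [neg_inj] at h1
      ext1
      exact mul_left_cancel₀ hP h1
    · rintro ⟨⟨⟨α, hα⟩, ⟨β, hβ⟩⟩, hab⟩
      simp only [LinearMap.mem_ker, bezoutMap, LinearMap.coe_mk, AddHom.coe_mk] at hab
      obtain ⟨c, hc1, hc2⟩ := h.exists_syzygy hP hab
      refine ⟨⟨homogeneousComponent E c, homogeneousComponent_mem _ _⟩, ?_⟩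
      have e1 := homogeneousComponent_mul_left (c := c) hQd (d + E)
      have e2 := homogeneousComponent_mul_left (c := c) hPd (d + E)
      rw [if_pos (by omega), show d + E - d = E by omega] at e1 e2
      rw [← hc1] at e1
      have hc2' : P * c = -β := by rw [hc2]; ring
      rw [hc2'] at e2
      rw [homogeneousComponent_eq_self ((mem_homogeneousSubmodule _ _).mp hα)] at e1
      have hβ' : (-β).IsHomogeneous (d + E) := ((mem_homogeneousSubmodule _ _).mp hβ).neg
      rw [homogeneousComponent_eq_self hβ'] at e2
      simp only [ψ, LinearMap.coe_mk, AddHom.coe_mk]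
      ext1
      refine Prod.ext ?_ ?_
      · ext1; exact e1.symm
      · ext1
        show -(P * homogeneousComponent E c) = β
        rw [← e2]; ring
  have hk : Module.finrank k (LinearMap.ker (bezoutMap P Q (d + E))) = (E + 2).choose 2 := by
    rw [← (LinearEquiv.ofBijective ψ hψ).finrank_eq, finrank_homog]
  rw [hk] at hr
  unfold bezoutSpace
  omega

lemma mem_bezoutSpace {P Q : MvPolynomial (Fin 3) k} {d : ℕ}
    (hPd : P.IsHomogeneous d) (hQd : Q.IsHomogeneous d) {M : ℕ} {f : MvPolynomial (Fin 3) k}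
    (hf : f.IsHomogeneous (d + M)) (hI : f ∈ Ideal.span {P, Q}) : f ∈ bezoutSpace P Q M := by
  obtain ⟨a, b, hab⟩ := Ideal.mem_span_pair.mp hI
  refine ⟨(⟨homogeneousComponent M a, homogeneousComponent_mem _ _⟩,
    ⟨homogeneousComponent M b, homogeneousComponent_mem _ _⟩), ?_⟩
  have e1 := homogeneousComponent_mul_left (c := a) hPd (d + M)
  have e2 := homogeneousComponent_mul_left (c := b) hQd (d + M)
  rw [if_pos (by omega), show d + M - d = M by omega] at e1 e2
  simp only [bezoutMap, LinearMap.coe_mk, AddHom.coe_mk]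
  rw [mul_comm _ P, mul_comm _ Q, ← e1, ← e2, ← map_add, mul_comm P, mul_comm Q, hab,
    homogeneousComponent_eq_self hf]

lemma bezoutSpace_le {P Q : MvPolynomial (Fin 3) k} {d : ℕ}
    (hPd : P.IsHomogeneous d) (hQd : Q.IsHomogeneous d) (M : ℕ) :
    bezoutSpace P Q M ≤ homogeneousSubmodule (Fin 3) k (d + M) := by
  rintro _ ⟨⟨a, b⟩, rfl⟩
  have h1 := ((mem_homogeneousSubmodule _ _).mp a.2).mul hPd
  have h2 := ((mem_homogeneousSubmodule _ _).mp b.2).mul hQd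
  rw [add_comm] at h1 h2
  exact h1.add h2

lemma homogeneousComponent_mem_span {P Q : MvPolynomial (Fin 3) k} {d : ℕ}
    (hPd : P.IsHomogeneous d) (hQd : Q.IsHomogeneous d) {f : MvPolynomial (Fin 3) k}
    (hI : f ∈ Ideal.span {P, Q}) (n : ℕ) : homogeneousComponent n f ∈ Ideal.span {P, Q} := by
  obtain ⟨a, b, rfl⟩ := Ideal.mem_span_pair.mp hI
  rw [map_add, mul_comm a, mul_comm b, homogeneousComponent_mul_left hPd,
    homogeneousComponent_mul_left hQd]
  split_ifs with h
  · exact add_mem (Ideal.mul_mem_right _ _ (Ideal.subset_span (by simp)))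
      (Ideal.mul_mem_right _ _ (Ideal.subset_span (by simp)))
  · simp

/-- Forms in the ideal `(P, Q, ℓ - 1)` already lie in `(P, Q)` when `ℓ` is a nonzerodivisor. -/
lemma mem_span_of_mem_sup {P Q ℓ : MvPolynomial (Fin 3) k} {d : ℕ}
    (hPd : P.IsHomogeneous d) (hQd : Q.IsHomogeneous d) (hℓ : ℓ.IsHomogeneous 1)
    (hnz : ∀ f, ℓ * f ∈ Ideal.span {P, Q} → f ∈ Ideal.span {P, Q}) {L : ℕ}
    {f : MvPolynomial (Fin 3) k} (hf : f.IsHomogeneous L)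
    (hI : f ∈ Ideal.span {P, Q} ⊔ Ideal.span {ℓ - 1}) : f ∈ Ideal.span {P, Q} := by
  set I := Ideal.span {P, Q} with hIdef
  obtain ⟨g, hg, r, hr, hgr⟩ := Submodule.mem_sup.mp hI
  obtain ⟨c, rfl⟩ := Ideal.mem_span_singleton'.mp hr
  -- component relations
  have hcomp : ∀ n, homogeneousComponent (n + 1) f
      - (ℓ * homogeneousComponent n c - homogeneousComponent (n + 1) c) ∈ I := by
    intro n
    have h1 := homogeneousComponent_mem_span hPd hQd hg (n + 1)
    have h2 : homogeneousComponent (n + 1) (ℓ * c) = ℓ * homogeneousComponent n c := by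
      rw [homogeneousComponent_mul_left hℓ, if_pos (by omega)]; simp
    rw [← hIdef] at h1
    convert h1 using 1
    rw [← h2, ← map_sub, ← map_sub]
    congr 1
    rw [← hgr]; ring
  have hcomp0 : homogeneousComponent 0 f + homogeneousComponent 0 c ∈ I := by
    have h1 := homogeneousComponent_mem_span hPd hQd hg 0
    have h2 : homogeneousComponent 0 (ℓ * c) = 0 := by
      rw [homogeneousComponent_mul_left hℓ, if_neg (by omega)]
    rw [← hIdef] at h1
    convert h1 using 1
    have : g = f + c - ℓ * c := by rw [← hgr]; ring
    rw [this, map_sub, h2, map_add, sub_zero]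
  have hfc : ∀ n, homogeneousComponent n f = if n = L then f else 0 := fun n =>
    homogeneousComponent_of_mem hf
  -- below `L`
  have hlow : ∀ n, n < L → homogeneousComponent n c ∈ I := by
    intro n
    induction n with
    | zero =>
      intro h
      have := hcomp0
      rwa [hfc, if_neg (by omega), zero_add] at this
    | succ n ih =>
      intro h
      have h1 := hcomp n
      rw [hfc, if_neg (by omega)] at h1
      have h2 := I.mul_mem_left ℓ (ih (by omega))
      have := add_mem h1 h2
      convert this using 1; ring
  have hhigh : ∀ j n, n ≥ L → n + j = L + c.totalDegree + 1 → homogeneousComponent n c ∈ I := by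
    intro j
    induction j with
    | zero =>
      intro n _ h2
      rw [homogeneousComponent_eq_zero _ _ (by omega)]; exact zero_mem _
    | succ j ih =>
      intro n h1 h2
      apply hnz
      have h3 := ih (n + 1) (by omega) (by omega)
      have h4 := hcomp n
      rw [hfc, if_neg (by omega)] at h4
      have := sub_mem h3 h4
      convert this using 1; ring
  have hL := hhigh (c.totalDegree + 1) L le_rfl (by omega)
  cases L with
  | zero =>
    have := sub_mem hcomp0 hL
    rw [hfc, if_pos rfl] at this
    convert this using 1; ring
  | succ n =>
    have h1 := hcomp n
    rw [hfc, if_pos rfl] at h1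
    have h2 := I.mul_mem_left ℓ (hlow n (by omega))
    have := sub_mem (add_mem h1 h2) hL
    convert this using 1; ring

end Dim

section Characters
variable {k A : Type*} [Field k] [IsAlgClosed k] [CommRing A] [Algebra k A] [Module.Finite k A]

lemma exists_joint_eigenvector {V : Type*} [AddCommGroup V] [Module k V] [Nontrivial V]
    (ρ : A →ₐ[k] Module.End k V) :
    ∃ (χ : A →ₐ[k] k) (v : V), v ≠ 0 ∧ ∀ a, ρ a v = χ a • v := by
  classical
  let _ : Module A V := Module.compHom V ρ.toRingHom
  have hsm : ∀ (a : A) (v : V), a • v = ρ a v := fun _ _ => rfl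
  have : IsNoetherianRing A := IsNoetherianRing.of_finite k A
  obtain ⟨p, hp⟩ := associatedPrimes.nonempty A V
  obtain ⟨hprime, v, hv⟩ := isAssociatedPrime_iff.mp (AssociatedPrimes.mem_iff.mp hp)
  have hbij : Function.Bijective (algebraMap k (A ⧸ p)) :=
    IsAlgClosed.algebraMap_bijective_of_isIntegral
  let e : k ≃ₐ[k] (A ⧸ p) := AlgEquiv.ofBijective (Algebra.ofId k (A ⧸ p)) hbij
  refine ⟨e.symm.toAlgHom.comp (Ideal.Quotient.mkₐ k p), v, ?_, ?_⟩
  · rintro rfl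
    apply hprime.ne_top
    rw [hv, Ideal.eq_top_iff_one, Submodule.mem_colon_singleton]
    simp
  · intro a
    set c := e.symm (Ideal.Quotient.mkₐ k p a) with hc
    have h1 : Ideal.Quotient.mkₐ k p a = algebraMap k (A ⧸ p) c := by
      have := e.apply_symm_apply (Ideal.Quotient.mkₐ k p a)
      rw [← hc] at this
      exact this.symm
    have h2 : a - algebraMap k A c ∈ p := by
      rw [← Ideal.Quotient.eq_zero_iff_mem, map_sub, sub_eq_zero]
      exact h1
    rw [hv, Submodule.mem_colon_singleton, Submodule.mem_bot, hsm, map_sub, AlgHom.commutes] at h2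
    simp only [LinearMap.sub_apply, Module.algebraMap_end_apply, sub_eq_zero] at h2
    exact h2

lemma exists_det_eq_prod_characters : ∀ (n : ℕ) {V : Type*} [AddCommGroup V] [Module k V]
    [Module.Finite k V] (_ : Module.finrank k V = n) (ρ : A →ₐ[k] Module.End k V),
    ∃ χ : Fin n → (A →ₐ[k] k), ∀ a, LinearMap.det (ρ a) = ∏ i, χ i a := by
  intro n
  induction n with
  | zero =>
    intro V _ _ _ hn ρ
    refine ⟨Fin.elim0, fun a => ?_⟩
    have := Module.finrank_zero_iff.mp hn
    rw [Subsingleton.elim (ρ a) LinearMap.id, LinearMap.det_id]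
    simp
  | succ n ih =>
    intro V _ _ _ hn ρ
    have : Nontrivial V := Module.nontrivial_of_finrank_pos (R := k) (by omega)
    obtain ⟨χ0, v, hv, hχ⟩ := exists_joint_eigenvector ρ
    let N : Submodule k V := k ∙ v
    have hN : ∀ a, N ≤ N.comap (ρ a) := by
      intro a
      rw [Submodule.span_singleton_le_iff_mem, Submodule.mem_comap, hχ]
      exact Submodule.smul_mem _ _ (Submodule.mem_span_singleton_self v)
    have hNf : Module.finrank k N = 1 := finrank_span_singleton hv
    have hQf : Module.finrank k (V ⧸ N) = n := by
      have := Submodule.finrank_quotient_add_finrank N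
      omega
    let ρ' : A →ₐ[k] Module.End k (V ⧸ N) :=
      { toFun := fun a => N.mapQ N (ρ a) (hN a)
        map_one' := by
          apply Submodule.linearMap_qext; ext x; simp
        map_mul' := by
          intro a b; apply Submodule.linearMap_qext; ext x; simp
        map_zero' := by
          apply Submodule.linearMap_qext; ext x; simp
        map_add' := by
          intro a b; apply Submodule.linearMap_qext; ext x; simp
        commutes' := by
          intro c; apply Submodule.linearMap_qext; ext x; simp [Module.algebraMap_end_apply] }
    obtain ⟨χ, hχ'⟩ := ih hQf ρ'
    refine ⟨Fin.cons χ0 χ, fun a => ?_⟩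
    rw [LinearMap.det_eq_det_mul_det N (ρ a) (hN a), Fin.prod_univ_succ]
    simp only [Fin.cons_zero, Fin.cons_succ]
    congr 1
    · have : LinearMap.restrict (ρ a) (p := N) (q := N) (fun x hx => hN a hx) = χ0 a • LinearMap.id := by
        ext ⟨x, hx⟩
        obtain ⟨c, rfl⟩ := Submodule.mem_span_singleton.mp hx
        simp [hχ, smul_comm c]
      rw [this, LinearMap.det_smul, hNf]
      simp
    · exact hχ' a

end Characters

section Macaulay
variable {k : Type*} [Field k]

/-- The algebra of functions on the scheme `P = Q = 0`, `ℓ = 1`. -/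
abbrev BezoutAlg (P Q ℓ : MvPolynomial (Fin 3) k) : Type _ :=
  MvPolynomial (Fin 3) k ⧸ (Ideal.span {P, Q} ⊔ Ideal.span {ℓ - 1})

/-- The restriction to forms of degree `L` of the quotient map. -/
noncomputable def bezoutQuot (P Q ℓ : MvPolynomial (Fin 3) k) (L : ℕ) :
    homogeneousSubmodule (Fin 3) k L →ₗ[k] BezoutAlg P Q ℓ :=
  (Ideal.Quotient.mkₐ k (Ideal.span {P, Q} ⊔ Ideal.span {ℓ - 1})).toLinearMap ∘ₗ
    (homogeneousSubmodule (Fin 3) k L).subtype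

lemma bezoutQuot_ell (P Q ℓ : MvPolynomial (Fin 3) k) :
    Ideal.Quotient.mk (Ideal.span {P, Q} ⊔ Ideal.span {ℓ - 1}) ℓ = 1 := by
  rw [← sub_eq_zero, ← map_one (Ideal.Quotient.mk _), ← map_sub, Ideal.Quotient.eq_zero_iff_mem]
  exact Ideal.mem_sup_right (Ideal.mem_span_singleton_self _)

variable {P Q ℓ : MvPolynomial (Fin 3) k} {d : ℕ}

lemma choose_two_mul_two (n : ℕ) :
    (((n + 2).choose 2 : ℕ) : ℤ) * 2 = (n + 2) * (n + 1) := by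
  have h2 := Nat.choose_two_right (n + 2)
  have h3 : (n + 2) * (n + 2 - 1) / 2 * 2 = (n + 2) * (n + 2 - 1) :=
    Nat.div_mul_cancel (even_iff_two_dvd.mp (Nat.even_mul_pred_self (n + 2)))
  rw [← h2, show n + 2 - 1 = n + 1 by omega] at h3
  exact_mod_cast h3

lemma finrank_range_bezoutQuot (hP : P ≠ 0) (hPd : P.IsHomogeneous d) (hQd : Q.IsHomogeneous d)
    (h : IsRelPrime P Q) (hℓ : ℓ.IsHomogeneous 1)
    (hnz : ∀ f, ℓ * f ∈ Ideal.span {P, Q} → f ∈ Ideal.span {P, Q}) (E : ℕ) :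
    Module.finrank k (LinearMap.range (bezoutQuot P Q ℓ (d + (d + E)))) = d ^ 2 := by
  have hr := LinearMap.finrank_range_add_finrank_ker (bezoutQuot P Q ℓ (d + (d + E)))
  have hk : (LinearMap.ker (bezoutQuot P Q ℓ (d + (d + E)))).map
      (homogeneousSubmodule (Fin 3) k (d + (d + E))).subtype = bezoutSpace P Q (d + E) := by
    apply le_antisymm
    · rintro _ ⟨f, hf, rfl⟩
      have hf2 : (f : MvPolynomial (Fin 3) k) ∈ Ideal.span {P, Q} ⊔ Ideal.span {ℓ - 1} :=
        Ideal.Quotient.eq_zero_iff_mem.mp hf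
      exact mem_bezoutSpace hPd hQd ((mem_homogeneousSubmodule _ _).mp f.2)
        (mem_span_of_mem_sup hPd hQd hℓ hnz ((mem_homogeneousSubmodule _ _).mp f.2) hf2)
    · intro f hf
      refine ⟨⟨f, bezoutSpace_le hPd hQd _ hf⟩, ?_, rfl⟩
      apply Ideal.Quotient.eq_zero_iff_mem.mpr
      apply Ideal.mem_sup_left
      obtain ⟨⟨a, b⟩, rfl⟩ := hf
      exact Ideal.mem_span_pair.mpr ⟨a, b, rfl⟩
  have hk2 : Module.finrank k (LinearMap.ker (bezoutQuot P Q ℓ (d + (d + E))))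
      = Module.finrank k (bezoutSpace P Q (d + E)) := by
    rw [← hk]
    exact (Submodule.equivMapOfInjective _ (Submodule.injective_subtype _) _).finrank_eq
  have hw := finrank_bezoutSpace hP hPd hQd h E
  rw [hk2, finrank_homog] at hr
  have e1 := choose_two_mul_two (d + (d + E))
  have e2 := choose_two_mul_two (d + E)
  have e3 := choose_two_mul_two E
  zify at hr hw ⊢
  push_cast at *
  nlinarith

lemma range_bezoutQuot (hP : P ≠ 0) (hPd : P.IsHomogeneous d) (hQd : Q.IsHomogeneous d)
    (h : IsRelPrime P Q) (hℓ : ℓ.IsHomogeneous 1)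
    (hnz : ∀ f, ℓ * f ∈ Ideal.span {P, Q} → f ∈ Ideal.span {P, Q}) :
    LinearMap.range (bezoutQuot P Q ℓ (d + d)) = ⊤ := by
  have hmono : ∀ L j, LinearMap.range (bezoutQuot P Q ℓ L) ≤
      LinearMap.range (bezoutQuot P Q ℓ (L + j)) := by
    intro L j
    rintro _ ⟨f, rfl⟩
    refine ⟨⟨f * ℓ ^ j, ?_⟩, ?_⟩
    · have := ((mem_homogeneousSubmodule _ _).mp f.2).mul (hℓ.pow j)
      rwa [one_mul] at this
    · show Ideal.Quotient.mk _ (f * ℓ ^ j) = Ideal.Quotient.mk _ _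
      rw [map_mul, map_pow, bezoutQuot_ell, one_pow, mul_one]
      rfl
  have heq : ∀ E, LinearMap.range (bezoutQuot P Q ℓ (d + d + E)) =
      LinearMap.range (bezoutQuot P Q ℓ (d + d)) := by
    intro E
    symm
    apply Submodule.eq_of_le_of_finrank_eq (hmono _ _)
    have h0 := finrank_range_bezoutQuot hP hPd hQd h hℓ hnz 0
    have h1 := finrank_range_bezoutQuot hP hPd hQd h hℓ hnz E
    rw [add_zero] at h0
    rw [h0, add_assoc, h1]
  rw [eq_top_iff]
  rintro x -
  obtain ⟨f, rfl⟩ := Ideal.Quotient.mk_surjective x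
  rw [← sum_homogeneousComponent f, map_sum]
  apply Submodule.sum_mem
  intro i _
  have : Ideal.Quotient.mk (Ideal.span {P, Q} ⊔ Ideal.span {ℓ - 1}) (homogeneousComponent i f)
      ∈ LinearMap.range (bezoutQuot P Q ℓ i) := ⟨⟨_, homogeneousComponent_mem i f⟩, rfl⟩
  rw [← heq i, add_comm]
  exact hmono i _ this

end Macaulay

section MacDet

/-- The rows of the Macaulay matrix: fixed integer forms `w`, and the multiples of `R` by the
monomials with exponents `h`. -/
noncomputable def macRow {S : Type*} [CommRing S] {r n : ℕ}
    (w : Fin r → MvPolynomial (Fin 3) ℤ) (h : Fin n → Fin 3 →₀ ℕ) (R : MvPolynomial (Fin 3) S) :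
    Fin r ⊕ Fin n → MvPolynomial (Fin 3) S :=
  Sum.elim (fun i => map (Int.castRingHom S) (w i)) (fun j => R * monomial (h j) 1)

/-- The Macaulay determinant. -/
noncomputable def macDet {S : Type*} [CommRing S] {r n : ℕ}
    (w : Fin r → MvPolynomial (Fin 3) ℤ) (h : Fin n → Fin 3 →₀ ℕ)
    (e : Fin r ⊕ Fin n → Fin 3 →₀ ℕ) (R : MvPolynomial (Fin 3) S) : S :=
  (Matrix.of fun i j => coeff (e j) (macRow w h R i)).det

lemma map_macRow {S S' : Type*} [CommRing S] [CommRing S'] (f : S →+* S') {r n : ℕ}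
    (w : Fin r → MvPolynomial (Fin 3) ℤ) (h : Fin n → Fin 3 →₀ ℕ) (R : MvPolynomial (Fin 3) S)
    (i : Fin r ⊕ Fin n) : macRow w h (map f R) i = map f (macRow w h R i) := by
  rcases i with i | j
  · simp only [macRow, Sum.elim_inl, map_map]
    congr 1
    exact congrArg _ (RingHom.ext_int _ _)
  · simp [macRow]

lemma map_macDet {S S' : Type*} [CommRing S] [CommRing S'] (f : S →+* S') {r n : ℕ}
    (w : Fin r → MvPolynomial (Fin 3) ℤ) (h : Fin n → Fin 3 →₀ ℕ)
    (e : Fin r ⊕ Fin n → Fin 3 →₀ ℕ) (R : MvPolynomial (Fin 3) S) :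
    macDet w h e (map f R) = f (macDet w h e R) := by
  rw [macDet, macDet, RingHom.map_det]
  congr 1
  ext i j
  simp [map_macRow, coeff_map]

end MacDet

section Identity
variable {k : Type} [Field k]

lemma macDet_ne_zero {L : ℕ} {r n : ℕ} (w : Fin r → MvPolynomial (Fin 3) ℤ)
    (h : Fin n → Fin 3 →₀ ℕ) (e : Fin r ⊕ Fin n ≃ Mon L) (R : MvPolynomial (Fin 3) k)
    (hL : ∀ i, (macRow w h R i).IsHomogeneous L) (hli : LinearIndependent k (macRow w h R)) :
    macDet w h (fun j => (e j : Fin 3 →₀ ℕ)) R ≠ 0 := by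
  rw [macDet, ← isUnit_iff_ne_zero, ← Matrix.isUnit_iff_isUnit_det,
    ← Matrix.linearIndependent_rows_iff_isUnit]
  rw [Fintype.linearIndependent_iff] at hli ⊢
  intro g hg
  apply hli
  ext m
  simp only [coeff_sum, coeff_smul, coeff_zero]
  by_cases hm : m.degree = L
  · obtain ⟨j, hj⟩ := e.surjective ⟨m, mem_finsuppAntidiag_iff_degree.mpr hm⟩
    have := congrFun hg j
    simp only [Matrix.row, Finset.sum_apply, Pi.smul_apply, Matrix.of_apply, hj, Pi.zero_apply] at this
    exact this
  · apply Finset.sum_eq_zero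
    intro i _
    rw [(hL i).coeff_eq_zero hm, smul_zero]

lemma mem_span_monomials {L : ℕ} {f : MvPolynomial (Fin 3) k} (hf : f.IsHomogeneous L) :
    f ∈ Submodule.span k ((fun m : Fin 3 →₀ ℕ => monomial m (1 : k)) '' {m | m.degree = L}) := by
  rw [f.as_sum]
  apply Submodule.sum_mem
  intro m hm
  rw [show monomial m (coeff m f) = coeff m f • monomial m (1 : k) by
    rw [smul_monomial, smul_eq_mul, mul_one]]
  apply Submodule.smul_mem
  apply Submodule.subset_span
  refine ⟨m, ?_, rfl⟩
  by_contra hne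
  exact (mem_support_iff.mp hm) (hf.coeff_eq_zero hne)

lemma Module.Finite.of_range_bezoutQuot {P Q ℓ : MvPolynomial (Fin 3) k} {d : ℕ}
    (hP : P ≠ 0) (hPd : P.IsHomogeneous d) (hQd : Q.IsHomogeneous d)
    (h : IsRelPrime P Q) (hℓ : ℓ.IsHomogeneous 1)
    (hnz : ∀ f, ℓ * f ∈ Ideal.span {P, Q} → f ∈ Ideal.span {P, Q}) :
    Module.Finite k (BezoutAlg P Q ℓ) :=
  Module.Finite.of_surjective (bezoutQuot P Q ℓ (d + d))
    (LinearMap.range_eq_top.mp (range_bezoutQuot hP hPd hQd h hℓ hnz))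

lemma exists_monomial_basis {P Q ℓ : MvPolynomial (Fin 3) k} {d : ℕ}
    (hP : P ≠ 0) (hPd : P.IsHomogeneous d) (hQd : Q.IsHomogeneous d)
    (h : IsRelPrime P Q) (hℓ : ℓ.IsHomogeneous 1)
    (hnz : ∀ f, ℓ * f ∈ Ideal.span {P, Q} → f ∈ Ideal.span {P, Q}) :
    ∃ m : Fin (d ^ 2) → Fin 3 →₀ ℕ, (∀ i, (m i).degree = d + d) ∧
      ∃ b : Module.Basis (Fin (d ^ 2)) k (BezoutAlg P Q ℓ),
        ∀ i, b i = Ideal.Quotient.mk _ (monomial (m i) 1) := by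
  set s : Set (BezoutAlg P Q ℓ) := (fun m : Fin 3 →₀ ℕ => Ideal.Quotient.mk _ (monomial m (1 : k))) ''
    {m | m.degree = d + d} with hs
  have hr := range_bezoutQuot hP hPd hQd h hℓ hnz
  have hspan : Submodule.span k s = ⊤ := by
    rw [eq_top_iff, ← hr]
    rintro _ ⟨f, rfl⟩
    have h1 := mem_span_monomials ((mem_homogeneousSubmodule _ _).mp f.2)
    have h2 := Submodule.mem_map_of_mem (f := (Ideal.Quotient.mkₐ k
      (Ideal.span {P, Q} ⊔ Ideal.span {ℓ - 1})).toLinearMap) h1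
    rw [Submodule.map_span, Set.image_image] at h2
    exact h2
  have hfr : Module.finrank k (BezoutAlg P Q ℓ) = d ^ 2 := by
    have := finrank_range_bezoutQuot hP hPd hQd h hℓ hnz 0
    rw [add_zero, hr, finrank_top] at this
    exact this
  have := Module.Finite.of_range_bezoutQuot hP hPd hQd h hℓ hnz
  obtain ⟨f, hfs, hsp, hli⟩ := Submodule.exists_fun_fin_finrank_span_eq k s
  have hn : Module.finrank k (Submodule.span k s) = d ^ 2 := by rw [hspan, finrank_top, hfr]
  choose m hm hmf using hfs
  refine ⟨fun i => m (finCongr hn.symm i), fun i => hm _, ?_⟩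
  let b := Module.Basis.mk hli (by rw [hsp, hspan])
  refine ⟨b.reindex (finCongr hn), fun i => ?_⟩
  rw [Module.Basis.reindex_apply, Module.Basis.mk_apply, ← hmf]
  rfl

lemma exists_basis_bezoutSpace (P Q : MvPolynomial (Fin 3) ℤ) (M : ℕ) :
    ∃ r, r = Module.finrank k (bezoutSpace (map (Int.castRingHom k) P)
        (map (Int.castRingHom k) Q) M) ∧ ∃ w : Fin r → MvPolynomial (Fin 3) ℤ,
      (∀ i, ∃ m : Fin 3 →₀ ℕ, m.degree = M ∧ (w i = monomial m 1 * P ∨ w i = monomial m 1 * Q)) ∧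
      LinearIndependent k (fun i => map (Int.castRingHom k) (w i)) ∧
      Submodule.span k (Set.range fun i => map (Int.castRingHom k) (w i)) =
        bezoutSpace (map (Int.castRingHom k) P) (map (Int.castRingHom k) Q) M := by
  set P' := map (Int.castRingHom k) P
  set Q' := map (Int.castRingHom k) Q
  set s : Set (MvPolynomial (Fin 3) k) := map (Int.castRingHom k) ''
    {w | ∃ m : Fin 3 →₀ ℕ, m.degree = M ∧ (w = monomial m 1 * P ∨ w = monomial m 1 * Q)} with hs
  have hspan : Submodule.span k s = bezoutSpace P' Q' M := by
    apply le_antisymm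
    · rw [Submodule.span_le]
      rintro _ ⟨_, ⟨m, hm, rfl | rfl⟩, rfl⟩
      · exact ⟨(⟨monomial m 1, isHomogeneous_monomial _ hm⟩, 0), by simp [bezoutMap, P']⟩
      · exact ⟨(0, ⟨monomial m 1, isHomogeneous_monomial _ hm⟩), by simp [bezoutMap, Q']⟩
    · rintro _ ⟨⟨a, b⟩, rfl⟩
      have key : ∀ R : MvPolynomial (Fin 3) k, (∀ m : Fin 3 →₀ ℕ, m.degree = M →
          monomial m 1 * R ∈ s) → ∀ a : homogeneousSubmodule (Fin 3) k M,
          (a : MvPolynomial (Fin 3) k) * R ∈ Submodule.span k s := by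
        intro R hR a
        have h1 := mem_span_monomials ((mem_homogeneousSubmodule _ _).mp a.2)
        have h2 := Submodule.mem_map_of_mem (f := LinearMap.mulRight k R) h1
        rw [Submodule.map_span, Set.image_image] at h2
        refine Submodule.span_mono ?_ h2
        rintro _ ⟨m, hm, rfl⟩
        exact hR m hm
      apply Submodule.add_mem
      · exact key P' (fun m hm => ⟨monomial m 1 * P, ⟨m, hm, Or.inl rfl⟩, by simp [P']⟩) a
      · exact key Q' (fun m hm => ⟨monomial m 1 * Q, ⟨m, hm, Or.inr rfl⟩, by simp [Q']⟩) b
  have : Module.Finite k (Submodule.span k s) := by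
    rw [hspan]
    exact Module.Finite.range _
  obtain ⟨f, hfs, hsp, hli⟩ := Submodule.exists_fun_fin_finrank_span_eq k s
  replace hsp := hsp.trans hspan
  have hn : Module.finrank k (Submodule.span k s) = Module.finrank k (bezoutSpace P' Q' M) := by
    rw [hspan]
  choose w hw hwf using hfs
  have hcomp : (fun i => map (Int.castRingHom k) (w (finCongr hn.symm i)))
      = f ∘ (finCongr hn.symm) := by
    ext1 i; simp [hwf]
  refine ⟨_, rfl, fun i => w (finCongr hn.symm i), fun i => hw _, ?_, ?_⟩
  · rw [hcomp]
    exact hli.comp _ (finCongr hn.symm).injective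
  · rw [hcomp, (finCongr hn.symm).surjective.range_comp, hsp]

lemma macRow_isHomogeneous {S : Type*} [CommRing S] {P Q : MvPolynomial (Fin 3) ℤ} {d E r n : ℕ}
    (hPd : P.IsHomogeneous d) (hQd : Q.IsHomogeneous d)
    {w : Fin r → MvPolynomial (Fin 3) ℤ} {h : Fin n → Fin 3 →₀ ℕ}
    (hw : ∀ i, ∃ m : Fin 3 →₀ ℕ, m.degree = d + E ∧ (w i = monomial m 1 * P ∨ w i = monomial m 1 * Q))
    (hh : ∀ i, (h i).degree = d + d) {R : MvPolynomial (Fin 3) S} (hR : R.IsHomogeneous E) :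
    ∀ i, (macRow w h R i).IsHomogeneous (d + d + E) := by
  rintro (i | j)
  · obtain ⟨m, hm, h1⟩ := hw i
    have hmh := isHomogeneous_monomial (1 : ℤ) hm
    have h2 : (w i).IsHomogeneous (d + d + E) := by
      rcases h1 with h1 | h1
      · rw [h1, show d + d + E = d + E + d by ring]; exact hmh.mul hPd
      · rw [h1, show d + d + E = d + E + d by ring]; exact hmh.mul hQd
    exact h2.map _
  · have := hR.mul (isHomogeneous_monomial (1 : S) (hh j))
    rw [add_comm] at this
    exact this

lemma linForm_isHomogeneous {S : Type*} [CommRing S] (u : S) : (linForm u).IsHomogeneous 1 := by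
  unfold linForm
  refine ((isHomogeneous_X _ _).add ?_).add ?_
  · have := (isHomogeneous_C (Fin 3) u).mul (isHomogeneous_X S (1 : Fin 3))
    rwa [zero_add] at this
  · have := (isHomogeneous_C (Fin 3) (u ^ 2)).mul (isHomogeneous_X S (2 : Fin 3))
    rwa [zero_add] at this

theorem exists_macaulay_aux [IsAlgClosed k] [CharZero k] {P Q : MvPolynomial (Fin 3) ℤ} {d : ℕ}
    (hP : P ≠ 0) (hPd : P.IsHomogeneous d) (hQd : Q.IsHomogeneous d)
    (hrel : IsRelPrime (map (Int.castRingHom k) P) (map (Int.castRingHom k) Q)) :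
    ∃ (Z : Fin (d ^ 2) → Fin 3 → k) (h : Fin (d ^ 2) → Fin 3 →₀ ℕ), (∀ i, Z i ≠ 0) ∧
      (∀ i, (h i).degree = d + d) ∧ ∀ E, ∃ (r : ℕ) (w : Fin r → MvPolynomial (Fin 3) ℤ)
      (e : Fin r ⊕ Fin (d ^ 2) ≃ Mon (d + d + E)) (κ : ℤ), κ ≠ 0 ∧
      (∀ i, ∃ m : Fin 3 →₀ ℕ, m.degree = d + E ∧
        (w i = monomial m 1 * P ∨ w i = monomial m 1 * Q)) ∧
      ∀ R : MvPolynomial (Fin 3) k, R.IsHomogeneous E →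
        macDet w h (fun j => (e j : Fin 3 →₀ ℕ)) R = κ * ∏ i, eval (Z i) R := by
  set P' := map (Int.castRingHom k) P with hP'
  set Q' := map (Int.castRingHom k) Q with hQ'
  have hPne : P' ≠ 0 := by
    rw [hP', Ne, map_eq_zero_iff _ (map_injective _ (RingHom.injective_int _))]
    exact hP
  have hPd' : P'.IsHomogeneous d := hPd.map _
  have hQd' : Q'.IsHomogeneous d := hQd.map _
  obtain ⟨u, hnz⟩ := exists_linForm_nonzerodivisor hPne hrel
  set ℓ := linForm (u : k) with hℓdef
  have hℓ : ℓ.IsHomogeneous 1 := linForm_isHomogeneous _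
  have hfin := Module.Finite.of_range_bezoutQuot hPne hPd' hQd' hrel hℓ hnz
  obtain ⟨h, hh, b, hb⟩ := exists_monomial_basis hPne hPd' hQd' hrel hℓ hnz
  have hfr : Module.finrank k (BezoutAlg P' Q' ℓ) = d ^ 2 := by
    rw [Module.finrank_eq_card_basis b, Fintype.card_fin]
  set q := Ideal.Quotient.mk (Ideal.span {P', Q'} ⊔ Ideal.span {ℓ - 1}) with hq
  obtain ⟨χ, hχ⟩ := exists_det_eq_prod_characters (d ^ 2) hfr (Algebra.lmul k (BezoutAlg P' Q' ℓ))
  set Z : Fin (d ^ 2) → Fin 3 → k := fun i j => χ i (q (X j)) with hZ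
  have hχZ : ∀ i R, χ i (q R) = eval (Z i) R := by
    intro i R
    have : ((χ i).comp (Ideal.Quotient.mkₐ k _)) = aeval (Z i) := by
      ext j
      simp [hZ, hq]
    have h2 := DFunLike.congr_fun this R
    rw [← coe_aeval_eq_eval]
    exact h2
  refine ⟨Z, h, ?_, hh, ?_⟩
  · intro i h0
    have h1 := hχZ i ℓ
    rw [hq, bezoutQuot_ell, map_one, h0] at h1
    simp [hℓdef, linForm] at h1
  intro E
  obtain ⟨r, hr, w, hw, hwli, hwsp⟩ := exists_basis_bezoutSpace (k := k) P Q (d + E)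
  have hrows : ∀ R : MvPolynomial (Fin 3) k, R.IsHomogeneous E →
      ∀ i, (macRow w h R i).IsHomogeneous (d + d + E) :=
    fun R hR => macRow_isHomogeneous hPd hQd hw hh hR
  have hcard : Fintype.card (Fin r ⊕ Fin (d ^ 2)) = Fintype.card (Mon (d + d + E)) := by
    have h1 := finrank_bezoutSpace hPne hPd' hQd' hrel E
    rw [← hr] at h1
    rw [Fintype.card_sum, Fintype.card_fin, Fintype.card_fin, card_Mon]
    have e1 := choose_two_mul_two (d + d + E)
    have e2 := choose_two_mul_two (d + E)
    have e3 := choose_two_mul_two E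
    zify at h1 ⊢
    push_cast at *
    nlinarith
  have e := Fintype.equivOfCardEq hcard
  have hℓE : (ℓ ^ E).IsHomogeneous E := by simpa using hℓ.pow E
  have hker : ∀ i, q (map (Int.castRingHom k) (w i)) = 0 := by
    intro i
    apply Ideal.Quotient.eq_zero_iff_mem.mpr
    apply Ideal.mem_sup_left
    obtain ⟨m, -, h1 | h1⟩ := hw i
    · rw [h1, map_mul]
      exact Ideal.mul_mem_left _ _ (Ideal.subset_span (by simp [hP', hQ']))
    · rw [h1, map_mul]
      exact Ideal.mul_mem_left _ _ (Ideal.subset_span (by simp [hP', hQ']))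
  have hqℓ : ∀ j, q (ℓ ^ E * monomial (h j) 1) = b j := by
    intro j
    rw [map_mul, map_pow, hq, bezoutQuot_ell, one_pow, one_mul, hb]
  have hli : LinearIndependent k (macRow w h (ℓ ^ E)) := by
    rw [Fintype.linearIndependent_iff]
    intro g hg
    rw [Fintype.sum_sum_type] at hg
    have h1 := congrArg (Ideal.Quotient.mkₐ k (Ideal.span {P', Q'} ⊔ Ideal.span {ℓ - 1})) hg
    simp only [macRow, Sum.elim_inl, Sum.elim_inr, map_add, map_sum, map_smul, map_zero] at h1
    have h2 : ∑ i, g (Sum.inl i) • q (map (Int.castRingHom k) (w i)) +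
      ∑ j, g (Sum.inr j) • q (ℓ ^ E * monomial (h j) 1) = 0 := h1
    simp only [hker, hqℓ, smul_zero, Finset.sum_const_zero, zero_add] at h2
    have h3 := Fintype.linearIndependent_iff.mp b.linearIndependent _ h2
    simp only [macRow, Sum.elim_inl, Sum.elim_inr, h3, zero_smul, Finset.sum_const_zero,
      add_zero] at hg
    have h4 := Fintype.linearIndependent_iff.mp hwli _ hg
    rintro (i | j)
    · exact h4 i
    · exact h3 j
  have hdet0 := macDet_ne_zero w h e (ℓ ^ E) (hrows _ hℓE) hli
  set κ : ℤ := macDet w h (fun j => (e j : Fin 3 →₀ ℕ)) ((linForm (u : ℤ)) ^ E) with hκ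
  have hκk : macDet w h (fun j => (e j : Fin 3 →₀ ℕ)) (ℓ ^ E) = (κ : k) := by
    have := map_macDet (Int.castRingHom k) w h (fun j => (e j : Fin 3 →₀ ℕ)) ((linForm (u : ℤ)) ^ E)
    rw [← hκ] at this
    simp only [eq_intCast] at this
    rw [← this]
    congr 1
    simp [linForm, hℓdef]
  refine ⟨r, w, e, κ, ?_, hw, ?_⟩
  · intro h0
    rw [hκk, h0] at hdet0
    simp at hdet0
  intro R hR
  set Mx := LinearMap.toMatrix b b (Algebra.lmul k (BezoutAlg P' Q' ℓ) (q R)) with hMx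
  have hMR : ∀ j, q R * b j = ∑ i, Mx i j • b i := by
    intro j
    rw [← b.sum_repr (q R * b j)]
    apply Finset.sum_congr rfl
    intro i _
    rw [hMx, LinearMap.toMatrix_apply]
    simp
  have hc : ∀ j, ∃ c : Fin r → k, ∑ i, c i • map (Int.castRingHom k) (w i) =
      R * monomial (h j) 1 - ∑ i, Mx i j • (ℓ ^ E * monomial (h i) 1) := by
    intro j
    apply (Submodule.mem_span_range_iff_exists_fun k).mp
    rw [hwsp]
    have hhom : (R * monomial (h j) 1 - ∑ i, Mx i j • (ℓ ^ E * monomial (h i) 1) :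
        MvPolynomial (Fin 3) k).IsHomogeneous (d + (d + E)) := by
      rw [← add_assoc]
      apply IsHomogeneous.sub
      · exact hrows R hR (Sum.inr j)
      · apply IsHomogeneous.sum
        intro i _
        have := hrows _ hℓE (Sum.inr i)
        exact (homogeneousSubmodule (Fin 3) k _).smul_mem _ this
    apply mem_bezoutSpace hPd' hQd' hhom
    apply mem_span_of_mem_sup hPd' hQd' hℓ hnz hhom
    rw [← Ideal.Quotient.eq_zero_iff_mem, map_sub, map_sum, sub_eq_zero, map_mul, ← hb, hMR]
    apply Finset.sum_congr rfl
    intro i _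
    rw [← hqℓ]
    rfl
  choose c hc using hc
  have hmat : (Matrix.of fun i j => coeff ((e j : Fin 3 →₀ ℕ)) (macRow w h R i)) =
      Matrix.fromBlocks 1 0 (Matrix.of c) Mx.transpose *
      (Matrix.of fun i j => coeff ((e j : Fin 3 →₀ ℕ)) (macRow w h (ℓ ^ E) i)) := by
    ext i j
    rw [Matrix.mul_apply, Fintype.sum_sum_type]
    rcases i with i | i
    · simp [Matrix.one_apply, macRow]
    · have h1 := congrArg (coeff (e j : Fin 3 →₀ ℕ)) (hc i)
      simp only [coeff_sub, coeff_sum, coeff_smul, smul_eq_mul] at h1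
      simp only [macRow, Matrix.of_apply, Sum.elim_inr, Sum.elim_inl, Matrix.fromBlocks_apply₂₁,
        Matrix.fromBlocks_apply₂₂, Matrix.transpose_apply]
      rw [h1]
      ring
  rw [macDet, hmat, Matrix.det_mul, Matrix.det_fromBlocks_zero₁₂, Matrix.det_one, one_mul,
    Matrix.det_transpose, hMx, LinearMap.det_toMatrix, hχ, ← hκk, mul_comm]
  congr 1
  exact Finset.prod_congr rfl fun i _ => hχZ i R

lemma map_eval_eq {S S' τ : Type*} [CommRing S] [CommRing S'] (f : S →+* S') (x : τ → S)
    (p : MvPolynomial τ S) : f (eval x p) = eval (f ∘ x) (map f p) := by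
  rw [eval_map, ← eval₂_id, eval₂_comp_left, RingHom.comp_id]

/-- The generic form of degree `E`. -/
noncomputable def genForm (k : Type*) [CommRing k] (E : ℕ) :
    MvPolynomial (Fin 3) (MvPolynomial (Mon E) k) :=
  ∑ m : Mon E, monomial (m : Fin 3 →₀ ℕ) (X m)

lemma map_genForm_isHomogeneous {k S : Type*} [CommRing k] [CommRing S] {E : ℕ}
    (f : MvPolynomial (Mon E) k →+* S) : (map f (genForm k E)).IsHomogeneous E := by
  rw [genForm, map_sum]
  apply IsHomogeneous.sum
  intro m _
  rw [map_monomial]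
  exact isHomogeneous_monomial _ m.degree_eq

lemma eq_map_genForm {k S : Type*} [CommRing k] [CommRing S] {E : ℕ} (σ : k →+* S)
    {R : MvPolynomial (Fin 3) S} (hR : R.IsHomogeneous E) :
    map (eval₂Hom σ fun m : Mon E => coeff (m : Fin 3 →₀ ℕ) R) (genForm k E) = R := by
  rw [genForm, map_sum]
  ext m
  simp only [map_monomial, coe_eval₂Hom, eval₂_X, coeff_sum, coeff_monomial]
  by_cases hm : m.degree = E
  · rw [Finset.sum_eq_single (⟨m, mem_finsuppAntidiag_iff_degree.mpr hm⟩ : Mon E)]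
    · simp
    · intro b _ hb
      rw [if_neg]
      rintro rfl
      exact hb rfl
    · simp
  · rw [hR.coeff_eq_zero hm]
    apply Finset.sum_eq_zero
    intro b _
    rw [if_neg]
    rintro rfl
    exact hm b.degree_eq

lemma macDet_genForm [Infinite k] {r n L E : ℕ} {w : Fin r → MvPolynomial (Fin 3) ℤ}
    {h : Fin n → Fin 3 →₀ ℕ} {e : Fin r ⊕ Fin n → Mon L} {κ : ℤ} {Z : Fin n → Fin 3 → k}
    (hk : ∀ R : MvPolynomial (Fin 3) k, R.IsHomogeneous E →
        macDet w h (fun j => (e j : Fin 3 →₀ ℕ)) R = κ * ∏ i, eval (Z i) R) :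
    macDet w h (fun j => (e j : Fin 3 →₀ ℕ)) (genForm k E)
      = κ * ∏ i, eval (fun j => C (Z i j)) (genForm k E) := by
  have key : ∀ c : Mon E → k, eval c (macDet w h (fun j => (e j : Fin 3 →₀ ℕ)) (genForm k E)) =
      eval c (κ * ∏ i, eval (fun j => C (Z i j)) (genForm k E)) := by
    intro c
    have h1 := map_macDet (eval c) w h (fun j => (e j : Fin 3 →₀ ℕ)) (genForm k E)
    rw [hk _ (map_genForm_isHomogeneous _)] at h1
    rw [← h1, map_mul, map_prod, map_intCast]
    refine congrArg (fun x : k => (κ : k) * x) (Finset.prod_congr rfl fun i _ => ?_)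
    have h2 := map_eval_eq (eval c) (fun j => C (Z i j)) (genForm k E)
    rw [h2]
    have h3 : (fun j => C (Z i j) : Fin 3 → MvPolynomial (Mon E) k) = C ∘ Z i := rfl
    have h4 : eval c ∘ (fun j => C (Z i j) : Fin 3 → MvPolynomial (Mon E) k) = Z i := by
      ext1 j
      exact eval_C _
    rw [h4]
  exact MvPolynomial.funext key

lemma macDet_eq_of_field [Infinite k] {r n L E : ℕ} {w : Fin r → MvPolynomial (Fin 3) ℤ}
    {h : Fin n → Fin 3 →₀ ℕ} {e : Fin r ⊕ Fin n → Mon L} {κ : ℤ} {Z : Fin n → Fin 3 → k}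
    (hk : ∀ R : MvPolynomial (Fin 3) k, R.IsHomogeneous E →
        macDet w h (fun j => (e j : Fin 3 →₀ ℕ)) R = κ * ∏ i, eval (Z i) R)
    {S : Type*} [CommRing S] (σ : k →+* S) (R : MvPolynomial (Fin 3) S) (hR : R.IsHomogeneous E) :
    macDet w h (fun j => (e j : Fin 3 →₀ ℕ)) R = κ * ∏ i, eval (σ ∘ Z i) R := by
  have h1 := map_macDet (eval₂Hom σ fun m : Mon E => coeff (m : Fin 3 →₀ ℕ) R) w h
    (fun j => (e j : Fin 3 →₀ ℕ)) (genForm k E)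
  rw [eq_map_genForm σ hR] at h1
  rw [h1, macDet_genForm hk, map_mul, map_prod, map_intCast]
  refine congrArg (fun x : S => (κ : S) * x) (Finset.prod_congr rfl fun i _ => ?_)
  have h2 := map_eval_eq (eval₂Hom σ fun m : Mon E => coeff (m : Fin 3 →₀ ℕ) R)
    (fun j => C (Z i j)) (genForm k E)
  rw [eq_map_genForm σ hR] at h2
  rw [h2]
  have h4 : (eval₂Hom σ fun m : Mon E => coeff (m : Fin 3 →₀ ℕ) R) ∘
      (fun j => C (Z i j) : Fin 3 → MvPolynomial (Mon E) k) = σ ∘ Z i := by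
    ext1 j
    exact eval₂_C _ _ _
  rw [h4]

/-- **Macaulay's resultant for two plane curves**: for coprime integer forms `P`, `Q` of degree
`d`, the product of the values of a form `R` at the `d ^ 2` points of intersection is, up to a
nonzero integer, the determinant of a matrix whose rows are multiples of `P`, `Q` and `R`. -/
theorem exists_macaulay [IsAlgClosed k] [CharZero k] {P Q : MvPolynomial (Fin 3) ℤ} {d : ℕ}
    (hP : P ≠ 0) (hPd : P.IsHomogeneous d) (hQd : Q.IsHomogeneous d)
    (hrel : IsRelPrime (map (Int.castRingHom k) P) (map (Int.castRingHom k) Q)) :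
    ∃ (Z : Fin (d ^ 2) → Fin 3 → k) (h : Fin (d ^ 2) → Fin 3 →₀ ℕ), (∀ i, Z i ≠ 0) ∧
      (∀ i, (h i).degree = d + d) ∧ ∀ E, ∃ (r : ℕ) (w : Fin r → MvPolynomial (Fin 3) ℤ)
      (e : Fin r ⊕ Fin (d ^ 2) ≃ Mon (d + d + E)) (κ : ℤ), κ ≠ 0 ∧
      (∀ i, ∃ m : Fin 3 →₀ ℕ, m.degree = d + E ∧
        (w i = monomial m 1 * P ∨ w i = monomial m 1 * Q)) ∧
      ∀ (S : Type) [CommRing S] (σ : k →+* S) (R : MvPolynomial (Fin 3) S), R.IsHomogeneous E →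
        macDet w h (fun j => (e j : Fin 3 →₀ ℕ)) R = κ * ∏ i, eval (σ ∘ Z i) R := by
  have : Infinite k := inferInstance
  obtain ⟨Z, h, h1, h2, h3⟩ := exists_macaulay_aux (k := k) hP hPd hQd hrel
  refine ⟨Z, h, h1, h2, fun E => ?_⟩
  obtain ⟨r, w, e, κ, h4, h5, h6⟩ := h3 E
  exact ⟨r, w, e, κ, h4, h5, fun S _ σ R hR => macDet_eq_of_field h6 σ R hR⟩

end Identity

/-- The first `n` coefficients of a polynomial, weighted by factorials and summed. -/
noncomputable def facNorm (n : ℕ) (p : Polynomial ℂ) : ℝ :=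
  ∑ i ∈ Finset.range n, ‖p.coeff i‖ * i.factorial

lemma facNorm_nonneg (n : ℕ) (p : Polynomial ℂ) : 0 ≤ facNorm n p :=
  Finset.sum_nonneg fun _ _ => by positivity

lemma facNorm_add_le (n : ℕ) (p q : Polynomial ℂ) :
    facNorm n (p + q) ≤ facNorm n p + facNorm n q := by
  unfold facNorm
  rw [← Finset.sum_add_distrib]
  refine Finset.sum_le_sum fun i _ => ?_
  rw [← add_mul, Polynomial.coeff_add]
  gcongr
  exact norm_add_le _ _

lemma facNorm_C_mul (n : ℕ) (c : ℂ) (p : Polynomial ℂ) :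
    facNorm n (Polynomial.C c * p) = ‖c‖ * facNorm n p := by
  simp [facNorm, Finset.mul_sum, mul_assoc]

lemma facNorm_neg (n : ℕ) (p : Polynomial ℂ) : facNorm n (-p) = facNorm n p := by
  simp [facNorm]

lemma facNorm_sub_le (n : ℕ) (p q : Polynomial ℂ) :
    facNorm n (p - q) ≤ facNorm n p + facNorm n q := by
  rw [sub_eq_add_neg, ← facNorm_neg n q]
  exact facNorm_add_le _ _ _

lemma facNorm_sum_le {ι : Type*} (n : ℕ) (s : Finset ι) (p : ι → Polynomial ℂ) :
    facNorm n (∑ i ∈ s, p i) ≤ ∑ i ∈ s, facNorm n (p i) := by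
  classical
  induction s using Finset.induction_on with
  | empty => simp [facNorm]
  | insert a s ha ih =>
    rw [Finset.sum_insert ha, Finset.sum_insert ha]
    exact (facNorm_add_le _ _ _).trans (by gcongr)

lemma norm_coeff_mul_factorial_le_facNorm {n i : ℕ} (h : i < n) (p : Polynomial ℂ) :
    ‖p.coeff i‖ * i.factorial ≤ facNorm n p :=
  Finset.single_le_sum (f := fun i => ‖p.coeff i‖ * (i.factorial : ℝ))
    (fun _ _ => by positivity) (Finset.mem_range.2 h)

lemma norm_coeff_le_facNorm {n i : ℕ} (h : i < n) (p : Polynomial ℂ) :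
    ‖p.coeff i‖ ≤ facNorm n p := by
  refine le_trans ?_ (norm_coeff_mul_factorial_le_facNorm h p)
  refine le_mul_of_one_le_right (norm_nonneg _) ?_
  exact_mod_cast i.factorial_pos

lemma facNorm_derivative_le (n : ℕ) (p : Polynomial ℂ) :
    facNorm n (Polynomial.derivative p) ≤ facNorm (n + 1) p := by
  unfold facNorm
  rw [Finset.sum_range_succ']
  refine le_add_of_le_of_nonneg (Finset.sum_le_sum fun i _ => le_of_eq ?_) (by positivity)
  rw [Polynomial.coeff_derivative, norm_mul, Nat.factorial_succ]
  have : ‖(i : ℂ) + 1‖ = i + 1 := by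
    rw [← Nat.cast_succ, Complex.norm_natCast]; simp
  rw [this]; push_cast; ring

lemma facNorm_eq_of_degree_lt {n m : ℕ} {p : Polynomial ℂ} (hp : p.degree < n) (h : n ≤ m) :
    facNorm m p = facNorm n p := by
  symm
  unfold facNorm
  refine Finset.sum_subset (Finset.range_mono h) fun i _ hi => ?_
  rw [Polynomial.degree_lt_iff_coeff_zero] at hp
  rw [hp i (by simpa using hi)]; simp

lemma facNorm_derivative_le_of_degree_lt {n : ℕ} {p : Polynomial ℂ} (hp : p.degree < n) :
    facNorm n (Polynomial.derivative p) ≤ facNorm n p :=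
  (facNorm_derivative_le n p).trans (facNorm_eq_of_degree_lt hp n.le_succ).le

lemma coeff_taylor_monomial (c d : ℂ) (i k : ℕ) :
    (Polynomial.taylor c (Polynomial.monomial i d)).coeff k
      = d * (i.choose k * c ^ (i - k)) := by
  rw [Polynomial.taylor_monomial, Polynomial.coeff_C_mul, Polynomial.coeff_X_add_C_pow]
  ring

lemma facNorm_taylor_monomial_le (n i : ℕ) (c d : ℂ) :
    facNorm n (Polynomial.taylor c (Polynomial.monomial i d))
      ≤ Real.exp ‖c‖ * (‖d‖ * i.factorial) := by
  unfold facNorm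
  have h1 : ∀ k, ‖(Polynomial.taylor c (Polynomial.monomial i d)).coeff k‖ * (k.factorial : ℝ)
      = (if k ≤ i then ‖c‖ ^ (i - k) / (i - k).factorial else 0) * (‖d‖ * i.factorial) := by
    intro k
    rw [coeff_taylor_monomial]
    split_ifs with hk
    · have := Nat.choose_mul_factorial_mul_factorial hk
      have h2 : (i.factorial : ℝ) = i.choose k * k.factorial * (i - k).factorial := by
        exact_mod_cast this.symm
      have h3 : ((i - k).factorial : ℝ) ≠ 0 := by positivity
      rw [h2]
      simp only [norm_mul, norm_pow, Complex.norm_natCast]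
      field_simp
    · rw [Nat.choose_eq_zero_of_lt (by omega)]; simp
  rw [Finset.sum_congr rfl fun k _ => h1 k, ← Finset.sum_mul]
  gcongr
  rw [← Finset.sum_filter]
  calc ∑ k ∈ Finset.range n with k ≤ i, ‖c‖ ^ (i - k) / ((i - k).factorial : ℝ)
      ≤ ∑ k ∈ Finset.range (i + 1), ‖c‖ ^ (i - k) / ((i - k).factorial : ℝ) := by
        refine Finset.sum_le_sum_of_subset_of_nonneg ?_ fun _ _ _ => by positivity
        intro k hk
        simp only [Finset.mem_filter, Finset.mem_range] at hk ⊢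
        omega
    _ = ∑ k ∈ Finset.range (i + 1), ‖c‖ ^ k / (k.factorial : ℝ) :=
        Finset.sum_range_reflect (fun k => ‖c‖ ^ k / (k.factorial : ℝ)) (i + 1)
    _ ≤ _ := Real.sum_le_exp_of_nonneg (norm_nonneg _) _

lemma facNorm_taylor_le {n : ℕ} {p : Polynomial ℂ} (hp : p.degree < n) (m : ℕ) (c : ℂ) :
    facNorm m (Polynomial.taylor c p) ≤ Real.exp ‖c‖ * facNorm n p := by
  have h0 : p = ∑ i ∈ Finset.range n, Polynomial.monomial i (p.coeff i) := by
    ext k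
    rw [Polynomial.finsetSum_coeff]
    simp only [Polynomial.coeff_monomial, Finset.sum_ite_eq', Finset.mem_range]
    split_ifs with h
    · rfl
    · rw [Polynomial.degree_lt_iff_coeff_zero] at hp
      exact hp k (by omega)
  calc facNorm m (Polynomial.taylor c p)
      = facNorm m (∑ i ∈ Finset.range n,
          Polynomial.taylor c (Polynomial.monomial i (p.coeff i))) := by
        rw [← map_sum, ← h0]
    _ ≤ _ := facNorm_sum_le _ _ _
    _ ≤ ∑ i ∈ Finset.range n, Real.exp ‖c‖ * (‖p.coeff i‖ * i.factorial) :=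
        Finset.sum_le_sum fun i _ => facNorm_taylor_monomial_le _ _ _ _
    _ = _ := by rw [← Finset.mul_sum]; rfl

/-- Dividing by `X + c` with `|c| ≥ 1` multiplies the first `a` coefficients by at most `a`. -/
lemma norm_coeff_le_of_X_add_C_mul {c : ℂ} (hc : 1 ≤ ‖c‖) {a : ℕ} {g : Polynomial ℂ} {ε : ℝ}
    (h : ∀ k < a, ‖((Polynomial.X + Polynomial.C c) * g).coeff k‖ ≤ ε) :
    ∀ k < a, ‖g.coeff k‖ ≤ a * ε := by
  have key : ∀ k < a, ‖g.coeff k‖ ≤ (k + 1) * ε := by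
    have hε : a ≠ 0 → 0 ≤ ε := fun h0 => (norm_nonneg _).trans (h 0 (by omega))
    intro k
    induction k with
    | zero =>
      intro hk
      have := h 0 hk
      rw [add_mul, Polynomial.coeff_add, Polynomial.coeff_C_mul] at this
      simp only [Polynomial.mul_coeff_zero, Polynomial.coeff_X_zero, zero_mul, zero_add,
        norm_mul] at this
      have h2 := norm_nonneg (g.coeff 0)
      simp only [Nat.cast_zero, zero_add, one_mul]
      nlinarith
    | succ k ih =>
      intro hk
      have h1 := ih (by omega)
      have := h (k + 1) hk
      rw [add_mul, Polynomial.coeff_add, Polynomial.coeff_C_mul, Polynomial.coeff_X_mul] at this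
      have h2 : ‖c * g.coeff (k + 1)‖ ≤ ε + (k + 1) * ε := by
        have := norm_sub_le (g.coeff k + c * g.coeff (k + 1)) (g.coeff k)
        rw [add_sub_cancel_left] at this
        linarith
      rw [norm_mul] at h2
      have h3 := norm_nonneg (g.coeff (k + 1))
      push_cast
      nlinarith
  intro k hk
  refine (key k hk).trans ?_
  have : 0 ≤ ε := (norm_nonneg _).trans (h 0 (by omega))
  gcongr
  exact_mod_cast hk

lemma norm_coeff_le_of_X_add_C_pow_mul {c : ℂ} (hc : 1 ≤ ‖c‖) {a : ℕ} {g : Polynomial ℂ} (m : ℕ)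
    {ε : ℝ} (h : ∀ k < a, ‖((Polynomial.X + Polynomial.C c) ^ m * g).coeff k‖ ≤ ε) :
    ∀ k < a, ‖g.coeff k‖ ≤ a ^ m * ε := by
  induction m generalizing ε with
  | zero => simpa using h
  | succ m ih =>
    have := norm_coeff_le_of_X_add_C_mul hc (g := (Polynomial.X + Polynomial.C c) ^ m * g)
      (fun k hk => by rw [← mul_assoc, ← pow_succ']; exact h k hk)
    intro k hk
    refine (ih this k hk).trans (le_of_eq ?_)
    ring

lemma norm_coeff_taylor_le {a : ℕ} {r : Polynomial ℂ} (hr : r.degree < a) {ε : ℝ}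
    (h : ∀ k < a, ‖r.coeff k‖ ≤ ε) (c : ℂ) (k : ℕ) :
    ‖(Polynomial.taylor c r).coeff k‖ ≤ a * (1 + ‖c‖) ^ a * ε := by
  have h0 : r = ∑ i ∈ Finset.range a, Polynomial.monomial i (r.coeff i) := by
    ext k
    rw [Polynomial.finsetSum_coeff]
    simp only [Polynomial.coeff_monomial, Finset.sum_ite_eq', Finset.mem_range]
    split_ifs with h
    · rfl
    · rw [Polynomial.degree_lt_iff_coeff_zero] at hr
      exact hr k (by omega)
  rw [h0, map_sum, Polynomial.finsetSum_coeff]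
  calc ‖∑ i ∈ Finset.range a, (Polynomial.taylor c (Polynomial.monomial i (r.coeff i))).coeff k‖
      ≤ ∑ i ∈ Finset.range a, (1 + ‖c‖) ^ a * ε := by
        refine norm_sum_le_of_le _ fun i hi => ?_
        rw [Finset.mem_range] at hi
        rw [coeff_taylor_monomial, norm_mul, mul_comm]
        gcongr
        · simp only [norm_mul, norm_pow, Complex.norm_natCast]
          calc (i.choose k : ℝ) * ‖c‖ ^ (i - k) ≤ (1 + ‖c‖) ^ i := by
                rw [add_pow]
                by_cases hk : k ≤ i
                · have := Finset.single_le_sum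
                    (f := fun m => (1 : ℝ) ^ m * ‖c‖ ^ (i - m) * (i.choose m : ℝ))
                    (fun _ _ => by positivity) (Finset.mem_range.2 (by omega : k < i + 1))
                  refine le_trans (le_of_eq ?_) this
                  simp [mul_comm]
                · rw [Nat.choose_eq_zero_of_lt (by omega)]
                  simp only [Nat.cast_zero, zero_mul]
                  exact Finset.sum_nonneg fun _ _ => by positivity
            _ ≤ _ := pow_le_pow_right₀ (by linarith [norm_nonneg c]) hi.le
        · exact h i hi
    _ = _ := by simp; ring

lemma facNorm_X_pow_mul_le (n a : ℕ) (p : Polynomial ℂ) :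
    facNorm (n + a) (Polynomial.X ^ a * p) ≤ (n + a : ℝ) ^ a * facNorm n p := by
  unfold facNorm
  rw [add_comm n a, Finset.sum_range_add, Finset.sum_eq_zero, zero_add, Finset.mul_sum]
  · refine Finset.sum_le_sum fun i hi => ?_
    rw [Finset.mem_range] at hi
    rw [add_comm a i, Polynomial.coeff_X_pow_mul, mul_left_comm]
    gcongr
    have : (i + a).factorial ≤ (n + a) ^ a * i.factorial := by
      calc (i + a).factorial = i.factorial * (i + 1).ascFactorial a :=
            (Nat.factorial_mul_ascFactorial i a).symm
        _ ≤ i.factorial * (n + a) ^ a := by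
          gcongr
          refine (Nat.ascFactorial_le_pow_add i a).trans ?_
          gcongr
        _ = _ := mul_comm _ _
    exact_mod_cast this
  · intro i hi
    rw [Finset.mem_range] at hi
    rw [Polynomial.coeff_X_pow_mul', if_neg (by omega)]; simp

/-- Hermite interpolation at the nodes `0, …, b - 1` with multiplicity `a`, quantitatively. -/
theorem facNorm_le_of_taylor_coeff_le {a : ℕ} (ha : 1 ≤ a) {M : ℝ} (hM : 3 ≤ M) :
    ∀ (b : ℕ) (p : Polynomial ℂ) (ε : ℝ), 0 ≤ ε → (a * b : ℝ) + 2 ≤ M → p.degree < (a * b : ℕ) →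
      (∀ j < b, ∀ k < a, ‖(Polynomial.taylor (j : ℂ) p).coeff k‖ ≤ ε) →
      facNorm (a * b) p ≤ M ^ (8 * (a * b)) * ε := by
  intro b
  induction b with
  | zero => intro p ε hε _ _ _; simpa [facNorm] using hε
  | succ b ih =>
    intro p ε hε hMb hp h
    have ha' : (1 : ℝ) ≤ a := by exact_mod_cast ha
    have hM1 : 1 ≤ M := by linarith
    have hb0 : (0 : ℝ) ≤ b := by positivity
    push_cast at hMb
    have haM : (a : ℝ) ≤ M := by nlinarith
    have hbM : (b : ℝ) + 2 ≤ M := by nlinarith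
    set r : Polynomial ℂ := ∑ i ∈ Finset.range a, Polynomial.monomial i (p.coeff i) with hr
    set q : Polynomial ℂ := ∑ i ∈ Finset.range (a * b), Polynomial.monomial i (p.coeff (i + a))
      with hq
    have hrc : ∀ k, r.coeff k = if k < a then p.coeff k else 0 := by
      intro k
      rw [hr, Polynomial.finsetSum_coeff]
      simp [Polynomial.coeff_monomial]
    have hqc : ∀ k, q.coeff k = if k < a * b then p.coeff (k + a) else 0 := by
      intro k
      rw [hq, Polynomial.finsetSum_coeff]
      simp [Polynomial.coeff_monomial]
    have hrd : r.degree < a := by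
      rw [Polynomial.degree_lt_iff_coeff_zero]
      intro k hk; rw [hrc, if_neg (by omega)]
    have hqd : q.degree < (a * b : ℕ) := by
      rw [Polynomial.degree_lt_iff_coeff_zero]
      intro k hk; rw [hqc, if_neg (by omega)]
    have hpq : p = r + Polynomial.X ^ a * q := by
      ext k
      rw [Polynomial.coeff_add, hrc, Polynomial.coeff_X_pow_mul']
      rcases lt_or_ge k a with hk | hk
      · rw [if_pos hk, if_neg (by omega), add_zero]
      · rw [if_neg (by omega), if_pos hk, zero_add, hqc, Nat.sub_add_cancel hk]
        split_ifs with h2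
        · rfl
        · rw [Polynomial.degree_lt_iff_coeff_zero] at hp
          refine hp k ?_
          rw [Nat.mul_succ]; omega
    have hrε : ∀ k < a, ‖r.coeff k‖ ≤ ε := by
      intro k hk
      rw [hrc, if_pos hk]
      simpa using h 0 (by omega) k hk
    have hnode : ∀ j < b, ∀ k < a,
        ‖(Polynomial.taylor (j : ℂ) (Polynomial.taylor 1 q)).coeff k‖ ≤ M ^ (2 * a + 2) * ε := by
      intro j hj
      rw [Polynomial.taylor_taylor]
      have hc : ‖(j : ℂ) + 1‖ = j + 1 := by
        rw [← Nat.cast_succ, Complex.norm_natCast]; simp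
      have hjb : (j : ℝ) + 1 ≤ b := by exact_mod_cast hj
      set c : ℂ := (j : ℂ) + 1 with hcdef
      clear_value c
      have h2 : (Polynomial.X + Polynomial.C c) ^ a * Polynomial.taylor c q
          = Polynomial.taylor c p - Polynomial.taylor c r := by
        rw [eq_sub_iff_add_eq']
        conv_rhs => rw [hpq]
        rw [LinearMap.map_add, Polynomial.taylor_mul, Polynomial.taylor_pow, Polynomial.taylor_X]
      have h3 : ∀ k < a, ‖((Polynomial.X + Polynomial.C c) ^ a * Polynomial.taylor c q).coeff k‖
          ≤ M ^ (a + 2) * ε := by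
        intro k hk
        rw [h2, Polynomial.coeff_sub]
        have h4 : ‖(Polynomial.taylor c p).coeff k‖ ≤ ε := by
          have := h (j + 1) (by omega) k hk
          rwa [Nat.cast_succ, ← hcdef] at this
        have h5 := norm_coeff_taylor_le hrd hrε c k
        have h6 : (a : ℝ) * (1 + ‖c‖) ^ a * ε ≤ M * M ^ a * ε := by
          gcongr
          rw [hc]; linarith
        have h7 : (1 : ℝ) ≤ M ^ a := one_le_pow₀ hM1
        calc _ ≤ ε + M * M ^ a * ε := (norm_sub_le _ _).trans (by linarith)
          _ ≤ M ^ (a + 2) * ε := by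
            rw [pow_add]
            have h8 : 1 + M * M ^ a ≤ M ^ a * M ^ 2 := by
              have : (1 + M) * M ^ a ≤ M ^ 2 * M ^ a := by
                gcongr; nlinarith
              linarith
            nlinarith
      intro k hk
      have := norm_coeff_le_of_X_add_C_pow_mul (by rw [hc]; linarith [j.cast_nonneg (α := ℝ)]) a h3
        k hk
      refine this.trans ?_
      calc (a : ℝ) ^ a * (M ^ (a + 2) * ε) ≤ M ^ a * (M ^ (a + 2) * ε) := by gcongr
        _ = _ := by ring
    have h1 : facNorm (a * b) (Polynomial.taylor 1 q)
        ≤ M ^ (8 * (a * b)) * (M ^ (2 * a + 2) * ε) := by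
      refine ih _ _ (by positivity) (by nlinarith) ?_ hnode
      rwa [Polynomial.degree_taylor]
    have h2 : facNorm (a * b) q ≤ M * facNorm (a * b) (Polynomial.taylor 1 q) := by
      have hd : (Polynomial.taylor 1 q).degree < (a * b : ℕ) := by
        rwa [Polynomial.degree_taylor]
      have := facNorm_taylor_le hd (a * b) (-1)
      rw [Polynomial.taylor_taylor, neg_add_cancel, Polynomial.taylor_zero] at this
      refine this.trans ?_
      gcongr
      · exact facNorm_nonneg _ _
      · rw [norm_neg, norm_one]
        linarith [Real.exp_one_lt_d9]
    have h3 : facNorm (a * (b + 1)) r ≤ M * ε * (M ^ a) := by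
      rw [facNorm_eq_of_degree_lt hrd (Nat.le_mul_of_pos_right _ (by omega))]
      calc facNorm a r ≤ ∑ i ∈ Finset.range a, ε * M ^ a := by
            refine Finset.sum_le_sum fun i hi => ?_
            rw [Finset.mem_range] at hi
            gcongr
            · exact hrε i hi
            · calc (i.factorial : ℝ) ≤ (i : ℝ) ^ i := by exact_mod_cast Nat.factorial_le_pow i
                _ ≤ M ^ i := by
                  gcongr
                  exact le_trans (by exact_mod_cast hi.le) haM
                _ ≤ _ := pow_le_pow_right₀ hM1 hi.le
        _ = a * ε * M ^ a := by simp; ring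
        _ ≤ _ := by gcongr
    have h4 : facNorm (a * (b + 1)) (Polynomial.X ^ a * q) ≤ M ^ a * facNorm (a * b) q := by
      rw [Nat.mul_succ]
      refine (facNorm_X_pow_mul_le _ _ _).trans ?_
      gcongr
      · exact facNorm_nonneg _ _
      · push_cast; nlinarith
    have h5 : facNorm (a * (b + 1)) p ≤ M * ε * M ^ a
        + M ^ a * (M * (M ^ (8 * (a * b)) * (M ^ (2 * a + 2) * ε))) := by
      conv_lhs => rw [hpq]
      refine (facNorm_add_le _ _ _).trans (add_le_add h3 (h4.trans ?_))
      gcongr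
      refine h2.trans ?_
      gcongr
    refine h5.trans ?_
    have e1 : M * ε * M ^ a ≤ M ^ (8 * (a * b) + (3 * a + 3)) * ε := by
      have : M * ε * M ^ a = M ^ (a + 1) * ε := by ring
      rw [this]
      gcongr ?_ * ε
      exact pow_le_pow_right₀ hM1 (by omega)
    have e2 : M ^ a * (M * (M ^ (8 * (a * b)) * (M ^ (2 * a + 2) * ε)))
        = M ^ (8 * (a * b) + (3 * a + 3)) * ε := by ring
    rw [e2]
    calc _ ≤ M * M ^ (8 * (a * b) + (3 * a + 3)) * ε := by
          have : 0 ≤ M ^ (8 * (a * b) + (3 * a + 3)) * ε := by positivity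
          nlinarith
      _ = M ^ (8 * (a * b) + (3 * a + 4)) * ε := by ring
      _ ≤ _ := by
        gcongr ?_ * ε
        refine pow_le_pow_right₀ hM1 ?_
        rw [Nat.mul_succ]; omega

/-- The coefficients of the power series `X ^ k * exp (j X)`. -/
noncomputable def expCoeff (k j i : ℕ) : ℂ :=
  if k ≤ i then (j : ℂ) ^ (i - k) / (i - k).factorial else 0

lemma choose_mul_pow_eq_expCoeff (k j i : ℕ) :
    (i.choose k * (j : ℂ) ^ (i - k)) = i.factorial / k.factorial * expCoeff k j i := by
  unfold expCoeff
  split_ifs with h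
  · have h2 : (i.factorial : ℂ) = i.choose k * k.factorial * (i - k).factorial := by
      exact_mod_cast (Nat.choose_mul_factorial_mul_factorial h).symm
    rw [h2]
    have h3 : (k.factorial : ℂ) ≠ 0 := by exact_mod_cast k.factorial_ne_zero
    have h4 : ((i - k).factorial : ℂ) ≠ 0 := by exact_mod_cast (i - k).factorial_ne_zero
    field_simp
  · rw [Nat.choose_eq_zero_of_lt (by omega)]; simp

/-- The functionals dual to Hermite interpolation: combinations of the series `X ^ k * exp (j X)`
approximating `X ^ l`. -/
theorem exists_hermite_dual {a b T : ℕ} (ha : 1 ≤ a) (hT : T ≤ a * b) {M : ℝ} (hM : 3 ≤ M)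
    (hMab : (a * b : ℝ) + 2 ≤ M) {l : ℕ} (hl : l < T) :
    ∃ f : Fin a → Fin b → ℂ, (∀ k j, ‖f k j‖ ≤ M ^ (8 * (a * b))) ∧
      ∀ i < T, ∑ k, ∑ j, f k j * expCoeff k j i = if i = l then 1 else 0 := by
  classical
  set H := M ^ (8 * (a * b)) with hH
  have hH0 : 0 ≤ H := by positivity
  let pol : (Fin T → ℂ) →ₗ[ℂ] Polynomial ℂ :=
    ∑ i : Fin T, (Polynomial.monomial (i : ℕ)).comp (LinearMap.proj i)
  have hpol : ∀ c (i : ℕ), (pol c).coeff i = if h : i < T then c ⟨i, h⟩ else 0 := by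
    intro c i
    simp only [pol, LinearMap.sum_apply, Polynomial.finsetSum_coeff, LinearMap.comp_apply,
      LinearMap.proj_apply, Polynomial.coeff_monomial]
    split_ifs with h
    · rw [Finset.sum_eq_single ⟨i, h⟩]
      · simp
      · intro j _ hj
        rw [if_neg]; intro h2; exact hj (Fin.ext h2)
      · simp
    · refine Finset.sum_eq_zero fun j _ => ?_
      rw [if_neg]; have := j.2; omega
  have hdeg : ∀ c, (pol c).degree < (a * b : ℕ) := by
    intro c
    rw [Polynomial.degree_lt_iff_coeff_zero]
    intro i hi
    rw [hpol, dif_neg (by omega)]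
  let A : (Fin T → ℂ) →ₗ[ℂ] (Fin a × Fin b → ℂ) :=
    LinearMap.pi fun kj => (Polynomial.lcoeff ℂ (kj.1 : ℕ)).comp
      ((Polynomial.taylor ((kj.2 : ℕ) : ℂ)).comp pol)
  have hAapp : ∀ c kj, A c kj
      = (Polynomial.taylor ((kj.2 : ℕ) : ℂ) (pol c)).coeff (kj.1 : ℕ) := fun c kj => rfl
  have hbound : ∀ c (i : Fin T), ‖c i‖ * (i : ℕ).factorial ≤ H * ‖A c‖ := by
    intro c i
    have h1 := facNorm_le_of_taylor_coeff_le ha hM b (pol c) ‖A c‖ (norm_nonneg _) hMab (hdeg c)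
      (fun j hj k hk => norm_le_pi_norm (A c) (⟨k, hk⟩, ⟨j, hj⟩))
    refine le_trans ?_ h1
    have := norm_coeff_mul_factorial_le_facNorm (i := i) (n := a * b) (by have := i.2; omega)
      (pol c)
    rwa [hpol, dif_pos i.2] at this
  have hinj : Function.Injective A := by
    rw [← LinearMap.ker_eq_bot, LinearMap.ker_eq_bot']
    intro c hc
    funext i
    have := hbound c i
    rw [hc, norm_zero, mul_zero] at this
    have h2 : (0 : ℝ) < (i : ℕ).factorial := by positivity
    have h3 := norm_nonneg (c i)
    have : ‖c i‖ = 0 := by nlinarith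
    simpa using this
  let e := LinearEquiv.ofInjective A hinj
  let φ : LinearMap.range A →ₗ[ℂ] ℂ := (LinearMap.proj (⟨l, hl⟩ : Fin T)).comp e.symm.toLinearMap
  have hφ : ∀ x, ‖φ x‖ ≤ H / l.factorial * ‖x‖ := by
    intro x
    have h1 := hbound (e.symm x) ⟨l, hl⟩
    have h2 : A (e.symm x) = x := by
      exact congrArg Subtype.val (e.apply_symm_apply x)
    rw [h2] at h1
    have h3 : (0 : ℝ) < l.factorial := by positivity
    rw [div_mul_eq_mul_div, le_div_iff₀ h3]
    exact h1
  obtain ⟨g, hg, hgn⟩ := exists_extension_norm_eq (LinearMap.range A)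
    (φ.mkContinuous _ hφ)
  have hgn' : ‖g‖ ≤ H / l.factorial := by
    rw [hgn]
    exact φ.mkContinuous_norm_le (by positivity) hφ
  have hlf : (l.factorial : ℂ) ≠ 0 := by exact_mod_cast l.factorial_ne_zero
  refine ⟨fun k j => l.factorial / (k : ℕ).factorial * g (Pi.single (k, j) 1), ?_, ?_⟩
  · intro k j
    have h1 : ‖g (Pi.single (k, j) 1)‖ ≤ H / l.factorial := by
      refine (g.le_opNorm _).trans ?_
      rw [Pi.norm_single, norm_one, mul_one]
      exact hgn'
    have h3 : (0 : ℝ) < l.factorial := by positivity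
    have h4 : (1 : ℝ) ≤ (k : ℕ).factorial := by exact_mod_cast (k : ℕ).factorial_pos
    rw [norm_mul, norm_div, Complex.norm_natCast, Complex.norm_natCast]
    calc _ ≤ (l.factorial : ℝ) / 1 * (H / l.factorial) := by gcongr
      _ = H := by field_simp
  · intro i hi
    have h1 : g (A (Pi.single ⟨i, hi⟩ 1)) = if i = l then 1 else 0 := by
      have := hg (e (Pi.single ⟨i, hi⟩ 1))
      have h2 : ((e (Pi.single ⟨i, hi⟩ 1) : LinearMap.range A) : Fin a × Fin b → ℂ)
        = A (Pi.single ⟨i, hi⟩ 1) := rfl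
      rw [h2] at this
      rw [this]
      simp only [LinearMap.mkContinuous_apply, φ, LinearMap.comp_apply, LinearEquiv.coe_coe,
        LinearEquiv.symm_apply_apply, LinearMap.proj_apply, Pi.single_apply, Fin.mk.injEq, eq_comm]
    have h2 : ∀ kj : Fin a × Fin b, A (Pi.single ⟨i, hi⟩ 1) kj
        = i.factorial / (kj.1 : ℕ).factorial * expCoeff kj.1 kj.2 i := by
      intro kj
      have h3 : pol (Pi.single ⟨i, hi⟩ 1) = Polynomial.monomial i 1 := by
        ext m
        rw [hpol, Polynomial.coeff_monomial]
        by_cases hm : m < T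
        · rw [dif_pos hm]; simp [Pi.single_apply, eq_comm]
        · rw [dif_neg hm, if_neg (by omega)]
      rw [hAapp, h3, coeff_taylor_monomial, one_mul, choose_mul_pow_eq_expCoeff]
    have h3 : A (Pi.single ⟨i, hi⟩ 1) = ∑ kj : Fin a × Fin b,
        (i.factorial / (kj.1 : ℕ).factorial * expCoeff kj.1 kj.2 i) •
          (Pi.single kj 1 : Fin a × Fin b → ℂ) := by
      funext kj
      rw [h2, Finset.sum_apply]
      simp [Pi.single_apply]
    rw [h3, map_sum, Fintype.sum_prod_type] at h1
    simp only [map_smul, smul_eq_mul] at h1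
    have hif : (i.factorial : ℂ) ≠ 0 := by exact_mod_cast i.factorial_ne_zero
    calc _ = (l.factorial / i.factorial : ℂ) * ∑ k : Fin a, ∑ j : Fin b,
          (i.factorial / (k : ℕ).factorial * expCoeff k j i) * g (Pi.single (k, j) 1) := by
          rw [Finset.mul_sum]
          refine Finset.sum_congr rfl fun k _ => ?_
          rw [Finset.mul_sum]
          refine Finset.sum_congr rfl fun j _ => ?_
          have : ((k : ℕ).factorial : ℂ) ≠ 0 := by exact_mod_cast (k : ℕ).factorial_ne_zero
          field_simp
      _ = _ := by
        rw [h1]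
        split_ifs with h
        · subst h; field_simp
        · simp

lemma degree_C_mul_lt {n : ℕ} {p : Polynomial ℂ} (hp : p.degree < n) (c : ℂ) :
    (Polynomial.C c * p).degree < n := by
  rw [Polynomial.degree_lt_iff_coeff_zero] at hp ⊢
  intro m hm; rw [Polynomial.coeff_C_mul, hp m hm, mul_zero]

lemma degree_sub_lt_of_lt {n : ℕ} {p q : Polynomial ℂ} (hp : p.degree < n) (hq : q.degree < n) :
    (p - q).degree < n :=
  (Polynomial.degree_sub_le _ _).trans_lt (max_lt hp hq)

lemma derivative_taylor (c : ℂ) (p : Polynomial ℂ) :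
    Polynomial.derivative (Polynomial.taylor c p)
      = Polynomial.taylor c (Polynomial.derivative p) := by
  simp [Polynomial.taylor_apply, Polynomial.derivative_comp]

lemma facNorm_iterate_derivative_le {n : ℕ} {p : Polynomial ℂ} (hp : p.degree < n) (i : ℕ) :
    (Polynomial.derivative^[i] p).degree < n ∧
      facNorm n (Polynomial.derivative^[i] p) ≤ facNorm n p := by
  induction i with
  | zero => exact ⟨hp, le_rfl⟩
  | succ i ih =>
    rw [Function.iterate_succ_apply']
    exact ⟨Polynomial.degree_derivative_le.trans_lt ih.1,
      (facNorm_derivative_le_of_degree_lt ih.1).trans ih.2⟩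

/-- The forward difference operator on polynomials. -/
noncomputable def polyDelta (p : Polynomial ℂ) : Polynomial ℂ := Polynomial.taylor 1 p - p

lemma facNorm_iterate_polyDelta_le {n : ℕ} {p : Polynomial ℂ} (hp : p.degree < n) (i : ℕ) :
    (polyDelta^[i] p).degree < n ∧ facNorm n (polyDelta^[i] p) ≤ 4 ^ i * facNorm n p := by
  induction i with
  | zero => exact ⟨hp, by simp⟩
  | succ i ih =>
    rw [Function.iterate_succ_apply']
    refine ⟨degree_sub_lt_of_lt ?_ ih.1, ?_⟩
    · rw [Polynomial.degree_taylor]; exact ih.1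
    · refine (facNorm_sub_le _ _ _).trans ?_
      have h1 := facNorm_taylor_le ih.1 n 1
      rw [norm_one] at h1
      have h2 := facNorm_nonneg n (polyDelta^[i] p)
      have h3 := Real.exp_one_lt_d9
      have h4 : Real.exp 1 * facNorm n (polyDelta^[i] p) ≤ 3 * facNorm n (polyDelta^[i] p) := by
        gcongr; linarith
      rw [pow_succ]
      linarith [ih.2]

lemma polyDelta_iterate_eq_zero {n : ℕ} {p : Polynomial ℂ} (hp : p.degree < n) :
    polyDelta^[n] p = 0 := by
  induction n generalizing p with
  | zero =>
    rw [Function.iterate_zero, id]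
    simpa [Polynomial.degree_lt_iff_coeff_zero, Polynomial.ext_iff] using hp
  | succ n ih =>
    rw [Function.iterate_succ_apply]
    apply ih
    by_cases h0 : p = 0
    · subst h0; simp [polyDelta]
    have h1 : (polyDelta p).degree < p.degree := by
      have := Polynomial.degree_sub_lt_left (p := Polynomial.taylor 1 p) (q := p)
        (Polynomial.degree_taylor _ _) (by rwa [Ne, Polynomial.taylor_eq_zero])
        (Polynomial.leadingCoeff_taylor _ _)
      rwa [Polynomial.degree_taylor] at this
    refine h1.trans_le ?_
    exact Order.le_of_lt_succ hp

lemma taylor_one_eq_sum_hasseDeriv {n : ℕ} {p : Polynomial ℂ} (hp : p.degree < n) :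
    Polynomial.taylor 1 p = ∑ i ∈ Finset.range n, Polynomial.hasseDeriv i p := by
  have hp' := (Polynomial.degree_lt_iff_coeff_zero _ _).1 hp
  ext k
  rw [Polynomial.taylor_coeff, Polynomial.finsetSum_coeff]
  rcases Nat.eq_zero_or_pos n with h0 | h0
  · subst h0
    have : p = 0 := by ext m; simpa using hp' m (Nat.zero_le _)
    simp [this]
  have hdeg : (Polynomial.hasseDeriv k p).natDegree < n := by
    by_cases hz : Polynomial.hasseDeriv k p = 0
    · rw [hz]; simpa using h0
    rw [Polynomial.natDegree_lt_iff_degree_lt hz, Polynomial.degree_lt_iff_coeff_zero]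
    intro m hm
    rw [Polynomial.hasseDeriv_coeff, hp' _ (by omega), mul_zero]
  rw [Polynomial.eval_eq_sum_range' hdeg]
  refine Finset.sum_congr rfl fun i _ => ?_
  rw [Polynomial.hasseDeriv_coeff, Polynomial.hasseDeriv_coeff, one_pow, mul_one, add_comm i k,
    Nat.choose_symm_add]

lemma hasseDeriv_eq_C_mul_iterate (i : ℕ) (p : Polynomial ℂ) :
    Polynomial.hasseDeriv i p
      = Polynomial.C ((i.factorial : ℂ)⁻¹) * Polynomial.derivative^[i] p := by
  rw [← Polynomial.factorial_smul_hasseDeriv]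
  have : (i.factorial : ℂ) ≠ 0 := by exact_mod_cast i.factorial_ne_zero
  ext k
  rw [Polynomial.coeff_C_mul, LinearMap.smul_apply, Polynomial.coeff_smul, nsmul_eq_mul]
  field_simp

/-- If `w₁ C` is nearly `w₀ C'` then `w₁ ^ i C` is nearly `w₀ ^ i C⁽ⁱ⁾`. -/
lemma facNorm_pow_mul_sub_iterate_derivative_le {n : ℕ} {C B : Polynomial ℂ}
    {w₀ w₁ : ℂ} (h0 : ‖w₀‖ ≤ 1) (h1 : ‖w₁‖ ≤ 1)
    (hBd : B.degree < n)
    (hB : B = Polynomial.C w₀ * Polynomial.derivative C - Polynomial.C w₁ * C) (i : ℕ) :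
    facNorm n (Polynomial.C (w₁ ^ i) * C - Polynomial.C (w₀ ^ i) * Polynomial.derivative^[i] C)
      ≤ i * facNorm n B := by
  induction i with
  | zero => simp [facNorm]
  | succ i ih =>
    have h2 : Polynomial.C (w₁ ^ (i + 1)) * C
        - Polynomial.C (w₀ ^ (i + 1)) * Polynomial.derivative^[i + 1] C
        = Polynomial.C w₁ * (Polynomial.C (w₁ ^ i) * C
            - Polynomial.C (w₀ ^ i) * Polynomial.derivative^[i] C)
          - Polynomial.C (w₀ ^ i) * Polynomial.derivative^[i] B := by
      rw [hB, Polynomial.iterate_derivative_sub, Polynomial.iterate_derivative_C_mul,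
        Polynomial.iterate_derivative_C_mul, ← Function.iterate_succ_apply]
      simp only [pow_succ, map_mul]
      ring
    rw [h2]
    refine (facNorm_sub_le _ _ _).trans ?_
    rw [facNorm_C_mul, facNorm_C_mul, norm_pow]
    have h3 := (facNorm_iterate_derivative_le hBd i).2
    have h4 : ‖w₀‖ ^ i ≤ 1 := pow_le_one₀ (norm_nonneg _) h0
    have h5 := mul_le_mul h1 ih (facNorm_nonneg _ _) zero_le_one
    have h6 := mul_le_mul h4 h3 (facNorm_nonneg _ _) zero_le_one
    push_cast
    linarith

/-- If `(w₂ - w₀) C` is nearly `w₀ Δ C` then `(w₂ - w₀) ^ i C` is nearly `w₀ ^ i Δ ^ i C`. -/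
lemma facNorm_pow_mul_sub_iterate_polyDelta_le {n : ℕ} {C B : Polynomial ℂ}
    {w₀ w₂ : ℂ} (h0 : ‖w₀‖ ≤ 1) (h2 : ‖w₂‖ ≤ 1) (hBd : B.degree < n)
    (hB : B = Polynomial.C w₀ * Polynomial.taylor 1 C - Polynomial.C w₂ * C) (i : ℕ) :
    facNorm n (Polynomial.C ((w₂ - w₀) ^ i) * C - Polynomial.C (w₀ ^ i) * polyDelta^[i] C)
      ≤ i * 4 ^ i * facNorm n B := by
  have hlin : ∀ (i : ℕ) (c d : ℂ) (p q : Polynomial ℂ),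
      polyDelta^[i] (Polynomial.C c * p - Polynomial.C d * q)
        = Polynomial.C c * polyDelta^[i] p - Polynomial.C d * polyDelta^[i] q := by
    intro i c d p q
    induction i with
    | zero => rfl
    | succ i ih =>
      simp only [Function.iterate_succ_apply', ih, polyDelta, map_sub, Polynomial.taylor_mul,
        Polynomial.taylor_C]
      ring
  induction i with
  | zero => simp [facNorm]
  | succ i ih =>
    have hB' : B = Polynomial.C w₀ * polyDelta C - Polynomial.C (w₂ - w₀) * C := by
      rw [hB, polyDelta, map_sub]; ring
    have h3 : Polynomial.C ((w₂ - w₀) ^ (i + 1)) * C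
        - Polynomial.C (w₀ ^ (i + 1)) * polyDelta^[i + 1] C
        = Polynomial.C (w₂ - w₀) * (Polynomial.C ((w₂ - w₀) ^ i) * C
            - Polynomial.C (w₀ ^ i) * polyDelta^[i] C)
          - Polynomial.C (w₀ ^ i) * polyDelta^[i] B := by
      rw [hB', hlin, ← Function.iterate_succ_apply]
      simp only [pow_succ, map_mul]
      ring
    rw [h3]
    refine (facNorm_sub_le _ _ _).trans ?_
    rw [facNorm_C_mul, facNorm_C_mul, norm_pow]
    have h4 := (facNorm_iterate_polyDelta_le hBd i).2
    have h5 : ‖w₀‖ ^ i ≤ 1 := pow_le_one₀ (norm_nonneg _) h0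
    have h6 : ‖w₂ - w₀‖ ≤ 2 := (norm_sub_le _ _).trans (by linarith)
    have h7 := mul_le_mul h6 ih (facNorm_nonneg _ _) (by norm_num)
    have h8 := mul_le_mul h5 h4 (facNorm_nonneg _ _) zero_le_one
    have h9 : 0 ≤ 4 ^ i * facNorm n B := mul_nonneg (by positivity) (facNorm_nonneg _ _)
    have h10 : 0 ≤ (i : ℝ) * (4 ^ i * facNorm n B) := by positivity
    push_cast
    calc _ ≤ 2 * (i * 4 ^ i * facNorm n B) + 1 * (4 ^ i * facNorm n B) := add_le_add h7 h8
      _ ≤ 4 * ((i : ℝ) * (4 ^ i * facNorm n B)) + 4 * (4 ^ i * facNorm n B) := by linarith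
      _ = _ := by ring

section Dichotomy

variable {a b T D : ℕ} {M δ : ℝ} {w : Fin 3 → ℂ} {C : Polynomial ℂ}

lemma one_le_pow_mul_facNorm (ha : 1 ≤ a) (hb : 1 ≤ b) (hT : T ≤ a * b) (hM : 3 ≤ M)
    (hw2 : ∃ i, ‖w i‖ = 1) (hC : C.degree < T) (hδ : δ ≤ 1 / 2)
    (h : ∀ k j, k + j ≤ D → ‖k.factorial * (Polynomial.taylor (j : ℂ) C).coeff k
      - w 0 ^ (D - k - j) * w 1 ^ k * w 2 ^ j‖ ≤ δ) :
    1 ≤ M ^ (D + 1) * facNorm (a * b) C := by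
  have hC' : C.degree < (a * b : ℕ) := hC.trans_le (by exact_mod_cast hT)
  have hN := facNorm_nonneg (a * b) C
  have hab : 0 < a * b := Nat.mul_pos ha hb
  have hMD : (1 : ℝ) ≤ M ^ D := one_le_pow₀ (by linarith)
  suffices hs : 1 / 2 ≤ M ^ D * facNorm (a * b) C by
    rw [pow_succ]
    nlinarith
  have hN' : facNorm (a * b) C ≤ M ^ D * facNorm (a * b) C := le_mul_of_one_le_left hN hMD
  have key : ∀ x y : ℂ, ‖y‖ = 1 → ‖x - y‖ ≤ δ → 1 / 2 ≤ ‖x‖ := by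
    intro x y hy hxy
    have := norm_sub_norm_le y x
    rw [norm_sub_rev] at this
    linarith
  obtain ⟨i, hi⟩ := hw2
  fin_cases i
  · have h1 := h 0 0 (by omega)
    simp only [Nat.factorial_zero, Nat.cast_one, one_mul, Nat.cast_zero, Polynomial.taylor_zero,
      Nat.sub_zero, pow_zero, mul_one] at h1
    have h2 := key _ _ (by rw [norm_pow]; simp [show ‖w 0‖ = 1 from hi]) h1
    exact (h2.trans (norm_coeff_le_facNorm hab C)).trans hN'
  · have h1 := h D 0 (by omega)
    simp only [Nat.cast_zero, Polynomial.taylor_zero, Nat.sub_self, pow_zero, one_mul,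
      mul_one] at h1
    have h2 := key _ _ (by rw [norm_pow]; simp [show ‖w 1‖ = 1 from hi]) h1
    rw [norm_mul, Complex.norm_natCast, mul_comm] at h2
    by_cases hD : D < a * b
    · exact (h2.trans (norm_coeff_mul_factorial_le_facNorm hD C)).trans hN'
    · rw [Polynomial.degree_lt_iff_coeff_zero] at hC'
      rw [hC' D (by omega)] at h2
      norm_num at h2
  · have h1 := h 0 D (by omega)
    simp only [Nat.factorial_zero, Nat.cast_one, one_mul, Nat.sub_zero, Nat.sub_self,
      pow_zero] at h1
    have h2 := key _ _ (by rw [norm_pow]; simp [show ‖w 2‖ = 1 from hi]) h1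
    refine (h2.trans (norm_coeff_le_facNorm hab _)).trans
      ((facNorm_taylor_le hC' (a * b) (D : ℂ)).trans ?_)
    gcongr
    rw [Complex.norm_natCast, ← mul_one (D : ℝ), Real.exp_nat_mul]
    gcongr
    linarith [Real.exp_one_lt_d9]

lemma facNorm_defect_le (ha : 1 ≤ a) (hT : T ≤ a * b) (hD : a + b ≤ D) (hM : 3 ≤ M)
    (hMab : (a * b : ℝ) + 2 ≤ M) (hw1 : ∀ i, ‖w i‖ ≤ 1) (hC : C.degree < T) (hδ : 0 ≤ δ)
    (h : ∀ k j, k + j ≤ D → ‖k.factorial * (Polynomial.taylor (j : ℂ) C).coeff k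
      - w 0 ^ (D - k - j) * w 1 ^ k * w 2 ^ j‖ ≤ δ) :
    facNorm (a * b) (Polynomial.C (w 0) * Polynomial.derivative C - Polynomial.C (w 1) * C)
        ≤ M ^ (8 * (a * b)) * (2 * δ) ∧
      facNorm (a * b) (Polynomial.C (w 0) * Polynomial.taylor 1 C - Polynomial.C (w 2) * C)
        ≤ M ^ (8 * (a * b)) * (2 * δ) := by
  have hC' : C.degree < (a * b : ℕ) := hC.trans_le (by exact_mod_cast hT)
  have hfac : ∀ (k : ℕ) (x : ℂ), ‖x‖ ≤ ‖(k.factorial : ℂ) * x‖ := by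
    intro k x
    rw [norm_mul, Complex.norm_natCast]
    refine le_mul_of_one_le_left (norm_nonneg _) ?_
    exact_mod_cast k.factorial_pos
  constructor
  · refine facNorm_le_of_taylor_coeff_le ha hM b _ _ (by positivity) hMab
      (degree_sub_lt_of_lt (degree_C_mul_lt (Polynomial.degree_derivative_le.trans_lt hC') _)
        (degree_C_mul_lt hC' _)) fun j hj k hk => (hfac k _).trans ?_
    have h1 := h (k + 1) j (by omega)
    have h2 := h k j (by omega)
    rw [map_sub, Polynomial.taylor_mul, Polynomial.taylor_mul, Polynomial.taylor_C,
      Polynomial.taylor_C, ← derivative_taylor, Polynomial.coeff_sub, Polynomial.coeff_C_mul,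
      Polynomial.coeff_C_mul, Polynomial.coeff_derivative]
    have e : (k.factorial : ℂ) * (w 0 * ((Polynomial.taylor (j : ℂ) C).coeff (k + 1) * (k + 1))
          - w 1 * (Polynomial.taylor (j : ℂ) C).coeff k)
        = w 0 * ((k + 1).factorial * (Polynomial.taylor (j : ℂ) C).coeff (k + 1)
            - w 0 ^ (D - (k + 1) - j) * w 1 ^ (k + 1) * w 2 ^ j)
          - w 1 * (k.factorial * (Polynomial.taylor (j : ℂ) C).coeff k
            - w 0 ^ (D - k - j) * w 1 ^ k * w 2 ^ j) := by
      rw [show D - k - j = (D - (k + 1) - j) + 1 by omega, Nat.factorial_succ]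
      push_cast
      ring
    rw [e]
    refine (norm_sub_le _ _).trans ?_
    rw [norm_mul, norm_mul]
    have h3 := mul_le_mul (hw1 0) h1 (norm_nonneg _) zero_le_one
    have h4 := mul_le_mul (hw1 1) h2 (norm_nonneg _) zero_le_one
    linarith
  · refine facNorm_le_of_taylor_coeff_le ha hM b _ _ (by positivity) hMab
      (degree_sub_lt_of_lt (degree_C_mul_lt (by rwa [Polynomial.degree_taylor]) _)
        (degree_C_mul_lt hC' _)) fun j hj k hk => (hfac k _).trans ?_
    have h1 := h k (j + 1) (by omega)
    have h2 := h k j (by omega)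
    rw [map_sub, Polynomial.taylor_mul, Polynomial.taylor_mul, Polynomial.taylor_C,
      Polynomial.taylor_C, Polynomial.taylor_taylor, Polynomial.coeff_sub, Polynomial.coeff_C_mul,
      Polynomial.coeff_C_mul]
    rw [Nat.cast_succ] at h1
    have e : (k.factorial : ℂ) * (w 0 * (Polynomial.taylor ((j : ℂ) + 1) C).coeff k
          - w 2 * (Polynomial.taylor (j : ℂ) C).coeff k)
        = w 0 * (k.factorial * (Polynomial.taylor ((j : ℂ) + 1) C).coeff k
            - w 0 ^ (D - k - (j + 1)) * w 1 ^ k * w 2 ^ (j + 1))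
          - w 2 * (k.factorial * (Polynomial.taylor (j : ℂ) C).coeff k
            - w 0 ^ (D - k - j) * w 1 ^ k * w 2 ^ j) := by
      rw [show D - k - j = (D - k - (j + 1)) + 1 by omega]
      ring
    rw [e]
    refine (norm_sub_le _ _).trans ?_
    rw [norm_mul, norm_mul]
    have h3 := mul_le_mul (hw1 0) h1 (norm_nonneg _) zero_le_one
    have h4 := mul_le_mul (hw1 2) h2 (norm_nonneg _) zero_le_one
    linarith

set_option maxHeartbeats 1000000 in
/-- A point whose monomials are nearly given by a jet functional is either detected by `δ`, or
lies close to the curve `(1 : t : exp t)` near `t = 0`. -/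
theorem exp_curve_dichotomy (ha : 1 ≤ a) (hb : 1 ≤ b) (hT : T ≤ a * b) (hD : a + b ≤ D)
    (hM : 3 ≤ M) (hMab : (a * b : ℝ) + 2 ≤ M) (hw1 : ∀ i, ‖w i‖ ≤ 1) (hw2 : ∃ i, ‖w i‖ = 1)
    (hC : C.degree < T) (hδ : 0 ≤ δ)
    (h : ∀ k j, k + j ≤ D → ‖k.factorial * (Polynomial.taylor (j : ℂ) C).coeff k
      - w 0 ^ (D - k - j) * w 1 ^ k * w 2 ^ j‖ ≤ δ) :
    1 ≤ M ^ (8 * (a * b) + 3 * T + D + 6) * δ ∨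
      (1 / 2 ≤ ‖w 0‖ ∧ ‖w 1 / w 0‖ ^ T ≤ M ^ (8 * (a * b) + 3 * T + D + 6) * δ ∧
        ‖w 2 / w 0 - Complex.exp (w 1 / w 0)‖ ≤ M ^ (8 * (a * b) + 3 * T + D + 6) * δ) := by
  have hM1 : 1 ≤ M := by linarith
  have hM0 : 0 ≤ M := by linarith
  have hTM : (T : ℝ) ≤ M := by
    have : (T : ℝ) ≤ a * b := by exact_mod_cast hT
    linarith
  rcases lt_or_ge (1 / 2) δ with hδ2 | hδ2
  · left
    have : M ≤ M ^ (8 * (a * b) + 3 * T + D + 6) := le_self_pow₀ hM1 (by omega)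
    nlinarith
  have hC' : C.degree < (a * b : ℕ) := hC.trans_le (by exact_mod_cast hT)
  have hN1 := one_le_pow_mul_facNorm ha hb hT hM hw2 hC hδ2 h
  obtain ⟨hB1, hB2⟩ := facNorm_defect_le ha hT hD hM hMab hw1 hC hδ h
  set B1 := Polynomial.C (w 0) * Polynomial.derivative C - Polynomial.C (w 1) * C with hB1def
  set B2 := Polynomial.C (w 0) * Polynomial.taylor 1 C - Polynomial.C (w 2) * C with hB2def
  set H := M ^ (8 * (a * b)) with hH
  have hH1 : 1 ≤ H := one_le_pow₀ hM1
  set N := facNorm (a * b) C with hN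
  have hN0 : 0 ≤ N := facNorm_nonneg _ _
  have hB1d : B1.degree < (a * b : ℕ) := degree_sub_lt_of_lt
    (degree_C_mul_lt (Polynomial.degree_derivative_le.trans_lt hC') _) (degree_C_mul_lt hC' _)
  have hB2d : B2.degree < (a * b : ℕ) := degree_sub_lt_of_lt
    (degree_C_mul_lt (by rwa [Polynomial.degree_taylor]) _) (degree_C_mul_lt hC' _)
  have hD1 := facNorm_pow_mul_sub_iterate_derivative_le (hw1 0) (hw1 1) hB1d hB1def
  have hD2 := facNorm_pow_mul_sub_iterate_polyDelta_le (hw1 0) (hw1 2) hB2d hB2def T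
  have hT1 : ‖w 1‖ ^ T * N ≤ T * (H * (2 * δ)) := by
    have h1 := hD1 T
    have h2 : Polynomial.derivative^[T] C = 0 := by
      rw [← Polynomial.factorial_smul_hasseDeriv]
      ext k
      rw [LinearMap.smul_apply, Polynomial.coeff_smul, Polynomial.hasseDeriv_coeff,
        (Polynomial.degree_lt_iff_coeff_zero _ _).1 hC _ (by omega)]
      simp
    rw [h2, mul_zero, sub_zero, facNorm_C_mul, norm_pow] at h1
    refine h1.trans ?_
    gcongr
  have hT2 : ‖w 2 - w 0‖ ^ T * N ≤ T * 4 ^ T * (H * (2 * δ)) := by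
    rw [polyDelta_iterate_eq_zero hC, mul_zero, sub_zero, facNorm_C_mul, norm_pow] at hD2
    refine hD2.trans ?_
    gcongr
  have h2T : (2 : ℝ) ^ T ≤ M ^ T := by gcongr; linarith
  have h4T : (4 : ℝ) ^ T ≤ M ^ T * M ^ T := by
    rw [← mul_pow]; gcongr; nlinarith
  rcases lt_or_ge ‖w 0‖ (1 / 2) with hw0 | hw0
  · left
    have hcase : (1 / 2 : ℝ) ^ T * N ≤ T * 4 ^ T * (H * (2 * δ)) := by
      obtain ⟨i, hi⟩ := hw2
      fin_cases i
      · have : ‖w 0‖ = 1 := hi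
        linarith
      · have h1 : ‖w 1‖ = 1 := hi
        rw [h1, one_pow, one_mul] at hT1
        have e1 : (1 / 2 : ℝ) ^ T * N ≤ 1 * N := by
          gcongr; exact pow_le_one₀ (by norm_num) (by norm_num)
        have e2 : (T : ℝ) * (H * (2 * δ)) ≤ T * 4 ^ T * (H * (2 * δ)) := by
          gcongr
          exact le_mul_of_one_le_right (by positivity) (one_le_pow₀ (by norm_num))
        linarith
      · have h1 : ‖w 2‖ = 1 := hi
        refine le_trans ?_ hT2
        gcongr
        have := norm_sub_norm_le (w 2) (w 0)
        linarith
    have e1 : N ≤ 2 ^ T * (T * 4 ^ T * (H * (2 * δ))) := by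
      rw [one_div, inv_pow, inv_mul_le_iff₀ (by positivity)] at hcase
      exact hcase
    calc (1 : ℝ) ≤ M ^ (D + 1) * N := hN1
      _ ≤ M ^ (D + 1) * (M ^ T * (M * (M ^ T * M ^ T) * (H * (M * δ)))) := by
        gcongr
        refine e1.trans ?_
        gcongr
        linarith
      _ = M ^ (8 * (a * b) + 3 * T + D + 3) * δ := by rw [hH]; ring
      _ ≤ _ := by
        gcongr ?_ * δ
        exact pow_le_pow_right₀ hM1 (by omega)
  right
  have hw00 : w 0 ≠ 0 := by
    intro h0; rw [h0, norm_zero] at hw0; norm_num at hw0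
  have hw0i : ‖(w 0)⁻¹‖ ≤ 2 := by
    rw [norm_inv, inv_le_comm₀ (by linarith) (by norm_num)]
    linarith
  set t := w 1 / w 0 with ht
  set Y := w 2 / w 0 with hY
  have ht2 : ‖t‖ ≤ 2 * ‖w 1‖ := by
    rw [ht, div_eq_mul_inv, norm_mul, mul_comm]
    gcongr
  have htT : ‖t‖ ^ T ≤ M ^ (8 * (a * b) + T + D + 3) * δ := by
    calc ‖t‖ ^ T ≤ ‖t‖ ^ T * (M ^ (D + 1) * N) := le_mul_of_one_le_right (by positivity) hN1
      _ ≤ (2 * ‖w 1‖) ^ T * (M ^ (D + 1) * N) := by gcongr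
      _ = 2 ^ T * M ^ (D + 1) * (‖w 1‖ ^ T * N) := by ring
      _ ≤ M ^ T * M ^ (D + 1) * (M * (H * (M * δ))) := by
        have e1 : (T : ℝ) * (H * (2 * δ)) ≤ M * (H * (M * δ)) := by gcongr; linarith
        have e2 := hT1.trans e1
        exact mul_le_mul (mul_le_mul_of_nonneg_right h2T (by positivity)) e2 (by positivity)
          (by positivity)
      _ = _ := by rw [hH]; ring
  have hle : ∀ m, m ≤ 8 * (a * b) + 3 * T + D + 6 → M ^ m * δ
      ≤ M ^ (8 * (a * b) + 3 * T + D + 6) * δ := fun m hm => by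
    gcongr ?_ * δ
    exact pow_le_pow_right₀ hM1 hm
  refine ⟨hw0, htT.trans (hle _ (by omega)), ?_⟩
  have hder : ∀ i < T, facNorm (a * b)
      (Polynomial.C (t ^ i) * C - Polynomial.derivative^[i] C) ≤ 2 ^ T * (T * (H * (2 * δ))) := by
    intro i hi
    have e : Polynomial.C (t ^ i) * C - Polynomial.derivative^[i] C
        = Polynomial.C ((w 0)⁻¹ ^ i) * (Polynomial.C (w 1 ^ i) * C
          - Polynomial.C (w 0 ^ i) * Polynomial.derivative^[i] C) := by
      rw [mul_sub, ← mul_assoc, ← mul_assoc, ← map_mul, ← map_mul, ← mul_pow, ← mul_pow,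
        inv_mul_cancel₀ hw00, one_pow, map_one, one_mul, ht, div_eq_inv_mul]
    rw [e, facNorm_C_mul, norm_pow]
    gcongr
    · exact facNorm_nonneg _ _
    · calc ‖(w 0)⁻¹‖ ^ i ≤ 2 ^ i := by gcongr
        _ ≤ 2 ^ T := pow_le_pow_right₀ (by norm_num) hi.le
    · refine (hD1 i).trans ?_
      have := facNorm_nonneg (a * b) B1
      gcongr
  have hsum : facNorm (a * b) (Polynomial.C (Y - ∑ i ∈ Finset.range T, t ^ i / i.factorial) * C)
      ≤ 2 * (H * (2 * δ)) + T * (2 ^ T * (T * (H * (2 * δ)))) := by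
    have e : Polynomial.C (Y - ∑ i ∈ Finset.range T, t ^ i / i.factorial) * C
        = -(Polynomial.C (w 0)⁻¹ * B2) - ∑ i ∈ Finset.range T,
          Polynomial.C ((i.factorial : ℂ)⁻¹)
            * (Polynomial.C (t ^ i) * C - Polynomial.derivative^[i] C) := by
      have e1 : Polynomial.C (w 0)⁻¹ * B2 = Polynomial.taylor 1 C - Polynomial.C Y * C := by
        rw [hB2def, mul_sub, ← mul_assoc, ← mul_assoc, ← map_mul, ← map_mul,
          inv_mul_cancel₀ hw00, map_one, one_mul, hY, div_eq_inv_mul]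
      rw [e1, taylor_one_eq_sum_hasseDeriv hC]
      simp only [hasseDeriv_eq_C_mul_iterate, map_sub, map_sum, mul_sub, sub_mul,
        Finset.sum_sub_distrib, Finset.sum_mul, ← mul_assoc, ← map_mul, div_eq_inv_mul]
      ring
    rw [e]
    refine (facNorm_sub_le _ _ _).trans (add_le_add ?_ ?_)
    · rw [facNorm_neg, facNorm_C_mul]
      gcongr
      exact facNorm_nonneg _ _
    · refine (facNorm_sum_le _ _ _).trans ?_
      calc _ ≤ ∑ i ∈ Finset.range T, 2 ^ T * (T * (H * (2 * δ))) := by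
            refine Finset.sum_le_sum fun i hi => ?_
            rw [facNorm_C_mul, norm_inv, Complex.norm_natCast]
            refine le_trans ?_ (hder i (Finset.mem_range.1 hi))
            refine mul_le_of_le_one_left (facNorm_nonneg _ _) (inv_le_one_of_one_le₀ ?_)
            exact_mod_cast i.factorial_pos
        _ = _ := by simp
  rw [facNorm_C_mul] at hsum
  have hmain : ‖Y - ∑ i ∈ Finset.range T, t ^ i / i.factorial‖
      ≤ M ^ (8 * (a * b) + 3 * T + D + 5) * δ := by
    calc ‖Y - ∑ i ∈ Finset.range T, t ^ i / i.factorial‖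
        ≤ ‖Y - ∑ i ∈ Finset.range T, t ^ i / i.factorial‖ * (M ^ (D + 1) * N) :=
          le_mul_of_one_le_right (norm_nonneg _) hN1
      _ = M ^ (D + 1) * (‖Y - ∑ i ∈ Finset.range T, t ^ i / i.factorial‖ * N) := by ring
      _ ≤ M ^ (D + 1) * (2 * (H * (2 * δ)) + T * (2 ^ T * (T * (H * (2 * δ))))) := by gcongr
      _ ≤ M ^ (D + 1) * (M ^ T * M * (H * (M * δ)) + M * (M ^ T * (M * (H * (M * δ))))) := by
        have : (1 : ℝ) ≤ M ^ T := one_le_pow₀ hM1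
        gcongr
        · nlinarith
        · linarith
        · linarith
      _ ≤ M ^ (D + 1) * (M * (M ^ T * M * (M * (H * (M * δ))))) := by
        gcongr
        have e1 : M ^ T * M * (H * (M * δ)) ≤ M * (M ^ T * (M * (H * (M * δ)))) := by
          have e2 : M ^ T * M * (H * (M * δ)) * 1 ≤ M ^ T * M * (H * (M * δ)) * M := by gcongr
          linarith
        have e3 : 0 ≤ M * (M ^ T * (M * (H * (M * δ)))) := by positivity
        have e4 : M * (M ^ T * M * (M * (H * (M * δ))))
            = M * (M * (M ^ T * (M * (H * (M * δ))))) := by ring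
        rw [e4]
        nlinarith
      _ = M ^ (8 * (a * b) + T + D + 5) * δ := by rw [hH]; ring
      _ ≤ _ := by
        gcongr ?_ * δ
        exact pow_le_pow_right₀ hM1 (by omega)
  have hexp := Complex.norm_exp_sub_sum_le_norm_mul_exp t T
  have hexp2 : ‖t‖ ^ T * Real.exp ‖t‖ ≤ M ^ (8 * (a * b) + 3 * T + D + 5) * δ := by
    have e1 : Real.exp ‖t‖ ≤ M ^ 2 := by
      calc Real.exp ‖t‖ ≤ Real.exp (2 : ℕ) := by
            gcongr; push_cast; linarith [hw1 1]
        _ = Real.exp 1 ^ 2 := by rw [← Real.exp_nat_mul, mul_one]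
        _ ≤ M ^ 2 := by gcongr; linarith [Real.exp_one_lt_d9]
    calc _ ≤ M ^ (8 * (a * b) + T + D + 3) * δ * M ^ 2 := by gcongr
      _ = M ^ (8 * (a * b) + T + D + 5) * δ := by ring
      _ ≤ _ := by
        gcongr ?_ * δ
        exact pow_le_pow_right₀ hM1 (by omega)
  have e : Y - Complex.exp t = (Y - ∑ i ∈ Finset.range T, t ^ i / i.factorial)
      - (Complex.exp t - ∑ i ∈ Finset.range T, t ^ i / i.factorial) := by ring
  rw [e]
  refine (norm_sub_le _ _).trans ?_
  have e2 : M ^ (8 * (a * b) + 3 * T + D + 6) * δ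
      = M * (M ^ (8 * (a * b) + 3 * T + D + 5) * δ) := by ring
  have e3 : 0 ≤ M ^ (8 * (a * b) + 3 * T + D + 5) * δ := by positivity
  rw [e2]
  nlinarith

end Dichotomy

section D3

variable {R S : Type*} [CommRing R] [CommRing S]

/-- The homogeneous version `X₀ ∂/∂X₁ + X₂ ∂/∂X₂` of the derivation `D1`. -/
noncomputable def D3 (R : Type*) [CommRing R] :
    Derivation R (MvPolynomial (Fin 3) R) (MvPolynomial (Fin 3) R) :=
  (X 0 : MvPolynomial (Fin 3) R) • pderiv 1 + (X 2 : MvPolynomial (Fin 3) R) • pderiv 2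

lemma D3_apply (p : MvPolynomial (Fin 3) R) : D3 R p = X 0 * pderiv 1 p + X 2 * pderiv 2 p := by
  simp [D3]

lemma map_D3 (f : R →+* S) (p : MvPolynomial (Fin 3) R) : map f (D3 R p) = D3 S (map f p) := by
  simp [D3_apply, pderiv_map]

lemma map_D3_iterate (f : R →+* S) (p : MvPolynomial (Fin 3) R) (i : ℕ) :
    map f ((D3 R)^[i] p) = (D3 S)^[i] (map f p) := by
  induction i with
  | zero => rfl
  | succ i ih => rw [Function.iterate_succ_apply', Function.iterate_succ_apply', map_D3, ih]

lemma MvPolynomial.IsHomogeneous.D3 {p : MvPolynomial (Fin 3) R} {n : ℕ} (hp : p.IsHomogeneous n) :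
    (D3 R p).IsHomogeneous n := by
  rw [D3_apply]
  rcases n with _ | n
  · rw [← totalDegree_zero_iff_isHomogeneous, totalDegree_eq_zero_iff_eq_C] at hp
    rw [hp]
    simpa using isHomogeneous_zero _ _ _
  · have h1 := (isHomogeneous_X R (0 : Fin 3)).mul (hp.pderiv (i := 1))
    have h2 := (isHomogeneous_X R (2 : Fin 3)).mul (hp.pderiv (i := 2))
    rw [add_comm 1, Nat.add_sub_cancel] at h1 h2
    exact h1.add h2

lemma MvPolynomial.IsHomogeneous.D3_iterate {p : MvPolynomial (Fin 3) R} {n : ℕ}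
    (hp : p.IsHomogeneous n) (i : ℕ) : ((_root_.D3 R)^[i] p).IsHomogeneous n := by
  induction i with
  | zero => exact hp
  | succ i ih => rw [Function.iterate_succ_apply']; exact ih.D3

lemma D3_X_zero : D3 R (X 0) = 0 := by simp [D3_apply, pderiv_X]
lemma D3_X_one : D3 R (X 1) = X 0 := by simp [D3_apply, pderiv_X]
lemma D3_X_two : D3 R (X 2) = X 2 := by simp [D3_apply, pderiv_X]

/-- The degree `D` homogenization of a polynomial in two variables. -/
noncomputable def homog (D : ℕ) (p : MvPolynomial (Fin 2) R) : MvPolynomial (Fin 3) R :=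
  ∑ m ∈ p.support, monomial
    (Finsupp.equivFunOnFinite.symm ![D - m.degree, m 0, m 1]) (p.coeff m)

lemma homog_isHomogeneous {D : ℕ} {p : MvPolynomial (Fin 2) R} (h : p.totalDegree ≤ D) :
    (homog D p).IsHomogeneous D := by
  refine IsHomogeneous.sum _ _ _ fun m hm => isHomogeneous_monomial _ ?_
  have h1 : m.degree ≤ D := by
    refine le_trans ?_ h
    exact le_totalDegree hm
  rw [Finsupp.degree_eq_sum] at h1 ⊢
  simp only [Fin.sum_univ_three, Finsupp.equivFunOnFinite_symm_apply_apply, Finsupp.degree_eq_sum,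
    Fin.sum_univ_two] at h1 ⊢
  simp
  omega

lemma map_homog (f : R →+* S) (hf : Function.Injective f) (D : ℕ) (p : MvPolynomial (Fin 2) R) :
    map f (homog D p) = homog D (map f p) := by
  simp [homog, map_monomial, support_map_of_injective p hf, coeff_map]

lemma homog_ne_zero {D : ℕ} {p : MvPolynomial (Fin 2) R} (h : p ≠ 0) : homog D p ≠ 0 := by
  intro h0
  apply h
  have h1 : aeval (![1, X 0, X 1] : Fin 3 → MvPolynomial (Fin 2) R) (homog D p) = p := by
    conv_rhs => rw [p.as_sum]
    rw [homog, map_sum]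
    refine Finset.sum_congr rfl fun m _ => ?_
    rw [aeval_monomial, Finsupp.prod_fintype _ _ (by simp), Fin.prod_univ_three,
      monomial_eq, Finsupp.prod_fintype _ _ (by simp), Fin.prod_univ_two]
    simp [algebraMap_eq]
  rw [← h1, h0, map_zero]

end D3

section Jet

/-- The expansion along the curve `t ↦ (1 : x + t : y exp t)`. -/
noncomputable def jet (x y : ℂ) : MvPolynomial (Fin 3) ℂ →ₐ[ℂ] PowerSeries ℂ :=
  aeval ![1, PowerSeries.C x + PowerSeries.X, PowerSeries.C y * PowerSeries.exp ℂ]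

lemma jet_D3 (x y : ℂ) (p : MvPolynomial (Fin 3) ℂ) :
    jet x y (D3 ℂ p) = PowerSeries.derivative ℂ (jet x y p) := by
  induction p using MvPolynomial.induction_on with
  | C a =>
    rw [← algebraMap_eq, Derivation.map_algebraMap, AlgHom.commutes, Derivation.map_algebraMap,
      map_zero]
  | add p q hp hq => simp only [map_add, hp, hq]
  | mul_X p i hp =>
    rw [Derivation.leibniz, map_mul (jet x y), Derivation.leibniz, map_add, smul_eq_mul,
      smul_eq_mul, map_mul, map_mul, hp, smul_eq_mul, smul_eq_mul]
    refine congrArg (fun u => jet x y p * u + _) ?_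
    have hC : ∀ c : ℂ, PowerSeries.derivative ℂ (PowerSeries.C c) = 0 := fun c => by
      ext n; simp
    fin_cases i
    · change jet x y (D3 ℂ (X 0)) = PowerSeries.derivative ℂ (jet x y (X 0))
      rw [D3_X_zero]; simp [jet]
    · change jet x y (D3 ℂ (X 1)) = PowerSeries.derivative ℂ (jet x y (X 1))
      rw [D3_X_one]; simp [jet, hC, PowerSeries.derivative_X]
    · change jet x y (D3 ℂ (X 2)) = PowerSeries.derivative ℂ (jet x y (X 2))
      rw [D3_X_two]; simp [jet, hC, Derivation.leibniz, PowerSeries.derivative_exp]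

lemma coeff_iterate_derivative (f : PowerSeries ℂ) (i l : ℕ) :
    PowerSeries.coeff l ((PowerSeries.derivative ℂ)^[i] f) * l.factorial
      = PowerSeries.coeff (l + i) f * (l + i).factorial := by
  induction i generalizing l with
  | zero => simp
  | succ i ih =>
    rw [Function.iterate_succ_apply', PowerSeries.coeff_derivative, mul_assoc,
      show ((l : ℂ) + 1) * l.factorial = (l + 1).factorial by rw [Nat.factorial_succ]; push_cast; rfl,
      ih, show l + 1 + i = l + (i + 1) by ring]

lemma jet_D3_iterate (x y : ℂ) (p : MvPolynomial (Fin 3) ℂ) (i : ℕ) :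
    jet x y ((D3 ℂ)^[i] p) = (PowerSeries.derivative ℂ)^[i] (jet x y p) := by
  induction i with
  | zero => rfl
  | succ i ih => rw [Function.iterate_succ_apply', Function.iterate_succ_apply', jet_D3, ih]

lemma constantCoeff_jet (x y : ℂ) (p : MvPolynomial (Fin 3) ℂ) :
    PowerSeries.coeff 0 (jet x y p) = eval ![1, x, y] p := by
  have : (PowerSeries.constantCoeff (R := ℂ)).comp (jet x y : _ →+* _)
      = eval (![1, x, y] : Fin 3 → ℂ) := by
    ext i
    · simp
    · fin_cases i <;> simp [jet]
  rw [← this]; simp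

/-- Up to a factorial, the jet coefficients are the values of the iterated derivatives. -/
lemma coeff_jet_mul_factorial (x y : ℂ) (p : MvPolynomial (Fin 3) ℂ) (i : ℕ) :
    PowerSeries.coeff i (jet x y p) * i.factorial = eval ![1, x, y] ((D3 ℂ)^[i] p) := by
  have := coeff_iterate_derivative (jet x y p) i 0
  rw [← constantCoeff_jet, jet_D3_iterate]
  simpa using this.symm

/-- Restriction to the affine chart `X₀ = 1`. -/
noncomputable def dehomog : MvPolynomial (Fin 3) ℂ →ₐ[ℂ] MvPolynomial (Fin 2) ℂ :=
  aeval ![1, X 0, X 1]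

lemma dehomog_homog (D : ℕ) (p : MvPolynomial (Fin 2) ℂ) : dehomog (homog D p) = p := by
  conv_rhs => rw [p.as_sum]
  rw [homog, map_sum]
  refine Finset.sum_congr rfl fun m _ => ?_
  rw [dehomog, aeval_monomial, Finsupp.prod_fintype _ _ (by simp), Fin.prod_univ_three,
    monomial_eq, Finsupp.prod_fintype _ _ (by simp), Fin.prod_univ_two]
  simp [algebraMap_eq]

lemma eval_dehomog (x y : ℂ) (p : MvPolynomial (Fin 3) ℂ) :
    eval ![x, y] (dehomog p) = eval ![1, x, y] p := by
  have : (eval ![x, y]).comp (dehomog : MvPolynomial (Fin 3) ℂ →+* MvPolynomial (Fin 2) ℂ)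
      = eval (![1, x, y] : Fin 3 → ℂ) := by
    ext i
    · simp [dehomog]
    · fin_cases i <;> simp [dehomog]
  rw [← this]; simp

lemma dehomog_D3 (p : MvPolynomial (Fin 3) ℂ) : dehomog (D3 ℂ p) = D1 (dehomog p) := by
  let D1' : Derivation ℂ (MvPolynomial (Fin 2) ℂ) (MvPolynomial (Fin 2) ℂ) :=
    pderiv 0 + (X 1 : MvPolynomial (Fin 2) ℂ) • pderiv 1
  have h1 : ∀ q, D1 q = D1' q := fun q => by simp [D1, D1']
  rw [h1]
  induction p using MvPolynomial.induction_on with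
  | C a =>
    rw [← algebraMap_eq, Derivation.map_algebraMap, AlgHom.commutes, Derivation.map_algebraMap,
      map_zero]
  | add p q hp hq => simp only [map_add, hp, hq]
  | mul_X p i hp =>
    rw [Derivation.leibniz, map_mul dehomog, Derivation.leibniz, map_add, smul_eq_mul,
      smul_eq_mul, map_mul, map_mul, hp, smul_eq_mul, smul_eq_mul]
    refine congrArg (fun u => dehomog p * u + _) ?_
    rw [← h1]
    fin_cases i
    · change dehomog (D3 ℂ (X 0)) = D1 (dehomog (X 0))
      rw [D3_X_zero]; simp [dehomog, D1]
    · change dehomog (D3 ℂ (X 1)) = D1 (dehomog (X 1))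
      rw [D3_X_one]; simp [dehomog, D1, pderiv_X]
    · change dehomog (D3 ℂ (X 2)) = D1 (dehomog (X 2))
      rw [D3_X_two]; simp [dehomog, D1, pderiv_X]

lemma eval_D1_iterate (x y : ℂ) (D i : ℕ) (p : MvPolynomial (Fin 2) ℂ) :
    eval ![x, y] (D1^[i] p) = eval ![1, x, y] ((D3 ℂ)^[i] (homog D p)) := by
  rw [← eval_dehomog]
  congr 1
  induction i with
  | zero => exact (dehomog_homog D p).symm
  | succ i ih => rw [Function.iterate_succ_apply', Function.iterate_succ_apply', dehomog_D3, ih]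

/-- The sum of the absolute values of the first `T` coefficients of a power series. -/
noncomputable def tnorm (T : ℕ) (f : PowerSeries ℂ) : ℝ :=
  ∑ l ∈ Finset.range T, ‖PowerSeries.coeff l f‖

lemma tnorm_nonneg (T : ℕ) (f : PowerSeries ℂ) : 0 ≤ tnorm T f :=
  Finset.sum_nonneg fun _ _ => norm_nonneg _

lemma norm_coeff_le_tnorm {T l : ℕ} (h : l < T) (f : PowerSeries ℂ) :
    ‖PowerSeries.coeff l f‖ ≤ tnorm T f :=
  Finset.single_le_sum (f := fun l => ‖PowerSeries.coeff l f‖) (fun _ _ => norm_nonneg _)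
    (Finset.mem_range.2 h)

lemma tnorm_mono {T T' : ℕ} (h : T ≤ T') (f : PowerSeries ℂ) : tnorm T f ≤ tnorm T' f :=
  Finset.sum_le_sum_of_subset_of_nonneg (Finset.range_mono h) fun _ _ _ => norm_nonneg _

lemma tnorm_add_le (T : ℕ) (f g : PowerSeries ℂ) : tnorm T (f + g) ≤ tnorm T f + tnorm T g := by
  unfold tnorm
  rw [← Finset.sum_add_distrib]
  exact Finset.sum_le_sum fun l _ => by rw [map_add]; exact norm_add_le _ _

lemma tnorm_C_mul (T : ℕ) (c : ℂ) (f : PowerSeries ℂ) :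
    tnorm T (PowerSeries.C c * f) = ‖c‖ * tnorm T f := by
  simp [tnorm, Finset.mul_sum]

lemma tnorm_smul (T : ℕ) (c : ℂ) (f : PowerSeries ℂ) : tnorm T (c • f) = ‖c‖ * tnorm T f := by
  simp [tnorm, Finset.mul_sum]

lemma tnorm_sum_le {ι : Type*} (T : ℕ) (s : Finset ι) (f : ι → PowerSeries ℂ) :
    tnorm T (∑ i ∈ s, f i) ≤ ∑ i ∈ s, tnorm T (f i) := by
  classical
  induction s using Finset.induction_on with
  | empty => simp [tnorm]
  | insert a s ha ih =>
    rw [Finset.sum_insert ha, Finset.sum_insert ha]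
    exact (tnorm_add_le _ _ _).trans (by gcongr)

lemma tnorm_mul_le (T : ℕ) (f g : PowerSeries ℂ) : tnorm T (f * g) ≤ tnorm T f * tnorm T g := by
  unfold tnorm
  rw [Finset.sum_mul_sum, ← Finset.sum_product']
  calc ∑ l ∈ Finset.range T, ‖PowerSeries.coeff l (f * g)‖
      ≤ ∑ l ∈ Finset.range T, ∑ p ∈ Finset.HasAntidiagonal.antidiagonal l,
          ‖PowerSeries.coeff p.1 f‖ * ‖PowerSeries.coeff p.2 g‖ := by
        refine Finset.sum_le_sum fun l _ => ?_
        rw [PowerSeries.coeff_mul]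
        exact norm_sum_le_of_le _ fun p _ => (norm_mul _ _).le
    _ = ∑ x ∈ (Finset.range T).sigma fun l => Finset.HasAntidiagonal.antidiagonal l,
          ‖PowerSeries.coeff x.2.1 f‖ * ‖PowerSeries.coeff x.2.2 g‖ := by
        rw [Finset.sum_sigma]
    _ = ∑ p ∈ ((Finset.range T).sigma fun l => Finset.HasAntidiagonal.antidiagonal l).image fun x => x.2,
          ‖PowerSeries.coeff p.1 f‖ * ‖PowerSeries.coeff p.2 g‖ := by
        rw [Finset.sum_image]
        rintro ⟨l, p⟩ h1 ⟨l', p'⟩ h2 (h : p = p')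
        subst h
        have h1' := (Finset.HasAntidiagonal.mem_antidiagonal.1 (Finset.mem_sigma.1 h1).2)
        have h2' := (Finset.HasAntidiagonal.mem_antidiagonal.1 (Finset.mem_sigma.1 h2).2)
        have : l = l' := h1'.symm.trans h2'
        subst this; rfl
    _ ≤ _ := by
        refine Finset.sum_le_sum_of_subset_of_nonneg ?_ fun _ _ _ => by positivity
        intro p hp
        simp only [Finset.mem_image, Finset.mem_sigma, Finset.mem_range, Finset.HasAntidiagonal.mem_antidiagonal,
          Finset.mem_product] at hp ⊢
        obtain ⟨x, ⟨h1, h2⟩, rfl⟩ := hp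
        omega

lemma tnorm_one_le (T : ℕ) : tnorm T 1 ≤ 1 := by
  unfold tnorm
  simp only [PowerSeries.coeff_one]
  rcases T with _ | T
  · simp
  · rw [Finset.sum_range_succ']; simp

lemma tnorm_pow_le (T : ℕ) (f : PowerSeries ℂ) (n : ℕ) : tnorm T (f ^ n) ≤ tnorm T f ^ n := by
  induction n with
  | zero => simpa using tnorm_one_le T
  | succ n ih =>
    rw [pow_succ, pow_succ]
    exact (tnorm_mul_le _ _ _).trans (mul_le_mul_of_nonneg_right ih (tnorm_nonneg _ _))

end Jet

section LOne

/-- The sum of the absolute values of the coefficients. -/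
noncomputable def l1 (p : MvPolynomial (Fin 3) ℂ) : ℝ := ∑ m ∈ p.support, ‖coeff m p‖

lemma l1_nonneg (p : MvPolynomial (Fin 3) ℂ) : 0 ≤ l1 p := Finset.sum_nonneg fun _ _ => norm_nonneg _

lemma l1_eq_sum {p : MvPolynomial (Fin 3) ℂ} {s : Finset (Fin 3 →₀ ℕ)} (h : p.support ⊆ s) :
    l1 p = ∑ m ∈ s, ‖coeff m p‖ :=
  Finset.sum_subset h fun m _ hm => by rw [notMem_support_iff.1 hm, norm_zero]

lemma norm_coeff_le_l1 (p : MvPolynomial (Fin 3) ℂ) (m : Fin 3 →₀ ℕ) : ‖coeff m p‖ ≤ l1 p := by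
  by_cases h : m ∈ p.support
  · exact Finset.single_le_sum (f := fun m => ‖coeff m p‖) (fun _ _ => norm_nonneg _) h
  · rw [notMem_support_iff.1 h, norm_zero]; exact l1_nonneg p

lemma l1_zero : l1 0 = 0 := by simp [l1]

lemma l1_add_le (p q : MvPolynomial (Fin 3) ℂ) : l1 (p + q) ≤ l1 p + l1 q := by
  classical
  rw [l1_eq_sum (support_add (p := p) (q := q)), l1_eq_sum (p := p) Finset.subset_union_left,
    l1_eq_sum (p := q) Finset.subset_union_right, ← Finset.sum_add_distrib]
  exact Finset.sum_le_sum fun m _ => by rw [coeff_add]; exact norm_add_le _ _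

lemma l1_sum_le {ι : Type*} (s : Finset ι) (f : ι → MvPolynomial (Fin 3) ℂ) :
    l1 (∑ i ∈ s, f i) ≤ ∑ i ∈ s, l1 (f i) := by
  classical
  induction s using Finset.induction_on with
  | empty => simp [l1_zero]
  | insert a s ha ih =>
    rw [Finset.sum_insert ha, Finset.sum_insert ha]
    exact (l1_add_le _ _).trans (by gcongr)

lemma l1_monomial (m : Fin 3 →₀ ℕ) (a : ℂ) : l1 (monomial m a) = ‖a‖ := by
  classical
  rw [l1_eq_sum (support_monomial_subset (s := m) (a := a))]
  simp

lemma l1_smul_le (a : ℂ) (p : MvPolynomial (Fin 3) ℂ) : l1 (a • p) ≤ ‖a‖ * l1 p := by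
  rw [l1_eq_sum (support_smul (a := a) (f := p)), l1, Finset.mul_sum]
  exact Finset.sum_le_sum fun m _ => by rw [coeff_smul, smul_eq_mul, norm_mul]

lemma l1_sub_le (p q : MvPolynomial (Fin 3) ℂ) : l1 (p - q) ≤ l1 p + l1 q := by
  have := l1_add_le p ((-1 : ℂ) • q)
  have h2 := l1_smul_le (-1) q
  simp only [norm_neg, norm_one, one_mul, neg_smul, one_smul, ← sub_eq_add_neg] at this h2
  linarith

lemma l1_mul_le (p q : MvPolynomial (Fin 3) ℂ) : l1 (p * q) ≤ l1 p * l1 q := by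
  have h : p * q = ∑ m ∈ p.support, ∑ n ∈ q.support, monomial (m + n) (coeff m p * coeff n q) := by
    conv_lhs => rw [p.as_sum, q.as_sum]
    simp_rw [Finset.sum_mul_sum, monomial_mul]
  rw [h]
  refine (l1_sum_le _ _).trans ?_
  rw [l1, l1, Finset.sum_mul_sum]
  refine Finset.sum_le_sum fun m _ => (l1_sum_le _ _).trans (Finset.sum_le_sum fun n _ => ?_)
  rw [l1_monomial, norm_mul]

lemma l1_one_le : l1 1 ≤ 1 := by
  have := l1_monomial 0 1
  simp only [monomial_zero', C_1, norm_one] at this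
  exact this.le

lemma aeval_le_l1_mul {A : Type*} [CommRing A] [Algebra ℂ A] (N : A → ℝ) (h0 : ∀ x, 0 ≤ N x)
    (hadd : ∀ x y, N (x + y) ≤ N x + N y) (hsmul : ∀ (c : ℂ) x, N (c • x) ≤ ‖c‖ * N x)
    (hmul : ∀ x y, N (x * y) ≤ N x * N y) (hone : N 1 ≤ 1) {g : Fin 3 → A} {c : ℝ}
    (hg : ∀ i, N (g i) ≤ c) {p : MvPolynomial (Fin 3) ℂ} {n : ℕ} (hp : p.IsHomogeneous n) :
    N (aeval g p) ≤ l1 p * c ^ n := by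
  classical
  have hz : N 0 ≤ 0 := by simpa using hsmul 0 0
  have hsum : ∀ (s : Finset (Fin 3 →₀ ℕ)) (f : (Fin 3 →₀ ℕ) → A),
      N (∑ i ∈ s, f i) ≤ ∑ i ∈ s, N (f i) := fun s f => by
    induction s using Finset.induction_on with
    | empty => simpa using hz
    | insert a s ha ih =>
      rw [Finset.sum_insert ha, Finset.sum_insert ha]
      exact (hadd _ _).trans (by gcongr)
  have hpow : ∀ x (k : ℕ), N x ≤ c → N (x ^ k) ≤ c ^ k := fun x k hx => by
    induction k with
    | zero => simpa using hone
    | succ k ih =>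
      rw [pow_succ, pow_succ]
      exact (hmul _ _).trans (mul_le_mul ih hx (h0 _) ((h0 _).trans ih))
  have hc : 0 ≤ c := (h0 _).trans (hg 0)
  conv_lhs => rw [p.as_sum, map_sum]
  refine (hsum _ _).trans ?_
  rw [l1, Finset.sum_mul]
  refine Finset.sum_le_sum fun m hm => ?_
  rw [aeval_monomial, ← Algebra.smul_def]
  refine (hsmul _ _).trans (mul_le_mul_of_nonneg_left ?_ (norm_nonneg _))
  rw [Finsupp.prod_fintype _ _ (by simp), Fin.prod_univ_three]
  have hd : n = m 0 + m 1 + m 2 := by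
    have : n = m.degree := hp.degree_eq_sum_deg_support hm
    rwa [Finsupp.degree_eq_sum, Fin.sum_univ_three] at this
  rw [hd, pow_add, pow_add]
  refine (hmul _ _).trans (mul_le_mul ((hmul _ _).trans ?_) (hpow _ _ (hg 2)) (h0 _) (by positivity))
  exact mul_le_mul (hpow _ _ (hg 0)) (hpow _ _ (hg 1)) (h0 _) (by positivity)

lemma norm_eval_le_l1 {p : MvPolynomial (Fin 3) ℂ} {n : ℕ} (hp : p.IsHomogeneous n) {z : Fin 3 → ℂ}
    {c : ℝ} (hz : ∀ i, ‖z i‖ ≤ c) : ‖eval z p‖ ≤ l1 p * c ^ n := by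
  have := aeval_le_l1_mul (fun x : ℂ => ‖x‖) norm_nonneg norm_add_le
    (fun c x => (norm_smul c x).le) (fun x y => (norm_mul x y).le) (by simp) hz hp
  simpa [coe_aeval_eq_eval] using this

lemma norm_exp_coeff_le (n : ℕ) : ‖PowerSeries.coeff n (PowerSeries.exp ℂ)‖ = 1 / n.factorial := by
  rw [PowerSeries.coeff_exp]; simp

lemma tnorm_exp_le (T : ℕ) : tnorm T (PowerSeries.exp ℂ) ≤ 3 := by
  unfold tnorm
  have h := Real.sum_le_exp_of_nonneg (x := 1) zero_le_one T
  have h2 := Real.exp_one_lt_d9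
  have h3 : ∑ l ∈ Finset.range T, ‖PowerSeries.coeff l (PowerSeries.exp ℂ)‖
      = ∑ l ∈ Finset.range T, (1 : ℝ) ^ l / l.factorial := by
    refine Finset.sum_congr rfl fun l _ => ?_
    rw [norm_exp_coeff_le, one_pow]
  rw [h3]; linarith

lemma tnorm_X_le (T : ℕ) : tnorm T (PowerSeries.X : PowerSeries ℂ) ≤ 1 := by
  unfold tnorm
  simp only [PowerSeries.coeff_X]
  have : ∀ l, ‖(if l = 1 then (1 : ℂ) else 0)‖ = if l = 1 then (1 : ℝ) else 0 := fun l => by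
    split_ifs <;> simp
  simp only [this, Finset.sum_ite_eq']
  split_ifs <;> norm_num

lemma tnorm_jet_le (T : ℕ) (x y : ℂ) {c : ℝ} (hc : 1 ≤ c) (hx : ‖x‖ + 1 ≤ c) (hy : 3 * ‖y‖ ≤ c)
    {p : MvPolynomial (Fin 3) ℂ} {n : ℕ} (hp : p.IsHomogeneous n) :
    tnorm T (jet x y p) ≤ l1 p * c ^ n := by
  refine aeval_le_l1_mul (tnorm T) (tnorm_nonneg T) (tnorm_add_le T) (fun c x => (tnorm_smul T c x).le)
    (tnorm_mul_le T) (tnorm_one_le T) ?_ hp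
  have hCx : tnorm T (PowerSeries.C x) ≤ ‖x‖ := by
    have := tnorm_C_mul T x 1
    rw [mul_one] at this
    rw [this]
    exact mul_le_of_le_one_right (norm_nonneg _) (tnorm_one_le T)
  intro i
  fin_cases i
  · exact (tnorm_one_le T).trans hc
  · exact (tnorm_add_le _ _ _).trans (by linarith [tnorm_X_le T])
  · refine (tnorm_C_mul T y _).le.trans ?_
    have := mul_le_mul_of_nonneg_left (tnorm_exp_le T) (norm_nonneg y)
    linarith

end LOne

section Chg

/-- The linear substitution straightening the curve `(1 : x + t : y exp t)`. -/
noncomputable def chg (x y : ℂ) : MvPolynomial (Fin 3) ℂ →ₐ[ℂ] MvPolynomial (Fin 3) ℂ :=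
  aeval ![X 0, X 1 + C x * X 0, C y * X 2]

lemma chg_isHomogeneous (x y : ℂ) {p : MvPolynomial (Fin 3) ℂ} {n : ℕ} (hp : p.IsHomogeneous n) :
    (chg x y p).IsHomogeneous n := by
  have := hp.aeval (![X 0, X 1 + C x * X 0, C y * X 2] : Fin 3 → MvPolynomial (Fin 3) ℂ) (n := 1)
    (fun i => by
      fin_cases i
      · exact isHomogeneous_X _ _
      · exact (isHomogeneous_X _ _).add (isHomogeneous_C_mul_X _ _)
      · exact isHomogeneous_C_mul_X _ _)
  simpa [chg] using this

lemma chg_chg (x y : ℂ) (hy : y ≠ 0) (p : MvPolynomial (Fin 3) ℂ) :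
    chg x y (chg (-x) y⁻¹ p) = p := by
  have : (chg x y).comp (chg (-x) y⁻¹) = AlgHom.id ℂ _ := by
    ext i : 1
    fin_cases i
    · simp [chg]
    · simp [chg, algebraMap_eq]
    · simp [chg, algebraMap_eq]
      rw [← mul_assoc, ← C_mul, inv_mul_cancel₀ hy, C_1, one_mul]
  exact DFunLike.congr_fun this p

lemma jet_chg (x y : ℂ) (p : MvPolynomial (Fin 3) ℂ) : jet 0 1 (chg x y p) = jet x y p := by
  have : (jet 0 1).comp (chg x y) = jet x y := by
    ext i : 1
    fin_cases i
    · simp [chg, jet]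
    · simp [chg, jet, add_comm]
    · simp [chg, jet]
  exact DFunLike.congr_fun this p

lemma eval_chg (x y : ℂ) (w : Fin 3 → ℂ) (p : MvPolynomial (Fin 3) ℂ) :
    eval w (chg x y p) = eval ![w 0, w 1 + x * w 0, y * w 2] p := by
  have : (aeval w).comp (chg x y) = (aeval (![w 0, w 1 + x * w 0, y * w 2] : Fin 3 → ℂ)) := by
    ext i : 1
    fin_cases i <;> simp [chg]
  have := DFunLike.congr_fun this p
  simpa [coe_aeval_eq_eval] using this

lemma l1_chg_le (x y : ℂ) {c : ℝ} (hc : 1 ≤ c) (hx : ‖x‖ + 1 ≤ c) (hy : ‖y‖ ≤ c)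
    {p : MvPolynomial (Fin 3) ℂ} {n : ℕ} (hp : p.IsHomogeneous n) :
    l1 (chg x y p) ≤ l1 p * c ^ n := by
  have hX : ∀ i, l1 (X i) ≤ 1 := fun i => by
    have := l1_monomial (Finsupp.single i 1) 1
    rw [norm_one] at this; exact this.le
  have hCX : ∀ (a : ℂ) i, l1 (C a * X i) ≤ ‖a‖ := fun a i => by
    rw [← smul_eq_C_mul]
    exact (l1_smul_le _ _).trans (mul_le_of_le_one_right (norm_nonneg _) (hX i))
  refine aeval_le_l1_mul l1 l1_nonneg l1_add_le l1_smul_le l1_mul_le l1_one_le ?_ hp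
  intro i
  fin_cases i
  · exact (hX 0).trans hc
  · exact (l1_add_le _ _).trans (by linarith [hX 1, hCX x 0])
  · exact (hCX y 2).trans hy

lemma coeff_jet_monomial (m : Fin 3 →₀ ℕ) (i : ℕ) :
    PowerSeries.coeff i (jet 0 1 (monomial m 1)) = expCoeff (m 1) (m 2) i := by
  rw [jet, aeval_monomial, Finsupp.prod_fintype _ _ (by simp), Fin.prod_univ_three]
  simp only [map_one, Matrix.cons_val_zero, one_pow, one_mul, Matrix.cons_val_one, map_zero,
    zero_add, Matrix.cons_val_two, Matrix.tail_cons, Matrix.head_cons]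
  rw [PowerSeries.coeff_X_pow_mul', PowerSeries.exp_pow_eq_rescale_exp, expCoeff]
  split_ifs
  · rw [PowerSeries.coeff_rescale, PowerSeries.coeff_exp]; simp; rfl
  · rfl

/-- The exponent `(L - k - j, k, j)`. -/
noncomputable def expo (L k j : ℕ) : Fin 3 →₀ ℕ := Finsupp.equivFunOnFinite.symm ![L - k - j, k, j]

lemma expo_degree {L k j : ℕ} (h : k + j ≤ L) : (expo L k j).degree = L := by
  simp [Finsupp.degree_eq_sum, Fin.sum_univ_three, expo]; omega

/-- Forms dual to the first `T` jet functionals. -/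
lemma exists_dual_forms {a b T L : ℕ} (ha : 1 ≤ a) (hT : T ≤ a * b) (hL : a + b ≤ L) {M : ℝ}
    (hM : 3 ≤ M) (hMab : (a * b : ℝ) + 2 ≤ M) :
    ∃ F : ℕ → MvPolynomial (Fin 3) ℂ, (∀ l, (F l).IsHomogeneous L) ∧
      (∀ l < T, ∀ i < T, PowerSeries.coeff i (jet 0 1 (F l)) = if i = l then 1 else 0) ∧
      ∀ l, l1 (F l) ≤ M ^ (8 * (a * b) + 1) := by
  have key : ∀ l, ∃ F : MvPolynomial (Fin 3) ℂ, F.IsHomogeneous L ∧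
      (l < T → ∀ i < T, PowerSeries.coeff i (jet 0 1 F) = if i = l then 1 else 0) ∧
      l1 F ≤ M ^ (8 * (a * b) + 1) := fun l => by
    by_cases hl : l < T
    swap
    · exact ⟨0, isHomogeneous_zero _ _ _, fun h => absurd h hl, by rw [l1_zero]; positivity⟩
    obtain ⟨f, hf, hf2⟩ := exists_hermite_dual ha hT hM hMab hl
    refine ⟨∑ k, ∑ j, f k j • monomial (expo L k j) 1, ?_, fun _ i hi => ?_, ?_⟩
    · refine IsHomogeneous.sum _ _ _ fun k _ => IsHomogeneous.sum _ _ _ fun j _ => ?_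
      rw [smul_monomial]
      exact isHomogeneous_monomial _ (expo_degree (by omega))
    · rw [← hf2 i hi]
      simp only [map_sum, map_smul, smul_eq_mul, coeff_jet_monomial]
      simp [expo]
    · refine (l1_sum_le _ _).trans ((Finset.sum_le_sum fun k _ => (l1_sum_le _ _).trans
        (Finset.sum_le_sum (g := fun _ => M ^ (8 * (a * b))) fun j _ => ?_)).trans ?_)
      · rw [smul_monomial, l1_monomial]; simpa using hf k j
      · simp only [Finset.sum_const, Finset.card_univ, Fintype.card_fin, nsmul_eq_mul]
        rw [pow_succ, mul_comm (M ^ _), ← mul_assoc]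
        gcongr
        linarith
  choose F h1 h2 h3 using key
  exact ⟨F, h1, fun l hl => h2 l hl, h3⟩

end Chg

section Prox

/-- A truncated measure of the distance from the projective point `z` to the curve
`(1 : x + t : y exp t)` near `t = 0`, to the order `T`. -/
noncomputable def prox (x y : ℂ) (T : ℕ) (ε : ℝ) (z : Fin 3 → ℂ) : ℝ :=
  open Classical in
  if z 0 = 0 then 1 else min 1 (4 * max ε (max (‖z 1 / z 0 - x‖ ^ T)
    ‖z 2 / (y * z 0) - Complex.exp (z 1 / z 0 - x)‖))

lemma prox_le_one (x y : ℂ) (T : ℕ) (ε : ℝ) (z : Fin 3 → ℂ) : prox x y T ε z ≤ 1 := by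
  unfold prox; split_ifs
  · exact le_rfl
  · exact min_le_left _ _

lemma le_prox (x y : ℂ) (T : ℕ) {ε : ℝ} (hε1 : ε ≤ 1) (hε : 0 ≤ ε) (z : Fin 3 → ℂ) :
    ε ≤ prox x y T ε z := by
  unfold prox; split_ifs
  · exact hε1
  · refine le_min hε1 ?_
    have := le_max_left ε (max (‖z 1 / z 0 - x‖ ^ T)
      ‖z 2 / (y * z 0) - Complex.exp (z 1 / z 0 - x)‖)
    linarith

lemma exists_norm_apply_eq (w : Fin 3 → ℂ) : ∃ i, ‖w i‖ = ‖w‖ := by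
  obtain ⟨i, -, hi⟩ := Finset.exists_mem_eq_sup (Finset.univ : Finset (Fin 3))
    Finset.univ_nonempty (fun i => ‖w i‖₊)
  exact ⟨i, by rw [Pi.norm_def, hi]; rfl⟩

lemma eval_smul_of_isHomogeneous {R : Type*} [CommRing R] {p : MvPolynomial (Fin 3) R} {n : ℕ}
    (hp : p.IsHomogeneous n) (c : R) (w : Fin 3 → R) : eval (c • w) p = c ^ n * eval w p := by
  rw [eval_eq, eval_eq, Finset.mul_sum]
  refine Finset.sum_congr rfl fun m hm => ?_
  have : n = m.degree := hp.degree_eq_sum_deg_support hm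
  simp only [Pi.smul_apply, smul_eq_mul, mul_pow, Finset.prod_mul_distrib, Finset.prod_pow_eq_pow_sum]
  rw [this, Finsupp.degree_apply]; ring

lemma sum_expCoeff_mul_pow (k j T : ℕ) (t : ℂ) : ∑ l ∈ Finset.range T, expCoeff k j l * t ^ l
    = t ^ k * ∑ i ∈ Finset.range (T - k), (j * t) ^ i / i.factorial := by
  rcases le_total T k with h | h
  · rw [Nat.sub_eq_zero_of_le h, Finset.sum_range_zero, mul_zero]
    refine Finset.sum_eq_zero fun l hl => ?_
    rw [expCoeff]
    split_ifs with h'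
    · have := Finset.mem_range.1 hl
      have h0 : l = k := by omega
      omega
    · rw [zero_mul]
  · obtain ⟨n, rfl⟩ := Nat.exists_eq_add_of_le h
    rw [Nat.add_sub_cancel_left, Finset.sum_range_add, Finset.mul_sum]
    rw [Finset.sum_eq_zero, zero_add]
    · refine Finset.sum_congr rfl fun i _ => ?_
      rw [expCoeff, if_pos (by omega), Nat.add_sub_cancel_left, pow_add, mul_pow]; ring
    · intro l hl
      rw [expCoeff, if_neg (by have := Finset.mem_range.1 hl; omega), zero_mul]

lemma norm_pow_sub_pow_le (u v : ℂ) (hu : ‖u‖ ≤ 4) (hv : ‖v‖ ≤ 4) (j : ℕ) :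
    ‖u ^ j - v ^ j‖ ≤ j * 4 ^ j * ‖u - v‖ := by
  induction j with
  | zero => simp
  | succ j ih =>
    have h : u ^ (j + 1) - v ^ (j + 1) = u * (u ^ j - v ^ j) + (u - v) * v ^ j := by ring
    rw [h]
    refine (norm_add_le _ _).trans ?_
    rw [norm_mul, norm_mul, norm_pow]
    have h1 : ‖u‖ * ‖u ^ j - v ^ j‖ ≤ 4 * (j * 4 ^ j * ‖u - v‖) := by gcongr
    have h2 : ‖u - v‖ * ‖v‖ ^ j ≤ ‖u - v‖ * 4 ^ j := by gcongr
    have h3 : 0 ≤ ‖u - v‖ * 4 ^ j := by positivity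
    push_cast
    rw [pow_succ]
    nlinarith

lemma norm_monomial_sub_le {t Y : ℂ} {M : ℝ} {k j E T : ℕ} (ht : ‖t‖ ≤ 1)
    (hs : ‖Y - Complex.exp t‖ ≤ 1) (hE : k + j ≤ E) (hM : 4 ≤ M) (hME : (E : ℝ) ≤ M) :
    ‖t ^ k * Y ^ j - ∑ l ∈ Finset.range T, expCoeff k j l * t ^ l‖
      ≤ M ^ (T + E + 1) * (‖t‖ ^ T + ‖Y - Complex.exp t‖) := by
  have hM1 : 1 ≤ M := by linarith
  have he : ‖Complex.exp t‖ ≤ 3 := by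
    rw [Complex.norm_exp]
    have h1 : t.re ≤ 1 := (Complex.re_le_norm t).trans ht
    have := Real.exp_le_exp.2 h1
    linarith [Real.exp_one_lt_d9]
  have hY : ‖Y‖ ≤ 4 := by
    have := norm_add_le (Y - Complex.exp t) (Complex.exp t)
    rw [sub_add_cancel] at this
    linarith
  have hjE : (j : ℝ) ≤ M := le_trans (by exact_mod_cast (by omega : j ≤ E)) hME
  rw [sum_expCoeff_mul_pow]
  have h1 : t ^ k * Y ^ j - t ^ k * ∑ i ∈ Finset.range (T - k), (j * t) ^ i / i.factorial
      = t ^ k * (Y ^ j - Complex.exp t ^ j) + t ^ k * (Complex.exp (j * t)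
        - ∑ i ∈ Finset.range (T - k), (j * t) ^ i / i.factorial) := by
    rw [Complex.exp_nat_mul]; ring
  rw [h1]
  have h2 : ‖t ^ k * (Y ^ j - Complex.exp t ^ j)‖ ≤ M ^ (T + E + 1) * ‖Y - Complex.exp t‖ := by
    rw [norm_mul, norm_pow]
    calc ‖t‖ ^ k * ‖Y ^ j - Complex.exp t ^ j‖
        ≤ 1 * (j * 4 ^ j * ‖Y - Complex.exp t‖) := by
          gcongr
          · exact pow_le_one₀ (norm_nonneg _) ht
          · exact norm_pow_sub_pow_le _ _ hY (by linarith) j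
      _ ≤ M * M ^ j * ‖Y - Complex.exp t‖ := by rw [one_mul]; gcongr
      _ ≤ _ := by
          rw [← pow_succ']
          gcongr ?_ * _
          exact pow_le_pow_right₀ hM1 (by omega)
  have h3 : ‖t ^ k * (Complex.exp (j * t) - ∑ i ∈ Finset.range (T - k), (j * t) ^ i / i.factorial)‖
      ≤ M ^ (T + E + 1) * ‖t‖ ^ T := by
    rw [norm_mul, norm_pow]
    have h4 := Complex.norm_exp_sub_sum_le_norm_mul_exp (j * t) (T - k)
    have h5 : ‖(j : ℂ) * t‖ = j * ‖t‖ := by simp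
    rw [h5] at h4
    calc ‖t‖ ^ k * _ ≤ ‖t‖ ^ k * ((j * ‖t‖) ^ (T - k) * Real.exp (j * ‖t‖)) := by gcongr
      _ ≤ ‖t‖ ^ k * ((j * ‖t‖) ^ (T - k) * M ^ j) := by
          gcongr
          calc Real.exp (j * ‖t‖) ≤ Real.exp (j * 1) := by gcongr
            _ = Real.exp 1 ^ j := by rw [Real.exp_nat_mul]
            _ ≤ M ^ j := by gcongr; linarith [Real.exp_one_lt_d9]
      _ = (j : ℝ) ^ (T - k) * M ^ j * ‖t‖ ^ (k + (T - k)) := by rw [mul_pow, pow_add]; ring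
      _ ≤ M ^ (T - k) * M ^ j * ‖t‖ ^ T := by
          gcongr ?_ * _ * ?_
          · exact pow_le_pow_left₀ (by positivity) hjE _
          · exact pow_le_pow_of_le_one (norm_nonneg _) ht (by omega)
      _ ≤ _ := by
          rw [← pow_add]
          gcongr ?_ * _
          exact pow_le_pow_right₀ hM1 (by omega)
  refine (norm_add_le _ _).trans ?_
  rw [mul_add]; linarith

/-- A form with a small jet is small near the curve. -/
theorem norm_eval_le_prox {x y : ℂ} (hy : y ≠ 0) {c M ε : ℝ} (hc : 1 ≤ c) (hx : ‖x‖ + 1 ≤ c)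
    (hyc : ‖y‖ ≤ c) {T E : ℕ} (hM : 4 ≤ M) (hME : (E : ℝ) ≤ M) {p : MvPolynomial (Fin 3) ℂ}
    (hp : p.IsHomogeneous E) (hj : tnorm T (jet x y p) ≤ ε) (z : Fin 3 → ℂ) :
    ‖eval z p‖ ≤ (1 + l1 p * c ^ E) * M ^ (T + E + 1) * ‖z‖ ^ E * prox x y T ε z := by
  have hM1 : 1 ≤ M := by linarith
  have hl1 := l1_nonneg p
  have hε : 0 ≤ ε := (tnorm_nonneg _ _).trans hj
  have hMpow : 1 ≤ M ^ (T + E + 1) := one_le_pow₀ hM1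
  by_cases h1 : prox x y T ε z = 1
  · rw [h1, mul_one]
    refine (norm_eval_le_l1 hp (norm_le_pi_norm z)).trans ?_
    gcongr
    have : 1 ≤ c ^ E := one_le_pow₀ hc
    nlinarith [mul_nonneg hl1 (sub_nonneg.2 this)]
  have hz0 : z 0 ≠ 0 := fun h => h1 (by rw [prox, if_pos h])
  rw [prox, if_neg hz0] at h1 ⊢
  set t := z 1 / z 0 - x with ht
  set Y := z 2 / (y * z 0) with hY
  set m := max ε (max (‖t‖ ^ T) ‖Y - Complex.exp t‖) with hm
  have hlt : 4 * m < 1 := by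
    by_contra h
    exact h1 (min_eq_left (not_lt.1 h))
  rw [min_eq_right hlt.le]
  have hm1 : ε ≤ m := le_max_left _ _
  have hm2 : ‖t‖ ^ T ≤ m := (le_max_left _ _).trans (le_max_right _ _)
  have hm3 : ‖Y - Complex.exp t‖ ≤ m := (le_max_right _ _).trans (le_max_right _ _)
  have ht1 : ‖t‖ ≤ 1 := by
    by_contra h
    have : 1 ≤ ‖t‖ ^ T := one_le_pow₀ (not_le.1 h).le
    linarith
  have hE : eval z p = z 0 ^ E * eval ![1, t, Y] (chg x y p) := by
    rw [eval_chg, ← eval_smul_of_isHomogeneous hp]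
    congr 2
    ext i
    fin_cases i
    · simp
    · simp [ht]; field_simp
    · simp [hY]; field_simp
  have hh := chg_isHomogeneous x y hp
  have hsum : eval ![1, t, Y] (chg x y p) - ∑ l ∈ Finset.range T,
      PowerSeries.coeff l (jet x y p) * t ^ l = ∑ n ∈ (chg x y p).support, coeff n (chg x y p) *
        (t ^ n 1 * Y ^ n 2 - ∑ l ∈ Finset.range T, expCoeff (n 1) (n 2) l * t ^ l) := by
    have hco : ∀ l, PowerSeries.coeff l (jet x y p) = ∑ n ∈ (chg x y p).support,
        coeff n (chg x y p) * expCoeff (n 1) (n 2) l := fun l => by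
      rw [← jet_chg]
      conv_lhs => rw [(chg x y p).as_sum, map_sum, map_sum]
      refine Finset.sum_congr rfl fun n _ => ?_
      rw [← mul_one (coeff n (chg x y p)), ← smul_eq_mul, ← smul_monomial, map_smul, map_smul,
        coeff_jet_monomial, smul_eq_mul, smul_eq_mul, mul_one]
    rw [eval_eq']
    simp_rw [hco, Finset.sum_mul, mul_sub, Finset.sum_sub_distrib]
    rw [Finset.sum_comm]
    congr 1
    · refine Finset.sum_congr rfl fun n _ => ?_
      rw [Fin.prod_univ_three]; simp
    · refine Finset.sum_congr rfl fun n _ => ?_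
      rw [Finset.mul_sum]
      exact Finset.sum_congr rfl fun l _ => by ring
  have hA : ‖∑ l ∈ Finset.range T, PowerSeries.coeff l (jet x y p) * t ^ l‖ ≤ m := by
    refine (norm_sum_le_of_le _ fun l _ => ?_).trans (hj.trans hm1)
    rw [norm_mul, norm_pow]
    exact mul_le_of_le_one_right (norm_nonneg _) (pow_le_one₀ (norm_nonneg _) ht1)
  have hB : ‖∑ n ∈ (chg x y p).support, coeff n (chg x y p) *
        (t ^ n 1 * Y ^ n 2 - ∑ l ∈ Finset.range T, expCoeff (n 1) (n 2) l * t ^ l)‖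
      ≤ l1 (chg x y p) * (M ^ (T + E + 1) * (2 * m)) := by
    rw [l1, Finset.sum_mul]
    refine norm_sum_le_of_le _ fun n hn => ?_
    rw [norm_mul]
    gcongr
    have hd : E = n.degree := hh.degree_eq_sum_deg_support hn
    rw [Finsupp.degree_eq_sum, Fin.sum_univ_three] at hd
    refine (norm_monomial_sub_le ht1 (by linarith) (by omega : n 1 + n 2 ≤ E) hM hME).trans ?_
    gcongr
    linarith
  have hl := l1_chg_le x y hc hx hyc hp
  have hm0 : 0 ≤ m := hε.trans hm1
  have hC : ‖eval ![1, t, Y] (chg x y p)‖ ≤ (1 + l1 p * c ^ E) * M ^ (T + E + 1) * (4 * m) := by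
    rw [sub_eq_iff_eq_add] at hsum
    rw [hsum]
    refine (norm_add_le _ _).trans ((add_le_add hB hA).trans ?_)
    have h5 : l1 (chg x y p) * (M ^ (T + E + 1) * (2 * m))
        ≤ (l1 p * c ^ E) * (M ^ (T + E + 1) * (2 * m)) := by gcongr
    have h6 : 0 ≤ (l1 p * c ^ E) * (M ^ (T + E + 1) * (2 * m)) := by positivity
    nlinarith [mul_nonneg hm0 (sub_nonneg.2 hMpow)]
  rw [hE, norm_mul, norm_pow]
  have h0 := norm_le_pi_norm z 0
  calc ‖z 0‖ ^ E * _ ≤ ‖z‖ ^ E * ((1 + l1 p * c ^ E) * M ^ (T + E + 1) * (4 * m)) := by gcongr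
    _ = _ := by ring

end Prox

section Probe

lemma norm_expCoeff_le {k j l T : ℕ} {M : ℝ} (hM : 1 ≤ M) (hj : (j : ℝ) ≤ M)
    (hl : l < T) :
    ‖expCoeff k j l‖ ≤ M ^ T := by
  unfold expCoeff
  split_ifs
  · rw [norm_div, norm_pow, Complex.norm_natCast, Complex.norm_natCast]
    refine (div_le_self (by positivity) (by exact_mod_cast Nat.factorial_pos _)).trans ?_
    exact (pow_le_pow_left₀ (by positivity) hj _).trans (pow_le_pow_right₀ hM (by omega))
  · rw [norm_zero]; positivity

/-- Forms of degree `D` with small jets which do not all become small away from the curve. -/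
theorem exists_probe_family {x y : ℂ} (hy : y ≠ 0) {a b T D : ℕ} (ha : 1 ≤ a) (hb : 1 ≤ b)
    (hT : T ≤ a * b) (hD : a + b ≤ D) {c M ε : ℝ} (hc : 1 ≤ c) (hx : ‖x‖ + 1 ≤ c) (hyc : ‖y‖ ≤ c)
    (hyc2 : ‖y⁻¹‖ ≤ c) (hM : 3 ≤ M) (hMab : (a * b : ℝ) + 2 ≤ M) (hMD : (D : ℝ) ≤ M) (hε : 0 < ε)
    (hε1 : ε ≤ 1) :
    ∃ R : Option (Mon D) → MvPolynomial (Fin 3) ℂ, (∀ o, (R o).IsHomogeneous D) ∧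
      (∀ o, tnorm T (jet x y (R o)) ≤ ε) ∧
      (∀ o, l1 (R o) ≤ c ^ D * M ^ (8 * (a * b) + T + 3)) ∧
      ∀ z, ∃ o, ‖z‖ ^ D * prox x y T ε z
        ≤ 4 * (2 * c) ^ D * M ^ (8 * (a * b) + 3 * T + D + 6) * ‖eval z (R o)‖ := by
  classical
  have hM1 : 1 ≤ M := by linarith
  have hTM : (T : ℝ) ≤ M := by
    have : (T : ℝ) ≤ a * b := by exact_mod_cast hT
    linarith
  obtain ⟨F, hF1, hF2, hF3⟩ := exists_dual_forms ha hT hD hM hMab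
  let R0 : Option (Mon D) → MvPolynomial (Fin 3) ℂ := fun o => o.elim (C (ε : ℂ) * X 0 ^ D)
    fun m => monomial (m : Fin 3 →₀ ℕ) 1 - ∑ l ∈ Finset.range T,
      expCoeff ((m : Fin 3 →₀ ℕ) 1) ((m : Fin 3 →₀ ℕ) 2) l • F l
  have hXD : (X 0 ^ D : MvPolynomial (Fin 3) ℂ) = monomial (Finsupp.single 0 D) 1 := by
    rw [X_pow_eq_monomial]
  have hR0h : ∀ o, (R0 o).IsHomogeneous D := by
    rintro (_ | m)
    · exact (isHomogeneous_X_pow 0 D).C_mul _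
    · refine (isHomogeneous_monomial _ m.degree_eq).sub (IsHomogeneous.sum _ _ _ fun l _ => ?_)
      rw [smul_eq_C_mul]
      exact (hF1 l).C_mul _
  have hR0j : ∀ o, tnorm T (jet 0 1 (R0 o)) ≤ ε := by
    rintro (_ | m)
    · have : jet 0 1 (R0 none) = PowerSeries.C (ε : ℂ) * 1 := by
        simp only [R0, Option.elim_none, map_mul, map_pow]
        rw [← algebraMap_eq, AlgHom.commutes]
        simp [jet]
      rw [this, tnorm_C_mul]
      have := tnorm_one_le T
      rw [Complex.norm_real, Real.norm_of_nonneg hε.le]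
      nlinarith
    · refine le_trans (le_of_eq ?_) hε.le
      refine Finset.sum_eq_zero fun i hi => ?_
      rw [norm_eq_zero]
      simp only [R0, Option.elim_some, map_sub, map_sum, map_smul, smul_eq_mul, coeff_jet_monomial]
      rw [Finset.sum_congr rfl fun l hl => by
        rw [hF2 l (Finset.mem_range.1 hl) i (Finset.mem_range.1 hi)]]
      simp [Finset.mem_range.1 hi]
  have hMonD : ∀ m : Mon D, D = (m : Fin 3 →₀ ℕ) 0 + (m : Fin 3 →₀ ℕ) 1 + (m : Fin 3 →₀ ℕ) 2 :=
    fun m => by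
      have := m.degree_eq
      rw [Finsupp.degree_eq_sum, Fin.sum_univ_three] at this
      exact this.symm
  have hR0l : ∀ o, l1 (R0 o) ≤ M ^ (8 * (a * b) + T + 3) := by
    rintro (_ | m)
    · have h1 : l1 (R0 none) ≤ 1 := by
        change l1 (C (ε : ℂ) * X 0 ^ D) ≤ 1
        rw [hXD, C_mul_monomial, l1_monomial, mul_one, Complex.norm_real, Real.norm_of_nonneg hε.le]
        exact hε1
      exact h1.trans (one_le_pow₀ hM1)
    · refine (l1_sub_le _ _).trans ?_
      rw [l1_monomial, norm_one]
      have hj : (((m : Fin 3 →₀ ℕ) 2 : ℕ) : ℝ) ≤ M :=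
        le_trans (by exact_mod_cast (by have := hMonD m; omega)) hMD
      have h1 : l1 (∑ l ∈ Finset.range T,
          expCoeff ((m : Fin 3 →₀ ℕ) 1) ((m : Fin 3 →₀ ℕ) 2) l • F l)
          ≤ M * (M ^ T * M ^ (8 * (a * b) + 1)) := by
        refine (l1_sum_le _ _).trans ((Finset.sum_le_sum (g := fun _ => M ^ T *
          M ^ (8 * (a * b) + 1)) fun l hl => ?_).trans ?_)
        · refine (l1_smul_le _ _).trans ?_
          exact mul_le_mul (norm_expCoeff_le hM1 hj (Finset.mem_range.1 hl)) (hF3 l) (l1_nonneg _)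
            (by positivity)
        · rw [Finset.sum_const, Finset.card_range, nsmul_eq_mul]
          gcongr
      have h2 : M * (M ^ T * M ^ (8 * (a * b) + 1)) = M ^ (8 * (a * b) + T + 2) := by ring
      rw [h2] at h1
      have h3 : M ^ (8 * (a * b) + T + 3) = M * M ^ (8 * (a * b) + T + 2) := by ring
      have h4 : 1 ≤ M ^ (8 * (a * b) + T + 2) := one_le_pow₀ hM1
      nlinarith
  refine ⟨fun o => chg (-x) y⁻¹ (R0 o), fun o => chg_isHomogeneous _ _ (hR0h o), fun o => ?_,
    fun o => ?_, fun z => ?_⟩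
  · rw [← jet_chg, chg_chg x y hy]; exact hR0j o
  · refine (l1_chg_le (-x) y⁻¹ hc (by rwa [norm_neg]) hyc2 (hR0h o)).trans ?_
    rw [mul_comm]
    gcongr
    exact hR0l o
  simp only [eval_chg]
  set w : Fin 3 → ℂ := ![z 0, z 1 + -x * z 0, y⁻¹ * z 2] with hw
  set K := M ^ (8 * (a * b) + 3 * T + D + 6) with hK
  have hK1 : 1 ≤ K := one_le_pow₀ hM1
  have hzw : ‖z‖ ≤ c * ‖w‖ := by
    have hw0 := norm_le_pi_norm w 0
    have hw1 := norm_le_pi_norm w 1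
    have hw2 := norm_le_pi_norm w 2
    rw [pi_norm_le_iff_of_nonneg (by positivity)]
    intro i
    fin_cases i
    · have : z 0 = w 0 := by simp [hw]
      simp only [Fin.zero_eta, this]
      nlinarith [norm_nonneg w]
    · have : z 1 = w 1 + x * w 0 := by simp [hw]
      simp only [Fin.mk_one, this]
      refine (norm_add_le _ _).trans ?_
      rw [norm_mul]
      calc ‖w 1‖ + ‖x‖ * ‖w 0‖ ≤ ‖w‖ + ‖x‖ * ‖w‖ := by gcongr
        _ = (‖x‖ + 1) * ‖w‖ := by ring
        _ ≤ _ := by gcongr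
    · have : z 2 = y * w 2 := by simp [hw, hy]
      simp only [Fin.reduceFinMk, this, norm_mul]
      gcongr
  rcases eq_or_ne w 0 with h0 | h0
  · refine ⟨none, ?_⟩
    have hz : ‖z‖ = 0 := le_antisymm (by simpa [h0] using hzw) (norm_nonneg _)
    have hD0 : D ≠ 0 := by omega
    rw [hz, zero_pow hD0, zero_mul]
    positivity
  have hW : 0 < ‖w‖ := norm_pos_iff.2 h0
  set W : ℂ := (‖w‖ : ℂ) with hWdef
  have hW0 : W ≠ 0 := by rw [hWdef]; exact_mod_cast hW.ne'
  have hWn : ‖W‖ = ‖w‖ := by rw [hWdef, Complex.norm_real, norm_norm]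
  set v : Fin 3 → ℂ := W⁻¹ • w with hv
  have hwv : w = W • v := by rw [hv, smul_smul, mul_inv_cancel₀ hW0, one_smul]
  have hvi : ∀ i, ‖v i‖ = ‖w i‖ / ‖w‖ := fun i => by
    rw [hv, Pi.smul_apply, smul_eq_mul, norm_mul, norm_inv, hWn, inv_mul_eq_div]
  obtain ⟨o, -, ho⟩ := Finset.exists_max_image (Finset.univ : Finset (Option (Mon D)))
    (fun o => ‖eval v (R0 o)‖) Finset.univ_nonempty
  set δ := ‖eval v (R0 o)‖ with hδ
  have ho' : ∀ o', ‖eval v (R0 o')‖ ≤ δ := fun o' => ho o' (Finset.mem_univ _)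
  let Cp : Polynomial ℂ := ∑ l ∈ Finset.range T,
    Polynomial.monomial l (eval v (F l) / l.factorial)
  have hkey := exp_curve_dichotomy (a := a) (b := b) (T := T) (D := D) (M := M) (w := v) (C := Cp)
    (δ := δ) ha hb hT hD hM hMab (fun i => by
      rw [hvi]; exact div_le_one_of_le₀ (norm_le_pi_norm w i) hW.le) (by
      obtain ⟨i, hi⟩ := exists_norm_apply_eq w
      exact ⟨i, by rw [hvi, hi, div_self hW.ne']⟩)
    (by
      refine (Polynomial.degree_sum_le _ _).trans_lt ((Finset.sup_lt_iff
        (WithBot.bot_lt_coe T)).2 fun l hl => ?_)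
      exact (Polynomial.degree_monomial_le _ _).trans_lt
        (Nat.cast_lt.2 (Finset.mem_range.1 hl))) (norm_nonneg _) (fun k j hkj => by
      have h1 := ho' (some ⟨expo D k j, mem_finsuppAntidiag_iff_degree.2 (expo_degree hkj)⟩)
      refine le_trans (le_of_eq ?_) h1
      rw [norm_sub_rev]
      congr 1
      simp only [R0, Option.elim_some, map_sub, map_sum, smul_eval, Cp, Polynomial.finsetSum_coeff]
      congr 1
      · rw [eval_monomial, Finsupp.prod_fintype _ _ (by simp), Fin.prod_univ_three]
        simp [expo]
      · rw [Finset.mul_sum]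
        refine Finset.sum_congr rfl fun l _ => ?_
        rw [coeff_taylor_monomial, choose_mul_pow_eq_expCoeff]
        have h2 : (l.factorial : ℂ) ≠ 0 := by exact_mod_cast Nat.factorial_ne_zero _
        have h3 : (k.factorial : ℂ) ≠ 0 := by exact_mod_cast Nat.factorial_ne_zero _
        simp only [expo, Finsupp.equivFunOnFinite_symm_apply_apply, Matrix.cons_val_one,
          Matrix.cons_val_zero, Matrix.cons_val]
        field_simp)
  refine ⟨o, ?_⟩
  have hev : ‖eval w (R0 o)‖ = ‖w‖ ^ D * δ := by
    rw [hwv, eval_smul_of_isHomogeneous (hR0h o), norm_mul, norm_pow, ← hwv, hWn]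
  have hδ0 : 0 ≤ δ := norm_nonneg _
  have h2D : (1 : ℝ) ≤ 2 ^ D := one_le_pow₀ (by norm_num)
  have hprox : prox x y T ε z ≤ 4 * 2 ^ D * K * δ := by
    rcases hkey with h | ⟨h1, h2, h3⟩
    · refine (prox_le_one _ _ _ _ _).trans (h.trans ?_)
      nlinarith [mul_nonneg (mul_nonneg (zero_le_one.trans hK1) hδ0) (sub_nonneg.2 h2D),
        mul_nonneg (zero_le_one.trans hK1) hδ0]
    · have hv0 : v 0 ≠ 0 := by rw [← norm_pos_iff]; linarith
      have hw0 : w 0 ≠ 0 := by rw [hwv, Pi.smul_apply, smul_eq_mul]; exact mul_ne_zero hW0 hv0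
      have hz0 : z 0 ≠ 0 := by simpa [hw] using hw0
      have hrat : ∀ i, v i / v 0 = w i / w 0 := fun i => by
        rw [hv, Pi.smul_apply, Pi.smul_apply, smul_eq_mul, smul_eq_mul,
          mul_div_mul_left _ _ (inv_ne_zero hW0)]
      rw [hrat, hrat] at h3
      rw [hrat] at h2
      have e1 : w 1 / w 0 = z 1 / z 0 - x := by
        simp only [hw, Matrix.cons_val_one, Matrix.cons_val_zero]; field_simp; ring
      have e2 : w 2 / w 0 = z 2 / (y * z 0) := by
        simp only [hw, Matrix.cons_val_zero, Matrix.cons_val]; field_simp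
      rw [e1] at h2
      rw [e1, e2] at h3
      have h4 : ε ≤ 2 ^ D * K * δ := by
        have h5 := ho' none
        simp only [R0, Option.elim_none, map_mul, map_pow, eval_C, eval_X, norm_mul, norm_pow,
          Complex.norm_real, Real.norm_of_nonneg hε.le] at h5
        have h6 : (1 / 2 : ℝ) ^ D ≤ ‖v 0‖ ^ D := pow_le_pow_left₀ (by norm_num) h1 D
        have h7 : ε = 2 ^ D * (ε * (1 / 2) ^ D) := by
          rw [mul_left_comm, ← mul_pow]; norm_num
        rw [h7, mul_assoc (2 ^ D) K]
        have h8 : ε * (1 / 2) ^ D ≤ δ := (mul_le_mul_of_nonneg_left h6 hε.le).trans h5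
        exact mul_le_mul_of_nonneg_left (h8.trans (le_mul_of_one_le_left hδ0 hK1)) (by positivity)
      have h9 : K * δ ≤ 2 ^ D * K * δ := by
        rw [mul_assoc]; exact le_mul_of_one_le_left (by positivity) h2D
      rw [prox, if_neg hz0]
      refine (min_le_right _ _).trans ?_
      have : max ε (max (‖z 1 / z 0 - x‖ ^ T) ‖z 2 / (y * z 0) - Complex.exp (z 1 / z 0 - x)‖)
          ≤ 2 ^ D * K * δ := max_le h4 (max_le (h2.trans h9) (h3.trans h9))
      linarith
  rw [hev]
  calc ‖z‖ ^ D * prox x y T ε z ≤ (c * ‖w‖) ^ D * (4 * 2 ^ D * K * δ) := by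
        have : 0 ≤ prox x y T ε z := hε.le.trans (le_prox x y T hε1 hε.le z)
        gcongr
    _ = _ := by rw [mul_pow, mul_pow]; ring

end Probe

section Factor

variable {R : Type*} [CommRing R] {ι : Type*}

lemma X_dvd_iff_forall {i : ι} {p : MvPolynomial ι R} :
    X i ∣ p ↔ ∀ m ∈ p.support, m i ≠ 0 := by
  classical
  rw [X_dvd_iff_modMonomial_eq_zero]
  have key : ∀ m : ι →₀ ℕ, Finsupp.single i 1 ≤ m ↔ m i ≠ 0 := fun m => by
    rw [Finsupp.single_le_iff, Nat.one_le_iff_ne_zero]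
  constructor
  · intro h m hm h0
    have := congrArg (coeff m) h
    rw [coeff_modMonomial_of_not_le _ (by rw [key]; simpa using h0), coeff_zero] at this
    exact (mem_support_iff.mp hm) this
  · intro h
    ext m
    by_cases hm : Finsupp.single i 1 ≤ m
    · rw [coeff_modMonomial_of_le _ hm, coeff_zero]
    · rw [coeff_modMonomial_of_not_le _ hm, coeff_zero]
      by_contra h0
      exact hm ((key m).mpr (h m (mem_support_iff.mpr h0)))

/-- The substitution `Xᵢ ↦ Xᵢ t`, which separates homogeneous components. -/
noncomputable def scaleVars (R ι : Type*) [CommRing R] :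
    MvPolynomial ι R →ₐ[R] Polynomial (MvPolynomial ι R) :=
  aeval fun i => Polynomial.C (X i) * Polynomial.X

lemma coeff_scaleVars (p : MvPolynomial ι R) (j : ℕ) :
    (scaleVars R ι p).coeff j = homogeneousComponent j p := by
  induction p using MvPolynomial.induction_on' with
  | monomial m a =>
    have h1 : scaleVars R ι (monomial m a) = Polynomial.C (monomial m a) * Polynomial.X ^ m.degree := by
      rw [scaleVars, aeval_monomial, monomial_eq, map_mul, Finsupp.prod, Finsupp.prod,
        Finsupp.degree_apply]
      simp only [mul_pow, Finset.prod_mul_distrib, Finset.prod_pow_eq_pow_sum, map_prod, map_pow,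
        mul_assoc]
      rfl
    rw [h1, Polynomial.coeff_C_mul_X_pow, homogeneousComponent_of_mem
      ((mem_homogeneousSubmodule _ _).mpr (isHomogeneous_monomial a rfl))]
  | add p q hp hq => rw [map_add, Polynomial.coeff_add, hp, hq, map_add]

lemma isHomogeneous_of_dvd [IsDomain R] {p q : MvPolynomial ι R} {d : ℕ} (hp : p.IsHomogeneous d)
    (h0 : p ≠ 0) (h : q ∣ p) : q.IsHomogeneous q.totalDegree := by
  obtain ⟨r, rfl⟩ := h
  have hq0 := left_ne_zero_of_mul h0
  have hr0 := right_ne_zero_of_mul h0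
  have hinj : ∀ f : MvPolynomial ι R, f ≠ 0 → scaleVars R ι f ≠ 0 := fun f hf h => hf <| by
    rw [← sum_homogeneousComponent f]
    refine Finset.sum_eq_zero fun j _ => ?_
    rw [← coeff_scaleVars, h, Polynomial.coeff_zero]
  have hsc : scaleVars R ι (q * r) = Polynomial.C (q * r) * Polynomial.X ^ d := by
    ext1 j
    rw [coeff_scaleVars, Polynomial.coeff_C_mul_X_pow,
      homogeneousComponent_of_mem ((mem_homogeneousSubmodule _ _).mpr hp)]
  have hd : (scaleVars R ι (q * r)).natDegree = d := by
    rw [hsc, Polynomial.natDegree_C_mul_X_pow _ _ h0]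
  have ht : (scaleVars R ι (q * r)).natTrailingDegree = d := by
    rw [hsc, Polynomial.C_mul_X_pow_eq_monomial, Polynomial.natTrailingDegree_monomial h0]
  rw [map_mul, Polynomial.natDegree_mul (hinj _ hq0) (hinj _ hr0)] at hd
  rw [map_mul, Polynomial.natTrailingDegree_mul (hinj _ hq0) (hinj _ hr0)] at ht
  have h1 := Polynomial.natTrailingDegree_le_natDegree (scaleVars R ι q)
  have h2 := Polynomial.natTrailingDegree_le_natDegree (scaleVars R ι r)
  set n := (scaleVars R ι q).natDegree with hn
  have h3 : ∀ j, j ≠ n → homogeneousComponent j q = 0 := fun j hj => by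
    rw [← coeff_scaleVars]
    rcases lt_or_gt_of_ne hj with h | h
    · exact Polynomial.coeff_eq_zero_of_lt_natTrailingDegree (by omega)
    · exact Polynomial.coeff_eq_zero_of_natDegree_lt (by omega)
  have h4 : q.IsHomogeneous n := by
    intro m hm
    by_contra hne
    have := congrArg (coeff m) (h3 m.degree fun h => hne <| by
      rw [← h, Finsupp.degree_eq_weight_one]; rfl)
    rw [coeff_homogeneousComponent, if_pos rfl] at this
    exact hm this
  rwa [h4.totalDegree hq0]

end Factor

section Derivation

variable {k : Type*} [Field k] [CharZero k]

lemma coeff_D3 (F : MvPolynomial (Fin 3) k) (m : Fin 3 →₀ ℕ) :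
    coeff m (D3 k F) = (if m 0 = 0 then 0 else
      coeff (m - Finsupp.single 0 1 + Finsupp.single 1 1) F * (m 1 + 1)) + m 2 * coeff m F := by
  classical
  rw [D3_apply, coeff_add, coeff_X_mul', coeff_X_mul', coeff_pderiv, coeff_pderiv]
  congr 1
  · simp only [Finsupp.mem_support_iff, ne_eq, ite_not]
    simp
  · by_cases h : m 2 = 0
    · simp [h]
    · have h1 : m - Finsupp.single 2 1 + Finsupp.single 2 1 = m :=
        tsub_add_cancel_of_le (by rw [Finsupp.single_le_iff]; omega)
      rw [if_pos (by simpa using h), h1]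
      have h2 : (((m - Finsupp.single 2 1 : Fin 3 →₀ ℕ) 2 : ℕ) : k) + 1 = m 2 := by
        rw [← Nat.cast_add_one]
        congr 1
        simp
        omega
      rw [h2, mul_comm]

lemma not_dvd_D3 {F : MvPolynomial (Fin 3) k} {n : ℕ} (hF : F.IsHomogeneous n) (hn : n ≠ 0)
    (h0 : ¬ X 0 ∣ F) (h2 : ¬ X 2 ∣ F) : ¬ F ∣ D3 k F := by
  classical
  rintro ⟨G, hG⟩
  have hF0 : F ≠ 0 := by rintro rfl; exact h0 (dvd_zero _)
  obtain ⟨c, hc⟩ : ∃ c : k, D3 k F = C c * F := by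
    rcases eq_or_ne G 0 with rfl | hG0
    · exact ⟨0, by simp [hG]⟩
    have h1 : (D3 k F).IsHomogeneous n := hF.D3
    have h3 : (D3 k F).totalDegree = n := h1.totalDegree (by rw [hG]; exact mul_ne_zero hF0 hG0)
    rw [hG, totalDegree_mul_of_isDomain hF0 hG0, hF.totalDegree hF0] at h3
    obtain hG1 := totalDegree_eq_zero_iff_eq_C.mp (show G.totalDegree = 0 by omega)
    exact ⟨coeff 0 G, by rw [hG, ← hG1, mul_comm]⟩
  have hco : ∀ m, (if m 0 = 0 then 0 else
      coeff (m - Finsupp.single 0 1 + Finsupp.single 1 1) F * ((m 1 : k) + 1)) + m 2 * coeff m F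
      = c * coeff m F := fun m => by rw [← coeff_D3, hc, coeff_C_mul]
  rw [X_dvd_iff_forall] at h0 h2
  push Not at h0 h2
  obtain ⟨m, hm, hm0⟩ := h0
  have hc0 : c = 0 := by
    obtain ⟨m', hm', hmin⟩ := Finset.exists_min_image (F.support.filter fun m => m 2 = 0)
      (fun m => m 0) (by obtain ⟨m', h, h'⟩ := h2; exact ⟨m', by simp [h'] ; simpa using h⟩)
    rw [Finset.mem_filter] at hm'
    have h := hco m'
    have hz : (if m' 0 = 0 then 0 else
      coeff (m' - Finsupp.single 0 1 + Finsupp.single 1 1) F * ((m' 1 : k) + 1)) = 0 := by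
      split_ifs with h1
      · rfl
      · have : coeff (m' - Finsupp.single 0 1 + Finsupp.single 1 1) F = 0 := by
          by_contra hne
          have := hmin (m' - Finsupp.single 0 1 + Finsupp.single 1 1)
            (by rw [Finset.mem_filter, mem_support_iff]; exact ⟨hne, by simp [hm'.2]⟩)
          simp at this
          omega
        rw [this, zero_mul]
    rw [hz, hm'.2, Nat.cast_zero, zero_mul, zero_add] at h
    exact (mul_eq_zero.mp h.symm).resolve_right (mem_support_iff.mp hm'.1)
  have hm2 : m 2 = 0 := by
    have h := hco m
    rw [if_pos hm0, hc0, zero_mul, zero_add] at h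
    exact_mod_cast (mul_eq_zero.mp h).resolve_right (mem_support_iff.mp hm)
  have hm1 : m 1 = n := by
    have : n = m.degree := by
      rw [Finsupp.degree_eq_weight_one]; exact (hF (mem_support_iff.mp hm)).symm
    rw [Finsupp.degree_eq_sum, Fin.sum_univ_three] at this
    omega
  have h := hco (m - Finsupp.single 1 1 + Finsupp.single 0 1)
  have e1 : m - Finsupp.single 1 1 + Finsupp.single 0 1 - Finsupp.single 0 1 + Finsupp.single 1 1
      = m := by
    rw [add_tsub_cancel_right, tsub_add_cancel_of_le (by rw [Finsupp.single_le_iff]; omega)]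
  rw [if_neg (by simp), e1, hc0, zero_mul] at h
  have e2 : (m - Finsupp.single 1 1 + Finsupp.single 0 1 : Fin 3 →₀ ℕ) 2 = 0 := by simp [hm2]
  rw [e2, Nat.cast_zero, zero_mul, add_zero] at h
  exact mem_support_iff.mp hm ((mul_eq_zero.mp h).resolve_right (Nat.cast_add_one_ne_zero _))

/-- Applying a derivation `m` times to `F ^ m * G` lowers the order along `F` to zero. -/
lemma not_dvd_iterate_derivation {A : Type*} [CommRing A] [Algebra k A] (δ : Derivation k A A)
    {F : A} (hF : Prime F) (hδ : ¬ F ∣ δ F) (m : ℕ) :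
    ∀ G, ¬ F ∣ G → ¬ F ∣ (δ^[m]) (F ^ m * G) := by
  induction m with
  | zero => intro G hG; simpa using hG
  | succ m ih =>
    intro G hG
    rw [Function.iterate_succ_apply]
    have h1 : δ (F ^ (m + 1) * G) = F ^ m * (((m + 1 : ℕ) : k) • (δ F * G) + F * δ G) := by
      rw [Derivation.leibniz, Derivation.leibniz_pow, Nat.cast_smul_eq_nsmul]
      simp only [smul_eq_mul, nsmul_eq_mul, add_tsub_cancel_right]
      push_cast
      ring
    rw [h1]
    apply ih
    intro h
    have h2 : F ∣ ((m + 1 : ℕ) : k) • (δ F * G) := (dvd_add_left (dvd_mul_right _ _)).mp h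
    have h3 : F ∣ δ F * G := by
      have := h2.mul_left (algebraMap k A ((m + 1 : ℕ) : k)⁻¹)
      rwa [← Algebra.smul_def, smul_smul, inv_mul_cancel₀ (Nat.cast_ne_zero.mpr (by omega)),
        one_smul] at this
    rcases hF.dvd_or_dvd h3 with h | h
    · exact hδ h
    · exact hG h

/-- If a polynomial in `u` with coefficients `c 0, …, c d`, not all divisible by the prime `F`,
then only `d` values of `u` make it divisible by `F`. -/
lemma card_filter_dvd_le {A : Type*} [CommRing A] [IsDomain A] [Algebra k A] {F : A} (hF : Prime F)
    (c : ℕ → A) (d : ℕ) (hc : ∃ i ≤ d, ¬ F ∣ c i) (N : ℕ) [DecidablePred fun u : ℕ =>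
      F ∣ ∑ i ∈ Finset.range (d + 1), (u : A) ^ i * c i] :
    ((Finset.range N).filter fun u : ℕ =>
      F ∣ ∑ i ∈ Finset.range (d + 1), (u : A) ^ i * c i).card ≤ d := by
  classical
  have : (Ideal.span {F}).IsPrime := (Ideal.span_singleton_prime hF.ne_zero).mpr hF
  let B := A ⧸ Ideal.span {F}
  let π : A →+* B := Ideal.Quotient.mk _
  have : CharZero B := charZero_of_injective_algebraMap (algebraMap k B).injective
  let g : Polynomial B := ∑ i ∈ Finset.range (d + 1), Polynomial.monomial i (π (c i))
  have hπ : ∀ a, π a = 0 ↔ F ∣ a := fun a => by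
    rw [Ideal.Quotient.eq_zero_iff_mem, Ideal.mem_span_singleton]
  have hg0 : g ≠ 0 := by
    obtain ⟨i, hi, hci⟩ := hc
    intro h
    have := congrArg (Polynomial.coeff · i) h
    simp only [g, Polynomial.finsetSum_coeff, Polynomial.coeff_monomial, Polynomial.coeff_zero] at this
    rw [Finset.sum_ite_eq' , if_pos (Finset.mem_range.mpr (by omega))] at this
    exact hci ((hπ _).mp this)
  have hgd : g.natDegree ≤ d := by
    refine Polynomial.natDegree_sum_le_of_forall_le _ _ fun i hi => ?_
    exact (Polynomial.natDegree_monomial_le _).trans (by have := Finset.mem_range.mp hi; omega)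
  have hev : ∀ u : ℕ, g.eval (u : B) = π (∑ i ∈ Finset.range (d + 1), (u : A) ^ i * c i) := by
    intro u
    simp only [g, Polynomial.eval_finsetSum, Polynomial.eval_monomial, map_sum, map_mul, map_pow,
      map_natCast, mul_comm]
  refine le_trans ?_ ((Polynomial.card_roots' g).trans hgd)
  refine le_trans ?_ (Multiset.toFinset_card_le _)
  refine Finset.card_le_card_of_injOn (fun u : ℕ => (u : B)) ?_ (Nat.cast_injective.injOn)
  intro u hu
  simp only [Finset.coe_filter, Set.mem_ofPred_eq] at hu
  simp only [Finset.mem_coe, Multiset.mem_toFinset]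
  rw [Polynomial.mem_roots hg0, Polynomial.IsRoot, hev, hπ]
  exact hu.2

/-- A suitable combination of the derivatives of a form is prime to it. -/
theorem exists_isRelPrime_sum_D3 {p : MvPolynomial (Fin 3) k} {d : ℕ} (hp : p.IsHomogeneous d)
    (hp0 : p ≠ 0) (h0 : ¬ X 0 ∣ p) (h2 : ¬ X 2 ∣ p) :
    ∃ u : ℕ, u ≤ d ^ 2 ∧
      IsRelPrime p (∑ i ∈ Finset.range (d + 1), (u : MvPolynomial (Fin 3) k) ^ i * (D3 k)^[i] p) := by
  classical
  have hdeg : ∀ s : Multiset (MvPolynomial (Fin 3) k), (∀ F ∈ s, Irreducible F) → s.prod ∣ p →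
      s.card ≤ d := by
    have h1 : ∀ s : Multiset (MvPolynomial (Fin 3) k), (∀ F ∈ s, Irreducible F) →
        s.card ≤ s.prod.totalDegree := by
      intro s
      induction s using Multiset.induction with
      | empty => simp
      | cons F s ih =>
        intro hs
        have hF : Irreducible F := hs F (Multiset.mem_cons_self _ _)
        have hs' : ∀ F ∈ s, Irreducible F := fun G hG => hs G (Multiset.mem_cons_of_mem hG)
        rw [Multiset.card_cons, Multiset.prod_cons, totalDegree_mul_of_isDomain hF.ne_zero
          (Multiset.prod_ne_zero fun h => (hs' 0 h).ne_zero rfl)]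
        have h2 : F.totalDegree ≠ 0 := by
          intro h
          rw [totalDegree_eq_zero_iff_eq_C] at h
          apply hF.not_isUnit
          rw [h]
          refine IsUnit.map C (Ne.isUnit fun h' => hF.ne_zero ?_)
          rw [h, h', C_0]
        have := ih hs'
        omega
    intro s hs hsp
    refine (h1 s hs).trans ?_
    exact (totalDegree_le_of_dvd_of_isDomain hsp hp0).trans (hp.totalDegree hp0).le
  obtain ⟨s, hs, hsp⟩ := UniqueFactorizationMonoid.exists_prime_factors p hp0
  have hs' : ∀ F ∈ s, Irreducible F := fun F hF => (hs F hF).irreducible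
  have hcard := hdeg s hs' hsp.dvd
  have hfac : ∀ F ∈ s, ∃ i ≤ d, ¬ F ∣ (D3 k)^[i] p := by
    intro F hF
    have hFp : F ∣ p := (Multiset.dvd_prod hF).trans hsp.dvd
    have hFn := isHomogeneous_of_dvd hp hp0 hFp
    have hF' : ¬ F ∣ D3 k F := by
      refine not_dvd_D3 hFn ?_ (fun h => h0 (h.trans hFp)) (fun h => h2 (h.trans hFp))
      intro h
      have := hdeg {F} (by simpa using hs' F hF) (by simpa using hFp)
      rw [totalDegree_eq_zero_iff_eq_C] at h
      apply (hs' F hF).not_isUnit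
      rw [h]
      refine IsUnit.map C (Ne.isUnit fun h' => (hs' F hF).ne_zero ?_)
      rw [h, h', C_0]
    obtain ⟨m, G, hG, hpG⟩ := WfDvdMonoid.max_power_factor hp0 (hs' F hF)
    refine ⟨m, ?_, ?_⟩
    · have := hdeg (Multiset.replicate m F)
        (fun G hG => by rw [Multiset.eq_of_mem_replicate hG]; exact hs' F hF)
        (by rw [Multiset.prod_replicate, hpG]; exact dvd_mul_right _ _)
      simpa using this
    · rw [hpG]
      exact not_dvd_iterate_derivation (D3 k) (hs F hF) hF' m G hG
  let Q : ℕ → MvPolynomial (Fin 3) k := fun u =>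
    ∑ i ∈ Finset.range (d + 1), (u : MvPolynomial (Fin 3) k) ^ i * (D3 k)^[i] p
  obtain ⟨u, hu, hnu⟩ : ∃ u ∈ Finset.range (d ^ 2 + 1), ∀ F ∈ s.toFinset, ¬ F ∣ Q u := by
    by_contra! hcon
    have h1 : Finset.range (d ^ 2 + 1) ⊆
        s.toFinset.biUnion fun F => (Finset.range (d ^ 2 + 1)).filter fun u => F ∣ Q u := by
      intro u hu
      obtain ⟨F, hF, hFu⟩ := hcon u hu
      exact Finset.mem_biUnion.mpr ⟨F, hF, Finset.mem_filter.mpr ⟨hu, hFu⟩⟩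
    have h3 := (Finset.card_le_card h1).trans (Finset.card_biUnion_le_card_mul _ _ d fun F hF =>
      card_filter_dvd_le (k := k) (hs F (Multiset.mem_toFinset.mp hF)) (fun i => (D3 k)^[i] p) d
        (hfac F (Multiset.mem_toFinset.mp hF)) _)
    rw [Finset.card_range] at h3
    have h4 := Multiset.toFinset_card_le s
    nlinarith
  refine ⟨u, by have := Finset.mem_range.mp hu; omega, ?_⟩
  refine WfDvdMonoid.isRelPrime_of_no_irreducible_factors (fun h => hp0 h.1) fun F hF hFp => ?_
  have hFprime := UniqueFactorizationMonoid.irreducible_iff_prime.mp hF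
  obtain ⟨G, hG, hFG⟩ := hFprime.exists_mem_multiset_dvd (hFp.trans hsp.symm.dvd)
  intro h
  have hass : Associated F G := hF.associated_of_dvd (hs' G hG) hFG
  exact hnu G (Multiset.mem_toFinset.mpr hG) (hass.symm.dvd.trans h)

/-- A nonzero integer form is a product of powers of `X₀` and `X₂` and a form that is coprime to
a combination of its derivatives. -/
theorem exists_coprime_pair (k : Type*) [Field k] [CharZero k] {p : MvPolynomial (Fin 3) ℤ} {D : ℕ}
    (hp : p.IsHomogeneous D) (hp0 : p ≠ 0) :
    ∃ (a e d u : ℕ) (q : MvPolynomial (Fin 3) ℤ), p = X 0 ^ a * X 2 ^ e * q ∧ d ≤ D ∧ u ≤ D ^ 2 ∧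
      q.IsHomogeneous d ∧ q ≠ 0 ∧
      IsRelPrime (map (Int.castRingHom k) q) (map (Int.castRingHom k)
        (∑ i ∈ Finset.range (d + 1), (u : MvPolynomial (Fin 3) ℤ) ^ i * (D3 ℤ)^[i] q)) := by
  obtain ⟨a, q1, hq1, rfl⟩ := WfDvdMonoid.max_power_factor hp0 (X_prime (R := ℤ) (i := (0 : Fin 3))).irreducible
  have hq10 : q1 ≠ 0 := right_ne_zero_of_mul hp0
  obtain ⟨e, q, hq2, rfl⟩ := WfDvdMonoid.max_power_factor hq10 (X_prime (R := ℤ) (i := (2 : Fin 3))).irreducible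
  have hq0 : q ≠ 0 := right_ne_zero_of_mul hq10
  have hqp : q ∣ X 0 ^ a * (X 2 ^ e * q) := (dvd_mul_left q _).trans (dvd_mul_left _ _)
  have hd := isHomogeneous_of_dvd hp hp0 hqp
  have hdD : q.totalDegree ≤ D :=
    (totalDegree_le_of_dvd_of_isDomain hqp hp0).trans (hp.totalDegree hp0).le
  have hinj : Function.Injective (Int.castRingHom k) := Int.cast_injective
  have hX : ∀ i : Fin 3, ¬ X i ∣ q → ¬ X i ∣ map (Int.castRingHom k) q := by
    intro i h
    rwa [X_dvd_iff_forall, support_map_of_injective _ hinj, ← X_dvd_iff_forall]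
  obtain ⟨u, hu, hrel⟩ := exists_isRelPrime_sum_D3 (hd.map (Int.castRingHom k))
    (by rwa [Ne, map_eq_zero_iff _ (map_injective _ hinj)])
    (hX 0 fun h => hq1 (h.trans (dvd_mul_left _ _))) (hX 2 hq2)
  refine ⟨a, e, q.totalDegree, u, q, by ring, hdD, hu.trans (Nat.pow_le_pow_left hdD 2), hd, hq0, ?_⟩
  convert hrel using 1
  simp [map_D3_iterate]

end Derivation

section Determinant

open Matrix

variable {S ι : Type*} [CommRing S] [Fintype ι] [DecidableEq ι]

/-- If the columns of `M` satisfy approximate relations `M * J = ε • B`, where `J` has a left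
inverse `F`, then `det M` is divisible by a power of `ε`. -/
lemma det_eq_pow_mul_det {T : ℕ} (M : Matrix ι ι S) (J : Matrix ι (Fin T) S) (F : Matrix (Fin T) ι S)
    (B : Matrix ι (Fin T) S) (ε : S) (hFJ : F * J = 1) (hMJ : M * J = ε • B) :
    M.det = ε ^ T * (fromBlocks M (-B) F 0).det := by
  have h1 : fromBlocks M 0 F (1 : Matrix (Fin T) (Fin T) S) * fromBlocks 1 (-J) 0 1 =
      fromBlocks M (ε • (-B)) F 0 := by
    rw [fromBlocks_multiply]
    simp [hFJ, hMJ]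
  have h2 := congrArg det h1
  rw [det_mul, det_fromBlocks_zero₁₂, det_fromBlocks_zero₂₁] at h2
  simp only [det_one, mul_one] at h2
  rw [h2]
  have h3 := det_mul_row (Sum.elim (fun _ : ι => (1 : S)) (fun _ : Fin T => ε)) (fromBlocks M (-B) F 0)
  rw [Fintype.prod_sum_type] at h3
  simp only [Sum.elim_inl, Sum.elim_inr, Finset.prod_const_one, Finset.prod_const, one_mul,
    Finset.card_univ, Fintype.card_fin] at h3
  rw [← h3]
  congr 1
  ext i j
  rcases i with i | i <;> rcases j with j | j <;> simp

/-- Quantitative form of `det_eq_pow_mul_det`. -/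
lemma norm_det_le_of_approx_kernel {T : ℕ} (M : Matrix ι ι ℂ) (J : Matrix ι (Fin T) ℂ)
    (F : Matrix (Fin T) ι ℂ) (hFJ : F * J = 1) {A δ : ℝ} (hA : 1 ≤ A) (hδ : 0 < δ)
    (hM : ∀ i j, ‖M i j‖ ≤ A) (hF : ∀ i j, ‖F i j‖ ≤ A) (hMJ : ∀ i j, ‖(M * J) i j‖ ≤ δ) :
    ‖M.det‖ ≤ δ ^ T * ((Fintype.card ι + T).factorial * A ^ (Fintype.card ι + T)) := by
  have hδ' : (δ : ℂ) ≠ 0 := by exact_mod_cast hδ.ne'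
  rw [det_eq_pow_mul_det M J F ((δ : ℂ)⁻¹ • (M * J)) δ hFJ (by rw [smul_smul, mul_inv_cancel₀ hδ', one_smul]),
    norm_mul, norm_pow, Complex.norm_real, Real.norm_of_nonneg hδ.le]
  refine mul_le_mul_of_nonneg_left ?_ (pow_nonneg hδ.le _)
  have h := Matrix.det_le (abv := NormedField.toAbsoluteValue ℂ)
    (A := fromBlocks M (-((δ : ℂ)⁻¹ • (M * J))) F 0) (x := A) (fun i j => by
      change ‖fromBlocks M (-((δ : ℂ)⁻¹ • (M * J))) F 0 i j‖ ≤ A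
      rcases i with i | i <;> rcases j with j | j
      · exact hM i j
      · simp only [fromBlocks_apply₁₂, Matrix.neg_apply, Matrix.smul_apply, smul_eq_mul, norm_neg, norm_mul,
          norm_inv, Complex.norm_real, Real.norm_of_nonneg hδ.le]
        refine le_trans ?_ hA
        rw [inv_mul_le_one₀ hδ]
        exact hMJ i j
      · exact hF i j
      · simp; linarith)
  rw [Fintype.card_sum, Fintype.card_fin, nsmul_eq_mul] at h
  exact h

end Determinant

section Torus

open Polynomial in
lemma mahlerMeasure_le_of_norm_eval_le {p : Polynomial ℂ} {s : ℝ} (hs : 0 < s)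
    (h : ∀ z : ℂ, ‖z‖ = 1 → ‖p.eval z‖ ≤ s) : p.mahlerMeasure ≤ s := by
  have hs' : (s : ℂ) ≠ 0 := by exact_mod_cast hs.ne'
  have hp : p = Polynomial.C (s : ℂ) * (Polynomial.C (s : ℂ)⁻¹ * p) := by
    rw [← mul_assoc, ← Polynomial.C_mul, mul_inv_cancel₀ hs', Polynomial.C_1, one_mul]
  set q := Polynomial.C (s : ℂ)⁻¹ * p with hq
  have h1 : q.mahlerMeasure ≤ 1 := by
    rcases eq_or_ne q 0 with h0 | h0
    · rw [h0]; simp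
    have h2 : q.logMahlerMeasure ≤ 0 := by
      rw [logMahlerMeasure_def]
      refine Real.circleAverage_mono_on_of_le_circle ?_ ?_
      · exact (analyticOnNhd_id.aeval_polynomial q).meromorphicOn.circleIntegrable_log_norm
      · intro z hz
        refine Real.log_nonpos (norm_nonneg _) ?_
        rw [hq, Polynomial.eval_mul, Polynomial.eval_C, norm_mul, norm_inv, Complex.norm_real,
          Real.norm_of_nonneg hs.le, inv_mul_le_one₀ hs]
        exact h z (by simpa using hz)
    rw [logMahlerMeasure_eq_log_MahlerMeasure] at h2
    exact (Real.log_nonpos_iff (mahlerMeasure_nonneg _)).mp h2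
  rw [hp, mahlerMeasure_mul, mahlerMeasure_const, Complex.norm_real, Real.norm_of_nonneg hs.le]
  exact mul_le_of_le_one_right hs.le h1

lemma exists_mahlerMeasure_le_norm_eval (p : Polynomial ℂ) :
    ∃ z : ℂ, ‖z‖ = 1 ∧ p.mahlerMeasure ≤ ‖p.eval z‖ := by
  rcases eq_or_ne p 0 with rfl | h0
  · exact ⟨1, by simp⟩
  by_contra! hcon
  obtain ⟨z, hz, hmax⟩ := (isCompact_sphere (0 : ℂ) 1).exists_isMaxOn ⟨1, by simp⟩
    (f := fun z => ‖p.eval z‖) (by fun_prop)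
  have hz1 : ‖z‖ = 1 := by simpa using hz
  have h1 : ∀ w : ℂ, ‖w‖ = 1 → ‖p.eval w‖ ≤ ‖p.eval z‖ := fun w hw => hmax (by simpa using hw)
  have hM := p.mahlerMeasure_pos_of_ne_zero h0
  have h2 := hcon z hz1
  have h3 : p.mahlerMeasure ≤ max ‖p.eval z‖ (p.mahlerMeasure / 2) :=
    mahlerMeasure_le_of_norm_eval_le (lt_max_of_lt_right (by positivity))
      fun w hw => (h1 w hw).trans (le_max_left _ _)
  rcases le_max_iff.mp h3 with h | h <;> linarith

lemma mahlerMeasure_linear (a b : ℂ) :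
    (Polynomial.C a * Polynomial.X + Polynomial.C b).mahlerMeasure = max ‖a‖ ‖b‖ := by
  rcases eq_or_ne a 0 with rfl | h
  · simp
  · exact Polynomial.mahlerMeasure_C_mul_X_add_C h b

lemma mahlerMeasure_finset_prod {ι : Type*} (s : Finset ι) (f : ι → Polynomial ℂ) :
    (∏ k ∈ s, f k).mahlerMeasure = ∏ k ∈ s, (f k).mahlerMeasure := by
  classical
  induction s using Finset.induction_on with
  | empty => simp
  | insert a s ha ih => rw [Finset.prod_insert ha, Finset.prod_insert ha, Polynomial.mahlerMeasure_mul, ih]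

lemma exists_torus_step {ι : Type*} (s : Finset ι) (u w : ι → ℂ) (c : ι → ℝ) (hc : ∀ k, 0 ≤ c k) :
    ∃ z : ℂ, ‖z‖ = 1 ∧ ∏ k ∈ s, max (c k) (max ‖w k‖ ‖u k‖) ≤ ∏ k ∈ s, max (c k) ‖u k + z * w k‖ := by
  classical
  obtain ⟨z, hz, h⟩ := exists_mahlerMeasure_le_norm_eval
    (∏ k ∈ s.filter fun k => c k < max ‖w k‖ ‖u k‖, (Polynomial.C (w k) * Polynomial.X + Polynomial.C (u k)))
  refine ⟨z, hz, ?_⟩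
  rw [mahlerMeasure_finset_prod, Polynomial.eval_prod, norm_prod] at h
  simp only [mahlerMeasure_linear, Polynomial.eval_add, Polynomial.eval_mul, Polynomial.eval_C,
    Polynomial.eval_X] at h
  rw [← Finset.prod_filter_mul_prod_filter_not s (fun k => c k < max ‖w k‖ ‖u k‖),
    ← Finset.prod_filter_mul_prod_filter_not s (fun k => c k < max ‖w k‖ ‖u k‖)
      (fun k => max (c k) ‖u k + z * w k‖)]
  refine mul_le_mul ?_ ?_ (Finset.prod_nonneg fun k _ => le_max_of_le_left (hc k))
    (Finset.prod_nonneg fun k _ => le_max_of_le_left (hc k))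
  · calc _ = ∏ k ∈ s with c k < max ‖w k‖ ‖u k‖, max ‖w k‖ ‖u k‖ :=
          Finset.prod_congr rfl fun k hk => max_eq_right (Finset.mem_filter.mp hk).2.le
      _ ≤ _ := h
      _ ≤ _ := by
        refine Finset.prod_le_prod (fun k _ => norm_nonneg _) fun k _ => ?_
        rw [mul_comm z, add_comm (u k)]
        exact le_max_right _ _
  · refine Finset.prod_le_prod (fun k _ => le_max_of_le_left (hc k)) fun k hk => ?_
    rw [max_eq_left (not_lt.mp (Finset.mem_filter.mp hk).2)]
    exact le_max_left _ _

/-- A torus point at which a product of linear forms is at least the product of the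
largest coefficients. -/
lemma exists_torus_max {ι o : Type*} [DecidableEq o] (s : Finset ι) (t : Finset o) (w : ι → o → ℂ) :
    ∀ c : ι → ℝ, (∀ k, 0 ≤ c k) → ∃ a : o → ℂ, (∀ j, ‖a j‖ = 1) ∧
      ∀ b : ι → ℝ, (∀ k, 0 ≤ b k) → (∀ k, b k ≤ c k ∨ ∃ j ∈ t, b k ≤ ‖w k j‖) →
        ∏ k ∈ s, b k ≤ ∏ k ∈ s, max (c k) ‖∑ j ∈ t, a j * w k j‖ := by
  induction t using Finset.induction_on with
  | empty =>
    intro c hc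
    refine ⟨fun _ => 1, by simp, fun b hb h => Finset.prod_le_prod (fun k _ => hb k) fun k _ => ?_⟩
    rcases h k with h | ⟨j, hj, -⟩
    · exact le_max_of_le_left h
    · simp at hj
  | insert j₀ t hj ih =>
    intro c hc
    obtain ⟨a, ha, h⟩ := ih (fun k => max (c k) ‖w k j₀‖) fun k => le_max_of_le_left (hc k)
    obtain ⟨z, hz, hz'⟩ := exists_torus_step s (fun k => ∑ j ∈ t, a j * w k j) (fun k => w k j₀) c hc
    refine ⟨Function.update a j₀ z, fun j => ?_, fun b hb hb' => ?_⟩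
    · by_cases hjj : j = j₀
      · subst hjj; simpa using hz
      · rw [Function.update_of_ne hjj]; exact ha j
    · refine (h b hb fun k => ?_).trans ?_
      · rcases hb' k with h | ⟨j, hj, h'⟩
        · exact Or.inl (le_max_of_le_left h)
        · rcases Finset.mem_insert.mp hj with rfl | hj
          · exact Or.inl (le_max_of_le_right h')
          · exact Or.inr ⟨j, hj, h'⟩
      · simp only [max_assoc]
        refine hz'.trans (le_of_eq (Finset.prod_congr rfl fun k _ => ?_))
        rw [Finset.sum_insert hj, Function.update_self, add_comm]
        congr 3
        refine Finset.sum_congr rfl fun j hj' => ?_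
        rw [Function.update_of_ne (by rintro rfl; exact hj hj')]

end Torus

section Macaulay

variable {k : Type} [Field k]

/-- The data of a Macaulay determinant computing, up to the nonzero integer `κ`, the product of the
values of forms of degree `E` at the points `Z`. -/
structure MacaulayData (P Q : MvPolynomial (Fin 3) ℤ) (d E : ℕ) (Z : Fin (d ^ 2) → Fin 3 → k) where
  r : ℕ
  w : Fin r → MvPolynomial (Fin 3) ℤ
  h : Fin (d ^ 2) → Fin 3 →₀ ℕ
  e : Fin r ⊕ Fin (d ^ 2) ≃ Mon (d + d + E)
  κ : ℤ
  κ_ne_zero : κ ≠ 0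
  degree_h : ∀ i, (h i).degree = d + d
  hw : ∀ i, ∃ m : Fin 3 →₀ ℕ, m.degree = d + E ∧ (w i = monomial m 1 * P ∨ w i = monomial m 1 * Q)
  det_eq : ∀ (S : Type) [CommRing S] (σ : k →+* S) (R : MvPolynomial (Fin 3) S), R.IsHomogeneous E →
    macDet w h (fun j => (e j : Fin 3 →₀ ℕ)) R = κ * ∏ i, eval (σ ∘ Z i) R

lemma exists_macaulayData [IsAlgClosed k] [CharZero k] {P Q : MvPolynomial (Fin 3) ℤ} {d : ℕ}
    (hP : P ≠ 0) (hPd : P.IsHomogeneous d) (hQd : Q.IsHomogeneous d)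
    (hrel : IsRelPrime (map (Int.castRingHom k) P) (map (Int.castRingHom k) Q)) :
    ∃ Z : Fin (d ^ 2) → Fin 3 → k, (∀ i, Z i ≠ 0) ∧ ∀ E, Nonempty (MacaulayData P Q d E Z) := by
  obtain ⟨Z, h, h1, h2, h3⟩ := exists_macaulay hP hPd hQd hrel
  refine ⟨Z, h1, fun E => ?_⟩
  obtain ⟨r, w, e, κ, h4, h5, h6⟩ := h3 E
  exact ⟨⟨r, w, h, e, κ, h4, h2, h5, h6⟩⟩

lemma eq_sum_of_equiv_Mon {R ι : Type*} [CommRing R] [Fintype ι] {L : ℕ} (e : ι ≃ Mon L)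
    {p : MvPolynomial (Fin 3) R} (hp : p.IsHomogeneous L) :
    p = ∑ j, coeff (e j : Fin 3 →₀ ℕ) p • monomial (e j : Fin 3 →₀ ℕ) 1 := by
  rw [e.sum_comp fun m : Mon L => coeff (m : Fin 3 →₀ ℕ) p • monomial (m : Fin 3 →₀ ℕ) (1 : R)]
  have h := congrArg Subtype.val ((homogCoord R L).left_inv ⟨p, (mem_homogeneousSubmodule _ _).mpr hp⟩)
  refine h.symm.trans (Finset.sum_congr rfl fun m _ => ?_)
  rw [smul_monomial, smul_eq_mul, mul_one]
  rfl

/-- The jets of the monomials. -/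
noncomputable def jetMat {ι : Type*} {L : ℕ} (e : ι ≃ Mon L) (x y : ℂ) (T : ℕ) :
    Matrix ι (Fin T) ℂ :=
  Matrix.of fun j t => PowerSeries.coeff (t : ℕ) (jet x y (monomial (e j : Fin 3 →₀ ℕ) 1))

lemma sum_coeff_mul_jetMat {ι : Type*} [Fintype ι] {L : ℕ} (e : ι ≃ Mon L) (x y : ℂ) {T : ℕ}
    {p : MvPolynomial (Fin 3) ℂ} (hp : p.IsHomogeneous L) (t : Fin T) :
    ∑ j, coeff (e j : Fin 3 →₀ ℕ) p * jetMat e x y T j t = PowerSeries.coeff (t : ℕ) (jet x y p) := by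
  conv_rhs => rw [eq_sum_of_equiv_Mon e hp]
  simp [jetMat, map_sum, map_smul]

lemma exists_jetMat_leftInverse {ι : Type*} [Fintype ι] {L a b T : ℕ} (e : ι ≃ Mon L) {x y : ℂ}
    (hy : y ≠ 0) (ha : 1 ≤ a) (hT : T ≤ a * b) (hL : a + b ≤ L) {c M : ℝ} (hc : 1 ≤ c)
    (hx : ‖x‖ + 1 ≤ c) (hyc : ‖y⁻¹‖ ≤ c) (hM : 3 ≤ M) (hMab : (a * b : ℝ) + 2 ≤ M) :
    ∃ F : Matrix (Fin T) ι ℂ, F * jetMat e x y T = 1 ∧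
      ∀ i j, ‖F i j‖ ≤ M ^ (8 * (a * b) + 1) * c ^ L := by
  obtain ⟨F, hF, hFj, hF1⟩ := exists_dual_forms ha hT hL hM hMab
  have hhom : ∀ l, (chg (-x) y⁻¹ (F l)).IsHomogeneous L := fun l => chg_isHomogeneous _ _ (hF l)
  refine ⟨Matrix.of fun l j => coeff (e j : Fin 3 →₀ ℕ) (chg (-x) y⁻¹ (F l)), ?_, fun l j => ?_⟩
  · ext l t
    rw [Matrix.mul_apply]
    simp only [Matrix.of_apply]
    rw [sum_coeff_mul_jetMat e x y (hhom l), ← jet_chg x y, chg_chg x y hy, hFj l l.2 t t.2,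
      Matrix.one_apply]
    simp [Fin.ext_iff, eq_comm]
  · refine (norm_coeff_le_l1 _ _).trans ((l1_chg_le (-x) y⁻¹ hc (by simpa using hx) hyc (hF l)).trans ?_)
    exact mul_le_mul_of_nonneg_right (hF1 l) (by positivity)

lemma MacaulayData.card_eq {P Q : MvPolynomial (Fin 3) ℤ} {d E : ℕ} {Z : Fin (d ^ 2) → Fin 3 → k}
    (mac : MacaulayData P Q d E Z) :
    Fintype.card (Fin mac.r ⊕ Fin (d ^ 2)) = (d + d + E + 2).choose 2 := by
  rw [Fintype.card_congr mac.e, card_Mon]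

/-- If `P`, `Q` and `R` nearly vanish to order `T` along the exponential curve at a point, then
the product of the values of `R` at the points of the cycle is very small. -/
lemma MacaulayData.norm_prod_eval_le {P Q : MvPolynomial (Fin 3) ℤ} {d E : ℕ}
    {Z : Fin (d ^ 2) → Fin 3 → k} (mac : MacaulayData P Q d E Z) (hPd : P.IsHomogeneous d)
    (hQd : Q.IsHomogeneous d) (σ : k →+* ℂ) {R : MvPolynomial (Fin 3) ℂ} (hR : R.IsHomogeneous E)
    {x y : ℂ} (hy : y ≠ 0) {a b T : ℕ} (ha : 1 ≤ a) (hT : T ≤ a * b) (hL : a + b ≤ d + d + E)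
    {c M A δ : ℝ} (hc : 1 ≤ c) (hx : ‖x‖ + 1 ≤ c) (hyc : ‖y⁻¹‖ ≤ c) (hyc3 : 3 * ‖y‖ ≤ c)
    (hM : 3 ≤ M) (hMab : (a * b : ℝ) + 2 ≤ M) (hA : 1 ≤ A)
    (hMA : M ^ (8 * (a * b) + 1) * c ^ (d + d + E) ≤ A)
    (hPA : l1 (map (Int.castRingHom ℂ) P) ≤ A) (hQA : l1 (map (Int.castRingHom ℂ) Q) ≤ A)
    (hRA : l1 R ≤ A) (hδ : 0 < δ)
    (hPδ : tnorm T (jet x y (map (Int.castRingHom ℂ) P)) * c ^ (d + d + E) ≤ δ)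
    (hQδ : tnorm T (jet x y (map (Int.castRingHom ℂ) Q)) * c ^ (d + d + E) ≤ δ)
    (hRδ : tnorm T (jet x y R) * c ^ (d + d + E) ≤ δ) :
    ‖(mac.κ : ℂ) * ∏ i, eval (σ ∘ Z i) R‖ ≤ δ ^ T * (((d + d + E + 2).choose 2 + T).factorial *
      A ^ ((d + d + E + 2).choose 2 + T)) := by
  rw [← mac.det_eq ℂ σ R hR, macDet, ← mac.card_eq]
  have hhom := macRow_isHomogeneous hPd hQd mac.hw mac.degree_h hR
  obtain ⟨F, hF, hFA⟩ := exists_jetMat_leftInverse mac.e hy ha hT hL hc hx hyc hM hMab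
  have hl1mono : ∀ m : Fin 3 →₀ ℕ, l1 (monomial m (1 : ℂ)) = 1 := fun m => by rw [l1_monomial]; simp
  have hmono : ∀ (m : Fin 3 →₀ ℕ), m.degree ≤ d + d + E →
      tnorm T (jet x y (monomial m 1)) ≤ c ^ (d + d + E) := fun m hm => by
    refine (tnorm_jet_le T x y hc hx hyc3 (isHomogeneous_monomial (1 : ℂ) rfl)).trans ?_
    rw [hl1mono, one_mul]
    exact pow_le_pow_right₀ hc hm
  have hmul : ∀ (m : Fin 3 →₀ ℕ) (p : MvPolynomial (Fin 3) ℂ), m.degree ≤ d + d + E →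
      tnorm T (jet x y p) * c ^ (d + d + E) ≤ δ → tnorm T (jet x y (monomial m 1 * p)) ≤ δ := by
    intro m p hm hp
    rw [map_mul, mul_comm]
    refine (tnorm_mul_le _ _ _).trans (le_trans ?_ hp)
    exact mul_le_mul_of_nonneg_left (hmono m hm) (tnorm_nonneg _ _)
  have hl1mul : ∀ (m : Fin 3 →₀ ℕ) (p : MvPolynomial (Fin 3) ℂ), l1 p ≤ A →
      l1 (monomial m 1 * p) ≤ A := fun m p hp => by
    refine (l1_mul_le _ _).trans ?_
    rwa [hl1mono, one_mul]
  have hrow : ∀ i, l1 (macRow mac.w mac.h R i) ≤ A ∧ tnorm T (jet x y (macRow mac.w mac.h R i)) ≤ δ := by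
    rintro (i | i)
    · obtain ⟨m, hm, h1⟩ := mac.hw i
      simp only [macRow, Sum.elim_inl]
      rcases h1 with h1 | h1
      · rw [h1, map_mul, map_monomial, map_one]
        exact ⟨hl1mul _ _ hPA, hmul _ _ (by omega) hPδ⟩
      · rw [h1, map_mul, map_monomial, map_one]
        exact ⟨hl1mul _ _ hQA, hmul _ _ (by omega) hQδ⟩
    · simp only [macRow, Sum.elim_inr]
      rw [mul_comm]
      exact ⟨hl1mul _ _ hRA, hmul _ _ (by have := mac.degree_h i; omega) hRδ⟩
  refine norm_det_le_of_approx_kernel _ (jetMat mac.e x y T) F hF hA hδ ?_ ?_ ?_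
  · intro i j
    exact (norm_coeff_le_l1 _ _).trans (hrow i).1
  · intro i j
    exact (hFA i j).trans hMA
  · intro i t
    rw [Matrix.mul_apply]
    simp only [Matrix.of_apply]
    rw [sum_coeff_mul_jetMat mac.e x y (hhom i)]
    exact (norm_coeff_le_tnorm t.2 _).trans (hrow i).2

end Macaulay

section Multiplicity

lemma exists_nat_linForm_ne_zero {k ι : Type*} [Field k] [CharZero k] [Fintype ι]
    (Z : ι → Fin 3 → k) (hZ : ∀ i, Z i ≠ 0) :
    ∃ u : ℕ, u ≤ 2 * Fintype.card ι ∧ ∀ i, Z i 0 + u * Z i 1 + u ^ 2 * Z i 2 ≠ 0 := by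
  classical
  let f : ι → Polynomial k := fun i =>
    Polynomial.C (Z i 0) + Polynomial.C (Z i 1) * Polynomial.X + Polynomial.C (Z i 2) * Polynomial.X ^ 2
  have hf : ∀ i, f i ≠ 0 := fun i h0 => by
    refine hZ i (funext fun j => ?_)
    have h1 := congrArg (fun p => Polynomial.coeff p j) h0
    fin_cases j <;> simpa [f, Polynomial.coeff_X, Polynomial.coeff_C] using h1
  have hdeg : (∏ i, f i).natDegree ≤ 2 * Fintype.card ι := by
    refine (Polynomial.natDegree_prod_le _ _).trans ?_
    refine (Finset.sum_le_card_nsmul _ _ 2 fun i _ => ?_).trans (by simp [mul_comm])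
    simp only [f]
    compute_degree
  have hne : (∏ i, f i) ≠ 0 := Finset.prod_ne_zero_iff.mpr fun i _ => hf i
  have : ∃ u ∈ Finset.range (2 * Fintype.card ι + 1), (∏ i, f i).eval (u : k) ≠ 0 := by
    by_contra! h
    refine hne (Polynomial.eq_zero_of_natDegree_lt_card_of_eval_eq_zero' _
      ((Finset.range (2 * Fintype.card ι + 1)).image (Nat.cast : ℕ → k)) ?_ ?_)
    · intro x hx
      obtain ⟨u, hu, rfl⟩ := Finset.mem_image.mp hx
      exact h u hu
    · rw [Finset.card_image_of_injective _ Nat.cast_injective, Finset.card_range]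
      omega
  obtain ⟨u, hu, h⟩ := this
  refine ⟨u, by simpa [Nat.lt_succ_iff] using hu, fun i h0 => h ?_⟩
  rw [Polynomial.eval_prod]
  refine Finset.prod_eq_zero (Finset.mem_univ i) ?_
  simp only [f, Polynomial.eval_add, Polynomial.eval_mul, Polynomial.eval_C, Polynomial.eval_X,
    Polynomial.eval_pow]
  rw [← h0]
  ring

lemma exists_separating_linear_form {ι : Type*} [Finite ι] (W : ι → Fin 3 → ℂ) (x y : ℂ) :
    ∃ u : ℂ, ∀ i, (W i 1 - x * W i 0) + u * (W i 2 - y * W i 0) = 0 → ∃ c : ℂ, W i = c • ![1, x, y] := by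
  classical
  have hfin : (Set.range fun i => -(W i 1 - x * W i 0) / (W i 2 - y * W i 0)).Finite := Set.finite_range _
  obtain ⟨u, hu⟩ := hfin.exists_notMem
  refine ⟨u, fun i h => ⟨W i 0, ?_⟩⟩
  have h2 : W i 2 - y * W i 0 = 0 := by
    by_contra h2
    refine hu ⟨i, ?_⟩
    simp only
    rw [div_eq_iff h2]
    linear_combination -h
  have h1 : W i 1 - x * W i 0 = 0 := by simpa [h2] using h
  funext j
  fin_cases j
  · simp
  · simp only [Fin.mk_one, Pi.smul_apply, smul_eq_mul]
    simp
    linear_combination h1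
  · simp
    linear_combination h2

lemma Polynomial.le_of_X_pow_dvd_mul {T s : ℕ} {G : Polynomial ℂ} (hG : G.coeff 0 ≠ 0)
    (h : (Polynomial.X : Polynomial ℂ) ^ T ∣ Polynomial.X ^ s * G) : T ≤ s := by
  by_contra! hlt
  obtain ⟨c, hc⟩ := h
  have h1 := congrArg (fun p => Polynomial.coeff p s) hc
  simp only [Polynomial.coeff_X_pow_mul', hlt.not_ge, le_refl, if_true, Nat.sub_self, if_false] at h1
  exact hG h1

variable {k : Type} [Field k]

/-- If `P` and `Q` vanish to order `T` along the exponential curve at a point, then this point occurs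
at least `T` times in the cycle. -/
lemma le_card_of_jet_eq_zero {P Q : MvPolynomial (Fin 3) ℤ} {d : ℕ}
    {Z : Fin (d ^ 2) → Fin 3 → k} (hZ : ∀ i, Z i ≠ 0)
    (hmac : ∀ E, Nonempty (MacaulayData P Q d E Z)) (hPd : P.IsHomogeneous d)
    (hQd : Q.IsHomogeneous d) (hd : 1 ≤ d) (σ : k →+* ℂ) {x y : ℂ} (hy : y ≠ 0) {T : ℕ} 
    (hP : ∀ t < T, PowerSeries.coeff t (jet x y (map (Int.castRingHom ℂ) P)) = 0)
    (hQ : ∀ t < T, PowerSeries.coeff t (jet x y (map (Int.castRingHom ℂ) Q)) = 0) :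
    T ≤ Nat.card {i // ∃ c : ℂ, σ ∘ Z i = c • ![1, x, y]} := by
  classical
  rcases Nat.eq_zero_or_pos T with rfl | hTpos
  · exact Nat.zero_le _
  obtain ⟨mac⟩ := hmac T
  have hσ : ∀ i, σ ∘ Z i ≠ 0 := fun i h => hZ i (funext fun j => by
    have := congrFun h j
    simpa using this)
  obtain ⟨v, -, hv⟩ := exists_nat_linForm_ne_zero (fun i => σ ∘ Z i) hσ
  obtain ⟨u, hu⟩ := exists_separating_linear_form (fun i => σ ∘ Z i) x y
  let n : MvPolynomial (Fin 3) ℂ := (X 1 - C x * X 0) + C u * (X 2 - C y * X 0)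
  let m : MvPolynomial (Fin 3) ℂ := X 0 + C (v : ℂ) * X 1 + C ((v : ℂ) ^ 2) * X 2
  have hX : ∀ (c : ℂ) (i : Fin 3), (C c * X i : MvPolynomial (Fin 3) ℂ).IsHomogeneous 1 := fun c i => by
    simpa using (isHomogeneous_C (Fin 3) c).mul (isHomogeneous_X ℂ i)
  have hn : n.IsHomogeneous 1 := by
    refine ((isHomogeneous_X ℂ 1).sub (hX _ _)).add ?_
    simpa using (isHomogeneous_C (Fin 3) u).mul ((isHomogeneous_X ℂ 2).sub (hX y 0))
  have hm : m.IsHomogeneous 1 := ((isHomogeneous_X ℂ 0).add (hX _ _)).add (hX _ _)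
  have hnT : (n ^ T).IsHomogeneous T := by simpa using hn.pow T
  have hmT : (m ^ T).IsHomogeneous T := by simpa using hm.pow T
  let R : MvPolynomial (Fin 3) (Polynomial ℂ) :=
    map Polynomial.C (n ^ T) + C Polynomial.X * map Polynomial.C (m ^ T)
  have hR : R.IsHomogeneous T := by
    refine (hnT.map _).add ?_
    simpa using (isHomogeneous_C (Fin 3) (Polynomial.X : Polynomial ℂ)).mul (hmT.map _)
  have hdet := mac.det_eq _ (Polynomial.C.comp σ) R hR
  obtain ⟨F, hF, -⟩ := exists_jetMat_leftInverse (a := T) (b := 1) (T := T) mac.e (x := x) hy hTpos (by omega)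
    (by omega) (c := max (‖x‖ + 1) ‖y⁻¹‖) (M := max 3 ((T : ℝ) * (1 : ℕ) + 2))
    (le_max_of_le_left (by linarith [norm_nonneg x])) (le_max_left _ _) (le_max_right _ _)
    (le_max_left _ _) (le_max_right _ _)
  have hjn : ∀ p, ∀ t < T, PowerSeries.coeff t (jet x y (n ^ T * p)) = 0 := by
    intro p t ht
    have h1 : PowerSeries.X ∣ jet x y n := by
      rw [PowerSeries.X_dvd_iff, ← PowerSeries.coeff_zero_eq_constantCoeff_apply, constantCoeff_jet]
      simp [n]
    have h2 : PowerSeries.X ^ T ∣ jet x y (n ^ T * p) := by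
      rw [map_mul, map_pow]
      exact Dvd.dvd.mul_right (pow_dvd_pow_of_dvd h1 T) _
    exact PowerSeries.X_pow_dvd_iff.mp h2 t ht
  have hsum : ∀ (p : MvPolynomial (Fin 3) ℂ), p.IsHomogeneous (d + d + T) → ∀ t : Fin T,
      ∑ j, coeff (mac.e j : Fin 3 →₀ ℕ) (map Polynomial.C p) * Polynomial.C (jetMat mac.e x y T j t)
        = Polynomial.C (PowerSeries.coeff (t : ℕ) (jet x y p)) := by
    intro p hp t
    rw [← sum_coeff_mul_jetMat mac.e x y hp t, map_sum]
    refine Finset.sum_congr rfl fun j _ => ?_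
    rw [coeff_map, map_mul]
  let B : Matrix (Fin mac.r ⊕ Fin (d ^ 2)) (Fin T) (Polynomial ℂ) := Matrix.of fun i t =>
    Sum.elim (fun _ => 0) (fun i => Polynomial.C (PowerSeries.coeff (t : ℕ)
      (jet x y (m ^ T * monomial (mac.h i) 1)))) i
  have hhomP : ∀ i, (map (Int.castRingHom ℂ) (mac.w i)).IsHomogeneous (d + d + T) := fun i => by
    simpa [macRow] using macRow_isHomogeneous hPd hQd mac.hw mac.degree_h hmT (Sum.inl i)
  have hhom : ∀ (p : MvPolynomial (Fin 3) ℂ) i, p.IsHomogeneous T →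
      (p * monomial (mac.h i) 1).IsHomogeneous (d + d + T) := fun p i hp => by
    simpa [macRow] using macRow_isHomogeneous hPd hQd mac.hw mac.degree_h hp (Sum.inr i)
  have hMJ : (Matrix.of fun i j => coeff (mac.e j : Fin 3 →₀ ℕ) (macRow mac.w mac.h R i)) *
      (jetMat mac.e x y T).map Polynomial.C = (Polynomial.X : Polynomial ℂ) • B := by
    ext1 i t
    rw [Matrix.mul_apply]
    simp only [Matrix.of_apply, Matrix.map_apply]
    rw [Matrix.smul_apply]
    rcases i with i | i
    · have h1 : macRow mac.w mac.h R (Sum.inl i) =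
          map Polynomial.C (map (Int.castRingHom ℂ) (mac.w i)) := by
        simp only [macRow, Sum.elim_inl, map_map]
        refine congrArg (fun f => map f (mac.w i)) (RingHom.ext_int _ _)
      rw [h1, hsum _ (hhomP i)]
      have h2 : PowerSeries.coeff (t : ℕ) (jet x y (map (Int.castRingHom ℂ) (mac.w i))) = 0 := by
        obtain ⟨μ, -, h3⟩ := mac.hw i
        have key : ∀ p : MvPolynomial (Fin 3) ℤ,
            (∀ t < T, PowerSeries.coeff t (jet x y (map (Int.castRingHom ℂ) p)) = 0) →
            PowerSeries.coeff (t : ℕ) (jet x y (map (Int.castRingHom ℂ) (monomial μ 1 * p))) = 0 := by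
          intro p hp
          rw [map_mul, map_mul]
          exact PowerSeries.X_pow_dvd_iff.mp
            (Dvd.dvd.mul_left (PowerSeries.X_pow_dvd_iff.mpr hp) _) _ t.2
        rcases h3 with h3 | h3
        · rw [h3]; exact key _ hP
        · rw [h3]; exact key _ hQ
      rw [h2]
      simp [B]
    · have h1 : macRow mac.w mac.h R (Sum.inr i) =
          map Polynomial.C (n ^ T * monomial (mac.h i) 1) +
            C Polynomial.X * map Polynomial.C (m ^ T * monomial (mac.h i) 1) := by
        simp only [macRow, Sum.elim_inr, R, map_mul, map_monomial, map_one]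
        ring
      rw [h1]
      simp only [coeff_add, coeff_C_mul, add_mul, Finset.sum_add_distrib, mul_assoc]
      rw [hsum _ (hhom _ i hnT), ← Finset.mul_sum, hsum _ (hhom _ i hmT), hjn _ t t.2]
      simp [B]
  have hFJ : F.map Polynomial.C * (jetMat mac.e x y T).map Polynomial.C = 1 := by
    rw [← Matrix.map_mul, hF]
    exact Matrix.map_one _ (map_zero _) (map_one _)
  have hdvd : (Polynomial.X : Polynomial ℂ) ^ T ∣ macDet mac.w mac.h (fun j => (mac.e j : Fin 3 →₀ ℕ)) R := by
    rw [macDet, det_eq_pow_mul_det _ _ _ B _ hFJ hMJ]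
    exact dvd_mul_right _ _
  have heval : ∀ i, eval (⇑(Polynomial.C.comp σ) ∘ Z i) R =
      Polynomial.C ((eval (σ ∘ Z i) n) ^ T) + Polynomial.X * Polynomial.C ((eval (σ ∘ Z i) m) ^ T) := by
    intro i
    have h1 : ∀ p, eval (⇑(Polynomial.C.comp σ) ∘ Z i) (map Polynomial.C p) =
        Polynomial.C (eval (σ ∘ Z i) p) := fun p => by
      rw [map_eval_eq]
      rfl
    simp only [R, map_add, map_mul, eval_C, h1, map_pow]
  have hm0 : ∀ i, eval (σ ∘ Z i) m ≠ 0 := fun i => by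
    simpa [m] using hv i
  let s := Finset.univ.filter fun i => eval (σ ∘ Z i) n = 0
  have hs : s.card ≤ Nat.card {i // ∃ c : ℂ, σ ∘ Z i = c • ![1, x, y]} := by
    rw [Nat.card_eq_fintype_card, Fintype.card_subtype]
    refine Finset.card_le_card fun i hi => ?_
    simp only [s, Finset.mem_filter, Finset.mem_univ, true_and] at hi ⊢
    exact hu i (by simpa [n] using hi)
  refine le_trans ?_ hs
  rw [hdet, ← Finset.prod_filter_mul_prod_filter_not Finset.univ (fun i => eval (σ ∘ Z i) n = 0)] at hdvd
  have h1 : ∏ i ∈ Finset.univ.filter (fun i => eval (σ ∘ Z i) n = 0), eval (⇑(Polynomial.C.comp σ) ∘ Z i) R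
      = Polynomial.X ^ s.card * ∏ i ∈ s, Polynomial.C ((eval (σ ∘ Z i) m) ^ T) := by
    rw [← Finset.prod_const, ← Finset.prod_mul_distrib]
    refine Finset.prod_congr rfl fun i hi => ?_
    rw [heval, (Finset.mem_filter.mp hi).2]
    simp [hTpos.ne']
  rw [h1] at hdvd
  refine Polynomial.le_of_X_pow_dvd_mul (G := (mac.κ : Polynomial ℂ) *
      ((∏ i ∈ s, Polynomial.C ((eval (σ ∘ Z i) m) ^ T)) *
        ∏ i ∈ Finset.univ.filter (fun i => ¬ eval (σ ∘ Z i) n = 0), eval (⇑(Polynomial.C.comp σ) ∘ Z i) R)) ?_ ?_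
  · rw [Polynomial.coeff_zero_eq_eval_zero]
    simp only [Polynomial.eval_mul, Polynomial.eval_prod, heval, Polynomial.eval_add, Polynomial.eval_C,
      Polynomial.eval_X, zero_mul, add_zero, Polynomial.eval_intCast]
    refine mul_ne_zero (Int.cast_ne_zero.mpr mac.κ_ne_zero) (mul_ne_zero ?_ ?_)
    · exact Finset.prod_ne_zero_iff.mpr fun i _ => pow_ne_zero _ (hm0 i)
    · exact Finset.prod_ne_zero_iff.mpr fun i hi => pow_ne_zero _ (Finset.mem_filter.mp hi).2
  · refine hdvd.trans (dvd_of_eq ?_)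
    ring

end Multiplicity

section PairBounds

/-- The combination of derivatives of `q` used as a second form coprime to `q`. -/
noncomputable def derivSum (d u : ℕ) (q : MvPolynomial (Fin 3) ℤ) : MvPolynomial (Fin 3) ℤ :=
  ∑ i ∈ Finset.range (d + 1), (u : MvPolynomial (Fin 3) ℤ) ^ i * (D3 ℤ)^[i] q

lemma natCast_pow_eq_C {R : Type*} [CommRing R] (u i : ℕ) :
    (u : MvPolynomial (Fin 3) R) ^ i = C ((u : R) ^ i) := by
  rw [map_pow, map_natCast]

lemma derivSum_isHomogeneous {d u : ℕ} {q : MvPolynomial (Fin 3) ℤ} (hq : q.IsHomogeneous d) :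
    (derivSum d u q).IsHomogeneous d := by
  refine IsHomogeneous.sum _ _ _ fun i _ => ?_
  have h := (isHomogeneous_C (Fin 3) ((u : ℤ) ^ i)).mul (hq.D3_iterate i)
  rw [zero_add, ← natCast_pow_eq_C] at h
  exact h

lemma map_derivSum {R : Type*} [CommRing R] (d u : ℕ) (q : MvPolynomial (Fin 3) ℤ) :
    map (Int.castRingHom R) (derivSum d u q) =
      ∑ i ∈ Finset.range (d + 1), ((u : R) ^ i) • (D3 R)^[i] (map (Int.castRingHom R) q) := by
  rw [derivSum, map_sum]
  refine Finset.sum_congr rfl fun i _ => ?_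
  rw [map_mul, map_D3_iterate, map_pow, map_natCast, natCast_pow_eq_C, C_mul']

lemma card_support_le {R : Type*} [CommRing R] {D : ℕ} {p : MvPolynomial (Fin 2) R}
    (hp : p.totalDegree ≤ D) : p.support.card ≤ (D + 1) ^ 2 := by
  classical
  have h : p.support.card ≤ (Finset.range (D + 1) ×ˢ Finset.range (D + 1)).card := by
    refine Finset.card_le_card_of_injOn (fun m => (m 0, m 1)) (fun m hm => ?_) fun m _ m' _ h => ?_
    · have h1 : m.degree ≤ D := (le_totalDegree hm).trans hp
      rw [Finsupp.degree_eq_sum, Fin.sum_univ_two] at h1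
      simp only [Finset.coe_product, Finset.coe_range, Set.mem_prod, Set.mem_Iio]
      omega
    · ext i
      simp only [Prod.mk.injEq] at h
      fin_cases i
      · exact h.1
      · exact h.2
  simpa [sq] using h

lemma l1_homog_le {D : ℕ} {p : MvPolynomial (Fin 2) ℤ} (hp : p.totalDegree ≤ D) {B : ℝ}
    (hB : ∀ v, ((|p.coeff v| : ℤ) : ℝ) ≤ B) :
    l1 (map (Int.castRingHom ℂ) (homog D p)) ≤ (D + 1) ^ 2 * B := by
  have hB0 : 0 ≤ B := le_trans (by positivity) (hB 0)
  rw [homog, map_sum]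
  refine (l1_sum_le _ _).trans ?_
  calc ∑ m ∈ p.support, l1 (map (Int.castRingHom ℂ)
        (monomial (Finsupp.equivFunOnFinite.symm ![D - m.degree, m 0, m 1]) (p.coeff m)))
      ≤ ∑ m ∈ p.support, B := Finset.sum_le_sum fun m _ => by
        rw [map_monomial, l1_monomial]
        refine le_trans (le_of_eq ?_) (hB m)
        simp
    _ = p.support.card * B := by rw [Finset.sum_const, nsmul_eq_mul]
    _ ≤ (D + 1) ^ 2 * B := by
        refine mul_le_mul_of_nonneg_right ?_ hB0
        exact_mod_cast card_support_le hp

lemma l1_D3_le {p : MvPolynomial (Fin 3) ℂ} {n : ℕ} (hp : p.IsHomogeneous n) :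
    l1 (D3 ℂ p) ≤ n * l1 p := by
  conv_lhs => rw [p.as_sum, map_sum]
  refine (l1_sum_le _ _).trans ?_
  rw [l1, Finset.mul_sum]
  refine Finset.sum_le_sum fun m hm => ?_
  have hdeg : m 0 + m 1 + m 2 = n := by
    have := hp (mem_support_iff.mp hm)
    have h2 : m.degree = n := by
      rw [Finsupp.degree_eq_weight_one]
      exact this
    rwa [Finsupp.degree_eq_sum, Fin.sum_univ_three] at h2
  have hX : ∀ i, l1 (X i) ≤ 1 := fun i => by
    have := l1_monomial (Finsupp.single i 1) 1
    rw [norm_one] at this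
    exact this.le
  have hpd : ∀ i, l1 (pderiv i (monomial m (coeff m p))) ≤ m i * ‖coeff m p‖ := fun i => by
    rw [pderiv_monomial, l1_monomial, norm_mul, mul_comm]
    simp
  rw [D3_apply]
  refine (l1_add_le _ _).trans ?_
  have h1 := (l1_mul_le (X 0) (pderiv 1 (monomial m (coeff m p)))).trans
    (mul_le_mul (hX 0) (hpd 1) (l1_nonneg _) zero_le_one)
  have h2 := (l1_mul_le (X 2) (pderiv 2 (monomial m (coeff m p)))).trans
    (mul_le_mul (hX 2) (hpd 2) (l1_nonneg _) zero_le_one)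
  have h3 : ((m 0 : ℝ) + m 1 + m 2) = n := by exact_mod_cast hdeg
  have h4 : (0 : ℝ) ≤ m 0 * ‖coeff m p‖ := by positivity
  rw [← h3]
  linarith

lemma l1_D3_iterate_le {p : MvPolynomial (Fin 3) ℂ} {n : ℕ} (hp : p.IsHomogeneous n) (i : ℕ) :
    l1 ((D3 ℂ)^[i] p) ≤ n ^ i * l1 p := by
  induction i with
  | zero => simp
  | succ i ih =>
    rw [Function.iterate_succ_apply', pow_succ', mul_assoc]
    exact (l1_D3_le (hp.D3_iterate i)).trans (mul_le_mul_of_nonneg_left ih (Nat.cast_nonneg _))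

lemma l1_le_l1_monomial_mul (s : Fin 3 →₀ ℕ) (q : MvPolynomial (Fin 3) ℂ) :
    l1 q ≤ l1 (monomial s 1 * q) := by
  classical
  have h : ∀ m ∈ q.support, s + m ∈ (monomial s 1 * q).support := fun m hm => by
    rw [mem_support_iff, add_comm, mul_comm, coeff_mul_monomial, mul_one]
    exact mem_support_iff.mp hm
  calc l1 q = ∑ m ∈ q.support.image (s + ·), ‖coeff m (monomial s 1 * q)‖ := by
        rw [Finset.sum_image fun a _ b _ h => add_left_cancel h, l1]
        refine Finset.sum_congr rfl fun m _ => ?_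
        rw [add_comm, mul_comm, coeff_mul_monomial, mul_one]
    _ ≤ l1 (monomial s 1 * q) := by
        refine Finset.sum_le_sum_of_subset_of_nonneg ?_ fun _ _ _ => norm_nonneg _
        intro m hm
        obtain ⟨m', hm', rfl⟩ := Finset.mem_image.mp hm
        exact h m' hm'

lemma l1_cofactor_le (a e : ℕ) (q : MvPolynomial (Fin 3) ℤ) :
    l1 (map (Int.castRingHom ℂ) q) ≤ l1 (map (Int.castRingHom ℂ) (X 0 ^ a * X 2 ^ e * q)) := by
  have h := l1_le_l1_monomial_mul (Finsupp.single 0 a + Finsupp.single 2 e)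
    (map (Int.castRingHom ℂ) q)
  have h2 : (monomial (Finsupp.single 0 a + Finsupp.single 2 e) 1 : MvPolynomial (Fin 3) ℂ)
      = X 0 ^ a * X 2 ^ e := by
    rw [X_pow_eq_monomial, X_pow_eq_monomial, monomial_mul, one_mul]
  rw [h2] at h
  simpa using h

lemma l1_derivSum_le {d u : ℕ} {q : MvPolynomial (Fin 3) ℤ} (hq : q.IsHomogeneous d) {M : ℝ}
    (hM : 1 ≤ M) (hu : (u : ℝ) ≤ M) (hd : (d + 1 : ℝ) ≤ M) :
    l1 (map (Int.castRingHom ℂ) (derivSum d u q)) ≤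
      M ^ (2 * d + 1) * l1 (map (Int.castRingHom ℂ) q) := by
  rw [map_derivSum]
  refine (l1_sum_le _ _).trans ?_
  have hl := l1_nonneg (map (Int.castRingHom ℂ) q)
  calc ∑ i ∈ Finset.range (d + 1), l1 (((u : ℂ) ^ i) • (D3 ℂ)^[i] (map (Int.castRingHom ℂ) q))
      ≤ ∑ i ∈ Finset.range (d + 1), M ^ d * (M ^ d * l1 (map (Int.castRingHom ℂ) q)) := by
        refine Finset.sum_le_sum fun i hi => (l1_smul_le _ _).trans ?_
        have hi' : i ≤ d := Nat.lt_succ_iff.mp (Finset.mem_range.mp hi)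
        have h1 := l1_D3_iterate_le (hq.map (Int.castRingHom ℂ)) i
        rw [norm_pow, Complex.norm_natCast]
        gcongr
        · exact l1_nonneg _
        · exact (pow_le_pow_left₀ (Nat.cast_nonneg _) hu i).trans (pow_le_pow_right₀ hM hi')
        · refine h1.trans ?_
          gcongr
          exact (pow_le_pow_left₀ (Nat.cast_nonneg _) (by linarith) i).trans (pow_le_pow_right₀ hM hi')
    _ = ((d : ℝ) + 1) * (M ^ d * (M ^ d * l1 (map (Int.castRingHom ℂ) q))) := by
        rw [Finset.sum_const, Finset.card_range, nsmul_eq_mul]; push_cast; ring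
    _ ≤ M * (M ^ d * (M ^ d * l1 (map (Int.castRingHom ℂ) q))) := by gcongr
    _ = _ := by ring

lemma tnorm_jet_le_of_eval_le {S : ℕ} {x y : ℂ} {p : MvPolynomial (Fin 3) ℂ} {δ : ℝ} (hδ : 0 ≤ δ)
    (h : ∀ i < S, ‖eval ![1, x, y] ((D3 ℂ)^[i] p)‖ ≤ δ) : tnorm S (jet x y p) ≤ δ * 3 := by
  calc tnorm S (jet x y p) ≤ ∑ l ∈ Finset.range S, δ * ‖PowerSeries.coeff l (PowerSeries.exp ℂ)‖ := by
        refine Finset.sum_le_sum fun l hl => ?_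
        have h1 := h l (Finset.mem_range.mp hl)
        rw [← coeff_jet_mul_factorial, norm_mul, Complex.norm_natCast] at h1
        rw [norm_exp_coeff_le, mul_one_div, le_div_iff₀ (by positivity)]
        exact h1
    _ = δ * tnorm S (PowerSeries.exp ℂ) := by rw [tnorm, Finset.mul_sum]
    _ ≤ δ * 3 := mul_le_mul_of_nonneg_left (tnorm_exp_le S) hδ

lemma jet_X_two_mul (x y : ℂ) (hy : y ≠ 0) :
    jet x y (X 2) * (PowerSeries.C y⁻¹ * PowerSeries.evalNegHom (PowerSeries.exp ℂ)) = 1 := by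
  have h : jet x y (X 2) = PowerSeries.C y * PowerSeries.exp ℂ := by simp [jet]
  rw [h, mul_mul_mul_comm, ← map_mul, mul_inv_cancel₀ hy, map_one, one_mul,
    PowerSeries.exp_mul_exp_neg_eq_one]

lemma jet_cofactor (x y : ℂ) (hy : y ≠ 0) (a e : ℕ) (q : MvPolynomial (Fin 3) ℂ) :
    jet x y q = (PowerSeries.C y⁻¹ * PowerSeries.evalNegHom (PowerSeries.exp ℂ)) ^ e *
      jet x y (X 0 ^ a * X 2 ^ e * q) := by
  have h0 : jet x y (X 0) = 1 := by simp [jet]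
  have h2 := congrArg (· ^ e) (jet_X_two_mul x y hy)
  simp only [mul_pow, one_pow] at h2
  rw [map_mul, map_mul, map_pow, map_pow, h0, one_pow, one_mul, mul_pow]
  linear_combination (-(jet x y q)) * h2

lemma tnorm_evalNegHom_exp_le (T : ℕ) :
    tnorm T (PowerSeries.evalNegHom (PowerSeries.exp ℂ)) ≤ 3 := by
  refine le_trans (le_of_eq ?_) (tnorm_exp_le T)
  refine Finset.sum_congr rfl fun l _ => ?_
  rw [PowerSeries.evalNegHom, PowerSeries.coeff_rescale, norm_mul]
  simp

lemma tnorm_jet_cofactor_le (S : ℕ) {x y : ℂ} (hy : y ≠ 0) (a : ℕ) {e D : ℕ} (he : e ≤ D)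
    (q : MvPolynomial (Fin 3) ℂ) {M : ℝ} (hM : 1 ≤ M) (hyM : 3 * ‖y⁻¹‖ ≤ M) :
    tnorm S (jet x y q) ≤ M ^ D * tnorm S (jet x y (X 0 ^ a * X 2 ^ e * q)) := by
  rw [jet_cofactor x y hy a e q]
  refine (tnorm_mul_le _ _ _).trans (mul_le_mul_of_nonneg_right ?_ (tnorm_nonneg _ _))
  refine (tnorm_pow_le _ _ _).trans ((pow_le_pow_left₀ (tnorm_nonneg _ _) ?_ e).trans
    (pow_le_pow_right₀ hM he))
  rw [tnorm_C_mul]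
  refine le_trans ?_ hyM
  rw [mul_comm]
  exact mul_le_mul_of_nonneg_right (tnorm_evalNegHom_exp_le S) (norm_nonneg _)

lemma norm_coeff_iterate_derivative_le (f : PowerSeries ℂ) (i l : ℕ) :
    ‖PowerSeries.coeff l ((PowerSeries.derivative ℂ)^[i] f)‖ ≤
      ((l + i : ℕ) : ℝ) ^ i * ‖PowerSeries.coeff (l + i) f‖ := by
  have h := congrArg norm (coeff_iterate_derivative f i l)
  rw [norm_mul, norm_mul, Complex.norm_natCast, Complex.norm_natCast,
    ← Nat.factorial_mul_ascFactorial] at h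
  have h1 : ((l + 1).ascFactorial i : ℝ) ≤ ((l + i : ℕ) : ℝ) ^ i := by
    exact_mod_cast Nat.ascFactorial_le_pow_add l i
  have h2 : (0 : ℝ) < l.factorial := by positivity
  push_cast at h h1 ⊢
  have h3 : ‖PowerSeries.coeff l ((PowerSeries.derivative ℂ)^[i] f)‖ =
      (l + 1).ascFactorial i * ‖PowerSeries.coeff (l + i) f‖ := by
    have : (l.factorial : ℝ) ≠ 0 := h2.ne'
    field_simp at h ⊢
    linarith
  rw [h3]
  exact mul_le_mul_of_nonneg_right h1 (norm_nonneg _)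

lemma tnorm_iterate_derivative_le (T i : ℕ) (f : PowerSeries ℂ) :
    tnorm T ((PowerSeries.derivative ℂ)^[i] f) ≤ ((T + i : ℕ) : ℝ) ^ i * tnorm (T + i) f := by
  calc tnorm T ((PowerSeries.derivative ℂ)^[i] f)
      ≤ ∑ l ∈ Finset.range T, ((T + i : ℕ) : ℝ) ^ i * ‖PowerSeries.coeff (i + l) f‖ := by
        refine Finset.sum_le_sum fun l hl => (norm_coeff_iterate_derivative_le f i l).trans ?_
        rw [add_comm i l]
        have := Finset.mem_range.mp hl
        gcongr
    _ = ((T + i : ℕ) : ℝ) ^ i * ∑ l ∈ Finset.range T, ‖PowerSeries.coeff (i + l) f‖ := by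
        rw [Finset.mul_sum]
    _ ≤ _ := by
        refine mul_le_mul_of_nonneg_left ?_ (by positivity)
        rw [tnorm, add_comm T i, Finset.sum_range_add]
        have : 0 ≤ ∑ l ∈ Finset.range i, ‖PowerSeries.coeff l f‖ :=
          Finset.sum_nonneg fun _ _ => norm_nonneg _
        linarith

lemma tnorm_jet_derivSum_le {T d u : ℕ} (hd : d ≤ T) (x y : ℂ) (q : MvPolynomial (Fin 3) ℤ) {M : ℝ}
    (hM : 1 ≤ M) (hu : (u : ℝ) ≤ M) (hT : 2 * (T : ℝ) + 1 ≤ M) :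
    tnorm T (jet x y (map (Int.castRingHom ℂ) (derivSum d u q))) ≤
      M ^ (2 * d + 1) * tnorm (2 * T) (jet x y (map (Int.castRingHom ℂ) q)) := by
  rw [map_derivSum, map_sum]
  refine (tnorm_sum_le _ _ _).trans ?_
  set f := jet x y (map (Int.castRingHom ℂ) q)
  have hl := tnorm_nonneg (2 * T) f
  have hdM : (d : ℝ) + 1 ≤ M := by
    have : (d : ℝ) ≤ T := by exact_mod_cast hd
    have : (0 : ℝ) ≤ T := by positivity
    linarith
  calc ∑ i ∈ Finset.range (d + 1), tnorm T (jet x y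
        (((u : ℂ) ^ i) • (D3 ℂ)^[i] (map (Int.castRingHom ℂ) q)))
      ≤ ∑ i ∈ Finset.range (d + 1), M ^ d * (M ^ d * tnorm (2 * T) f) := by
        refine Finset.sum_le_sum fun i hi => ?_
        have hi' : i ≤ d := Nat.lt_succ_iff.mp (Finset.mem_range.mp hi)
        rw [map_smul, jet_D3_iterate, tnorm_smul, norm_pow, Complex.norm_natCast]
        gcongr
        · exact tnorm_nonneg _ _
        · exact (pow_le_pow_left₀ (Nat.cast_nonneg _) hu i).trans (pow_le_pow_right₀ hM hi')
        · refine (tnorm_iterate_derivative_le T i f).trans ?_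
          gcongr
          · exact tnorm_nonneg _ _
          · have h1 : ((T + i : ℕ) : ℝ) ≤ M := by
              have : ((T + i : ℕ) : ℝ) ≤ 2 * T := by exact_mod_cast (by omega)
              linarith
            exact (pow_le_pow_left₀ (Nat.cast_nonneg _) h1 i).trans (pow_le_pow_right₀ hM hi')
          · exact tnorm_mono (by omega) f
    _ = ((d : ℝ) + 1) * (M ^ d * (M ^ d * tnorm (2 * T) f)) := by
        rw [Finset.sum_const, Finset.card_range, nsmul_eq_mul]; push_cast; ring
    _ ≤ M * (M ^ d * (M ^ d * tnorm (2 * T) f)) := by gcongr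
    _ = _ := by ring

lemma coeff_jet_derivSum_eq_zero {T d u : ℕ} (hd : d ≤ T) (x y : ℂ) (q : MvPolynomial (Fin 3) ℤ)
    (h : ∀ t < 2 * T, PowerSeries.coeff t (jet x y (map (Int.castRingHom ℂ) q)) = 0) :
    ∀ t < T, PowerSeries.coeff t (jet x y (map (Int.castRingHom ℂ) (derivSum d u q))) = 0 := by
  intro t ht
  rw [map_derivSum, map_sum, map_sum]
  refine Finset.sum_eq_zero fun i hi => ?_
  have hi' : i ≤ d := Nat.lt_succ_iff.mp (Finset.mem_range.mp hi)
  rw [map_smul, jet_D3_iterate, map_smul]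
  have h1 := coeff_iterate_derivative (jet x y (map (Int.castRingHom ℂ) q)) i t
  rw [h _ (by omega), zero_mul] at h1
  rw [(mul_eq_zero.mp h1).resolve_right (Nat.cast_ne_zero.mpr (Nat.factorial_ne_zero t)), smul_zero]

lemma coeff_jet_cofactor_eq_zero {S : ℕ} {x y : ℂ} (hy : y ≠ 0) (a e : ℕ)
    (q : MvPolynomial (Fin 3) ℂ)
    (h : ∀ t < S, PowerSeries.coeff t (jet x y (X 0 ^ a * X 2 ^ e * q)) = 0) :
    ∀ t < S, PowerSeries.coeff t (jet x y q) = 0 := by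
  rw [← PowerSeries.X_pow_dvd_iff] at h ⊢
  rw [jet_cofactor x y hy a e q]
  exact Dvd.dvd.mul_left h _

lemma coeff_jet_eq_zero_of_eval {x y : ℂ} {p : MvPolynomial (Fin 3) ℂ} {t : ℕ}
    (h : eval ![1, x, y] ((D3 ℂ)^[t] p) = 0) : PowerSeries.coeff t (jet x y p) = 0 := by
  rw [← coeff_jet_mul_factorial] at h
  exact (mul_eq_zero.mp h).resolve_right (Nat.cast_ne_zero.mpr (Nat.factorial_ne_zero t))

end PairBounds

section Heights

open NumberField

variable {K : Type} [Field K] [NumberField K]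

lemma prod_embeddings_eq_prod_infinitePlace (f : InfinitePlace K → ℝ) :
    ∏ φ : K →+* ℂ, f (InfinitePlace.mk φ) = ∏ v : InfinitePlace K, f v ^ v.mult := by
  classical
  rw [← Finset.prod_fiberwise Finset.univ InfinitePlace.mk]
  refine Finset.prod_congr rfl fun v _ => ?_
  rw [← InfinitePlace.card_filter_mk_eq, ← Finset.prod_const]
  refine Finset.prod_congr rfl fun φ hφ => ?_
  rw [(Finset.mem_filter.mp hφ).2]

lemma norm_eq_iSup_norm_apply (w : Fin 3 → ℂ) : ‖w‖ = ⨆ i, ‖w i‖ := by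
  apply le_antisymm
  · obtain ⟨i, hi⟩ := exists_norm_apply_eq w
    rw [← hi]
    exact Finite.le_ciSup (fun i => ‖w i‖) i
  · exact ciSup_le fun i => norm_le_pi_norm w i

lemma prod_embeddings_mul_finprod_eq_one {x : K} (hx : x ≠ 0) :
    (∏ φ : K →+* ℂ, ‖φ x‖) * ∏ᶠ v : FinitePlace K, v x = 1 := by
  rw [← prod_abs_eq_one hx, ← prod_embeddings_eq_prod_infinitePlace (fun v => v x)]
  rfl

lemma mulHeight_eq_prod_embeddings {z : Fin 3 → K} (hz : z ≠ 0) :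
    Height.mulHeight z =
      (∏ φ : K →+* ℂ, ‖φ ∘ z‖) * ∏ᶠ v : FinitePlace K, ⨆ i, v (z i) := by
  rw [mulHeight_eq hz, ← prod_embeddings_eq_prod_infinitePlace (fun v => ⨆ i, v (z i))]
  congr 1
  exact Finset.prod_congr rfl fun φ _ => (norm_eq_iSup_norm_apply _).symm

lemma hasFiniteMulSupport_iSup_finitePlace {z : Fin 3 → K} (hz : z ≠ 0) :
    (fun v : FinitePlace K => ⨆ i, v (z i)).HasFiniteMulSupport := by
  have : Nonempty {j // z j ≠ 0} := nonempty_subtype.mpr <| Function.ne_iff.mp hz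
  suffices (fun v : FinitePlace K => ⨆ i : {j // z j ≠ 0}, v (z i)).HasFiniteMulSupport by
    convert! this with v
    obtain ⟨i, hi⟩ : ∃ j, z j ≠ 0 := Function.ne_iff.mp hz
    refine le_antisymm (ciSup_le fun j => ?_)
      (ciSup_le fun ⟨j, hj⟩ => Finite.le_ciSup_of_le j le_rfl)
    rcases eq_or_ne (z j) 0 with h | h
    · rw [h, map_zero]
      exact Real.iSup_nonneg' ⟨⟨i, hi⟩, apply_nonneg v _⟩
    · exact Finite.le_ciSup_of_le ⟨j, h⟩ le_rfl
  exact Function.HasFiniteMulSupport.iSup fun j => FinitePlace.hasFiniteMulSupport j.2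

lemma finitePlace_isNonarchimedean (v : FinitePlace K) : IsNonarchimedean v.val :=
  fun x y => FinitePlace.add_le v x y

lemma iSup_finitePlace_nonneg (v : FinitePlace K) (z : Fin 3 → K) : 0 ≤ ⨆ i, v (z i) :=
  Real.iSup_nonneg fun _ => apply_nonneg v _

lemma prod_norm_le_prod_norm_eval_mul_mulHeight {z : Fin 3 → K} (hz : z ≠ 0) {L : ℕ}
    {R : MvPolynomial (Fin 3) ℤ} (hR : R.IsHomogeneous L)
    (hne : eval z (map (Int.castRingHom K) R) ≠ 0) :
    ∏ φ : K →+* ℂ, ‖φ ∘ z‖ ^ L ≤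
      (∏ φ : K →+* ℂ, ‖eval (φ ∘ z) (map (Int.castRingHom ℂ) R)‖) * Height.mulHeight z ^ L := by
  have h1 := prod_embeddings_mul_finprod_eq_one hne
  have h2 : ∏ᶠ v : FinitePlace K, v (eval z (map (Int.castRingHom K) R)) ≤
      (∏ᶠ v : FinitePlace K, ⨆ i, v (z i)) ^ L := by
    rw [finprod_pow (hasFiniteMulSupport_iSup_finitePlace hz)]
    refine finprod_le_finprod (FinitePlace.hasFiniteMulSupport hne) (fun v => apply_nonneg v _)
      ((hasFiniteMulSupport_iSup_finitePlace hz).pow L) fun v => ?_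
    refine (IsNonarchimedean.eval_mvPolynomial_le (finitePlace_isNonarchimedean v)
      (hR.map _) z).trans ?_
    refine mul_le_of_le_one_left (pow_nonneg (iSup_finitePlace_nonneg v z) _) ?_
    refine Real.iSup_le (fun s => ?_) zero_le_one
    rw [coeff_map]
    exact (finitePlace_isNonarchimedean v).apply_intCast_le_one
  have h3 : ∀ φ : K →+* ℂ, ‖φ (eval z (map (Int.castRingHom K) R))‖ =
      ‖eval (φ ∘ z) (map (Int.castRingHom ℂ) R)‖ := by
    intro φ
    rw [map_eval_eq, map_map]
    exact congrArg (fun f : ℤ →+* ℂ => ‖eval (φ ∘ z) (map f R)‖) (RingHom.ext_int _ _)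
  simp only [h3] at h1
  rw [mulHeight_eq_prod_embeddings hz, mul_pow, Finset.prod_pow]
  have h4 : 0 ≤ (∏ φ : K →+* ℂ, ‖φ ∘ z‖) ^ L :=
    pow_nonneg (Finset.prod_nonneg fun _ _ => norm_nonneg _) _
  calc _ = (∏ φ : K →+* ℂ, ‖φ ∘ z‖) ^ L *
      ((∏ φ : K →+* ℂ, ‖eval (φ ∘ z) (map (Int.castRingHom ℂ) R)‖) *
        ∏ᶠ v : FinitePlace K, v (eval z (map (Int.castRingHom K) R))) := by rw [h1, mul_one]
    _ ≤ (∏ φ : K →+* ℂ, ‖φ ∘ z‖) ^ L *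
      ((∏ φ : K →+* ℂ, ‖eval (φ ∘ z) (map (Int.castRingHom ℂ) R)‖) *
        (∏ᶠ v : FinitePlace K, ⨆ i, v (z i)) ^ L) := by
        refine mul_le_mul_of_nonneg_left (mul_le_mul_of_nonneg_left h2 ?_) h4
        exact Finset.prod_nonneg fun _ _ => norm_nonneg _
    _ = _ := by ring

lemma prod_mulHeight_le {n : ℕ} {κ : K} (hκ : κ ≠ 0) {Z : Fin n → Fin 3 → K} (hZ : ∀ i, Z i ≠ 0)
    {L : ℕ} {B : ℝ}
    (hfin : ∀ v : FinitePlace K, v κ * ∏ k, (⨆ i, v (Z k i)) ^ L ≤ 1)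
    (hinf : ∀ φ : K →+* ℂ, ‖φ κ‖ * ∏ k, ‖φ ∘ Z k‖ ^ L ≤ B) :
    ∏ k, Height.mulHeight (Z k) ^ L ≤ B ^ Module.finrank ℚ K := by
  have hs : ∀ k, (fun v : FinitePlace K => (⨆ i, v (Z k i)) ^ L).HasFiniteMulSupport :=
    fun k => (hasFiniteMulSupport_iSup_finitePlace (hZ k)).pow L
  have hs' : (fun v : FinitePlace K => ∏ k, (⨆ i, v (Z k i)) ^ L).HasFiniteMulSupport :=
    Function.HasFiniteMulSupport.prod (fun k => hs k) _
  have h1 : (∏ᶠ v : FinitePlace K, v κ) * ∏ k, (∏ᶠ v : FinitePlace K, ⨆ i, v (Z k i)) ^ L ≤ 1 := by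
    have : ∏ k, (∏ᶠ v : FinitePlace K, ⨆ i, v (Z k i)) ^ L =
        ∏ᶠ v : FinitePlace K, ∏ k, (⨆ i, v (Z k i)) ^ L := by
      rw [finprod_prod_comm _ _ fun k _ => hs k]
      exact Finset.prod_congr rfl fun k _ => finprod_pow (hasFiniteMulSupport_iSup_finitePlace (hZ k)) L
    rw [this, ← finprod_mul_distrib (FinitePlace.hasFiniteMulSupport hκ) hs']
    rw [← finprod_one (α := FinitePlace K)]
    refine finprod_le_finprod ((FinitePlace.hasFiniteMulSupport hκ).mul hs') (fun v => ?_)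
      (by fun_prop) hfin
    exact mul_nonneg (apply_nonneg v _) (Finset.prod_nonneg fun k _ =>
      pow_nonneg (iSup_finitePlace_nonneg v _) _)
  have h2 : (∏ φ : K →+* ℂ, ‖φ κ‖) * ∏ k, (∏ φ : K →+* ℂ, ‖φ ∘ Z k‖) ^ L ≤
      B ^ Module.finrank ℚ K := by
    have : ∏ k, (∏ φ : K →+* ℂ, ‖φ ∘ Z k‖) ^ L = ∏ φ : K →+* ℂ, ∏ k, ‖φ ∘ Z k‖ ^ L := by
      rw [Finset.prod_comm]
      exact Finset.prod_congr rfl fun k _ => (Finset.prod_pow _ _ _).symm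
    rw [this, ← Finset.prod_mul_distrib, ← Embeddings.card K ℂ, ← Finset.card_univ,
      ← Finset.prod_const]
    exact Finset.prod_le_prod (fun φ _ => by positivity) fun φ _ => hinf φ
  calc ∏ k, Height.mulHeight (Z k) ^ L
      = ((∏ φ : K →+* ℂ, ‖φ κ‖) * ∏ k, (∏ φ : K →+* ℂ, ‖φ ∘ Z k‖) ^ L) *
        ((∏ᶠ v : FinitePlace K, v κ) * ∏ k, (∏ᶠ v : FinitePlace K, ⨆ i, v (Z k i)) ^ L) := by
        rw [mul_mul_mul_comm, prod_embeddings_mul_finprod_eq_one hκ, one_mul,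
          ← Finset.prod_mul_distrib]
        refine Finset.prod_congr rfl fun k _ => ?_
        rw [mulHeight_eq_prod_embeddings (hZ k), mul_pow]
    _ ≤ B ^ Module.finrank ℚ K * 1 := by
        refine mul_le_mul h2 h1 ?_ (le_trans ?_ h2)
        · refine mul_nonneg (finprod_nonneg fun v => apply_nonneg v _)
            (Finset.prod_nonneg fun k _ => pow_nonneg (finprod_nonneg fun v =>
              iSup_finitePlace_nonneg v _) _)
        · positivity
    _ = _ := mul_one _

end Heights

section Resultant

/-- The quadratic polynomial `z₀ + z₁ t + z₂ t²`. -/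
noncomputable def quad {R : Type*} [CommRing R] (z : Fin 3 → R) : Polynomial R :=
  .C (z 0) + .C (z 1) * .X + .C (z 2) * .X ^ 2

lemma coeff_quad {R : Type*} [CommRing R] (z : Fin 3 → R) (i : Fin 3) :
    (quad z).coeff i = z i := by
  fin_cases i <;> simp [quad, Polynomial.coeff_X, Polynomial.coeff_C,
    Polynomial.coeff_X_pow]

lemma natDegree_quad_le {R : Type*} [CommRing R] (z : Fin 3 → R) : (quad z).natDegree ≤ 2 := by
  unfold quad
  compute_degree

lemma norm_le_two_mul_mahlerMeasure_quad (z : Fin 3 → ℂ) : ‖z‖ ≤ 2 * (quad z).mahlerMeasure := by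
  obtain ⟨i, hi⟩ := exists_norm_apply_eq z
  rw [← hi, ← coeff_quad z i]
  refine ((quad z).norm_coeff_le_choose_mul_mahlerMeasure i).trans ?_
  refine mul_le_mul_of_nonneg_right ?_ (Polynomial.mahlerMeasure_nonneg _)
  have h : (quad z).natDegree.choose (i : ℕ) ≤ 2 :=
    (Nat.choose_le_choose _ (natDegree_quad_le z)).trans (by fin_cases i <;> decide)
  exact_mod_cast h

lemma mul_prod_norm_le_of_norm_eval_le {n L : ℕ} (κ : ℂ) (Z : Fin n → Fin 3 → ℂ) {B : ℝ}
    (h : ∀ t : ℂ, ‖t‖ = 1 → ‖κ * ∏ k, (quad (Z k)).eval t ^ L‖ ≤ B) :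
    ‖κ‖ * ∏ k, ‖Z k‖ ^ L ≤ 2 ^ (n * L) * B := by
  obtain ⟨t, ht, h1⟩ := exists_mahlerMeasure_le_norm_eval
    (Polynomial.C κ * ∏ k, quad (Z k) ^ L)
  rw [Polynomial.mahlerMeasure_mul, mahlerMeasure_finset_prod, Polynomial.mahlerMeasure_const,
    Polynomial.eval_mul, Polynomial.eval_C, Polynomial.eval_prod] at h1
  simp only [Polynomial.eval_pow] at h1
  have h2 := h1.trans (h t ht)
  calc ‖κ‖ * ∏ k, ‖Z k‖ ^ L ≤ ‖κ‖ * ∏ k, (2 ^ L * (quad (Z k) ^ L).mahlerMeasure) := by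
        refine mul_le_mul_of_nonneg_left (Finset.prod_le_prod (fun k _ => by positivity)
          fun k _ => ?_) (norm_nonneg _)
        have : (quad (Z k) ^ L).mahlerMeasure = (quad (Z k)).mahlerMeasure ^ L := by
          rw [← Fin.prod_const, mahlerMeasure_finset_prod, Fin.prod_const]
        rw [this, ← mul_pow]
        exact pow_le_pow_left₀ (norm_nonneg _) (norm_le_two_mul_mahlerMeasure_quad _) _
    _ = 2 ^ (n * L) * (‖κ‖ * ∏ k, (quad (Z k) ^ L).mahlerMeasure) := by
        rw [Finset.prod_mul_distrib, Fin.prod_const, ← pow_mul, mul_comm L n]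
        ring
    _ ≤ _ := by gcongr

lemma mul_prod_iSup_le_one {K : Type} [Field K] {v : AbsoluteValue K ℝ} (hv : IsNonarchimedean v)
    {n L : ℕ} (κ : K) (Z : Fin n → Fin 3 → K) (g : Polynomial ℤ)
    (hg : g.map (Int.castRingHom K) = Polynomial.C κ * ∏ k, quad (Z k) ^ L) :
    v κ * ∏ k, (⨆ i, v (Z k i)) ^ L ≤ 1 := by
  have hmul := Polynomial.gaussNorm_mul (v := v) hv one_pos
  have hpow : ∀ (p : Polynomial K) (m : ℕ), (p ^ m).gaussNorm v 1 = p.gaussNorm v 1 ^ m := by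
    intro p m
    induction m with
    | zero => rw [pow_zero, pow_zero, ← Polynomial.C_1, Polynomial.gaussNorm_C, map_one]
    | succ m ih => rw [pow_succ, hmul, ih, pow_succ]
  have hprod : ∀ s : Finset (Fin n), (∏ k ∈ s, quad (Z k) ^ L).gaussNorm v 1 =
      ∏ k ∈ s, (quad (Z k)).gaussNorm v 1 ^ L := by
    classical
    intro s
    induction s using Finset.induction_on with
    | empty => rw [Finset.prod_empty, Finset.prod_empty, ← Polynomial.C_1, Polynomial.gaussNorm_C,
        map_one]
    | insert a s ha ih => rw [Finset.prod_insert ha, Finset.prod_insert ha, hmul, ih, hpow]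
  have h1 : (g.map (Int.castRingHom K)).gaussNorm v 1 ≤ 1 := by
    obtain ⟨i, hi⟩ := Polynomial.exists_eq_gaussNorm v 1 (g.map (Int.castRingHom K))
    rw [hi, one_pow, mul_one, Polynomial.coeff_map]
    exact hv.apply_intCast_le_one
  rw [hg, hmul, hprod, Polynomial.gaussNorm_C] at h1
  refine le_trans (mul_le_mul_of_nonneg_left (Finset.prod_le_prod (fun k _ => ?_) fun k _ => ?_)
    (v.nonneg _)) h1
  · exact pow_nonneg (Real.iSup_nonneg fun _ => v.nonneg _) _
  · refine pow_le_pow_left₀ (Real.iSup_nonneg fun _ => v.nonneg _) (ciSup_le fun i => ?_) _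
    have := (quad (Z k)).le_gaussNorm v zero_le_one i
    rwa [coeff_quad, one_pow, mul_one] at this

end Resultant

lemma norm_det_le_factorial_mul_pow {ι : Type*} [Fintype ι] [DecidableEq ι] (M : Matrix ι ι ℂ)
    {A : ℝ} (h : ∀ i j, ‖M i j‖ ≤ A) :
    ‖M.det‖ ≤ (Fintype.card ι).factorial * A ^ Fintype.card ι := by
  have := Matrix.det_le (A := M) (abv := NormedField.toAbsoluteValue ℂ) (x := A) h
  rwa [nsmul_eq_mul] at this

section

variable {k : Type} [Field k] {P Q : MvPolynomial (Fin 3) ℤ} {d E : ℕ}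
  {Z : Fin (d ^ 2) → Fin 3 → k}

lemma norm_linForm_eval_le {u : ℂ} {B : ℝ} (hB : 1 + ‖u‖ + ‖u‖ ^ 2 ≤ B) (z : Fin 3 → ℂ) :
    ‖eval z (linForm u)‖ ≤ B * ‖z‖ := by
  have h : eval z (linForm u) = z 0 + u * z 1 + u ^ 2 * z 2 := by simp [linForm]
  rw [h]
  calc _ ≤ ‖z 0‖ + ‖u‖ * ‖z 1‖ + ‖u‖ ^ 2 * ‖z 2‖ := by
        refine (norm_add₃_le).trans_eq ?_
        rw [norm_mul, norm_mul, norm_pow]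
    _ ≤ ‖z‖ + ‖u‖ * ‖z‖ + ‖u‖ ^ 2 * ‖z‖ := by
        gcongr <;> exact norm_le_pi_norm z _
    _ = (1 + ‖u‖ + ‖u‖ ^ 2) * ‖z‖ := by ring
    _ ≤ _ := by gcongr

lemma MacaulayData.one_le_mul_prod_norm [CharZero k] (mac : MacaulayData P Q d E Z) (hZ : ∀ i, Z i ≠ 0)
    (σ : k →+* ℂ) {B : ℝ} (hB : 3 * (2 * (d : ℝ) ^ 2 + 1) ^ 2 ≤ B) :
    1 ≤ B ^ (d ^ 2 * E) * (‖(mac.κ : ℂ)‖ * ∏ i, ‖σ ∘ Z i‖ ^ E) := by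
  obtain ⟨u, hu, hne⟩ := exists_nat_linForm_ne_zero Z hZ
  rw [Fintype.card_fin] at hu
  have hhom : ((linForm (u : ℤ)) ^ E).IsHomogeneous E := by
    have := (linForm_isHomogeneous (u : ℤ)).pow E
    rwa [one_mul] at this
  have hmap : ∀ {S : Type} [CommRing S],
      map (Int.castRingHom S) ((linForm (u : ℤ)) ^ E) = linForm (u : S) ^ E := by
    intro S _
    simp [linForm]
  have h1 := mac.det_eq k (RingHom.id k) _ (hhom.map (Int.castRingHom k))
  have h2 := mac.det_eq ℂ σ _ (hhom.map (Int.castRingHom ℂ))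
  rw [map_macDet] at h1 h2
  set g : ℤ := macDet mac.w mac.h (fun j => (mac.e j : Fin 3 →₀ ℕ)) ((linForm (u : ℤ)) ^ E)
  have hg : g ≠ 0 := by
    intro h0
    rw [h0, map_zero] at h1
    refine mul_ne_zero (Int.cast_ne_zero.mpr mac.κ_ne_zero)
      (Finset.prod_ne_zero_iff.mpr fun i _ => ?_) h1.symm
    rw [hmap, map_pow]
    refine pow_ne_zero _ ?_
    simpa [linForm] using hne i
  have h3 : (1 : ℝ) ≤ ‖(g : ℂ)‖ := by
    rw [Complex.norm_intCast]
    exact_mod_cast Int.one_le_abs hg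
  rw [eq_intCast] at h2
  rw [h2, norm_mul, norm_prod] at h3
  have hu' : ‖(u : ℂ)‖ ≤ 2 * (d : ℝ) ^ 2 := by
    rw [Complex.norm_natCast]
    exact_mod_cast hu
  have hB' : 1 + ‖(u : ℂ)‖ + ‖(u : ℂ)‖ ^ 2 ≤ B := by
    refine le_trans ?_ hB
    have := norm_nonneg (u : ℂ)
    nlinarith
  refine h3.trans ?_
  calc _ ≤ ‖(mac.κ : ℂ)‖ * ∏ i, (B ^ E * ‖σ ∘ Z i‖ ^ E) := by
        gcongr with i
        rw [hmap, map_pow, norm_pow, ← mul_pow]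
        exact pow_le_pow_left₀ (norm_nonneg _) (norm_linForm_eval_le hB' _) _
    _ = _ := by
        rw [Finset.prod_mul_distrib, Fin.prod_const, ← pow_mul, mul_comm E]
        ring

lemma MacaulayData.l1_macRow_le (mac : MacaulayData P Q d E Z) {A : ℝ}
    (hPA : l1 (map (Int.castRingHom ℂ) P) ≤ A) (hQA : l1 (map (Int.castRingHom ℂ) Q) ≤ A)
    {R : MvPolynomial (Fin 3) ℂ} (hRA : l1 R ≤ A) (i) : l1 (macRow mac.w mac.h R i) ≤ A := by
  have hl1mul : ∀ (m : Fin 3 →₀ ℕ) (p : MvPolynomial (Fin 3) ℂ), l1 p ≤ A →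
      l1 (monomial m 1 * p) ≤ A := fun m p hp => by
    refine (l1_mul_le _ _).trans ?_
    rwa [l1_monomial, norm_one, one_mul]
  rcases i with i | i
  · obtain ⟨m, hm, h1⟩ := mac.hw i
    simp only [macRow, Sum.elim_inl]
    rcases h1 with h1 | h1
    · rw [h1, map_mul, map_monomial, map_one]
      exact hl1mul _ _ hPA
    · rw [h1, map_mul, map_monomial, map_one]
      exact hl1mul _ _ hQA
  · simp only [macRow, Sum.elim_inr]
    rw [mul_comm]
    exact hl1mul _ _ hRA

lemma l1_pow_le (p : MvPolynomial (Fin 3) ℂ) (n : ℕ) : l1 (p ^ n) ≤ l1 p ^ n := by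
  induction n with
  | zero => simpa using l1_one_le
  | succ n ih =>
    rw [pow_succ, pow_succ]
    exact (l1_mul_le _ _).trans (mul_le_mul_of_nonneg_right ih (l1_nonneg _))

lemma l1_linForm_le {u : ℂ} (hu : ‖u‖ = 1) : l1 (linForm u) ≤ 3 := by
  have h : ∀ (c : ℂ) (i : Fin 3), ‖c‖ = 1 → l1 (C c * X i) ≤ 1 := fun c i hc => by
    rw [C_mul_X_eq_monomial, l1_monomial, hc]
  have h0 : l1 (X 0) ≤ 1 := by simpa using h 1 0 norm_one
  have h1 := h u 1 hu
  have h2 := h (u ^ 2) 2 (by rw [norm_pow, hu, one_pow])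
  have h3 := l1_add_le (X 0 + C u * X 1) (C (u ^ 2) * X 2)
  have h4 := l1_add_le (X 0) (C u * X 1)
  unfold linForm
  linarith

lemma MacaulayData.prod_mulHeight_le (mac : MacaulayData P Q d E Z) (hZ : ∀ i, Z i ≠ 0) {A : ℝ}
    (hPA : l1 (map (Int.castRingHom ℂ) P) ≤ A) (hQA : l1 (map (Int.castRingHom ℂ) Q) ≤ A)
    (hA : 3 ^ E ≤ A) {K : Type} [Field K] [NumberField K] (ι : K →+* k)
    {Y : Fin (d ^ 2) → Fin 3 → K} (hY : ∀ i, ι ∘ Y i = Z i) :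
    ∏ i, Height.mulHeight (Y i) ^ E ≤ (2 ^ (d ^ 2 * E) * (((d + d + E + 2).choose 2).factorial *
      A ^ (d + d + E + 2).choose 2)) ^ Module.finrank ℚ K := by
  have hhom : ((linForm (Polynomial.X : Polynomial ℤ)) ^ E).IsHomogeneous E := by
    have := (linForm_isHomogeneous (Polynomial.X : Polynomial ℤ)).pow E
    rwa [one_mul] at this
  set G : Polynomial ℤ := macDet mac.w mac.h (fun j => (mac.e j : Fin 3 →₀ ℕ))
    ((linForm (Polynomial.X : Polynomial ℤ)) ^ E) with hG
  have hGk : G.map (Int.castRingHom k) =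
      Polynomial.C (mac.κ : k) * ∏ i, quad (Z i) ^ E := by
    have h1 := mac.det_eq (Polynomial k) Polynomial.C _
      (hhom.map (Polynomial.mapRingHom (Int.castRingHom k)))
    rw [map_macDet, ← hG] at h1
    rw [← Polynomial.coe_mapRingHom, h1]
    refine congrArg₂ (· * ·) (by simp) (Finset.prod_congr rfl fun i _ => ?_)
    simp only [linForm, quad, map_pow, map_add, map_mul, map_X, map_C, eval_X, eval_C,
      Function.comp_apply, Polynomial.coe_mapRingHom, Polynomial.map_X]
    ring
  have hquad : ∀ {S S' : Type} [CommRing S] [CommRing S'] (f : S →+* S') (z : Fin 3 → S),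
      (quad z).map f = quad (f ∘ z) := by
    intro S S' _ _ f z
    simp [quad]
  have hGK : G.map (Int.castRingHom K) =
      Polynomial.C (mac.κ : K) * ∏ i, quad (Y i) ^ E := by
    apply Polynomial.map_injective ι ι.injective
    rw [Polynomial.map_map, (RingHom.ext_int _ _ : ι.comp (Int.castRingHom K) = Int.castRingHom k),
      hGk, Polynomial.map_mul, Polynomial.map_prod, Polynomial.map_C]
    simp only [Polynomial.map_pow, hquad, hY, map_intCast]
  have hY0 : ∀ i, Y i ≠ 0 := fun i h => hZ i (by rw [← hY i, h]; ext j; simp)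
  refine _root_.prod_mulHeight_le (κ := (mac.κ : K)) (Int.cast_ne_zero.mpr mac.κ_ne_zero) hY0
    (fun v => mul_prod_iSup_le_one (finitePlace_isNonarchimedean v) _ Y G hGK) fun φ => ?_
  refine mul_prod_norm_le_of_norm_eval_le _ (fun i => φ ∘ Y i) fun t ht => ?_
  have h1 : φ (mac.κ : K) * ∏ i, (quad (φ ∘ Y i)).eval t ^ E =
      macDet mac.w mac.h (fun j => (mac.e j : Fin 3 →₀ ℕ)) (linForm t ^ E) := by
    have h2 := congrArg (fun p => (p.map φ).eval t) hGK
    simp only [Polynomial.map_map, Polynomial.map_mul, Polynomial.map_prod, Polynomial.map_pow,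
      Polynomial.map_C, hquad, Polynomial.eval_mul, Polynomial.eval_prod, Polynomial.eval_pow,
      Polynomial.eval_C] at h2
    rw [← h2, (RingHom.ext_int _ _ : φ.comp (Int.castRingHom K) = Int.castRingHom ℂ), hG,
      Polynomial.eval_map, ← Polynomial.coe_eval₂RingHom, ← map_macDet]
    congr 1
    simp [linForm]
  rw [h1, macDet, ← mac.card_eq]
  refine norm_det_le_factorial_mul_pow _ fun i j => ?_
  refine (norm_coeff_le_l1 _ _).trans (mac.l1_macRow_le hPA hQA ?_ i)
  exact ((l1_pow_le _ _).trans (pow_le_pow_left₀ (l1_nonneg _) (l1_linForm_le ht) _)).trans hA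

end

section

variable {k : Type} [Field k] {P Q : MvPolynomial (Fin 3) ℤ} {d D : ℕ}
  {Z : Fin (d ^ 2) → Fin 3 → k}

lemma MacaulayData.exists_prod_norm_mul_prox_le (mac : MacaulayData P Q d D Z)
    (hPd : P.IsHomogeneous d) (hQd : Q.IsHomogeneous d) (σ : k →+* ℂ)
    {x y : ℂ} (hy : y ≠ 0) {a b T : ℕ} (ha : 1 ≤ a) (hb : 1 ≤ b) (hT : T ≤ a * b) (hL : a + b ≤ D)
    (hdD : d ≤ D)
    {c M H ε : ℝ} (hc : 1 ≤ c) (hx : ‖x‖ + 1 ≤ c) (hyc : ‖y⁻¹‖ ≤ c) (hyc3 : 3 * ‖y‖ ≤ c)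
    (hM : 3 ≤ M) (hMab : (a * b : ℝ) + 2 ≤ M) (hcM : c ≤ M) (hMD : (D : ℝ) ≤ M)
    (hMN : ((D + 2).choose 2 + 1 : ℝ) ≤ M) (hH : 1 ≤ H)
    (hPA : l1 (map (Int.castRingHom ℂ) P) ≤ H) (hQA : l1 (map (Int.castRingHom ℂ) Q) ≤ H)
    (hε : 0 < ε) (hε1 : ε ≤ 1)
    (hPδ : tnorm T (jet x y (map (Int.castRingHom ℂ) P)) ≤ ε)
    (hQδ : tnorm T (jet x y (map (Int.castRingHom ℂ) Q)) ≤ ε) :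
    ‖(mac.κ : ℂ)‖ * ∏ i, (‖σ ∘ Z i‖ ^ D * prox x y T ε (σ ∘ Z i)) ≤
      (M ^ (11 * (a * b) + 3 * D + 8)) ^ d ^ 2 * ((ε * M ^ (3 * D + 1)) ^ T *
      (((d + d + D + 2).choose 2 + T).factorial *
      (H * M ^ (9 * (a * b) + 3 * D + 4)) ^ ((d + d + D + 2).choose 2 + T))) := by
  classical
  have hyc' : ‖y‖ ≤ c := by linarith [norm_nonneg y]
  obtain ⟨R, hRh, hRε, hRl, hR⟩ :=
    exists_probe_family hy ha hb hT hL hc hx hyc' hyc hM hMab hMD hε hε1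
  have hM1 : 1 ≤ M := by linarith
  have hM0 : 0 < M := by linarith
  obtain ⟨v, hv, htor⟩ := exists_torus_max Finset.univ Finset.univ
    (fun i o => eval (σ ∘ Z i) (R o)) 0 (fun _ => le_rfl)
  set C1 : ℝ := M ^ (11 * (a * b) + 3 * D + 8) with hC1
  have hC1pos : 0 < C1 := by positivity
  have hC1le : 4 * (2 * c) ^ D * M ^ (8 * (a * b) + 3 * T + D + 6) ≤ C1 := by
    have h2c : (2 * c) ^ D ≤ (M ^ 2) ^ D :=
      pow_le_pow_left₀ (by linarith) (by nlinarith) _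
    calc _ ≤ M ^ 2 * (M ^ 2) ^ D * M ^ (8 * (a * b) + 3 * T + D + 6) := by
          gcongr; nlinarith
      _ = M ^ (2 + 2 * D + (8 * (a * b) + 3 * T + D + 6)) := by
          rw [← pow_mul, ← pow_add, ← pow_add]
      _ ≤ _ := pow_le_pow_right₀ hM1 (by omega)
  set b' : Fin (d ^ 2) → ℝ := fun i => ‖σ ∘ Z i‖ ^ D * prox x y T ε (σ ∘ Z i) / C1 with hb'
  have hprox : ∀ z, 0 ≤ prox x y T ε z := fun z => hε.le.trans (le_prox x y T hε1 hε.le z)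
  have h1 := htor b' (fun i => by have := hprox (σ ∘ Z i); positivity) fun i => by
    obtain ⟨o, ho⟩ := hR (σ ∘ Z i)
    refine Or.inr ⟨o, Finset.mem_univ _, ?_⟩
    rw [hb', div_le_iff₀ hC1pos, mul_comm _ C1]
    exact ho.trans (by gcongr)
  set Ra : MvPolynomial (Fin 3) ℂ := ∑ o, v o • R o with hRa
  have hRah : Ra.IsHomogeneous D := by
    refine IsHomogeneous.sum _ _ _ fun o _ => ?_
    rw [smul_eq_C_mul]
    simpa using (isHomogeneous_C (Fin 3) (v o)).mul (hRh o)
  have hev : ∀ i, ∑ o, v o * eval (σ ∘ Z i) (R o) = eval (σ ∘ Z i) Ra := by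
    intro i
    simp only [hRa, map_sum, smul_eval]
  have hcard : (Fintype.card (Option (Mon D)) : ℝ) ≤ M := by
    rw [Fintype.card_option, card_Mon]
    push_cast
    exact hMN
  have hcD : c ^ D ≤ M ^ D := pow_le_pow_left₀ (by linarith) hcM _
  have hcL : c ^ (d + d + D) ≤ M ^ (3 * D) :=
    (pow_le_pow_left₀ (by linarith) hcM _).trans (pow_le_pow_right₀ hM1 (by omega))
  have hRal : l1 Ra ≤ H * M ^ (9 * (a * b) + 3 * D + 4) := by
    calc l1 Ra ≤ ∑ o, l1 (v o • R o) := l1_sum_le _ _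
      _ ≤ ∑ o : Option (Mon D), M ^ D * M ^ (8 * (a * b) + T + 3) := by
          refine Finset.sum_le_sum fun o _ => (l1_smul_le _ _).trans ?_
          rw [hv, one_mul]
          exact (hRl o).trans (by gcongr)
      _ = Fintype.card (Option (Mon D)) * (M ^ D * M ^ (8 * (a * b) + T + 3)) := by
          rw [Finset.sum_const, nsmul_eq_mul, Finset.card_univ]
      _ ≤ M * (M ^ D * M ^ (8 * (a * b) + T + 3)) := by gcongr
      _ = M ^ (1 + D + (8 * (a * b) + T + 3)) := by ring
      _ ≤ M ^ (9 * (a * b) + 3 * D + 4) := pow_le_pow_right₀ hM1 (by omega)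
      _ ≤ _ := le_mul_of_one_le_left (by positivity) hH
  have hRat : tnorm T (jet x y Ra) ≤ ε * M := by
    calc tnorm T (jet x y Ra) = tnorm T (∑ o, v o • jet x y (R o)) := by
          rw [hRa, map_sum]; simp only [map_smul]
      _ ≤ ∑ o, tnorm T (v o • jet x y (R o)) := tnorm_sum_le _ _ _
      _ ≤ ∑ o : Option (Mon D), ε := by
          refine Finset.sum_le_sum fun o _ => ?_
          refine (tnorm_smul _ _ _).le.trans ?_
          rw [hv, one_mul]
          exact hRε o
      _ = Fintype.card (Option (Mon D)) * ε := by
          rw [Finset.sum_const, nsmul_eq_mul, Finset.card_univ]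
      _ ≤ _ := by rw [mul_comm]; gcongr
  have hHA : H ≤ H * M ^ (9 * (a * b) + 3 * D + 4) :=
    le_mul_of_one_le_right (by linarith) (one_le_pow₀ hM1)
  have hδ' : ∀ {s : ℝ}, s ≤ ε → s * c ^ (d + d + D) ≤ ε * M ^ (3 * D + 1) := by
    intro s hs
    calc s * c ^ (d + d + D) ≤ ε * M ^ (3 * D) := by gcongr
      _ ≤ _ := by
        refine mul_le_mul_of_nonneg_left (pow_le_pow_right₀ hM1 (by omega)) hε.le
  have h2 := mac.norm_prod_eval_le hPd hQd σ hRah hy ha hT (by omega) hc hx hyc hyc3 hM hMab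
    (A := H * M ^ (9 * (a * b) + 3 * D + 4)) (δ := ε * M ^ (3 * D + 1)) (hH.trans hHA)
    (by
      calc M ^ (8 * (a * b) + 1) * c ^ (d + d + D) ≤ M ^ (8 * (a * b) + 1) * M ^ (3 * D) := by gcongr
        _ = M ^ (8 * (a * b) + 1 + 3 * D) := by rw [← pow_add]
        _ ≤ M ^ (9 * (a * b) + 3 * D + 4) := pow_le_pow_right₀ hM1 (by omega)
        _ ≤ _ := le_mul_of_one_le_left (by positivity) hH)
    (hPA.trans hHA) (hQA.trans hHA) hRal (by positivity) (hδ' hPδ) (hδ' hQδ)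
    (by
      calc tnorm T (jet x y Ra) * c ^ (d + d + D) ≤ ε * M * M ^ (3 * D) := by gcongr
        _ = _ := by ring)
  rw [norm_mul, norm_prod] at h2
  have h3 : ∏ i, b' i ≤ ∏ i, ‖eval (σ ∘ Z i) Ra‖ := by
    refine h1.trans_eq (Finset.prod_congr rfl fun i _ => ?_)
    rw [hev, Pi.zero_apply, max_eq_right (norm_nonneg _)]
  have h4 : ∏ i, (‖σ ∘ Z i‖ ^ D * prox x y T ε (σ ∘ Z i)) = C1 ^ d ^ 2 * ∏ i, b' i := by
    rw [hb', Finset.prod_div_distrib, Fin.prod_const]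
    field_simp
  rw [h4]
  calc _ = C1 ^ d ^ 2 * (‖(mac.κ : ℂ)‖ * ∏ i, b' i) := by ring
    _ ≤ C1 ^ d ^ 2 * (‖(mac.κ : ℂ)‖ * ∏ i, ‖eval (σ ∘ Z i) Ra‖) := by gcongr
    _ ≤ _ := by gcongr

lemma choose_two_le {d D : ℕ} (hd : d ≤ D) (hD : 1 ≤ D) : (d + d + D + 2).choose 2 ≤ 10 * D ^ 2 := by
  refine (Nat.choose_le_choose 2 (by omega : d + d + D + 2 ≤ 3 * D + 2)).trans ?_
  rw [Nat.choose_two_right]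
  refine Nat.div_le_of_le_mul ?_
  have : 3 * D + 2 - 1 = 3 * D + 1 := by omega
  rw [this]
  nlinarith

lemma MacaulayData.prod_prox_le [CharZero k] (mac : MacaulayData P Q d D Z) (hZ : ∀ i, Z i ≠ 0)
    (hPd : P.IsHomogeneous d) (hQd : Q.IsHomogeneous d) (σ : k →+* ℂ)
    {x y : ℂ} (hy : y ≠ 0) {a b T : ℕ} (ha : 1 ≤ a) (hb : 1 ≤ b) (hT : T ≤ a * b)
    (hT2 : a * b ≤ 2 * T) (hL : a + b ≤ D) (hDT : D ≤ T) (hTD : T ≤ D ^ 2)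
    (hdD : d ≤ D) {c M H ε : ℝ} (hc : 1 ≤ c) (hx : ‖x‖ + 1 ≤ c) (hyc : ‖y⁻¹‖ ≤ c)
    (hyc3 : 3 * ‖y‖ ≤ c) (hcM : c ≤ M) (hM : 20 * (D : ℝ) ^ 2 ≤ M) (hH : 1 ≤ H)
    (hPA : l1 (map (Int.castRingHom ℂ) P) ≤ H) (hQA : l1 (map (Int.castRingHom ℂ) Q) ≤ H)
    (hε : 0 < ε) (hε1 : ε ≤ 1)
    (hPδ : tnorm T (jet x y (map (Int.castRingHom ℂ) P)) ≤ ε)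
    (hQδ : tnorm T (jet x y (map (Int.castRingHom ℂ) Q)) ≤ ε) :
    ∏ i, prox x y T ε (σ ∘ Z i) ≤ ε ^ T * (M ^ (500 * (T * D ^ 2)) * H ^ (11 * D ^ 2)) := by
  have hD1 : 1 ≤ D := by omega
  have hD1' : (1 : ℝ) ≤ D := by exact_mod_cast hD1
  have hD2 : (D : ℝ) ≤ (D : ℝ) ^ 2 := by nlinarith
  have hM1 : 1 ≤ M := by nlinarith
  have hM0 : 0 < M := by linarith
  have hN := choose_two_le hdD hD1
  have hTR : (T : ℝ) ≤ (D : ℝ) ^ 2 := by exact_mod_cast hTD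
  have hd2 : d ^ 2 ≤ D ^ 2 := Nat.pow_le_pow_left hdD 2
  have hd2R : (d : ℝ) ^ 2 ≤ (D : ℝ) ^ 2 := by exact_mod_cast hd2
  have h1 := mac.exists_prod_norm_mul_prox_le hPd hQd σ hy ha hb hT hL hdD hc hx hyc hyc3
    (by nlinarith : (3 : ℝ) ≤ M)
    (by
      have : (a * b : ℝ) ≤ 2 * T := by exact_mod_cast hT2
      nlinarith)
    hcM (by nlinarith)
    (by
      have h := choose_two_le (Nat.zero_le D) hD1
      have h' : ((0 + 0 + D + 2).choose 2 : ℝ) ≤ 10 * (D : ℝ) ^ 2 := by exact_mod_cast h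
      rw [show 0 + 0 + D + 2 = D + 2 by omega] at h'
      nlinarith) hH hPA hQA hε hε1 hPδ hQδ
  set N := (d + d + D + 2).choose 2
  have h2 := mac.one_le_mul_prod_norm hZ σ (B := M ^ 2) (by
    calc 3 * (2 * (d : ℝ) ^ 2 + 1) ^ 2 ≤ 3 * (2 * (D : ℝ) ^ 2 + 1 * (D : ℝ) ^ 2) ^ 2 := by
          gcongr
          nlinarith
      _ ≤ (20 * (D : ℝ) ^ 2) ^ 2 := by nlinarith [sq_nonneg ((D : ℝ) ^ 2)]
      _ ≤ M ^ 2 := by gcongr)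
  have hprox : ∀ z, 0 ≤ prox x y T ε z := fun z => hε.le.trans (le_prox x y T hε1 hε.le z)
  have hpp : 0 ≤ ∏ i, prox x y T ε (σ ∘ Z i) := Finset.prod_nonneg fun i _ => hprox _
  have hfac : ((N + T).factorial : ℝ) ≤ M ^ (N + T) := by
    have h3 : ((N + T).factorial : ℝ) ≤ ((N + T : ℕ) : ℝ) ^ (N + T) := by
      exact_mod_cast Nat.factorial_le_pow _
    refine h3.trans (pow_le_pow_left₀ (by positivity) ?_ _)
    have : ((N + T : ℕ) : ℝ) ≤ 10 * (D : ℝ) ^ 2 + (D : ℝ) ^ 2 := by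
      exact_mod_cast Nat.add_le_add hN hTD
    nlinarith
  rw [Finset.prod_mul_distrib] at h1
  calc ∏ i, prox x y T ε (σ ∘ Z i)
      ≤ ((M ^ 2) ^ (d ^ 2 * D) * (‖(mac.κ : ℂ)‖ * ∏ i, ‖σ ∘ Z i‖ ^ D)) *
          ∏ i, prox x y T ε (σ ∘ Z i) := le_mul_of_one_le_left hpp h2
    _ = (M ^ 2) ^ (d ^ 2 * D) * (‖(mac.κ : ℂ)‖ * ((∏ i, ‖σ ∘ Z i‖ ^ D) *
          ∏ i, prox x y T ε (σ ∘ Z i))) := by ring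
    _ ≤ (M ^ 2) ^ (d ^ 2 * D) * ((M ^ (11 * (a * b) + 3 * D + 8)) ^ d ^ 2 *
          ((ε * M ^ (3 * D + 1)) ^ T * (M ^ (N + T) *
          (H * M ^ (9 * (a * b) + 3 * D + 4)) ^ (N + T)))) := by
        refine mul_le_mul_of_nonneg_left (h1.trans ?_) (by positivity)
        gcongr
    _ = ε ^ T * (M ^ (2 * (d ^ 2 * D) + (11 * (a * b) + 3 * D + 8) * d ^ 2 + (3 * D + 1) * T +
          (N + T) + (9 * (a * b) + 3 * D + 4) * (N + T)) * H ^ (N + T)) := by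
        simp only [mul_pow, ← pow_mul, pow_add M]
        ring
    _ ≤ _ := by
        gcongr
        · have e1 : (11 * (a * b) + 3 * D + 8) * d ^ 2 ≤ (33 * T) * D ^ 2 :=
            Nat.mul_le_mul (by omega) hd2
          have e2 : d ^ 2 * D ≤ T * D ^ 2 := by
            rw [mul_comm T]; exact Nat.mul_le_mul hd2 hDT
          have e3 : (9 * (a * b) + 3 * D + 4) * (N + T) ≤ 25 * T * (11 * D ^ 2) :=
            Nat.mul_le_mul (by omega) (by omega)
          have e4 : (3 * D + 1) * T ≤ (4 * D ^ 2) * T := Nat.mul_le_mul_right _ (by nlinarith)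
          have e5 : N + T ≤ 11 * (T * D ^ 2) := by nlinarith
          nlinarith
        · omega

end

section Level

/-- A cycle of algebraic points attached to a form `p` of degree `D` whose derivatives along the
exponential curve are small at `(1 : x : y)` up to order `3 * T`. -/
structure Level (x y : ℂ) (p : MvPolynomial (Fin 3) ℤ) (D T : ℕ) (ε A B N : ℝ) where
  d : ℕ
  Z : Fin (d ^ 2) → Fin 3 → AlgebraicClosure ℚ
  d_le : d ≤ D
  ne_zero : ∀ i, Z i ≠ 0
  prod_prox_le : ∀ σ : AlgebraicClosure ℚ →+* ℂ, ∏ i, prox x y T ε (σ ∘ Z i) ≤ A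
  prod_mulHeight_le : ∀ (K : Type) [Field K] [NumberField K] (ι : K →+* AlgebraicClosure ℚ)
    (Y : Fin (d ^ 2) → Fin 3 → K), (∀ i, ι ∘ Y i = Z i) →
    ∏ i, Height.mulHeight (Y i) ^ D ≤ B ^ Module.finrank ℚ K
  le_card : ∀ (σ : AlgebraicClosure ℚ →+* ℂ) (x' y' : ℂ), y' ≠ 0 →
    (∀ i < 2 * T, eval ![1, x', y'] ((D3 ℂ)^[i] (map (Int.castRingHom ℂ) p)) = 0) →
    T ≤ Nat.card {i // ∃ c : ℂ, σ ∘ Z i = c • ![1, x', y']}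
  norm_eval_le : ∀ i < 2 * T, ∀ w : Fin 3 → ℂ,
    ‖eval w ((D3 ℂ)^[i] (map (Int.castRingHom ℂ) p))‖ ≤ N * (‖w‖ ^ D * prox x y T ε w)

lemma exists_mul_bounds {D T : ℕ} (hD : 2 ≤ D) (hDT : D ≤ T) (hTD : 8 * T ≤ D ^ 2) :
    ∃ a b : ℕ, 1 ≤ a ∧ 1 ≤ b ∧ T ≤ a * b ∧ a * b ≤ 2 * T ∧ a + b ≤ D := by
  have ha : 1 ≤ D / 2 := by omega
  refine ⟨D / 2, (T + D / 2 - 1) / (D / 2), ha, ?_, ?_, ?_, ?_⟩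
  · rw [Nat.le_div_iff_mul_le (by omega)]; omega
  · have := Nat.lt_mul_div_succ (T + D / 2 - 1) (b := D / 2) (by omega)
    rw [mul_add] at this
    omega
  · have := Nat.mul_div_le (T + D / 2 - 1) (D / 2)
    omega
  · have h1 : (T + D / 2 - 1) / (D / 2) ≤ D - D / 2 := by
      refine Nat.div_le_of_le_mul ?_
      obtain ⟨s, hs⟩ | ⟨s, hs⟩ := Nat.even_or_odd D
      · have h2 : D / 2 = s := by omega
        have h3 : D - D / 2 = s := by omega
        rw [h3, h2]
        subst hs
        have h4 : T + s ≤ s * s := by nlinarith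
        omega
      · have h2 : D / 2 = s := by omega
        have h3 : D - D / 2 = s + 1 := by omega
        rw [h3, h2]
        subst hs
        have h4 : T + s ≤ s * (s + 1) := by nlinarith
        omega
    omega

set_option maxHeartbeats 1000000 in
lemma exists_level {x y : ℂ} (hy : y ≠ 0) {p : MvPolynomial (Fin 3) ℤ} {D T : ℕ}
    (hp : p.IsHomogeneous D) (hp0 : p ≠ 0) (hD : 2 ≤ D) (hDT : D ≤ T) (hTD : 8 * T ≤ D ^ 2)
    {c M H ε δ : ℝ} (hc : 1 ≤ c) (hx : ‖x‖ + 1 ≤ c) (hyc : 3 * ‖y⁻¹‖ ≤ c)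
    (hyc3 : 3 * ‖y‖ ≤ c) (hcM : c ≤ M) (hM : 20 * (D : ℝ) ^ 2 ≤ M) (hH : 1 ≤ H)
    (hpH : M ^ (2 * D + 1) * l1 (map (Int.castRingHom ℂ) p) ≤ H) (hε : 0 < ε) (hε1 : ε ≤ 1)
    (hpδ : tnorm (3 * T) (jet x y (map (Int.castRingHom ℂ) p)) ≤ δ) (hδ : M ^ (4 * T) * δ ≤ ε) :
    Nonempty (Level x y p D T ε (ε ^ T * (M ^ (500 * (T * D ^ 2)) * H ^ (11 * D ^ 2)))
      (M ^ (21 * D ^ 3) * H ^ (10 * D ^ 2)) (M ^ (7 * T) * H)) := by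
  have hD' : (2 : ℝ) ≤ D := by exact_mod_cast hD
  have hM4 : 4 ≤ M := by nlinarith
  have hM1 : 1 ≤ M := by linarith
  have hM0 : 0 < M := by linarith
  have hTD' : 8 * (T : ℝ) ≤ (D : ℝ) ^ 2 := by exact_mod_cast hTD
  have hD2 : (D : ℝ) ≤ (D : ℝ) ^ 2 := by nlinarith
  have hδ0 : 0 ≤ δ := (tnorm_nonneg _ _).trans hpδ
  have hl := l1_nonneg (map (Int.castRingHom ℂ) p)
  have hδ' : ∀ n, n ≤ 4 * T → M ^ n * δ ≤ ε := fun n hn =>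
    (mul_le_mul_of_nonneg_right (pow_le_pow_right₀ hM1 hn) hδ0).trans hδ
  have hH' : ∀ n, n ≤ 2 * D + 1 → M ^ n * l1 (map (Int.castRingHom ℂ) p) ≤ H := fun n hn =>
    (mul_le_mul_of_nonneg_right (pow_le_pow_right₀ hM1 hn) hl).trans hpH
  have hlH : l1 (map (Int.castRingHom ℂ) p) ≤ H := by simpa using hH' 0 (by omega)
  obtain ⟨a₀, e₀, d, u, q, hpq, hdD, hu, hq, hq0, hrel⟩ :=
    exists_coprime_pair (AlgebraicClosure ℚ) hp hp0
  change IsRelPrime _ (map _ (derivSum d u q)) at hrel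
  have hu' : (u : ℝ) ≤ M := by
    have : (u : ℝ) ≤ (D : ℝ) ^ 2 := by exact_mod_cast hu
    linarith
  have hdD' : (d : ℝ) ≤ D := by exact_mod_cast hdD
  have hQd := derivSum_isHomogeneous (u := u) hq
  obtain ⟨Z, hZ, hmac⟩ := exists_macaulayData hq0 hq hQd hrel
  obtain ⟨mac⟩ := hmac D
  obtain ⟨a, b, ha, hb, hab, hab2, habD⟩ := exists_mul_bounds hD hDT hTD
  have he₀ : e₀ ≤ D := by
    have h1 : p.totalDegree = D := hp.totalDegree hp0
    have h2 : p.totalDegree = (X 0 ^ a₀ * X 2 ^ e₀ : MvPolynomial (Fin 3) ℤ).totalDegree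
        + q.totalDegree := by
      rw [hpq]
      exact totalDegree_mul_of_isDomain (mul_ne_zero (pow_ne_zero _ (X_ne_zero _))
        (pow_ne_zero _ (X_ne_zero _))) hq0
    rw [totalDegree_mul_of_isDomain (pow_ne_zero _ (X_ne_zero _)) (pow_ne_zero _ (X_ne_zero _)),
      totalDegree_X_pow, totalDegree_X_pow] at h2
    omega
  have hpq' : map (Int.castRingHom ℂ) p = X 0 ^ a₀ * X 2 ^ e₀ * map (Int.castRingHom ℂ) q := by
    rw [hpq]; simp
  have hyM : 3 * ‖y⁻¹‖ ≤ M := hyc.trans hcM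
  have hq3 : tnorm (2 * T) (jet x y (map (Int.castRingHom ℂ) q)) ≤ M ^ D * δ := by
    refine (tnorm_jet_cofactor_le _ hy a₀ he₀ _ hM1 hyM).trans
      (mul_le_mul_of_nonneg_left ?_ (by positivity))
    rw [← hpq']
    exact (tnorm_mono (by omega) _).trans hpδ
  have hqε : tnorm T (jet x y (map (Int.castRingHom ℂ) q)) ≤ ε :=
    (tnorm_mono (by omega) _).trans (hq3.trans (hδ' D (by omega)))
  have hQε : tnorm T (jet x y (map (Int.castRingHom ℂ) (derivSum d u q))) ≤ ε := by
    refine (tnorm_jet_derivSum_le (by omega) x y q hM1 hu' (by linarith)).trans ?_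
    refine (mul_le_mul_of_nonneg_left hq3 (by positivity)).trans ?_
    rw [← mul_assoc, ← pow_add]
    exact hδ' _ (by omega)
  have hql : l1 (map (Int.castRingHom ℂ) q) ≤ l1 (map (Int.castRingHom ℂ) p) := by
    have := l1_cofactor_le a₀ e₀ q
    rwa [← hpq] at this
  have hqH := hql.trans hlH
  have hQH : l1 (map (Int.castRingHom ℂ) (derivSum d u q)) ≤ H := by
    refine (l1_derivSum_le hq hM1 hu' (by linarith)).trans ?_
    refine (mul_le_mul_of_nonneg_left hql (by positivity)).trans (hH' _ (by omega))
  have hyc1 : ‖y⁻¹‖ ≤ c := by linarith [norm_nonneg y⁻¹]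
  have hyc2 : ‖y‖ ≤ c := by linarith [norm_nonneg y]
  refine ⟨⟨d, Z, hdD, hZ, fun σ => ?_, fun K _ _ ι Y hY => ?_, fun σ x' y' hy' hvan => ?_,
    fun i hi w => ?_⟩⟩
  · exact mac.prod_prox_le hZ hq hQd σ hy ha hb hab hab2 habD hDT (by omega) hdD hc hx hyc1 hyc3 hcM
      hM hH hqH hQH hε hε1 hqε hQε
  · have h3 : (3 : ℝ) ^ D ≤ H * M ^ D :=
      (pow_le_pow_left₀ (by norm_num) (by linarith) D).trans
        (le_mul_of_one_le_left (by positivity) hH)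
    have hHM : H ≤ H * M ^ D := le_mul_of_one_le_right (by linarith) (one_le_pow₀ hM1)
    refine (mac.prod_mulHeight_le hZ (hqH.trans hHM) (hQH.trans hHM) h3 ι hY).trans ?_
    refine pow_le_pow_left₀ (by positivity) ?_ _
    set n := (d + d + D + 2).choose 2 with hn
    have hn1 : n ≤ 10 * D ^ 2 := choose_two_le hdD (by omega)
    have hn2 : (n : ℝ) ≤ M := by
      have : (n : ℝ) ≤ 10 * (D : ℝ) ^ 2 := by exact_mod_cast hn1
      nlinarith
    have hf : (n.factorial : ℝ) ≤ M ^ n := by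
      calc (n.factorial : ℝ) ≤ (n : ℝ) ^ n := by exact_mod_cast Nat.factorial_le_pow n
        _ ≤ _ := pow_le_pow_left₀ (by positivity) hn2 n
    have hd2 : d ^ 2 ≤ D ^ 2 := Nat.pow_le_pow_left hdD 2
    have hexp : d ^ 2 * D + n + D * n ≤ 21 * D ^ 3 := by
      have h5 : d ^ 2 * D ≤ D ^ 2 * D := Nat.mul_le_mul_right _ hd2
      have h6 : D * n ≤ D * (10 * D ^ 2) := Nat.mul_le_mul_left _ hn1
      have h7 : D ^ 2 ≤ D ^ 3 := Nat.pow_le_pow_right (by omega) (by norm_num)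
      nlinarith
    calc (2 : ℝ) ^ (d ^ 2 * D) * (n.factorial * (H * M ^ D) ^ n)
        ≤ M ^ (d ^ 2 * D) * (M ^ n * (H * M ^ D) ^ n) := by
          gcongr
          linarith
      _ = M ^ (d ^ 2 * D + n + D * n) * H ^ n := by
          rw [mul_pow, ← pow_mul, pow_add, pow_add]; ring
      _ ≤ _ := mul_le_mul (pow_le_pow_right₀ hM1 hexp) (pow_le_pow_right₀ hH hn1)
          (by positivity) (by positivity)
  · have hjp : ∀ t < 2 * T, PowerSeries.coeff t (jet x' y' (map (Int.castRingHom ℂ) q)) = 0 := by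
      refine coeff_jet_cofactor_eq_zero hy' a₀ e₀ _ ?_
      rw [← hpq']
      exact fun t ht => coeff_jet_eq_zero_of_eval (hvan t ht)
    rcases Nat.eq_zero_or_pos d with rfl | hd
    · exfalso
      have h0 := hjp 0 (by omega)
      obtain ⟨r, hr⟩ : ∃ r : ℤ, q = C r := ⟨_, (totalDegree_eq_zero_iff_eq_C (p := q)).mp
        (by rw [hq.totalDegree hq0])⟩
      rw [hr, map_C, constantCoeff_jet, eval_C] at h0
      refine hq0 ?_
      rw [hr, show r = 0 by simpa using h0, C_0]
    · exact le_card_of_jet_eq_zero hZ hmac hq hQd hd σ hy' (fun t ht => hjp t (by omega))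
        (coeff_jet_derivSum_eq_zero (by omega) x' y' q hjp)
  · have hpC : (map (Int.castRingHom ℂ) p).IsHomogeneous D := hp.map _
    have h1 : tnorm T (jet x y ((D3 ℂ)^[i] (map (Int.castRingHom ℂ) p))) ≤ ε := by
      rw [jet_D3_iterate]
      refine (tnorm_iterate_derivative_le T i _).trans ?_
      have h2 : (T + i : ℝ) ≤ M := by
        have : (i : ℝ) ≤ 2 * T := by exact_mod_cast hi.le
        linarith
      calc _ ≤ M ^ i * δ := mul_le_mul (pow_le_pow_left₀ (by positivity) (by exact_mod_cast h2) i)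
            ((tnorm_mono (by omega : T + i ≤ 3 * T) _).trans hpδ) (tnorm_nonneg _ _) (by positivity)
        _ ≤ ε := hδ' _ (by omega)
    refine (norm_eval_le_prox hy hc hx hyc2 hM4 (by linarith : (D : ℝ) ≤ M) (hpC.D3_iterate i) h1 w).trans ?_
    have hpr : 0 ≤ prox x y T ε w := hε.le.trans (le_prox x y T hε1 hε.le w)
    rw [mul_assoc]
    refine mul_le_mul_of_nonneg_right ?_ (by positivity)
    have h3 : l1 ((D3 ℂ)^[i] (map (Int.castRingHom ℂ) p)) ≤ M ^ (2 * T) * H := by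
      refine (l1_D3_iterate_le hpC i).trans (mul_le_mul ?_ hlH hl (by positivity))
      exact (pow_le_pow_left₀ (by positivity) (by linarith) i).trans
        (pow_le_pow_right₀ hM1 hi.le)
    have h4 : 1 ≤ M ^ (2 * T) * H * M ^ D :=
      one_le_mul_of_one_le_of_one_le (one_le_mul_of_one_le_of_one_le (one_le_pow₀ hM1) hH)
        (one_le_pow₀ hM1)
    have h5 : l1 ((D3 ℂ)^[i] (map (Int.castRingHom ℂ) p)) * c ^ D ≤ M ^ (2 * T) * H * M ^ D := by
      gcongr
    calc _ ≤ (M * (M ^ (2 * T) * H * M ^ D)) * M ^ (T + D + 1) := by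
          gcongr; nlinarith
      _ = M ^ (3 * T + 2 * D + 2) * H := by
          rw [show 3 * T + 2 * D + 2 = 1 + 2 * T + D + (T + D + 1) by ring, pow_add, pow_add, pow_add]
          ring
      _ ≤ _ := mul_le_mul_of_nonneg_right (pow_le_pow_right₀ hM1 (by omega)) (by linarith)

end Level

section Asymptotics

lemma eventually_mul_rpow_le {a b : ℝ} (h : a < b) (K : ℝ) :
    ∀ᶠ D : ℕ in Filter.atTop, K * (D : ℝ) ^ a ≤ (D : ℝ) ^ b := by
  have h1 := (tendsto_rpow_atTop (sub_pos.mpr h)).comp (tendsto_natCast_atTop_atTop (R := ℝ))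
  filter_upwards [h1.eventually_ge_atTop K, Filter.eventually_ge_atTop 1] with D hD hD1
  have hD0 : (0 : ℝ) < D := by exact_mod_cast hD1
  calc K * (D : ℝ) ^ a ≤ (D : ℝ) ^ (b - a) * (D : ℝ) ^ a :=
        mul_le_mul_of_nonneg_right hD (by positivity)
    _ = (D : ℝ) ^ b := by rw [← Real.rpow_add hD0]; ring_nf

lemma eventually_rpow_mul_log_le {a b : ℝ} (h : a < b) {K : ℝ} (hK : 0 < K) :
    ∀ᶠ D : ℕ in Filter.atTop, K * (D : ℝ) ^ a * Real.log D ≤ (D : ℝ) ^ b := by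
  have h1 := ((isLittleO_log_rpow_atTop (sub_pos.mpr h)).bound (inv_pos.mpr hK))
  filter_upwards [tendsto_natCast_atTop_atTop.eventually h1, Filter.eventually_ge_atTop 1]
    with D hD hD1
  have hD0 : (0 : ℝ) < D := by exact_mod_cast hD1
  have h2 : Real.log D ≤ K⁻¹ * (D : ℝ) ^ (b - a) := by
    refine (le_abs_self _).trans ?_
    rwa [Real.norm_eq_abs, Real.norm_of_nonneg (by positivity)] at hD
  calc K * (D : ℝ) ^ a * Real.log D ≤ K * (D : ℝ) ^ a * (K⁻¹ * (D : ℝ) ^ (b - a)) :=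
        mul_le_mul_of_nonneg_left h2 (by positivity)
    _ = (D : ℝ) ^ a * (D : ℝ) ^ (b - a) := by field_simp
    _ = (D : ℝ) ^ b := by rw [← Real.rpow_add hD0]; ring_nf

variable {x y : ℂ} {p : MvPolynomial (Fin 3) ℤ} {D T : ℕ} {A' B' N' ε A B N : ℝ}

/-- Weakening the bounds of a level. -/
def Level.mono (l : Level x y p D T ε A B N) (hε : 0 ≤ ε) (hε1 : ε ≤ 1) (hA : A ≤ A') (hB0 : 0 ≤ B)
    (hB : B ≤ B') (hN : N ≤ N') : Level x y p D T ε A' B' N' where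
  d := l.d
  Z := l.Z
  d_le := l.d_le
  ne_zero := l.ne_zero
  prod_prox_le σ := (l.prod_prox_le σ).trans hA
  prod_mulHeight_le K _ _ ι Y hY :=
    (l.prod_mulHeight_le K ι Y hY).trans (pow_le_pow_left₀ hB0 hB _)
  le_card := l.le_card
  norm_eval_le i hi w := (l.norm_eval_le i hi w).trans
    (mul_le_mul_of_nonneg_right hN
      (mul_nonneg (by positivity) (hε.trans (le_prox x y T hε1 hε w))))

lemma half_rpow_le_floor {D : ℕ} (hD : 1 ≤ D) {τ : ℝ} (hτ : 0 ≤ τ) :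
    (D : ℝ) ^ τ ≤ 2 * (⌊(D : ℝ) ^ τ⌋₊ : ℝ) := by
  have h1 : (1 : ℝ) ≤ (D : ℝ) ^ τ := Real.one_le_rpow (by exact_mod_cast hD) hτ
  have h2 := Nat.lt_floor_add_one ((D : ℝ) ^ τ)
  have h3 : (1 : ℝ) ≤ (⌊(D : ℝ) ^ τ⌋₊ : ℝ) := by exact_mod_cast Nat.le_floor (by simpa using h1)
  linarith

set_option maxHeartbeats 1000000 in
lemma eventually_level {ξ η : ℂ} (hη : η ≠ 0) {β τ ν : ℝ} (hτ1 : 1 ≤ τ) (hτ2 : τ < 2) (hβ : τ < β)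
    (hν : 2 + β - τ < ν) (P : ℕ → MvPolynomial (Fin 2) ℤ)
    (hP : ∀ᶠ D : ℕ in Filter.atTop,
      P D ≠ 0 ∧ (P D).totalDegree ≤ D ∧
      (∀ v, ((|(P D).coeff v| : ℤ) : ℝ) ≤ Real.exp ((D : ℝ) ^ β)) ∧
      ∀ i < 3 * ⌊(D : ℝ) ^ τ⌋₊,
        ‖eval ![ξ, η] (D1^[i] ((P D).map (Int.castRingHom ℂ)))‖ ≤ Real.exp (-(D : ℝ) ^ ν)) :
    ∀ᶠ D : ℕ in Filter.atTop, Nonempty (Level ξ η (homog D (P D)) D ⌊(D : ℝ) ^ τ⌋₊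
      (Real.exp (-((D : ℝ) ^ ν / 2)))
      (Real.exp (-((⌊(D : ℝ) ^ τ⌋₊ : ℝ) * (D : ℝ) ^ ν / 4)))
      (Real.exp (21 * (D : ℝ) ^ (2 + β))) (Real.exp (3 * (D : ℝ) ^ β))) := by
  set c : ℝ := 1 + ‖ξ‖ + 3 * ‖η‖ + 3 * ‖η⁻¹‖ with hc
  filter_upwards [hP, eventually_mul_rpow_le hτ2 8, eventually_rpow_mul_log_le hβ (K := 3000) (by norm_num),
    eventually_mul_rpow_le (show β < ν by linarith) 2,
    eventually_mul_rpow_le (show 2 + β < τ + ν by linarith) 184,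
    Filter.eventually_ge_atTop 20, Filter.eventually_ge_atTop ⌈c⌉₊]
    with D hPD h8 hlog hβν h184 hD20 hDc
  obtain ⟨hp0, hdeg, hcoeff, hsmall⟩ := hPD
  have hD0 : (20 : ℝ) ≤ D := by exact_mod_cast hD20
  have hDpos : (0 : ℝ) < D := by linarith
  have hcD : c ≤ D := Nat.ceil_le.mp hDc
  set T := ⌊(D : ℝ) ^ τ⌋₊ with hT
  have hTle : (T : ℝ) ≤ (D : ℝ) ^ τ := Nat.floor_le (by positivity)
  have hTge : (D : ℝ) ^ τ ≤ 2 * (T : ℝ) := half_rpow_le_floor (by omega) (by linarith)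
  have hDT : D ≤ T := Nat.le_floor (by
    simpa using Real.rpow_le_rpow_of_exponent_le (by linarith : (1 : ℝ) ≤ D) hτ1)
  have hTD : 8 * T ≤ D ^ 2 := by
    have : 8 * (T : ℝ) ≤ (D : ℝ) ^ 2 := by
      rw [← Real.rpow_two]; linarith
    exact_mod_cast this
  set μ : ℝ := 3 * Real.log D with hμ
  have hlog0 : 0 ≤ Real.log D := Real.log_nonneg (by linarith)
  have hμ0 : 0 ≤ μ := by positivity
  have hM : Real.exp μ = (D : ℝ) ^ 3 := by
    rw [hμ, show (3 : ℝ) * Real.log D = ((3 : ℕ) : ℝ) * Real.log D by norm_num, Real.exp_nat_mul,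
      Real.exp_log hDpos]
  have hTμ : 1000 * (T * μ) ≤ (D : ℝ) ^ β := by
    calc 1000 * (T * μ) ≤ 1000 * ((D : ℝ) ^ τ * μ) := by gcongr
      _ = 3000 * (D : ℝ) ^ τ * Real.log D := by rw [hμ]; ring
      _ ≤ _ := hlog
  have hDTr : (D : ℝ) ≤ T := by exact_mod_cast hDT
  have hDμ : (D : ℝ) * μ ≤ T * μ := by gcongr
  have hD1μ : μ ≤ D * μ := le_mul_of_one_le_left hμ0 (by linarith)
  have hsq : (D : ℝ) ^ 2 * (D : ℝ) ^ β = (D : ℝ) ^ (2 + β) := by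
    rw [Real.rpow_add hDpos, Real.rpow_two]
  have hν0 : (D : ℝ) ^ τ * (D : ℝ) ^ ν = (D : ℝ) ^ (τ + ν) := by rw [Real.rpow_add hDpos]
  have hexp : ∀ n : ℕ, Real.exp μ ^ n = Real.exp (n * μ) := fun n => (Real.exp_nat_mul μ n).symm
  set L := (D : ℝ) ^ β with hL
  have hL0 : 0 ≤ L := by positivity
  have hph := homog_isHomogeneous hdeg
  have hl1 : l1 (map (Int.castRingHom ℂ) (homog D (P D))) ≤ (D + 1) ^ 2 * Real.exp L :=
    l1_homog_le hdeg hcoeff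
  have hD3 : 20 * (D : ℝ) ^ 2 ≤ (D : ℝ) ^ 3 := by
    rw [pow_succ (D : ℝ) 2, mul_comm]
    gcongr
  have hDD : (D : ℝ) ≤ (D : ℝ) ^ 2 := le_self_pow₀ (by linarith) (by norm_num)
  have hD2M : ((D : ℝ) + 1) ^ 2 ≤ Real.exp μ := by
    rw [hM, add_sq]
    linarith only [hD3, hDD, hD0]
  obtain ⟨lev⟩ := exists_level (x := ξ) (y := η) hη hph (homog_ne_zero hp0) (by omega) hDT hTD
    (c := c) (M := Real.exp μ) (H := Real.exp (2 * L)) (ε := Real.exp (-((D : ℝ) ^ ν / 2)))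
    (δ := Real.exp (-(D : ℝ) ^ ν) * 3)
    (by rw [hc]; linarith [norm_nonneg ξ, norm_nonneg η, norm_nonneg η⁻¹])
    (by rw [hc]; linarith [norm_nonneg ξ, norm_nonneg η, norm_nonneg η⁻¹])
    (by rw [hc]; linarith [norm_nonneg ξ, norm_nonneg η, norm_nonneg η⁻¹])
    (by rw [hc]; linarith [norm_nonneg ξ, norm_nonneg η, norm_nonneg η⁻¹])
    (by rw [hM]; linarith only [hD3, hDD, hD0, hcD])
    (by rw [hM]; exact hD3)
    (Real.one_le_exp (by positivity))
    (by
      calc _ ≤ Real.exp μ ^ (2 * D + 1) * (Real.exp μ * Real.exp L) := by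
            refine mul_le_mul_of_nonneg_left (hl1.trans ?_) (by positivity)
            exact mul_le_mul_of_nonneg_right hD2M (by positivity)
        _ = Real.exp ((2 * D + 2) * μ + L) := by
            rw [hexp, ← Real.exp_add, ← Real.exp_add]; push_cast; ring_nf
        _ ≤ _ := Real.exp_le_exp.mpr (by linarith))
    (Real.exp_pos _) (Real.exp_le_one_iff.mpr (by
      have : (0 : ℝ) ≤ (D : ℝ) ^ ν := by positivity
      linarith))
    (tnorm_jet_le_of_eval_le (Real.exp_pos _).le fun i hi => by
      rw [map_homog _ (RingHom.injective_int _), ← eval_D1_iterate]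
      exact hsmall i hi)
    (by
      calc _ ≤ Real.exp μ ^ (4 * T) * (Real.exp (-(D : ℝ) ^ ν) * Real.exp μ) := by
            have : (3 : ℝ) ≤ Real.exp μ := by rw [hM]; linarith only [hD3, hDD, hD0]
            gcongr
        _ = Real.exp (4 * (T * μ) + μ - (D : ℝ) ^ ν) := by
            rw [hexp, ← Real.exp_add, ← Real.exp_add]; push_cast; ring_nf
        _ ≤ _ := Real.exp_le_exp.mpr (by linarith))
  have hTμD : (D : ℝ) ^ 2 * (1000 * (T * μ)) ≤ (D : ℝ) ^ 2 * L := by gcongr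
  refine ⟨lev.mono (Real.exp_pos _).le (Real.exp_le_one_iff.mpr (by
      have : (0 : ℝ) ≤ (D : ℝ) ^ ν := by positivity
      linarith)) ?_ (by positivity) ?_ ?_⟩
  · rw [hexp, ← Real.exp_nat_mul, ← Real.exp_nat_mul, ← Real.exp_add, ← Real.exp_add]
    refine Real.exp_le_exp.mpr ?_
    push_cast
    have h1 : (D : ℝ) ^ τ * (D : ℝ) ^ ν ≤ 2 * (T : ℝ) * (D : ℝ) ^ ν := by gcongr
    nlinarith
  · rw [hexp, ← Real.exp_nat_mul, ← Real.exp_add]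
    refine Real.exp_le_exp.mpr ?_
    push_cast
    have h1 : (D : ℝ) ^ 2 * (D * μ) ≤ (D : ℝ) ^ 2 * (T * μ) := by gcongr
    nlinarith
  · rw [hexp, ← Real.exp_add]
    refine Real.exp_le_exp.mpr ?_
    push_cast
    linarith

end Asymptotics

section Proximity

/-- Minus the logarithm of the proximity of `w` to the exponential curve at `(1 : x : y)`. -/
noncomputable def lam (x y : ℂ) (T : ℕ) (ε : ℝ) (w : Fin 3 → ℂ) : ℝ := -Real.log (prox x y T ε w)

variable {x y : ℂ} {T : ℕ} {ε : ℝ}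

lemma lam_nonneg (hε : 0 ≤ ε) (hε1 : ε ≤ 1) (w : Fin 3 → ℂ) : 0 ≤ lam x y T ε w :=
  neg_nonneg.mpr (Real.log_nonpos (hε.trans (le_prox x y T hε1 hε w)) (prox_le_one x y T ε w))

lemma prox_pos (hε : 0 < ε) (hε1 : ε ≤ 1) (w : Fin 3 → ℂ) : 0 < prox x y T ε w :=
  hε.trans_le (le_prox x y T hε1 hε.le w)

lemma prox_smul {c : ℂ} (hc : c ≠ 0) (w : Fin 3 → ℂ) : prox x y T ε (c • w) = prox x y T ε w := by
  have h1 : c * w 1 / (c * w 0) = w 1 / w 0 := mul_div_mul_left _ _ hc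
  have h2 : c * w 2 / (y * (c * w 0)) = w 2 / (y * w 0) := by
    rw [mul_left_comm, mul_div_mul_left _ _ hc]
  simp only [prox, Pi.smul_apply, smul_eq_mul, h1, h2, mul_eq_zero, hc, false_or]

lemma lam_smul {c : ℂ} (hc : c ≠ 0) (w : Fin 3 → ℂ) : lam x y T ε (c • w) = lam x y T ε w := by
  rw [lam, lam, prox_smul hc]

lemma lam_eq_zero_of_apply_zero {w : Fin 3 → ℂ} (hw : w 0 = 0) : lam x y T ε w = 0 := by
  rw [lam, prox, if_pos hw, Real.log_one, neg_zero]

lemma lam_eq_zero_of_apply_two {w : Fin 3 → ℂ} (hw : w 2 = 0) :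
    lam x y T ε w = 0 := by
  by_cases h0 : w 0 = 0
  · exact lam_eq_zero_of_apply_zero h0
  rw [lam, prox, if_neg h0, hw, zero_div, zero_sub, norm_neg]
  have h1 : (1 : ℝ) ≤ 4 * max (‖w 1 / w 0 - x‖ ^ T) ‖Complex.exp (w 1 / w 0 - x)‖ := by
    rcases le_total 1 ‖w 1 / w 0 - x‖ with h | h
    · have h2 : 1 ≤ ‖w 1 / w 0 - x‖ ^ T := one_le_pow₀ h
      have h3 := le_max_left (‖w 1 / w 0 - x‖ ^ T) ‖Complex.exp (w 1 / w 0 - x)‖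
      linarith
    · have h2 : Real.exp (-1) ≤ ‖Complex.exp (w 1 / w 0 - x)‖ := by
        rw [Complex.norm_exp]
        refine Real.exp_le_exp.mpr ?_
        have := (abs_le.mp ((Complex.abs_re_le_norm (w 1 / w 0 - x)).trans h)).1
        exact this
      have h3 := le_max_right (‖w 1 / w 0 - x‖ ^ T) ‖Complex.exp (w 1 / w 0 - x)‖
      have h4 : (1 / 4 : ℝ) ≤ Real.exp (-1) := by
        rw [Real.exp_neg, ← one_div]
        exact one_div_le_one_div_of_le (Real.exp_pos _) (by linarith [Real.exp_one_lt_d9])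
      linarith
  have h5 : (1 : ℝ) ≤ 4 * max ε (max (‖w 1 / w 0 - x‖ ^ T) ‖Complex.exp (w 1 / w 0 - x)‖) :=
    h1.trans (mul_le_mul_of_nonneg_left (le_max_right _ _) (by norm_num))
  rw [min_eq_left h5, Real.log_one, neg_zero]

/-- A larger order of contact only makes the proximity smaller in a controlled way. -/
lemma min_le_lam {S : ℕ} {δ : ℝ} (hδ : 0 < δ) (hδ1 : δ ≤ 1) (hε : 0 < ε) (hε1 : ε ≤ 1) (hST : S ≤ T)
    (hT : 0 < T) (w : Fin 3 → ℂ) :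
    min (-Real.log δ) ((S : ℝ) / T * lam x y T ε w) - Real.log 4 ≤ lam x y S δ w := by
  have hT' : (0 : ℝ) < T := by exact_mod_cast hT
  have hlog4 : 0 ≤ Real.log 4 := Real.log_nonneg (by norm_num)
  set L := lam x y T ε w with hL
  have hL0 : 0 ≤ L := lam_nonneg hε.le hε1 w
  rcases hL0.eq_or_lt with h0 | hLpos
  · rw [← h0, mul_zero]
    have h1 := lam_nonneg (x := x) (y := y) (T := S) hδ.le hδ1 w
    have h2 := min_le_right (-Real.log δ) 0
    linarith
  have hw0 : w 0 ≠ 0 := fun h => hLpos.ne' (by rw [hL, lam_eq_zero_of_apply_zero h])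
  have hexpL : prox x y T ε w = Real.exp (-L) := by
    rw [hL, lam, neg_neg, Real.exp_log (prox_pos hε hε1 w)]
  have hlt : Real.exp (-L) < 1 := Real.exp_lt_one_iff.mpr (by linarith)
  rw [prox, if_neg hw0] at hexpL
  set a := ‖w 1 / w 0 - x‖ with ha
  set b := ‖w 2 / (y * w 0) - Complex.exp (w 1 / w 0 - x)‖ with hb
  have hm : 4 * max ε (max (a ^ T) b) = Real.exp (-L) := by
    rcases min_choice 1 (4 * max ε (max (a ^ T) b)) with h | h
    · rw [h] at hexpL; linarith
    · rwa [h] at hexpL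
  have hm0 : 0 ≤ max ε (max (a ^ T) b) := hε.le.trans (le_max_left _ _)
  have haT : a ^ T ≤ Real.exp (-L) :=
    ((le_max_left _ _).trans (le_max_right ε _)).trans (by linarith)
  have hbL : b ≤ Real.exp (-L) :=
    ((le_max_right _ _).trans (le_max_right ε _)).trans (by linarith)
  have hfrac : (S : ℝ) / T * L ≤ L := by
    have : (S : ℝ) / T ≤ 1 := (div_le_one hT').mpr (by exact_mod_cast hST)
    exact mul_le_of_le_one_left hL0 this
  have haS : a ^ S ≤ Real.exp (-((S : ℝ) / T * L)) := by
    have h1 : a ≤ Real.exp (-(L / T)) := by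
      refine le_of_pow_le_pow_left₀ hT.ne' (Real.exp_pos _).le ?_
      rw [← Real.exp_nat_mul, mul_neg, mul_div_cancel₀ _ hT'.ne']
      exact haT
    refine (pow_le_pow_left₀ (norm_nonneg _) h1 S).trans (le_of_eq ?_)
    rw [← Real.exp_nat_mul]
    congr 1
    ring
  have hbS : b ≤ Real.exp (-((S : ℝ) / T * L)) := hbL.trans (Real.exp_le_exp.mpr (by linarith))
  set m := min (-Real.log δ) ((S : ℝ) / T * L) with hmdef
  have hδm : δ ≤ Real.exp (-m) := by
    rw [← Real.log_le_iff_le_exp hδ]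
    have := min_le_left (-Real.log δ) ((S : ℝ) / T * L)
    linarith
  have hem : Real.exp (-((S : ℝ) / T * L)) ≤ Real.exp (-m) :=
    Real.exp_le_exp.mpr (by have := min_le_right (-Real.log δ) ((S : ℝ) / T * L); linarith)
  have hprox : prox x y S δ w ≤ 4 * Real.exp (-m) := by
    rw [prox, if_neg hw0]
    refine (min_le_right _ _).trans (mul_le_mul_of_nonneg_left ?_ (by norm_num))
    exact max_le hδm (max_le (haS.trans hem) (hbS.trans hem))
  have h1 := Real.log_le_log (prox_pos hδ hδ1 w) hprox
  rw [Real.log_mul (by norm_num) (Real.exp_pos _).ne', Real.log_exp] at h1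
  rw [lam]
  linarith

/-- A point other than `(1 : x : y)` has bounded order of contact. -/
lemma exists_lam_le (hy : y ≠ 0) {w : Fin 3 → ℂ} (hw0 : w 0 = 1) (hw : w ≠ ![1, x, y]) :
    ∃ c : ℝ, 0 ≤ c ∧ ∀ (T : ℕ) (ε : ℝ), 1 ≤ T → 0 < ε → ε ≤ 1 → lam x y T ε w ≤ c * T := by
  have key : ∃ r : ℝ, 0 < r ∧ r ≤ 1 ∧ ∀ T : ℕ, 1 ≤ T →
      r ^ T ≤ max (‖w 1 / w 0 - x‖ ^ T) ‖w 2 / (y * w 0) - Complex.exp (w 1 / w 0 - x)‖ := by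
    by_cases h1 : w 1 = x
    · have h2 : w 2 ≠ y := fun h2 => hw (by
        funext i; fin_cases i <;> simp [hw0, h1, h2])
      have h3 : 0 < ‖w 2 / (y * w 0) - Complex.exp (w 1 / w 0 - x)‖ := by
        rw [norm_pos_iff, hw0, h1, mul_one, div_one, sub_self, Complex.exp_zero, sub_ne_zero]
        exact fun h => h2 ((div_eq_one_iff_eq hy).mp h)
      refine ⟨min 1 ‖w 2 / (y * w 0) - Complex.exp (w 1 / w 0 - x)‖, lt_min one_pos h3,
        min_le_left _ _, fun T hT => ?_⟩
      exact (pow_le_of_le_one (le_min zero_le_one h3.le) (min_le_left _ _) (by omega)).trans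
        ((min_le_right _ _).trans (le_max_right _ _))
    · have h3 : 0 < ‖w 1 / w 0 - x‖ := by
        rw [norm_pos_iff, hw0, div_one, sub_ne_zero]; exact h1
      refine ⟨min 1 ‖w 1 / w 0 - x‖, lt_min one_pos h3, min_le_left _ _, fun T _ => ?_⟩
      exact (pow_le_pow_left₀ (le_min zero_le_one h3.le) (min_le_right _ _) T).trans (le_max_left _ _)
  obtain ⟨r, hr0, hr1, hr⟩ := key
  refine ⟨-Real.log r, neg_nonneg.mpr (Real.log_nonpos hr0.le hr1), fun T ε hT hε hε1 => ?_⟩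
  have h1 : r ^ T ≤ prox x y T ε w := by
    rw [prox, if_neg (by rw [hw0]; exact one_ne_zero)]
    refine le_min (pow_le_one₀ hr0.le hr1) ?_
    have h2 := (hr T hT).trans (le_max_right ε _)
    have h3 : 0 < r ^ T := pow_pos hr0 T
    linarith
  have h2 := Real.log_le_log (pow_pos hr0 T) h1
  rw [Real.log_pow] at h2
  rw [lam]
  linarith

end Proximity

section Galois

variable {K : Type} [Field K] [NumberField K]

lemma log_mulHeight_nonneg (z : Fin 3 → K) : 0 ≤ Real.log (Height.mulHeight z) :=
  Real.log_nonneg (Height.one_le_mulHeight z)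

lemma card_algEquiv [IsGalois ℚ K] : Fintype.card (K ≃ₐ[ℚ] K) = Module.finrank ℚ K := by
  rw [← Nat.card_eq_fintype_card, IsGalois.card_aut_eq_finrank]

lemma bijective_comp_algEquiv [IsGalois ℚ K] (ι : K →+* ℂ) :
    Function.Bijective (fun g : K ≃ₐ[ℚ] K => ι.comp (g : K →+* K)) := by
  rw [Fintype.bijective_iff_injective_and_card]
  refine ⟨fun g h hgh => ?_, ?_⟩
  · ext a
    have := RingHom.congr_fun hgh a
    exact ι.injective this
  · rw [card_algEquiv, NumberField.Embeddings.card K ℂ]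

instance : Algebra.IsAlgebraic ℚ (AlgebraicClosure ℚ) := by
  convert AlgebraicClosure.isAlgebraic ℚ
  · rfl
  · exact Subsingleton.elim _ _

lemma exists_extension {k : Type} [Field k] [CharZero k] [Algebra.IsAlgebraic ℚ k]
    (j : K →+* k) (φ : K →+* ℂ) :
    ∃ σ : k →+* ℂ, σ.comp j = φ := by
  let : Algebra K k := j.toAlgebra
  let : Algebra K ℂ := φ.toAlgebra
  have : IsScalarTower ℚ K k := IsScalarTower.of_algebraMap_eq' (Subsingleton.elim _ _)
  have : Algebra.IsAlgebraic K k := Algebra.IsAlgebraic.tower_top (K := ℚ) K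
  let f : k →ₐ[K] ℂ := IsAlgClosed.lift
  exact ⟨f, f.comp_algebraMap⟩

lemma prod_embeddings_eq_prod_algEquiv {M : Type*} [CommMonoid M] [IsGalois ℚ K] (ι : K →+* ℂ)
    (f : (K →+* ℂ) → M) :
    ∏ φ, f φ = ∏ g : K ≃ₐ[ℚ] K, f (ι.comp (g : K →+* K)) :=
  ((bijective_comp_algEquiv ι).prod_comp f).symm

lemma exists_galois_field {k : Type} [Field k] [CharZero k] [Algebra.IsAlgebraic ℚ k]
    [IsAlgClosed k] {S : Set k} (hS : S.Finite) :
    ∃ (K : Type) (_ : Field K) (_ : NumberField K) (_ : IsGalois ℚ K) (j : K →+* k),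
      S ⊆ Set.range j := by
  have := hS.to_subtype
  let F : IntermediateField ℚ k := IntermediateField.adjoin ℚ S
  have : FiniteDimensional ℚ F := IntermediateField.finiteDimensional_adjoin
    fun x _ => (Algebra.IsAlgebraic.isAlgebraic x).isIntegral
  have : IsAlgClosure ℚ k := ⟨inferInstance, inferInstance⟩
  have : Normal ℚ k := inferInstance
  let N : IntermediateField ℚ k := IntermediateField.normalClosure ℚ F k
  have hN : FiniteDimensional ℚ N := normalClosure.is_finiteDimensional ℚ F k
  have hG : IsGalois ℚ N := { to_normal := normalClosure.normal ℚ F k }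
  refine ⟨N, inferInstance, { to_finiteDimensional := ?_ }, ?_, N.val.toRingHom, fun x hx => ?_⟩
  · convert hN
  · convert hG
  · exact ⟨⟨x, IntermediateField.le_normalClosure F (IntermediateField.subset_adjoin ℚ S hx)⟩, rfl⟩

end Galois

section Conjugates

variable {K : Type} [Field K]

lemma eval_embedding_comp (ι : K →+* ℂ) (z : Fin 3 → K) (q : MvPolynomial (Fin 3) ℤ) :
    eval (ι ∘ z) (map (Int.castRingHom ℂ) q) = ι (eval z (map (Int.castRingHom K) q)) := by
  have h := map_eval_eq ι z (map (Int.castRingHom K) q)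
  rw [map_map, RingHom.ext_int (ι.comp (Int.castRingHom K)) (Int.castRingHom ℂ)] at h
  exact h.symm

variable [NumberField K]

lemma eval_comp_algEquiv (g : K ≃ₐ[ℚ] K) (z : Fin 3 → K) (q : MvPolynomial (Fin 3) ℤ) :
    eval (g ∘ z) (map (Int.castRingHom K) q) = g (eval z (map (Int.castRingHom K) q)) := by
  have h := map_eval_eq (g : K →+* K) z (map (Int.castRingHom K) q)
  rw [map_map, RingHom.ext_int ((g : K →+* K).comp (Int.castRingHom K)) (Int.castRingHom K)] at h
  exact h.symm

variable {x y : ℂ} {p : MvPolynomial (Fin 3) ℤ} {D T : ℕ} {ε A B N : ℝ}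

lemma Level.sum_lam_le [IsGalois ℚ K] (l : Level x y p D T ε A B N) (ι : K →+* ℂ) (hN : 0 < N)
    (hε : 0 < ε) (hε1 : ε ≤ 1) (hp : p.IsHomogeneous D) {z : Fin 3 → K} (hz : z ≠ 0) {i : ℕ}
    (hi : i < 2 * T) (hne : eval z (map (Int.castRingHom K) ((D3 ℤ)^[i] p)) ≠ 0) :
    ∑ g : K ≃ₐ[ℚ] K, lam x y T ε (ι ∘ g ∘ z) ≤
      Module.finrank ℚ K * Real.log N + D * Real.log (Height.mulHeight z) := by
  have hH := prod_norm_le_prod_norm_eval_mul_mulHeight hz (hp.D3_iterate i) hne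
  rw [prod_embeddings_eq_prod_algEquiv ι, prod_embeddings_eq_prod_algEquiv ι] at hH
  set w : (K ≃ₐ[ℚ] K) → Fin 3 → ℂ := fun g => ι ∘ g ∘ z with hw
  have hw0 : ∀ g, 0 < ‖w g‖ := fun g => by
    rw [norm_pos_iff]
    intro h0
    refine hz (funext fun t => ?_)
    have := congrFun h0 t
    simpa [hw] using this
  have hH' : ∏ g, ‖w g‖ ^ D ≤ (∏ g, N * (‖w g‖ ^ D * prox x y T ε (w g))) *
      Height.mulHeight z ^ D := by
    refine hH.trans (mul_le_mul_of_nonneg_right ?_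
      (pow_nonneg (zero_le_one.trans (Height.one_le_mulHeight z)) _))
    refine Finset.prod_le_prod (fun _ _ => norm_nonneg _) fun g _ => ?_
    rw [map_D3_iterate]
    exact l.norm_eval_le i hi (w g)
  rw [Finset.prod_mul_distrib, Finset.prod_mul_distrib, Finset.prod_const, Finset.card_univ,
    card_algEquiv] at hH'
  have hW : 0 < ∏ g, ‖w g‖ ^ D := Finset.prod_pos fun g _ => pow_pos (hw0 g) _
  have hP : 0 < ∏ g, prox x y T ε (w g) := Finset.prod_pos fun g _ => prox_pos hε hε1 _
  have hM : 0 < Height.mulHeight z := zero_lt_one.trans_le (Height.one_le_mulHeight z)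
  have h1 : 1 ≤ N ^ Module.finrank ℚ K * (∏ g, prox x y T ε (w g)) * Height.mulHeight z ^ D := by
    refine le_of_mul_le_mul_right ?_ hW
    linarith
  have h2 := Real.log_nonneg h1
  rw [Real.log_mul (by positivity) (by positivity), Real.log_mul (by positivity) hP.ne',
    Real.log_pow, Real.log_pow, Real.log_prod (fun g _ => (prox_pos hε hε1 _).ne')] at h2
  simp only [lam, Finset.sum_neg_distrib]
  linarith

lemma card_mul_le_card_image_mul_sum {G α : Type*} [Group G] [Fintype G] [MulAction G α]
    [DecidableEq α] (f : α → ℝ) (hf : ∀ a, 0 ≤ f a) (a : α) (g₁ : G) :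
    Fintype.card G * f (g₁ • a) ≤
      (Finset.univ.image fun g : G => g • a).card * ∑ g : G, f (g • a) := by
  classical
  set s := (Finset.univ.filter fun g : G => g • a = g₁ • a).card
  have hfib : ∀ b ∈ Finset.univ.image fun g : G => g • a,
      (Finset.univ.filter fun g : G => g • a = b).card = s := by
    intro b hb
    obtain ⟨h, -, rfl⟩ := Finset.mem_image.mp hb
    refine Finset.card_equiv (Equiv.mulLeft (g₁ * h⁻¹)) fun g => ?_
    simp only [Finset.mem_filter, Finset.mem_univ, true_and, Equiv.coe_mulLeft, mul_smul,
      smul_left_cancel_iff, inv_smul_eq_iff]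
  have hcard : Fintype.card G = (Finset.univ.image fun g : G => g • a).card * s := by
    rw [← Finset.card_univ, Finset.card_eq_sum_card_image (fun g : G => g • a),
      Finset.sum_congr rfl hfib, Finset.sum_const, smul_eq_mul]
  have hsum : (s : ℝ) * f (g₁ • a) ≤ ∑ g : G, f (g • a) := by
    rw [← nsmul_eq_mul, ← Finset.sum_const]
    calc ∑ _g ∈ Finset.univ.filter fun g : G => g • a = g₁ • a, f (g₁ • a)
        = ∑ g ∈ Finset.univ.filter fun g : G => g • a = g₁ • a, f (g • a) :=
          Finset.sum_congr rfl fun g hg => by rw [(Finset.mem_filter.mp hg).2]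
      _ ≤ _ := Finset.sum_le_sum_of_subset_of_nonneg (Finset.filter_subset _ _)
          fun g _ _ => hf _
  rw [hcard, Nat.cast_mul, mul_assoc]
  exact mul_le_mul_of_nonneg_left hsum (Nat.cast_nonneg _)

open Classical in
/-- The finite set of conjugates of a point of `K³`. -/
noncomputable def conjugates (z : Fin 3 → K) : Finset (Fin 3 → K) :=
  Finset.univ.image fun g : K ≃ₐ[ℚ] K => (g ∘ z : Fin 3 → K)

lemma card_conjugates_pos (z : Fin 3 → K) : 0 < (conjugates z).card := by
  classical
  exact Finset.card_pos.mpr ⟨_, Finset.mem_image_of_mem _ (Finset.mem_univ 1)⟩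

lemma card_mul_le_card_conjugates_mul_sum [IsGalois ℚ K] (f : (Fin 3 → K) → ℝ) (hf : ∀ a, 0 ≤ f a)
    (z : Fin 3 → K) (g₁ : K ≃ₐ[ℚ] K) :
    Module.finrank ℚ K * f (g₁ ∘ z) ≤ (conjugates z).card * ∑ g : K ≃ₐ[ℚ] K, f (g ∘ z) := by
  classical
  have h := card_mul_le_card_image_mul_sum f hf z g₁
  have he : ∀ g : K ≃ₐ[ℚ] K, g • z = g ∘ z := fun g => rfl
  simp only [card_algEquiv, he] at h
  rw [conjugates]
  convert h using 4

lemma Level.card_conjugates_le [IsGalois ℚ K] (l : Level x y p D T ε A B N)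
    (j : K →+* AlgebraicClosure ℚ) (σ : AlgebraicClosure ℚ →+* ℂ)
    {Y : Fin (l.d ^ 2) → Fin 3 → K} (hY : ∀ i, j ∘ Y i = l.Z i) {z : Fin 3 → K} (hz0 : z 0 = 1)
    (hz2 : z 2 ≠ 0)
    (hmin : ∀ g : K ≃ₐ[ℚ] K, Height.mulHeight z ≤ Height.mulHeight (g ∘ z))
    (hvan : ∀ i < 2 * T, eval z (map (Int.castRingHom K) ((D3 ℤ)^[i] p)) = 0) :
    T * (conjugates z).card ≤ D ^ 2 ∧
      D * ((conjugates z).card * T * Real.log (Height.mulHeight z)) ≤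
        Module.finrank ℚ K * Real.log B := by
  classical
  set F : (Fin 3 → K) → Finset (Fin (l.d ^ 2)) := fun w =>
    Finset.univ.filter fun i => ∃ c : K, Y i = c • w with hF
  have hY0 : ∀ i, Y i ≠ 0 := fun i h0 => l.ne_zero i (by
    rw [← hY, h0]
    ext t
    simp)
  have hone : ∀ w ∈ conjugates z, w 0 = 1 := by
    intro w hw
    obtain ⟨g, -, rfl⟩ := Finset.mem_image.mp hw
    simp [hz0]
  have hdisj : Set.PairwiseDisjoint (conjugates z : Set (Fin 3 → K)) F := by
    intro w hw w' hw' hne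
    refine Finset.disjoint_left.mpr fun i hi hi' => hne ?_
    obtain ⟨c, hc⟩ := (Finset.mem_filter.mp hi).2
    obtain ⟨c', hc'⟩ := (Finset.mem_filter.mp hi').2
    have h0 := congrFun (hc.symm.trans hc') 0
    simp only [Pi.smul_apply, smul_eq_mul, hone w hw, hone w' hw', mul_one] at h0
    have hc0 : c ≠ 0 := fun h => hY0 i (by rw [hc, h, zero_smul])
    rw [hc, ← h0] at hc'
    exact smul_right_injective _ hc0 hc'
  have hcard : ∀ w ∈ conjugates z, T ≤ (F w).card := by
    intro w hw
    obtain ⟨g, -, rfl⟩ := Finset.mem_image.mp hw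
    have hv : (![1, σ (j (g (z 1))), σ (j (g (z 2)))] : Fin 3 → ℂ) = (σ.comp j) ∘ g ∘ z := by
      ext t
      fin_cases t <;> simp [hz0]
    have h := l.le_card σ (σ (j (g (z 1)))) (σ (j (g (z 2)))) (by simpa using hz2) fun i hi => by
      rw [hv, ← map_D3_iterate, eval_embedding_comp, eval_comp_algEquiv, hvan i hi, map_zero,
        map_zero]
    refine h.trans ?_
    rw [Nat.card_eq_fintype_card, Fintype.card_subtype]
    refine Finset.card_le_card fun i hi => ?_
    obtain ⟨c, hc⟩ := (Finset.mem_filter.mp hi).2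
    refine Finset.mem_filter.mpr ⟨Finset.mem_univ _, Y i 0, funext fun t => ?_⟩
    rw [hv, ← hY] at hc
    have h0 : σ (j (Y i 0)) = c := by simpa [hz0] using congrFun hc 0
    have ht : σ (j (Y i t)) = c * σ (j (g (z t))) := congrFun hc t
    rw [← h0, ← map_mul, ← map_mul] at ht
    exact (σ.comp j).injective ht
  have hsub : (conjugates z).biUnion F ⊆ Finset.univ := Finset.subset_univ _
  refine ⟨?_, ?_⟩
  · calc T * (conjugates z).card = ∑ _w ∈ conjugates z, T := by simp [mul_comm]
      _ ≤ ∑ w ∈ conjugates z, (F w).card := Finset.sum_le_sum hcard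
      _ = ((conjugates z).biUnion F).card := (Finset.card_biUnion hdisj).symm
      _ ≤ (Finset.univ : Finset (Fin (l.d ^ 2))).card := Finset.card_le_card hsub
      _ ≤ D ^ 2 := by
        rw [Finset.card_univ, Fintype.card_fin]
        exact Nat.pow_le_pow_left l.d_le 2
  · have hprod := l.prod_mulHeight_le K j Y hY
    have hpos : ∀ i, 0 < Height.mulHeight (Y i) := fun i =>
      zero_lt_one.trans_le (Height.one_le_mulHeight _)
    have hlog := Real.log_le_log (Finset.prod_pos fun i _ => pow_pos (hpos i) D) hprod
    rw [Real.log_prod (fun i _ => (pow_pos (hpos i) D).ne'), Real.log_pow] at hlog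
    simp only [Real.log_pow, ← Finset.mul_sum] at hlog
    refine le_trans (mul_le_mul_of_nonneg_left ?_ (Nat.cast_nonneg _)) hlog
    calc (conjugates z).card * T * Real.log (Height.mulHeight z)
        = ∑ _w ∈ conjugates z, T * Real.log (Height.mulHeight z) := by
          rw [Finset.sum_const, nsmul_eq_mul, mul_assoc]
      _ ≤ ∑ w ∈ conjugates z, ∑ i ∈ F w, Real.log (Height.mulHeight (Y i)) := by
          refine Finset.sum_le_sum fun w hw => ?_
          have h1 : ∀ i ∈ F w, Real.log (Height.mulHeight z) ≤
              Real.log (Height.mulHeight (Y i)) := by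
            intro i hi
            obtain ⟨c, hc⟩ := (Finset.mem_filter.mp hi).2
            have hc0 : c ≠ 0 := fun h => hY0 i (by rw [hc, h, zero_smul])
            obtain ⟨g, -, rfl⟩ := Finset.mem_image.mp hw
            rw [hc, Height.mulHeight_smul_eq_mulHeight _ hc0]
            exact Real.log_le_log (zero_lt_one.trans_le (Height.one_le_mulHeight z)) (hmin g)
          have h2 := Finset.card_nsmul_le_sum (F w) _ _ h1
          rw [nsmul_eq_mul] at h2
          refine le_trans (mul_le_mul_of_nonneg_right ?_ (log_mulHeight_nonneg z)) h2
          exact_mod_cast hcard w hw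
      _ = ∑ i ∈ (conjugates z).biUnion F, Real.log (Height.mulHeight (Y i)) :=
          (Finset.sum_biUnion hdisj).symm
      _ ≤ ∑ i, Real.log (Height.mulHeight (Y i)) :=
          Finset.sum_le_sum_of_subset_of_nonneg hsub fun i _ _ => log_mulHeight_nonneg _

end Conjugates

section Pigeonhole

variable {K : Type} [Field K] [NumberField K]
variable {x y : ℂ} {p : MvPolynomial (Fin 3) ℤ} {D T : ℕ} {ε A B N : ℝ}

/-- Some point of the cycle, suitably normalised, is close to `(1 : x : y)` on average over its
conjugates. -/
lemma Level.exists_sum_lam_ge [IsGalois ℚ K] (l : Level x y p D T ε A B N)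
    (j : K →+* AlgebraicClosure ℚ) (ι : K →+* ℂ) (hε : 0 < ε) (hε1 : ε ≤ 1)
    {Y : Fin (l.d ^ 2) → Fin 3 → K} (hY : ∀ i, j ∘ Y i = l.Z i) {u v : ℝ} (hu : 0 < u) (hv : 0 ≤ v)
    (huv : (D : ℝ) ^ 2 * u + v * Real.log B < -Real.log A) :
    ∃ z : Fin 3 → K, z 0 = 1 ∧ z 2 ≠ 0 ∧
      (∀ g : K ≃ₐ[ℚ] K, Height.mulHeight z ≤ Height.mulHeight (g ∘ z)) ∧
      u * Module.finrank ℚ K + v * (D * Real.log (Height.mulHeight z)) ≤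
        ∑ g : K ≃ₐ[ℚ] K, lam x y T ε (ι ∘ g ∘ z) := by
  have hn : (0 : ℝ) < Module.finrank ℚ K := by exact_mod_cast Module.finrank_pos
  have hlow : ∀ g : K ≃ₐ[ℚ] K, -Real.log A ≤ ∑ i, lam x y T ε (ι ∘ g ∘ Y i) := by
    intro g
    obtain ⟨σ, hσ⟩ := exists_extension j (ι.comp (g : K →+* K))
    have he : ∀ i, σ ∘ l.Z i = ι ∘ g ∘ Y i := fun i => by
      rw [← hY]
      ext t
      exact RingHom.congr_fun hσ (Y i t)
    have h := l.prod_prox_le σ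
    have hpos : ∀ i, 0 < prox x y T ε (σ ∘ l.Z i) := fun i => prox_pos hε hε1 _
    have h2 := Real.log_le_log (Finset.prod_pos fun i _ => hpos i) h
    rw [Real.log_prod fun i _ => (hpos i).ne'] at h2
    simp only [lam, Finset.sum_neg_distrib, ← he]
    linarith
  have hex : ∃ i, u * Module.finrank ℚ K + v * (D * Real.log (Height.mulHeight (Y i))) ≤
      ∑ g : K ≃ₐ[ℚ] K, lam x y T ε (ι ∘ g ∘ Y i) := by
    by_contra! hcon
    have h1 : ∑ i, ∑ g : K ≃ₐ[ℚ] K, lam x y T ε (ι ∘ g ∘ Y i) ≤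
        ∑ i, (u * Module.finrank ℚ K + v * (D * Real.log (Height.mulHeight (Y i)))) :=
      Finset.sum_le_sum fun i _ => (hcon i).le
    have h2 : Module.finrank ℚ K * -Real.log A ≤
        ∑ i, ∑ g : K ≃ₐ[ℚ] K, lam x y T ε (ι ∘ g ∘ Y i) := by
      rw [Finset.sum_comm, ← card_algEquiv (K := K), ← Finset.card_univ, ← nsmul_eq_mul]
      exact Finset.card_nsmul_le_sum _ _ _ fun g _ => hlow g
    have hpos : ∀ i, 0 < Height.mulHeight (Y i) := fun i =>
      zero_lt_one.trans_le (Height.one_le_mulHeight _)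
    have h3 := Real.log_le_log (Finset.prod_pos fun i _ => pow_pos (hpos i) D)
      (l.prod_mulHeight_le K j Y hY)
    rw [Real.log_prod (fun i _ => (pow_pos (hpos i) D).ne'), Real.log_pow] at h3
    simp only [Real.log_pow] at h3
    rw [Finset.sum_add_distrib, Finset.sum_const, Finset.card_univ, Fintype.card_fin, nsmul_eq_mul,
      ← Finset.mul_sum] at h1
    have h4 : ((l.d ^ 2 : ℕ) : ℝ) ≤ (D : ℝ) ^ 2 := by exact_mod_cast Nat.pow_le_pow_left l.d_le 2
    have h5 := mul_le_mul_of_nonneg_right h4 (mul_pos hu hn).le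
    have h6 := mul_le_mul_of_nonneg_left h3 hv
    have h7 := mul_lt_mul_of_pos_left huv hn
    linarith
  obtain ⟨i, hi⟩ := hex
  have hpos : 0 < ∑ g : K ≃ₐ[ℚ] K, lam x y T ε (ι ∘ g ∘ Y i) :=
    lt_of_lt_of_le (add_pos_of_pos_of_nonneg (mul_pos hu hn)
      (mul_nonneg hv (mul_nonneg (Nat.cast_nonneg _) (log_mulHeight_nonneg _)))) hi
  have h0 : Y i 0 ≠ 0 := fun h => hpos.ne'
    (Finset.sum_eq_zero fun g _ => lam_eq_zero_of_apply_zero (by simp [h]))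
  have h2 : Y i 2 ≠ 0 := fun h => hpos.ne'
    (Finset.sum_eq_zero fun g _ => lam_eq_zero_of_apply_two (by simp [h]))
  set w : Fin 3 → K := (Y i 0)⁻¹ • Y i with hw
  have hlam : ∀ g : K ≃ₐ[ℚ] K, lam x y T ε (ι ∘ g ∘ w) = lam x y T ε (ι ∘ g ∘ Y i) := by
    intro g
    have he : ι ∘ g ∘ w = (ι (g (Y i 0)))⁻¹ • (ι ∘ g ∘ Y i) := by
      ext t
      simp [hw]
    rw [he, lam_smul (by simpa using h0)]
  obtain ⟨g₀, -, hg₀⟩ := Finset.exists_min_image Finset.univ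
    (fun g : K ≃ₐ[ℚ] K => Height.mulHeight (g ∘ w)) Finset.univ_nonempty
  have hH : Height.mulHeight (g₀ ∘ w) ≤ Height.mulHeight (Y i) := by
    refine (hg₀ 1 (Finset.mem_univ _)).trans_eq ?_
    exact Height.mulHeight_smul_eq_mulHeight _ (inv_ne_zero h0)
  refine ⟨g₀ ∘ w, by simp [hw, h0], by simp [hw, h0, h2], fun g => hg₀ (g * g₀) (Finset.mem_univ _),
    ?_⟩
  calc u * Module.finrank ℚ K + v * (D * Real.log (Height.mulHeight (g₀ ∘ w)))
      ≤ u * Module.finrank ℚ K + v * (D * Real.log (Height.mulHeight (Y i))) := by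
        gcongr
    _ ≤ ∑ g : K ≃ₐ[ℚ] K, lam x y T ε (ι ∘ g ∘ w) := by simpa only [hlam] using hi
    _ = ∑ g : K ≃ₐ[ℚ] K, lam x y T ε (ι ∘ (g * g₀ : K ≃ₐ[ℚ] K) ∘ w) :=
        (Equiv.sum_comp (Equiv.mulRight g₀) fun g : K ≃ₐ[ℚ] K => lam x y T ε (ι ∘ g ∘ w)).symm
    _ = _ := rfl

end Pigeonhole

section Numerics

lemma eventually_lt_mul_log {a : ℝ} (ha : 0 < a) (c : ℝ) :
    ∀ᶠ D : ℕ in Filter.atTop, c < a * Real.log D :=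
  ((Real.tendsto_log_atTop.comp (tendsto_natCast_atTop_atTop (R := ℝ))).const_mul_atTop ha
    ).eventually_gt_atTop c

lemma log_exponents_contradiction {τ β e c₁ c₂ L l : ℝ} (hτ1 : 1 ≤ τ) (hl0 : 0 ≤ l)
    (h₁ : (τ - 1) * l + (e + 1 - τ) * L ≤ c₁)
    (h₂ : (e + β - τ) * L ≤ c₂ + (2 + β - 2 * τ) * l)
    (hL₁ : c₂ < (e + β - τ) * L)
    (hL₂ : c₁ * (2 + β - 2 * τ) + c₂ * (τ - 1) <
      (e * (β + 1 - τ) - (τ - 1) * (2 - τ)) * L) : False := by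
  rcases le_or_gt (2 + β - 2 * τ) 0 with h | h
  · linarith [mul_nonneg (neg_nonneg.mpr h) hl0]
  · have h3 := mul_le_mul_of_nonneg_left h₁ h.le
    have h4 := mul_le_mul_of_nonneg_left h₂ (sub_nonneg.mpr hτ1)
    linarith only [h3, h4, hL₂]

lemma eventually_no_intermediate_level {τ β e C : ℝ} (hτ1 : 1 ≤ τ) (hβ : τ < β) (he : 0 < e)
    (heκ : (τ - 1) * (2 - τ) / (β + 1 - τ) < e) (hC : 0 < C) :
    ∀ᶠ D : ℕ in Filter.atTop, ∀ E : ℕ, 1 ≤ E → E ≤ D → ∀ a : ℝ, 0 ≤ a →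
      a ≤ C * (E : ℝ) ^ (1 + β - τ) →
      (E : ℝ) ^ τ * (D : ℝ) ^ (e - τ) * ((D : ℝ) ^ β + D * a) ≤ 10 * (E : ℝ) ^ β + 2 * (E * a) →
      False := by
  have hκ : 0 < e * (β + 1 - τ) - (τ - 1) * (2 - τ) := by
    rw [div_lt_iff₀ (by linarith)] at heκ
    linarith
  filter_upwards [eventually_lt_mul_log he (Real.log 12),
    eventually_lt_mul_log (show 0 < e + β - τ by linarith) (Real.log (12 * C)),
    eventually_lt_mul_log hκ
      (Real.log 12 * (2 + β - 2 * τ) + Real.log (12 * C) * (τ - 1))] with D hD1 hD2 hD3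
  intro E hE hED a ha0 ha h
  have hE0 : (0 : ℝ) < E := by exact_mod_cast hE
  have hD0 : (0 : ℝ) < D := by exact_mod_cast hE.trans hED
  have hl0 : 0 ≤ Real.log E := Real.log_nonneg (by exact_mod_cast hE)
  have hlL : Real.log E ≤ Real.log D := Real.log_le_log hE0 (by exact_mod_cast hED)
  set q := (E : ℝ) ^ τ * (D : ℝ) ^ (e - τ) with hq
  have hq0 : 0 < q := by positivity
  have hDβ : 0 < (D : ℝ) ^ β := by positivity
  have hEβ : 0 < (E : ℝ) ^ β := by positivity
  have hlogq : Real.log q = τ * Real.log E + (e - τ) * Real.log D := by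
    rw [hq, Real.log_mul (by positivity) (by positivity), Real.log_rpow hE0, Real.log_rpow hD0]
  rcases le_total ((E : ℝ) * a) ((E : ℝ) ^ β) with hcase | hcase
  · have h1 : q * (D : ℝ) ^ β ≤ 12 * (E : ℝ) ^ β := by
      have : 0 ≤ q * (D * a) := by positivity
      linarith
    have h2 := Real.log_le_log (by positivity) h1
    rw [Real.log_mul hq0.ne' hDβ.ne', Real.log_mul (by norm_num) hEβ.ne', hlogq,
      Real.log_rpow hE0, Real.log_rpow hD0] at h2
    have h3 := mul_le_mul_of_nonneg_left hlL (sub_nonneg.mpr hβ.le)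
    linarith
  · have ha' : 0 < a := by
      by_contra hna
      have : a = 0 := le_antisymm (not_lt.mp hna) ha0
      rw [this, mul_zero] at hcase
      linarith
    have h1 : q * (D * a) ≤ 12 * (E * a) := by
      have : 0 ≤ q * (D : ℝ) ^ β := by positivity
      linarith
    have h2 : q * (D : ℝ) ^ β ≤ 12 * (E * (C * (E : ℝ) ^ (1 + β - τ))) := by
      have h3 : 0 ≤ q * (D * a) := by positivity
      have h4 := mul_le_mul_of_nonneg_left ha hE0.le
      linarith
    have h3 := Real.log_le_log (by positivity) h1
    have h4 := Real.log_le_log (by positivity) h2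
    have hEb : (E : ℝ) ^ (1 + β - τ) ≠ 0 := by positivity
    have hE12 : (12 : ℝ) * (E * (C * (E : ℝ) ^ (1 + β - τ))) =
        12 * C * (E * (E : ℝ) ^ (1 + β - τ)) := by ring
    rw [Real.log_mul hq0.ne' (mul_pos hD0 ha').ne', Real.log_mul hD0.ne' ha'.ne',
      Real.log_mul (x := 12) (by norm_num) (mul_pos hE0 ha').ne', Real.log_mul hE0.ne' ha'.ne',
      hlogq] at h3
    rw [hE12, Real.log_mul hq0.ne' hDβ.ne', hlogq,
      Real.log_mul (x := 12 * C) (by positivity) (mul_ne_zero hE0.ne' hEb),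
      Real.log_mul hE0.ne' hEb, Real.log_rpow hE0, Real.log_rpow hD0] at h4
    exact log_exponents_contradiction (c₁ := Real.log 12) (c₂ := Real.log (12 * C)) hτ1 hl0
      (by linarith) (by linarith) hD2 hD3

end Numerics

section Descent

lemma add_one_rpow_le {E : ℕ} (hE : 1 ≤ E) {s : ℝ} (hs : 0 ≤ s) :
    ((E + 1 : ℕ) : ℝ) ^ s ≤ 2 ^ s * (E : ℝ) ^ s := by
  rw [← Real.mul_rpow (by norm_num) (Nat.cast_nonneg E)]
  refine Real.rpow_le_rpow (Nat.cast_nonneg _) ?_ hs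
  have : (1 : ℝ) ≤ E := by exact_mod_cast hE
  push_cast
  linarith

lemma conjugates_count_bounds {E m : ℕ} (hE : 1 ≤ E) {τ β h n : ℝ} (hτ1 : 1 ≤ τ) (hτ2 : τ < 2)
    (hβ : τ < β) (hh : 0 ≤ h) (hn : 0 ≤ n)
    (hm₁ : ⌊((E + 1 : ℕ) : ℝ) ^ τ⌋₊ * m ≤ (E + 1) ^ 2)
    (hm₂ : ((E + 1 : ℕ) : ℝ) * (m * ⌊((E + 1 : ℕ) : ℝ) ^ τ⌋₊ * h) ≤
      n * (21 * ((E + 1 : ℕ) : ℝ) ^ (2 + β))) :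
    (m : ℝ) ≤ 4 * (E : ℝ) ^ (2 - τ) ∧
      m * h ≤ n * (42 * 2 ^ (1 + β - τ) * (E : ℝ) ^ (1 + β - τ)) := by
  have hfl := half_rpow_le_floor (D := E + 1) (by omega) (show 0 ≤ τ by linarith)
  set F : ℝ := ((E + 1 : ℕ) : ℝ) with hF
  set T : ℕ := ⌊F ^ τ⌋₊ with hT
  have hF0 : 0 < F := by rw [hF]; exact_mod_cast Nat.succ_pos E
  have hFτ : 0 < F ^ τ := by positivity
  have hm₁' : (T : ℝ) * m ≤ F ^ 2 := by rw [hF]; exact_mod_cast hm₁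
  have hm0 : (0 : ℝ) ≤ m := Nat.cast_nonneg m
  constructor
  · have h1 : F ^ τ * m ≤ F ^ τ * (2 * F ^ (2 - τ)) := by
      have h2 : F ^ τ * (2 * F ^ (2 - τ)) = 2 * F ^ 2 := by
        rw [mul_left_comm, ← Real.rpow_add hF0, show τ + (2 - τ) = (2 : ℕ) by push_cast; ring,
          Real.rpow_natCast]
      rw [h2]
      linarith only [mul_le_mul_of_nonneg_right hfl hm0, hm₁']
    have h2 := le_of_mul_le_mul_left h1 hFτ
    have h3 := add_one_rpow_le hE (show 0 ≤ 2 - τ by linarith)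
    have h4 : (2 : ℝ) ^ (2 - τ) ≤ 2 := by
      calc (2 : ℝ) ^ (2 - τ) ≤ 2 ^ (1 : ℝ) :=
            Real.rpow_le_rpow_of_exponent_le (by norm_num) (by linarith)
        _ = 2 := Real.rpow_one 2
    have h5 := mul_le_mul_of_nonneg_right h4 (show 0 ≤ (E : ℝ) ^ (2 - τ) by positivity)
    linarith only [h2, h3, h5]
  · have h1 : F * F ^ τ * (m * h) ≤ F * F ^ τ * (42 * n * F ^ (1 + β - τ)) := by
      have h2 : F * F ^ τ * (42 * n * F ^ (1 + β - τ)) = 42 * n * F ^ (2 + β) := by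
        rw [show 2 + β = 1 + τ + (1 + β - τ) by ring, Real.rpow_add hF0, Real.rpow_add hF0,
          Real.rpow_one]
        ring
      rw [h2]
      have h3 := mul_le_mul_of_nonneg_right hfl (show 0 ≤ F * (m * h) by positivity)
      linarith only [h3, hm₂]
    have h2 := le_of_mul_le_mul_left h1 (by positivity)
    have h3 := mul_le_mul_of_nonneg_left (add_one_rpow_le hE (show 0 ≤ 1 + β - τ by linarith))
      (show 0 ≤ 42 * n by positivity)
    linarith only [h2, h3]

lemma descent_contradiction {G : Type*} [Fintype G] [Nonempty G] (a b : G → ℝ) {D E m : ℕ}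
    (hE : 1 ≤ E) (hED : E ≤ D) {τ β ν e h : ℝ} (hτ1 : 1 ≤ τ) (hτ2 : τ < 2) (hβ : τ < β)
    (hh : 0 ≤ h) (hm : 1 ≤ m)
    (hm₁ : ⌊((E + 1 : ℕ) : ℝ) ^ τ⌋₊ * m ≤ (E + 1) ^ 2)
    (hm₂ : ((E + 1 : ℕ) : ℝ) * (m * ⌊((E + 1 : ℕ) : ℝ) ^ τ⌋₊ * h) ≤
      Fintype.card G * (21 * ((E + 1 : ℕ) : ℝ) ^ (2 + β)))
    (hsum : ∑ g, a g ≤ Fintype.card G * (3 * (E : ℝ) ^ β) + E * h)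
    (hmax : ∀ g, Fintype.card G * a g ≤ m * ∑ g, a g)
    (hmin : ∀ g, min ((E : ℝ) ^ ν / 2)
      ((⌊(E : ℝ) ^ τ⌋₊ : ℝ) / ⌊(D : ℝ) ^ τ⌋₊ * b g) - Real.log 4 ≤ a g)
    (hlow : (D : ℝ) ^ (e + β) * Fintype.card G + (D : ℝ) ^ e * (D * h) ≤ ∑ g, b g)
    (hcap : 2 * (15 + 42 * 2 ^ (1 + β - τ)) * (E : ℝ) ^ (2 + β - τ) < (E : ℝ) ^ ν)
    (hno : ∀ r : ℝ, 0 ≤ r → r ≤ 42 * 2 ^ (1 + β - τ) * (E : ℝ) ^ (1 + β - τ) →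
      (E : ℝ) ^ τ * (D : ℝ) ^ (e - τ) * ((D : ℝ) ^ β + D * r) ≤
        10 * (E : ℝ) ^ β + 2 * (E * r) → False) : False := by
  set n : ℝ := (Fintype.card G : ℝ) with hn
  have hn0 : 0 < n := by rw [hn]; exact_mod_cast Fintype.card_pos
  have hm' : (1 : ℝ) ≤ m := by exact_mod_cast hm
  have hE1 : (1 : ℝ) ≤ E := by exact_mod_cast hE
  have hE0 : (0 : ℝ) < E := by linarith
  have hD0 : (0 : ℝ) < D := by exact_mod_cast hE.trans hED
  have hlog4 : Real.log 4 ≤ 2 := by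
    rw [show (4 : ℝ) = 2 ^ 2 by norm_num, Real.log_pow]
    push_cast
    linarith [Real.log_two_lt_d9]
  obtain ⟨hmE, hmh⟩ := conjugates_count_bounds hE hτ1 hτ2 hβ hh hn0.le hm₁ hm₂
  set C : ℝ := 42 * 2 ^ (1 + β - τ) with hC
  have hEb : 0 < (E : ℝ) ^ (1 + β - τ) := by positivity
  have hEβ : 1 ≤ (E : ℝ) ^ β := Real.one_le_rpow hE1 (by linarith)
  by_cases hg : ∃ g, (E : ℝ) ^ ν / 2 ≤ (⌊(E : ℝ) ^ τ⌋₊ : ℝ) / ⌊(D : ℝ) ^ τ⌋₊ * b g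
  · obtain ⟨g, hg⟩ := hg
    have h1 := hmin g
    rw [min_eq_left hg] at h1
    have h2 := hmax g
    have h3 := mul_le_mul_of_nonneg_left hsum (Nat.cast_nonneg (α := ℝ) m)
    have h4 : (m : ℝ) * (E : ℝ) ^ β ≤ 4 * (E : ℝ) ^ (2 + β - τ) := by
      rw [show 2 + β - τ = (2 - τ) + β by ring, Real.rpow_add hE0, ← mul_assoc]
      exact mul_le_mul_of_nonneg_right hmE (by positivity)
    have h5 : (E : ℝ) * (m * h) ≤ n * (C * (E : ℝ) ^ (2 + β - τ)) := by
      rw [show 2 + β - τ = 1 + (1 + β - τ) by ring, Real.rpow_add hE0, Real.rpow_one]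
      linarith only [mul_le_mul_of_nonneg_left hmh hE0.le]
    have h6 : n * a g ≤ n * ((12 + C) * (E : ℝ) ^ (2 + β - τ)) := by
      linarith only [h2, h3, h5, mul_le_mul_of_nonneg_left h4 hn0.le]
    have h7 := le_of_mul_le_mul_left h6 hn0
    have h8 : 1 ≤ (E : ℝ) ^ (2 + β - τ) := Real.one_le_rpow hE1 (by linarith)
    linarith only [h1, h7, h8, hlog4, hcap]
  · push Not at hg
    have h1 : ∀ g, (⌊(E : ℝ) ^ τ⌋₊ : ℝ) / ⌊(D : ℝ) ^ τ⌋₊ * b g - Real.log 4 ≤ a g := fun g => by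
      have := hmin g
      rwa [min_eq_right (hg g).le] at this
    have h2 := Finset.sum_le_sum fun g (_ : g ∈ Finset.univ) => h1 g
    rw [Finset.sum_sub_distrib, ← Finset.mul_sum, Finset.sum_const, Finset.card_univ,
      nsmul_eq_mul, ← hn] at h2
    have hfE := half_rpow_le_floor hE (show 0 ≤ τ by linarith)
    have hDτ : 0 < (D : ℝ) ^ τ := by positivity
    have hfD : (⌊(D : ℝ) ^ τ⌋₊ : ℝ) ≤ (D : ℝ) ^ τ := Nat.floor_le hDτ.le
    have hfD0 : (0 : ℝ) < ⌊(D : ℝ) ^ τ⌋₊ := by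
      have := half_rpow_le_floor (hE.trans hED) (show 0 ≤ τ by linarith)
      linarith
    have hq : (E : ℝ) ^ τ * (D : ℝ) ^ (-τ) ≤ 2 * ((⌊(E : ℝ) ^ τ⌋₊ : ℝ) / ⌊(D : ℝ) ^ τ⌋₊) := by
      rw [Real.rpow_neg hD0.le, ← div_eq_mul_inv, ← mul_div_assoc]
      exact div_le_div₀ (by positivity) hfE hfD0 hfD
    have hS0 : 0 ≤ (D : ℝ) ^ (e + β) * n + (D : ℝ) ^ e * (D * h) := by positivity
    have h3 : (E : ℝ) ^ τ * (D : ℝ) ^ (-τ) *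
        ((D : ℝ) ^ (e + β) * n + (D : ℝ) ^ e * (D * h)) ≤
        2 * (n * (3 * (E : ℝ) ^ β) + E * h + n * Real.log 4) := by
      have h4 := mul_le_mul_of_nonneg_right hq hS0
      have h5 := mul_le_mul_of_nonneg_left hlow
        (show 0 ≤ (⌊(E : ℝ) ^ τ⌋₊ : ℝ) / ⌊(D : ℝ) ^ τ⌋₊ by positivity)
      linarith only [h4, h5, h2, hsum]
    refine hno (h / n) (by positivity) ?_ ?_
    · rw [div_le_iff₀ hn0, mul_comm]
      exact (le_mul_of_one_le_left hh hm').trans hmh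
    · refine le_of_mul_le_mul_left ?_ hn0
      have hr : n * (h / n) = h := mul_div_cancel₀ h hn0.ne'
      have hl : n * ((E : ℝ) ^ τ * (D : ℝ) ^ (e - τ) * ((D : ℝ) ^ β + D * (h / n))) =
          (E : ℝ) ^ τ * (D : ℝ) ^ (-τ) * ((D : ℝ) ^ (e + β) * n + (D : ℝ) ^ e * (D * h)) := by
        rw [sub_eq_add_neg, Real.rpow_add hD0, Real.rpow_add hD0]
        linear_combination ((E : ℝ) ^ τ * (D : ℝ) ^ e * (D : ℝ) ^ (-τ) * D) * hr
      rw [hl]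
      have h6 : n * (10 * (E : ℝ) ^ β + 2 * (E * (h / n))) = n * (10 * (E : ℝ) ^ β) + 2 * (E * h) := by
        linear_combination (2 * (E : ℝ)) * hr
      rw [h6]
      have h7 := mul_le_mul_of_nonneg_left hlog4 hn0.le
      have h8 := mul_le_mul_of_nonneg_left hEβ hn0.le
      linarith only [h3, h7, h8]

end Descent

section Algebraicity

lemma Level.exists_lam_le_of_not_algebraic {x y : ℂ} {p : MvPolynomial (Fin 3) ℤ} {D T : ℕ}
    {ε A B N : ℝ} (l : Level x y p D T ε A B N) (hT : 1 ≤ T) (hy : y ≠ 0)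
    (hxy : ¬(IsAlgebraic ℚ x ∧ IsAlgebraic ℚ y)) (σ : AlgebraicClosure ℚ →+* ℂ) :
    ∃ c : ℝ, 0 ≤ c ∧ ∀ x' y' : ℂ, y' ≠ 0 →
      (∀ i < 2 * T, eval ![1, x', y'] ((D3 ℂ)^[i] (map (Int.castRingHom ℂ) p)) = 0) →
      ∀ (S : ℕ) (δ : ℝ), 1 ≤ S → 0 < δ → δ ≤ 1 → lam x y S δ ![1, x', y'] ≤ c * S := by
  have halg : ∀ a : AlgebraicClosure ℚ, IsAlgebraic ℚ (σ a) := fun a => by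
    have h : IsAlgebraic ℚ a := Algebra.IsAlgebraic.isAlgebraic a
    exact h.algHom σ.toRatAlgHom
  have hi : ∀ i, ∃ c : ℝ, 0 ≤ c ∧ (l.Z i 0 ≠ 0 → ∀ (S : ℕ) (δ : ℝ), 1 ≤ S → 0 < δ → δ ≤ 1 →
      lam x y S δ ((σ (l.Z i 0))⁻¹ • (σ ∘ l.Z i)) ≤ c * S) := by
    intro i
    by_cases h0 : l.Z i 0 = 0
    · exact ⟨0, le_rfl, fun h => absurd h0 h⟩
    have hσ0 : σ (l.Z i 0) ≠ 0 := by simpa using h0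
    obtain ⟨c, hc0, hc⟩ := exists_lam_le (x := x) hy
      (w := (σ (l.Z i 0))⁻¹ • (σ ∘ l.Z i)) (by simp [hσ0]) (by
        intro h
        refine hxy ⟨?_, ?_⟩
        · have h1 : (σ (l.Z i 0))⁻¹ * σ (l.Z i 1) = x := by simpa using congrFun h 1
          rw [← h1, ← map_inv₀, ← map_mul]
          exact halg _
        · have h2 : (σ (l.Z i 0))⁻¹ * σ (l.Z i 2) = y := by simpa using congrFun h 2
          rw [← h2, ← map_inv₀, ← map_mul]
          exact halg _)
    exact ⟨c, hc0, fun _ => hc⟩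
  choose c hc0 hc using hi
  refine ⟨∑ i, c i, Finset.sum_nonneg fun i _ => hc0 i, fun x' y' hy' hv S δ hS hδ hδ1 => ?_⟩
  have hcard := hT.trans (l.le_card σ x' y' hy' hv)
  obtain ⟨⟨i, b, hb⟩⟩ := (Nat.card_pos_iff.mp hcard).1
  have hb0 : σ (l.Z i 0) = b := by simpa using congrFun hb 0
  have hbne : b ≠ 0 := fun h => l.ne_zero i (funext fun t => by
    have := congrFun hb t
    rw [h, zero_smul] at this
    simpa using this)
  have hw : ((σ (l.Z i 0))⁻¹ • (σ ∘ l.Z i)) = ![1, x', y'] := by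
    rw [hb, hb0, inv_smul_smul₀ hbne]
  have h := hc i (fun h => hbne (by rw [← hb0, h, map_zero])) S δ hS hδ hδ1
  rw [hw] at h
  exact h.trans (mul_le_mul_of_nonneg_right
    (Finset.single_le_sum (fun i _ => hc0 i) (Finset.mem_univ i)) (Nat.cast_nonneg S))

/-- The cycle attached to a form of degree `D` with the exponents of the main theorem. -/
abbrev ExpLevel (β τ ν : ℝ) (x y : ℂ) (p : MvPolynomial (Fin 3) ℤ) (D : ℕ) :=
  Level x y p D ⌊(D : ℝ) ^ τ⌋₊ (Real.exp (-((D : ℝ) ^ ν / 2)))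
    (Real.exp (-((⌊(D : ℝ) ^ τ⌋₊ : ℝ) * (D : ℝ) ^ ν / 4))) (Real.exp (21 * (D : ℝ) ^ (2 + β)))
    (Real.exp (3 * (D : ℝ) ^ β))

lemma one_le_floor_rpow {D : ℕ} (hD : 1 ≤ D) {τ : ℝ} (hτ : 0 ≤ τ) : 1 ≤ ⌊(D : ℝ) ^ τ⌋₊ :=
  (Nat.one_le_floor_iff _).mpr (Real.one_le_rpow (by exact_mod_cast hD) hτ)

lemma exp_neg_rpow_le_one (D : ℕ) (ν : ℝ) : Real.exp (-((D : ℝ) ^ ν / 2)) ≤ 1 :=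
  Real.exp_le_one_iff.mpr (by
    have : 0 ≤ (D : ℝ) ^ ν := by positivity
    linarith)

set_option maxHeartbeats 1000000 in
theorem isAlgebraic_of_eventually_level {x y : ℂ} (hy : y ≠ 0) {β τ ν : ℝ} (hτ1 : 1 ≤ τ)
    (hτ2 : τ < 2) (hβ : τ < β) (hν : 2 + β - τ + (τ - 1) * (2 - τ) / (β + 1 - τ) < ν)
    (p : ℕ → MvPolynomial (Fin 3) ℤ) (hp : ∀ᶠ D in Filter.atTop, (p D).IsHomogeneous D)
    (hl : ∀ᶠ D in Filter.atTop, Nonempty (ExpLevel β τ ν x y (p D) D)) :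
    IsAlgebraic ℚ x ∧ IsAlgebraic ℚ y := by
  by_contra hxy
  obtain ⟨e, he1, he2⟩ := exists_between
    (show (τ - 1) * (2 - τ) / (β + 1 - τ) < ν + τ - 2 - β by linarith)
  have he : 0 < e := lt_of_le_of_lt
    (div_nonneg (mul_nonneg (by linarith) (by linarith)) (by linarith)) he1
  obtain ⟨σ⟩ : Nonempty (AlgebraicClosure ℚ →+* ℂ) :=
    ⟨(IsAlgClosed.lift : AlgebraicClosure ℚ →ₐ[ℚ] ℂ).toRingHom⟩
  obtain ⟨D₀, hD₀⟩ := Filter.eventually_atTop.mp (((hp.and hl).and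
    (eventually_mul_rpow_le (show 2 + β - τ < ν by linarith)
      (2 * (15 + 42 * 2 ^ (1 + β - τ)) + 1))).and (Filter.eventually_ge_atTop 1))
  have hhom : ∀ E, D₀ ≤ E → (p E).IsHomogeneous E := fun E hE => (hD₀ E hE).1.1.1
  have hlev : ∀ E, D₀ ≤ E → Nonempty (ExpLevel β τ ν x y (p E) E) := fun E hE =>
    (hD₀ E hE).1.1.2
  have hone : ∀ E, D₀ ≤ E → 1 ≤ E := fun E hE => (hD₀ E hE).2
  have hcap : ∀ E : ℕ, D₀ ≤ E →
      2 * (15 + 42 * 2 ^ (1 + β - τ)) * (E : ℝ) ^ (2 + β - τ) < (E : ℝ) ^ ν := fun E hE => by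
    have h1 := (hD₀ E hE).1.2
    have h2 : 0 < (E : ℝ) ^ (2 + β - τ) :=
      Real.rpow_pos_of_pos (by exact_mod_cast hone E hE) _
    linarith only [h1, h2]
  have lev : ∀ E, D₀ ≤ E → ExpLevel β τ ν x y (p E) E := fun E hE => Classical.choice (hlev E hE)
  obtain ⟨c, hc0, hc⟩ := (lev D₀ le_rfl).exists_lam_le_of_not_algebraic
    (one_le_floor_rpow (hone D₀ le_rfl) (by linarith)) hy hxy σ
  obtain ⟨D, hD, hno, hpig, hthree, hbot⟩ := ((Filter.eventually_ge_atTop D₀).and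
    ((eventually_no_intermediate_level hτ1 hβ he he1
      (show (0 : ℝ) < 42 * 2 ^ (1 + β - τ) by positivity)).and
    ((eventually_mul_rpow_le (show 2 + e + β < τ + ν by linarith) 177).and
    ((eventually_mul_rpow_le (show 0 < e from he) 4).and
      (eventually_mul_rpow_le (show τ < e + β by linarith) (c + 1)))))).exists
  have hD1 := hone D hD
  have hDpos : (0 : ℝ) < D := by exact_mod_cast hD1
  rw [Real.rpow_zero, mul_one] at hthree
  obtain ⟨K, _, _, _, j, hj⟩ := exists_galois_field (k := AlgebraicClosure ℚ)
    (S := ⋃ E ∈ Set.Icc D₀ D, {a | ∃ (h : D₀ ≤ E) (i : Fin ((lev E h).d ^ 2)) (t : Fin 3),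
      (lev E h).Z i t = a}) (by
    refine (Set.finite_Icc D₀ D).biUnion fun E hE => ?_
    refine ((Set.finite_univ).image
      (fun it : Fin ((lev E hE.1).d ^ 2) × Fin 3 => (lev E hE.1).Z it.1 it.2)).subset ?_
    rintro a ⟨h, i, t, rfl⟩
    exact ⟨(i, t), trivial, rfl⟩)
  have hY : ∀ E (h : D₀ ≤ E), E ≤ D → ∃ Y : Fin ((lev E h).d ^ 2) → Fin 3 → K,
      ∀ i, j ∘ Y i = (lev E h).Z i := by
    intro E h hED
    have h1 : ∀ i t, ∃ a, j a = (lev E h).Z i t := fun i t =>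
      hj (Set.mem_biUnion (show E ∈ Set.Icc D₀ D from ⟨h, hED⟩) ⟨h, i, t, rfl⟩)
    choose Y hY using h1
    exact ⟨Y, fun i => funext fun t => hY i t⟩
  set ι := σ.comp j with hι
  have hn : (0 : ℝ) < Module.finrank ℚ K := by exact_mod_cast Module.finrank_pos
  obtain ⟨YD, hYD⟩ := hY D hD le_rfl
  obtain ⟨z, hz0, hz2, hzmin, hz⟩ := (lev D hD).exists_sum_lam_ge j ι (Real.exp_pos _)
    (exp_neg_rpow_le_one D ν) hYD (u := (D : ℝ) ^ (e + β)) (v := (D : ℝ) ^ e) (by positivity)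
    (by positivity) (by
      rw [Real.log_exp, Real.log_exp, neg_neg]
      have h1 : (D : ℝ) ^ 2 * (D : ℝ) ^ (e + β) = (D : ℝ) ^ (2 + e + β) := by
        rw [← Real.rpow_natCast, ← Real.rpow_add hDpos]
        congr 1
        push_cast
        ring
      have h2 : (D : ℝ) ^ e * (21 * (D : ℝ) ^ (2 + β)) = 21 * (D : ℝ) ^ (2 + e + β) := by
        rw [mul_left_comm, ← Real.rpow_add hDpos]
        congr 2
        ring
      have h3 := mul_le_mul_of_nonneg_right (half_rpow_le_floor hD1 (show 0 ≤ τ by linarith))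
        (show 0 ≤ (D : ℝ) ^ ν by positivity)
      rw [← Real.rpow_add hDpos] at h3
      have h4 : 0 < (D : ℝ) ^ (2 + e + β) := by positivity
      rw [h1, h2]
      linarith only [h3, h4, hpig])
  have hzne : z ≠ 0 := fun h => one_ne_zero (hz0.symm.trans (congrFun h 0))
  have hh := log_mulHeight_nonneg z
  set h := Real.log (Height.mulHeight z) with hhdef
  set Van : ℕ → Prop := fun E => ∀ i < 2 * ⌊(E : ℝ) ^ τ⌋₊,
    eval z (map (Int.castRingHom K) ((D3 ℤ)^[i] (p E))) = 0 with hVan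
  have hsum : ∀ E, D₀ ≤ E → ¬Van E →
      ∑ g : K ≃ₐ[ℚ] K, lam x y ⌊(E : ℝ) ^ τ⌋₊ (Real.exp (-((E : ℝ) ^ ν / 2))) (ι ∘ g ∘ z) ≤
        Module.finrank ℚ K * (3 * (E : ℝ) ^ β) + E * h := by
    intro E hE hVE
    simp only [hVan, not_forall] at hVE
    obtain ⟨i, hi, hne⟩ := hVE
    have := (lev E hE).sum_lam_le ι (Real.exp_pos _) (Real.exp_pos _) (exp_neg_rpow_le_one E ν)
      (hhom E hE) hzne hi hne
    rwa [Real.log_exp] at this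
  have hVD : Van D := by
    by_contra hcon
    have h1 := hz.trans (hsum D hD hcon)
    rw [Real.rpow_add hDpos] at h1
    have h2 : 0 < (D : ℝ) ^ β * Module.finrank ℚ K := by positivity
    have h3 := mul_le_mul_of_nonneg_right hthree h2.le
    have h4 := mul_le_mul_of_nonneg_right hthree (show 0 ≤ (D : ℝ) * h by positivity)
    have h5 : 0 ≤ (D : ℝ) * h := by positivity
    linarith only [h1, h2, h3, h4, h5]
  have hVD₀ : ¬Van D₀ := by
    intro hcon
    have h1 : ∀ g : K ≃ₐ[ℚ] K, lam x y ⌊(D : ℝ) ^ τ⌋₊ (Real.exp (-((D : ℝ) ^ ν / 2))) (ι ∘ g ∘ z) ≤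
        c * ⌊(D : ℝ) ^ τ⌋₊ := by
      intro g
      have hv : (![1, ι (g (z 1)), ι (g (z 2))] : Fin 3 → ℂ) = ι ∘ g ∘ z := by
        ext t
        fin_cases t <;> simp [hz0]
      rw [← hv]
      refine hc _ _ (by simpa using hz2) (fun i hi => ?_) _ _
        (one_le_floor_rpow hD1 (by linarith)) (Real.exp_pos _) (exp_neg_rpow_le_one D ν)
      rw [hv, ← map_D3_iterate, eval_embedding_comp, eval_comp_algEquiv, hcon i hi, map_zero,
        map_zero]
    have h2 := Finset.sum_le_card_nsmul Finset.univ _ _ fun g _ => h1 g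
    rw [Finset.card_univ, card_algEquiv, nsmul_eq_mul] at h2
    have h3 : (⌊(D : ℝ) ^ τ⌋₊ : ℝ) ≤ (D : ℝ) ^ τ := Nat.floor_le (by positivity)
    have h4 : 0 < (D : ℝ) ^ τ := by positivity
    have h5 : (D : ℝ) ^ (e + β) * Module.finrank ℚ K ≤ Module.finrank ℚ K * (c * (D : ℝ) ^ τ) := by
      have h6 : 0 ≤ (D : ℝ) ^ e * (D * h) := by positivity
      have h7 := mul_le_mul_of_nonneg_left h3 (mul_nonneg hn.le hc0)
      linarith only [hz, h2, h6, h7]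
    have h8 := mul_le_mul_of_nonneg_right hbot hn.le
    have h9 := mul_pos h4 hn
    linarith only [h5, h8, h9]
  obtain ⟨E, hE, hED, hVE, hVE'⟩ : ∃ E, D₀ ≤ E ∧ E < D ∧ ¬Van E ∧ Van (E + 1) := by
    by_contra! hcon
    have : ∀ E, D₀ ≤ E → E ≤ D → ¬Van E := fun E hE =>
      Nat.le_induction (fun _ => hVD₀) (fun E hE ih hED => hcon E hE hED (ih (by omega))) E hE
    exact this D hD le_rfl hVD
  obtain ⟨Y, hYE⟩ := hY (E + 1) (by omega) hED
  have hE1 := hone E hE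
  obtain ⟨hm₁, hm₂⟩ := (lev (E + 1) (by omega)).card_conjugates_le j σ hYE hz0 hz2 hzmin hVE'
  rw [Real.log_exp] at hm₂
  refine descent_contradiction (D := D) (E := E) (m := (conjugates z).card) (ν := ν) (e := e)
    (h := h)
    (fun g : K ≃ₐ[ℚ] K => lam x y ⌊(E : ℝ) ^ τ⌋₊ (Real.exp (-((E : ℝ) ^ ν / 2))) (ι ∘ g ∘ z))
    (fun g : K ≃ₐ[ℚ] K => lam x y ⌊(D : ℝ) ^ τ⌋₊ (Real.exp (-((D : ℝ) ^ ν / 2))) (ι ∘ g ∘ z))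
    hE1 hED.le hτ1 hτ2 hβ hh (card_conjugates_pos z) hm₁ ?_ ?_ ?_ ?_
    ?_ (hcap E hE) (hno E hE1 hED.le)
  · rwa [card_algEquiv]
  · rw [card_algEquiv]
    exact hsum E hE hVE
  · intro g
    rw [card_algEquiv]
    exact card_mul_le_card_conjugates_mul_sum
      (fun w => lam x y ⌊(E : ℝ) ^ τ⌋₊ (Real.exp (-((E : ℝ) ^ ν / 2))) (ι ∘ w))
      (fun w => lam_nonneg (Real.exp_pos _).le (exp_neg_rpow_le_one E ν) _) z g
  · intro g
    have := min_le_lam (x := x) (y := y) (S := ⌊(E : ℝ) ^ τ⌋₊) (T := ⌊(D : ℝ) ^ τ⌋₊)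
      (Real.exp_pos _) (exp_neg_rpow_le_one E ν) (Real.exp_pos _) (exp_neg_rpow_le_one D ν)
      (Nat.floor_le_floor (Real.rpow_le_rpow (Nat.cast_nonneg _) (by exact_mod_cast hED.le)
        (by linarith))) (one_le_floor_rpow hD1 (by linarith)) (ι ∘ g ∘ z)
    rwa [Real.log_exp, neg_neg] at this
  · rwa [card_algEquiv]

end Algebraicity

section Liouville

variable {K : Type} [Field K] [NumberField K]

lemma one_le_norm_eval_mul {z : Fin 3 → K} (hz0 : z 0 = 1) {R : MvPolynomial (Fin 3) ℤ} {L : ℕ}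
    (hR : R.IsHomogeneous L) {b W : ℝ} (hb : l1 (map (Int.castRingHom ℂ) R) ≤ b)
    (hW : ∀ φ : K →+* ℂ, ‖φ ∘ z‖ ≤ W) (hbW : 1 ≤ b * W ^ L) (φ₀ : K →+* ℂ)
    (hne : eval z (map (Int.castRingHom K) R) ≠ 0) :
    1 ≤ ‖eval (φ₀ ∘ z) (map (Int.castRingHom ℂ) R)‖ * (b * W ^ L) ^ Module.finrank ℚ K *
      Height.mulHeight z ^ L := by
  classical
  have hz : z ≠ 0 := fun h => one_ne_zero (hz0.symm.trans (congrFun h 0))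
  have h1 := prod_norm_le_prod_norm_eval_mul_mulHeight hz hR hne
  have hone : ∀ φ : K →+* ℂ, 1 ≤ ‖φ ∘ z‖ := fun φ => by
    simpa [hz0] using norm_le_pi_norm (φ ∘ z) 0
  have h2 : 1 ≤ ∏ φ : K →+* ℂ, ‖φ ∘ z‖ ^ L := by
    simpa using Finset.prod_le_prod (s := Finset.univ) (fun _ _ => zero_le_one)
      fun (φ : K →+* ℂ) _ => one_le_pow₀ (n := L) (hone φ)
  have h3 : ∀ φ : K →+* ℂ, ‖eval (φ ∘ z) (map (Int.castRingHom ℂ) R)‖ ≤ b * W ^ L := fun φ =>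
    (norm_eval_le_l1 (hR.map _) (norm_le_pi_norm (φ ∘ z))).trans (mul_le_mul hb
      (pow_le_pow_left₀ (norm_nonneg _) (hW φ) L) (by positivity) ((l1_nonneg _).trans hb))
  have h4 : ∏ φ : K →+* ℂ, ‖eval (φ ∘ z) (map (Int.castRingHom ℂ) R)‖ ≤
      ‖eval (φ₀ ∘ z) (map (Int.castRingHom ℂ) R)‖ * (b * W ^ L) ^ Module.finrank ℚ K := by
    rw [← Finset.mul_prod_erase _ _ (Finset.mem_univ φ₀)]
    refine mul_le_mul_of_nonneg_left ?_ (norm_nonneg _)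
    refine (Finset.prod_le_prod (fun φ _ => norm_nonneg _) fun φ _ => h3 φ).trans ?_
    rw [Finset.prod_const]
    refine pow_le_pow_right₀ hbW ?_
    exact (Finset.card_le_univ _).trans_eq (NumberField.Embeddings.card K ℂ)
  have hM : 0 ≤ Height.mulHeight z ^ L :=
    pow_nonneg (zero_le_one.trans (Height.one_le_mulHeight z)) _
  exact (h2.trans h1).trans (mul_le_mul_of_nonneg_right h4 hM)

lemma exists_numberField_of_isAlgebraic {x y : ℂ} (hx : IsAlgebraic ℚ x) (hy : IsAlgebraic ℚ y) :
    ∃ (K : Type) (_ : Field K) (_ : NumberField K) (φ : K →+* ℂ) (a b : K), φ a = x ∧ φ b = y := by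
  let F : IntermediateField ℚ ℂ := IntermediateField.adjoin ℚ {x, y}
  have hF : FiniteDimensional ℚ F := IntermediateField.finiteDimensional_adjoin fun s hs => by
    rcases hs with rfl | rfl
    · exact hx.isIntegral
    · exact hy.isIntegral
  refine ⟨F, inferInstance, { to_finiteDimensional := ?_ }, F.val.toRingHom,
    ⟨x, IntermediateField.subset_adjoin ℚ _ (by simp)⟩,
    ⟨y, IntermediateField.subset_adjoin ℚ _ (by simp)⟩, rfl, rfl⟩
  convert hF

theorem eventually_eval_eq_zero {ξ η : ℂ} (hξ : IsAlgebraic ℚ ξ) (hη : IsAlgebraic ℚ η)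
    {β τ ν : ℝ} (hτ1 : 1 ≤ τ) (hβ : τ < β) (hν : β < ν) (P : ℕ → MvPolynomial (Fin 2) ℤ)
    (hP : ∀ᶠ D : ℕ in Filter.atTop,
      P D ≠ 0 ∧ (P D).totalDegree ≤ D ∧
      (∀ v, ((|(P D).coeff v| : ℤ) : ℝ) ≤ Real.exp ((D : ℝ) ^ β)) ∧
      ∀ i < 3 * ⌊(D : ℝ) ^ τ⌋₊,
        ‖eval ![ξ, η] (D1^[i] ((P D).map (Int.castRingHom ℂ)))‖ ≤ Real.exp (-(D : ℝ) ^ ν)) :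
    ∀ᶠ D : ℕ in Filter.atTop, ∀ i < 3 * ⌊(D : ℝ) ^ τ⌋₊,
      eval ![ξ, η] (D1^[i] ((P D).map (Int.castRingHom ℂ))) = 0 := by
  obtain ⟨K, _, _, φ₀, a, b, rfl, rfl⟩ := exists_numberField_of_isAlgebraic hξ hη
  set z : Fin 3 → K := ![1, a, b] with hz
  have hφz : φ₀ ∘ z = ![1, φ₀ a, φ₀ b] := by
    ext t
    fin_cases t <;> simp [hz]
  obtain ⟨W, hW1, hW⟩ : ∃ W : ℝ, 1 ≤ W ∧ ∀ φ : K →+* ℂ, ‖φ ∘ z‖ ≤ W := by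
    refine ⟨1 + ∑ φ : K →+* ℂ, ‖φ ∘ z‖,
      le_add_of_nonneg_right (Finset.sum_nonneg fun φ _ => norm_nonneg _), fun φ => ?_⟩
    have := Finset.single_le_sum (f := fun φ : K →+* ℂ => ‖φ ∘ z‖) (fun φ _ => norm_nonneg _)
      (Finset.mem_univ φ)
    linarith
  set n := Module.finrank ℚ K with hn
  set h := Real.log (Height.mulHeight z) with hh
  have hM : 0 < Height.mulHeight z := zero_lt_one.trans_le (Height.one_le_mulHeight z)
  have hh0 : 0 ≤ h := log_mulHeight_nonneg z
  have hlW : 0 ≤ Real.log W := Real.log_nonneg hW1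
  filter_upwards [hP, eventually_rpow_mul_log_le hβ (K := 3) (by norm_num),
    eventually_mul_rpow_le hν (n * (4 + Real.log W) + h + 1), Filter.eventually_ge_atTop 1]
    with D hPD hlog hDν hD1 i hi
  obtain ⟨-, hdeg, hcoeff, hsmall⟩ := hPD
  have hD1' : (1 : ℝ) ≤ D := by exact_mod_cast hD1
  have hDpos : (0 : ℝ) < D := by linarith
  set t := (D : ℝ) ^ β with ht
  have ht0 : 0 < t := by positivity
  have hDt : (D : ℝ) ≤ t := by
    simpa using Real.rpow_le_rpow_of_exponent_le hD1' (show 1 ≤ β by linarith)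
  by_contra hne
  set R := (D3 ℤ)^[i] (homog D (P D)) with hR
  have hRh : R.IsHomogeneous D := (homog_isHomogeneous hdeg).D3_iterate i
  have hRmap : map (Int.castRingHom ℂ) R =
      (D3 ℂ)^[i] (homog D (map (Int.castRingHom ℂ) (P D))) := by
    rw [hR, map_D3_iterate, map_homog _ (RingHom.injective_int _)]
  have heval : eval (φ₀ ∘ z) (map (Int.castRingHom ℂ) R) =
      eval ![φ₀ a, φ₀ b] (D1^[i] ((P D).map (Int.castRingHom ℂ))) := by
    rw [hφz, hRmap, eval_D1_iterate]
  have hneK : eval z (map (Int.castRingHom K) R) ≠ 0 := fun h0 => hne (by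
    rw [← heval, eval_embedding_comp, h0, map_zero])
  have hl1 : l1 (map (Int.castRingHom ℂ) R) ≤ Real.exp (4 * t) := by
    have h1 : l1 (map (Int.castRingHom ℂ) R) ≤
        (D : ℝ) ^ i * ((D + 1) ^ 2 * Real.exp t) := by
      rw [hR, map_D3_iterate]
      exact (l1_D3_iterate_le ((homog_isHomogeneous hdeg).map _) i).trans
        (mul_le_mul_of_nonneg_left (l1_homog_le hdeg hcoeff) (by positivity))
    have h2 : (D : ℝ) ^ i ≤ Real.exp t := by
      rw [← Real.exp_log hDpos, ← Real.exp_nat_mul]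
      refine Real.exp_le_exp.mpr (le_trans ?_ hlog)
      refine mul_le_mul_of_nonneg_right ?_ (Real.log_nonneg hD1')
      have h3 : (i : ℝ) ≤ 3 * ⌊(D : ℝ) ^ τ⌋₊ := by exact_mod_cast hi.le
      have h4 : (⌊(D : ℝ) ^ τ⌋₊ : ℝ) ≤ (D : ℝ) ^ τ := Nat.floor_le (by positivity)
      linarith only [h3, h4]
    have h3 : ((D : ℝ) + 1) ^ 2 ≤ Real.exp (2 * t) := by
      rw [mul_comm, Real.exp_mul, Real.rpow_two]
      refine pow_le_pow_left₀ (by positivity) ?_ 2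
      have := Real.add_one_le_exp t
      linarith only [this, hDt]
    calc l1 (map (Int.castRingHom ℂ) R) ≤ (D : ℝ) ^ i * ((D + 1) ^ 2 * Real.exp t) := h1
      _ ≤ Real.exp t * (Real.exp (2 * t) * Real.exp t) := by gcongr
      _ = Real.exp (4 * t) := by
        rw [← Real.exp_add, ← Real.exp_add]
        ring_nf
  have hWD : W ^ D = Real.exp (D * Real.log W) := by
    rw [Real.exp_nat_mul, Real.exp_log (by linarith)]
  have hHD : Height.mulHeight z ^ D = Real.exp (D * h) := by
    rw [Real.exp_nat_mul, Real.exp_log hM]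
  have hfin := one_le_norm_eval_mul (z := z) (by simp [hz]) hRh hl1 hW
    (one_le_mul_of_one_le_of_one_le (Real.one_le_exp (by positivity)) (one_le_pow₀ hW1)) φ₀ hneK
  rw [heval, hWD, hHD, ← Real.exp_add, ← Real.exp_nat_mul, ← hn] at hfin
  have h5 : 1 ≤ Real.exp (-(D : ℝ) ^ ν) * Real.exp (n * (4 * t + D * Real.log W)) *
      Real.exp (D * h) := hfin.trans (by
    gcongr
    exact hsmall i hi)
  rw [← Real.exp_add, ← Real.exp_add, Real.one_le_exp_iff] at h5
  have h6 := mul_le_mul_of_nonneg_right hDt hh0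
  have h7 := mul_le_mul_of_nonneg_left (mul_le_mul_of_nonneg_right hDt hlW)
    (Nat.cast_nonneg (α := ℝ) n)
  linarith only [h5, h6, h7, hDν, ht0]

end Liouville

theorem stmt0 (ξ η : ℂ) (hη : η ≠ 0) (β τ ν : ℝ)
    (hτ1 : 1 ≤ τ) (hτ2 : τ < 2) (hβ : τ < β)
    (hν : 2 + β - τ + (τ - 1) * (2 - τ) / (β + 1 - τ) < ν)
    (P : ℕ → MvPolynomial (Fin 2) ℤ)
    (hP : ∀ᶠ D : ℕ in Filter.atTop,
      P D ≠ 0 ∧ (P D).totalDegree ≤ D ∧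
      (∀ v, ((|(P D).coeff v| : ℤ) : ℝ) ≤ Real.exp ((D : ℝ) ^ β)) ∧
      ∀ i < 3 * ⌊(D : ℝ) ^ τ⌋₊,
        ‖eval ![ξ, η] (D1^[i] ((P D).map (Int.castRingHom ℂ)))‖ ≤ Real.exp (-(D : ℝ) ^ ν)) :
    IsAlgebraic ℚ ξ ∧ IsAlgebraic ℚ η ∧
    ∀ᶠ D : ℕ in Filter.atTop, ∀ i < 3 * ⌊(D : ℝ) ^ τ⌋₊,
      eval ![ξ, η] (D1^[i] ((P D).map (Int.castRingHom ℂ))) = 0 := by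
  have hν' : 2 + β - τ < ν := lt_of_le_of_lt (le_add_of_nonneg_right
    (div_nonneg (mul_nonneg (by linarith) (by linarith)) (by linarith))) hν
  obtain ⟨hξa, hηa⟩ := isAlgebraic_of_eventually_level hη hτ1 hτ2 hβ hν
    (fun D => homog D (P D)) (hP.mono fun D h => homog_isHomogeneous h.2.1)
    (eventually_level hη hτ1 hτ2 hβ hν' P hP)
  exact ⟨hξa, hηa, eventually_eval_eq_zero hξa hηa hτ1 hβ (by linarith) P hP⟩
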